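/- Let p > 3 be a prime. If p ≡ 1 (mod 3), write 4p = x^2 + 27y^2 with integers x, y; then Σ_{n=0}^{p−1} n^2·V_n^{(3)}/243^n ≡ (1/16)x^2 − (1/8)p − p^2/(8x^2) (mod p^3) and Σ_{n=0}^{p−1} n^3·V_n^{(3)}/243^n ≡ (7/128)x^2 − (5/64)p − 5p^2/(64x^2) (mod p^3). If p ≡ 2 (mod 3), then Σ_{n=0}^{p−1} n^2·V_n^{(3)}/243^n ≡ (1/8)(2p+1)·C(⌊2p/3⌋, ⌊p/3⌋)^2 (mod p^2) and Σ_{n=0}^{p−1} n^3·V_n^{(3)}/243^n ≡ (3/64)(2p+1)·C(⌊2p/3⌋, ⌊p/3⌋)^2 − p/32 (mod p^2). Moreover, Σ_{n=0}^{p−1} (8n+1)·V_n^{(3)}/243^n ≡ (p/3)·p − (22/3)p^3·U_{p−3} (mod p^4), where (p/3) is the Legendre symbol. -/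

import Mathlib

/-- `a ≡ b (mod p^r)` for rationals: the numerator of `a - b` in lowest terms
is divisible by `p^r`. -/
def ratCongr (p r : ℕ) (a b : ℚ) : Prop := (p : ℤ)^r ∣ (a - b).num
/-- The sequence `U_n`: `U_0 = 1`, `U_n = -2·∑_{k=1}^{⌊n/2⌋} C(n,2k)·U_{n-2k}` for `n ≥ 1`. -/
def seqU : ℕ → ℚ
  | 0 => 1
  | (n+1) => -2 * ∑ j ∈ Finset.range ((n+1)/2),
      ((n+1).choose (2*(j+1)) : ℚ) * seqU (n - 1 - 2*j)
  decreasing_by omega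

/-- `V_n^{(3)} = Σ_{k=0}^{n} C(n,k)·C(n+k,k)·(-1)^k·C(2k,k)·C(3k,k)·27^{n-k}`. -/
def seqV3 (n : ℕ) : ℚ :=
  ∑ k ∈ Finset.range (n+1),
    (n.choose k : ℚ) * ((n+k).choose k : ℚ) * (-1)^k * ((2*k).choose k : ℚ) *
      ((3*k).choose k : ℚ) * 27^(n-k)

instance : Fact (Nat.Prime 3) := ⟨by norm_num⟩

namespace S19

variable {p : ℕ} [hp : Fact p.Prime]

/-- `x ∈ p^r ℤ_p`. -/
def Dv (r : ℕ) (x : ℚ_[p]) : Prop := ∃ y : ℤ_[p], x = (p : ℚ_[p])^r * y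

lemma Dv.zero (r : ℕ) : Dv r (0 : ℚ_[p]) := ⟨0, by simp⟩
lemma Dv.add {r : ℕ} {x y : ℚ_[p]} (hx : Dv r x) (hy : Dv r y) : Dv r (x + y) := by
  obtain ⟨a, rfl⟩ := hx; obtain ⟨b, rfl⟩ := hy
  exact ⟨a + b, by push_cast; ring⟩
lemma Dv.neg {r : ℕ} {x : ℚ_[p]} (hx : Dv r x) : Dv r (-x) := by
  obtain ⟨a, rfl⟩ := hx
  exact ⟨-a, by push_cast; ring⟩
lemma Dv.sub {r : ℕ} {x y : ℚ_[p]} (hx : Dv r x) (hy : Dv r y) : Dv r (x - y) := by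
  rw [sub_eq_add_neg]; exact hx.add hy.neg
lemma Dv.mul' {r s : ℕ} {x y : ℚ_[p]} (hx : Dv r x) (hy : Dv s y) : Dv (r + s) (x * y) := by
  obtain ⟨a, rfl⟩ := hx; obtain ⟨b, rfl⟩ := hy
  exact ⟨a * b, by push_cast; ring⟩
lemma Dv.mono {r s : ℕ} {x : ℚ_[p]} (hx : Dv r x) (h : s ≤ r) : Dv s x := by
  obtain ⟨a, rfl⟩ := hx; obtain ⟨d, rfl⟩ := Nat.exists_eq_add_of_le h
  exact ⟨p ^ d * a, by push_cast; ring⟩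
lemma Dv.mul {r : ℕ} {x y : ℚ_[p]} (hx : Dv 0 x) (hy : Dv r y) : Dv r (x * y) := by
  simpa using hx.mul' hy
lemma Dv.mulr {r : ℕ} {x y : ℚ_[p]} (hx : Dv r x) (hy : Dv 0 y) : Dv r (x * y) := by
  simpa using hx.mul' hy
lemma Dv.pow {x : ℚ_[p]} (hx : Dv 0 x) (n : ℕ) : Dv 0 (x ^ n) := by
  obtain ⟨a, rfl⟩ := hx
  exact ⟨a ^ n, by push_cast; ring⟩
lemma Dv.sum {ι : Type*} {r : ℕ} {s : Finset ι} {f : ι → ℚ_[p]} (h : ∀ i ∈ s, Dv r (f i)) :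
    Dv r (∑ i ∈ s, f i) := by
  classical
  induction s using Finset.induction_on with
  | empty => simpa using Dv.zero r
  | insert a s ha ih =>
    rw [Finset.sum_insert ha]
    exact (h a (by simp)).add (ih fun i hi => h i (by simp [hi]))
lemma Dv.prod {ι : Type*} {s : Finset ι} {f : ι → ℚ_[p]} (h : ∀ i ∈ s, Dv 0 (f i)) :
    Dv 0 (∏ i ∈ s, f i) := by
  classical
  induction s using Finset.induction_on with
  | empty => exact ⟨1, by simp⟩
  | insert a s ha ih =>
    rw [Finset.prod_insert ha]
    exact (h a (by simp)).mul (ih fun i hi => h i (by simp [hi]))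
lemma Dv.int (n : ℤ) : Dv 0 (n : ℚ_[p]) := ⟨n, by simp⟩
lemma Dv.nat (n : ℕ) : Dv 0 (n : ℚ_[p]) := ⟨n, by simp⟩
lemma Dv.one : Dv 0 (1 : ℚ_[p]) := ⟨1, by simp⟩
lemma Dv.ofNat (n : ℕ) [n.AtLeastTwo] : Dv 0 (OfNat.ofNat n : ℚ_[p]) := ⟨OfNat.ofNat n, by
  simp; rfl⟩
lemma Dv.pp (r : ℕ) : Dv r ((p : ℚ_[p]) ^ r) := ⟨1, by simp⟩
lemma Dv.p1 : Dv 1 (p : ℚ_[p]) := ⟨1, by simp⟩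
lemma ppne : (p : ℚ_[p]) ≠ 0 := by exact_mod_cast hp.out.ne_zero
lemma Dv.cancel {r s : ℕ} {x : ℚ_[p]} (h : Dv (r + s) ((p : ℚ_[p]) ^ r * x)) : Dv s x := by
  obtain ⟨a, ha⟩ := h
  refine ⟨a, ?_⟩
  have : (p : ℚ_[p]) ^ r ≠ 0 := pow_ne_zero _ ppne
  apply mul_left_cancel₀ this; rw [ha]; ring

lemma dv_iff_norm {r : ℕ} {x : ℚ_[p]} : Dv r x ↔ ‖x‖ ≤ (p : ℝ) ^ (-(r : ℤ)) := by
  have hp0 : (0 : ℝ) < p := by exact_mod_cast hp.out.pos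
  constructor
  · rintro ⟨a, rfl⟩
    rw [norm_mul, norm_pow, Padic.norm_p]
    have := PadicInt.norm_le_one a
    rw [zpow_neg, zpow_natCast, inv_pow]
    have h2 : (0 : ℝ) ≤ ((p : ℝ) ^ r)⁻¹ := by positivity
    exact mul_le_of_le_one_right h2 this
  · intro h
    have hne : (p : ℚ_[p]) ^ r ≠ 0 := pow_ne_zero _ ppne
    refine ⟨⟨x / p ^ r, ?_⟩, ?_⟩
    · rw [norm_div, norm_pow, Padic.norm_p, div_le_one (by positivity)]
      rw [zpow_neg, zpow_natCast] at h
      simpa using h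
    · simp only []; field_simp

/-- units -/
def Un (x : ℚ_[p]) : Prop := Dv 0 x ∧ Dv 0 x⁻¹ ∧ x ≠ 0
lemma un_iff_norm {x : ℚ_[p]} : Un x ↔ ‖x‖ = 1 := by
  unfold Un
  rw [dv_iff_norm, dv_iff_norm, norm_inv]
  simp only [CharP.cast_eq_zero, neg_zero, zpow_zero]
  constructor
  · rintro ⟨h1, h2, h3⟩
    have : 0 < ‖x‖ := norm_pos_iff.mpr h3
    rw [inv_le_one₀ this] at h2
    exact le_antisymm h1 h2
  · intro h; rw [h]; refine ⟨le_rfl, by simp, ?_⟩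
    intro h0; rw [h0] at h; simp at h
lemma Un.int {n : ℤ} (h : ¬ (p : ℤ) ∣ n) : Un (n : ℚ_[p]) := by
  rw [un_iff_norm]
  have h1 := Padic.norm_int_le_one (p := p) n
  rw [← Padic.norm_intCast_lt_one_iff] at h
  exact le_antisymm h1 (not_lt.mp h)
lemma Un.nat {n : ℕ} (h : ¬ p ∣ n) : Un (n : ℚ_[p]) := by
  have := Un.int (p := p) (n := (n : ℤ)) (by exact_mod_cast h)
  simpa using this
lemma Un.mul {x y : ℚ_[p]} (hx : Un x) (hy : Un y) : Un (x * y) := by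
  rw [un_iff_norm] at *; rw [norm_mul, hx, hy]; simp
lemma Un.inv {x : ℚ_[p]} (hx : Un x) : Un x⁻¹ := by
  rw [un_iff_norm] at *; rw [norm_inv, hx]; simp
lemma Un.neg {x : ℚ_[p]} (hx : Un x) : Un (-x) := by
  rw [un_iff_norm] at *; rw [norm_neg, hx]
lemma Un.div {x y : ℚ_[p]} (hx : Un x) (hy : Un y) : Un (x / y) := by
  rw [div_eq_mul_inv]; exact hx.mul hy.inv
lemma Un.pow {x : ℚ_[p]} (hx : Un x) (n : ℕ) : Un (x ^ n) := by
  rw [un_iff_norm] at *; rw [norm_pow, hx]; simp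
lemma Un.one : Un (1 : ℚ_[p]) := by rw [un_iff_norm]; simp
lemma Un.prod {ι : Type*} {s : Finset ι} {f : ι → ℚ_[p]} (h : ∀ i ∈ s, Un (f i)) :
    Un (∏ i ∈ s, f i) := by
  rw [un_iff_norm, norm_prod]
  exact Finset.prod_eq_one fun i hi => un_iff_norm.mp (h i hi)
lemma Un.dv {x : ℚ_[p]} (hx : Un x) : Dv 0 x := hx.1
lemma Un.dvi {x : ℚ_[p]} (hx : Un x) : Dv 0 x⁻¹ := hx.2.1
lemma Un.ne {x : ℚ_[p]} (hx : Un x) : x ≠ 0 := hx.2.2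
lemma Dv.div {r : ℕ} {x y : ℚ_[p]} (hx : Dv r x) (hy : Un y) : Dv r (x / y) := by
  rw [div_eq_mul_inv]; exact hx.mulr hy.dvi
lemma Dv.of_mul {r : ℕ} {x y : ℚ_[p]} (h : Dv r (x * y)) (hx : Un x) : Dv r y := by
  have := h.div hx
  rwa [mul_div_cancel_left₀ _ hx.ne] at this
/-- perturbation of a unit -/
lemma Un.of_sub {x y : ℚ_[p]} (hx : Un x) (h : Dv 1 (x - y)) : Un y := by
  rw [un_iff_norm] at *
  rw [dv_iff_norm] at h
  have h1 : ‖x - y‖ < 1 := lt_of_le_of_lt h (by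
    have : (1 : ℝ) < p := by exact_mod_cast hp.out.one_lt
    simpa using inv_lt_one_of_one_lt₀ this)
  have h2 : y = x - (x - y) := by ring
  have h3 : ‖x - y‖ ≠ ‖x‖ := by rw [hx]; exact h1.ne
  rw [h2, sub_eq_add_neg, IsUltrametricDist.norm_add_eq_max_of_norm_ne_norm (by rw [norm_neg]; exact h3.symm), norm_neg, hx]
  exact max_eq_left h1.le
lemma Un.not_dv {x : ℚ_[p]} (hx : Un x) : ¬ Dv 1 x := by
  intro h
  have : Un (0 : ℚ_[p]) := hx.of_sub (by simpa using h)
  exact this.ne rfl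

/-- congruence -/
def Cg (r : ℕ) (x y : ℚ_[p]) : Prop := Dv r (x - y)
lemma Cg.refl (r : ℕ) (x : ℚ_[p]) : Cg r x x := by unfold Cg; rw [sub_self]; exact Dv.zero r
lemma Cg.symm {r : ℕ} {x y : ℚ_[p]} (h : Cg r x y) : Cg r y x := by
  unfold Cg at *; have := h.neg; rwa [neg_sub] at this
lemma Cg.trans {r : ℕ} {x y z : ℚ_[p]} (h : Cg r x y) (h' : Cg r y z) : Cg r x z := by
  unfold Cg at *; have := h.add h'; rwa [sub_add_sub_cancel] at this
lemma Cg.add {r : ℕ} {x y z w : ℚ_[p]} (h : Cg r x y) (h' : Cg r z w) : Cg r (x + z) (y + w) := by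
  unfold Cg at *; have := h.add h'; rwa [add_sub_add_comm]
lemma Cg.neg {r : ℕ} {x y : ℚ_[p]} (h : Cg r x y) : Cg r (-x) (-y) := by
  unfold Cg at *; have := h.neg; convert this using 1; ring
lemma Cg.sub {r : ℕ} {x y z w : ℚ_[p]} (h : Cg r x y) (h' : Cg r z w) : Cg r (x - z) (y - w) := by
  rw [sub_eq_add_neg, sub_eq_add_neg]; exact h.add h'.neg
lemma Cg.mul {r : ℕ} {x y z w : ℚ_[p]} (h : Cg r x y) (h' : Cg r z w) (hx : Dv 0 x) (hw : Dv 0 w) :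
    Cg r (x * z) (y * w) := by
  unfold Cg at *
  have := (hx.mul h').add (h.mulr hw)
  convert this using 1; ring
lemma Cg.mul_left {r : ℕ} {x y z : ℚ_[p]} (h : Cg r x y) (hz : Dv 0 z) : Cg r (z * x) (z * y) := by
  unfold Cg at *; rw [← mul_sub]; exact hz.mul h
lemma Cg.dv {r s : ℕ} {x y : ℚ_[p]} (h : Cg r x y) (hs : s ≤ r) (hy : Dv s y) : Dv s x := by
  have := (Dv.mono h hs).add hy
  rwa [sub_add_cancel] at this
lemma Cg.mono {r s : ℕ} {x y : ℚ_[p]} (h : Cg r x y) (hs : s ≤ r) : Cg s x y := Dv.mono h hs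
lemma Cg.pow {r : ℕ} {x y : ℚ_[p]} (h : Cg r x y) (hy : Dv 0 y) (n : ℕ) : Cg r (x ^ n) (y ^ n) := by
  have hx : Dv 0 x := h.dv (Nat.zero_le _) hy
  induction n with
  | zero => simpa using Cg.refl r 1
  | succ n ih => rw [pow_succ, pow_succ]; exact ih.mul h (hx.pow n) hy
lemma Cg.sum {ι : Type*} {r : ℕ} {s : Finset ι} {f g : ι → ℚ_[p]} (h : ∀ i ∈ s, Cg r (f i) (g i)) :
    Cg r (∑ i ∈ s, f i) (∑ i ∈ s, g i) := by
  unfold Cg; rw [← Finset.sum_sub_distrib]; exact Dv.sum h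
lemma Cg.prod {ι : Type*} {r : ℕ} {s : Finset ι} {f g : ι → ℚ_[p]} (h : ∀ i ∈ s, Cg r (f i) (g i))
    (hg : ∀ i ∈ s, Dv 0 (g i)) :
    Cg r (∏ i ∈ s, f i) (∏ i ∈ s, g i) := by
  classical
  induction s using Finset.induction_on with
  | empty => simpa using Cg.refl r 1
  | insert a s ha ih =>
    rw [Finset.prod_insert ha, Finset.prod_insert ha]
    exact (h a (by simp)).mul (ih (fun i hi => h i (by simp [hi])) (fun i hi => hg i (by simp [hi])))
      ((h a (by simp)).dv (Nat.zero_le _) (hg a (by simp)))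
      (Dv.prod fun i hi => hg i (by simp [hi]))
lemma Cg.inv {r : ℕ} {x y : ℚ_[p]} (h : Cg r x y) (hx : Un x) (hy : Un y) : Cg r x⁻¹ y⁻¹ := by
  unfold Cg at *
  have := (hx.dvi.mul hy.dvi).mul h.neg
  convert this using 1
  have := hx.ne; have := hy.ne
  field_simp; ring
lemma Cg.div {r : ℕ} {x y z w : ℚ_[p]} (h : Cg r x y) (h' : Cg r z w) (hx : Dv 0 x) (hz : Un z) (hw : Un w) :
    Cg r (x / z) (y / w) := by
  rw [div_eq_mul_inv, div_eq_mul_inv]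
  exact h.mul (h'.inv hz hw) hx hw.dvi
lemma Cg.of_eq {r : ℕ} {x y : ℚ_[p]} (h : x = y) : Cg r x y := h ▸ Cg.refl r x
lemma Cg.un {x y : ℚ_[p]} (h : Cg 1 x y) (hx : Un x) : Un y := hx.of_sub h

/-- transfer to the frozen statement -/
lemma ratCongr_of_cg {r : ℕ} {a b : ℚ} (h : Cg r (a : ℚ_[p]) (b : ℚ_[p])) : ratCongr p r a b := by
  unfold ratCongr Cg at *
  rw [← Rat.cast_sub] at h
  set q := a - b with hq
  rw [← Padic.norm_int_le_pow_iff_dvd]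
  rw [dv_iff_norm] at h
  have e : ((q.num : ℤ) : ℚ_[p]) = (q : ℚ_[p]) * ((q.den : ℤ) : ℚ_[p]) := by
    have : (q.den : ℚ_[p]) ≠ 0 := by exact_mod_cast q.den_ne_zero
    rw [Rat.cast_def q]; field_simp; simp
  rw [e, norm_mul]
  have h1 := Padic.norm_int_le_one (p := p) (q.den : ℤ)
  calc _ ≤ ‖(q : ℚ_[p])‖ * 1 := by gcongr
    _ ≤ _ := by simpa using h
end S19

namespace S19
open Finset

set_option linter.unusedSectionVars false
section generic
variable {K : Type*} [Field K] [CharZero K]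

def w (k : ℕ) (x : K) : K := ∏ i ∈ range k, ((x + 1 + i) * (x - i))
lemma w_zero (x : K) : w 0 x = 1 := by simp [w]
lemma w_succ (k : ℕ) (x : K) : w (k+1) x = w k x * ((x + 1 + k) * (x - k)) := by
  simp [w, prod_range_succ]
lemma w_up (k : ℕ) (x : K) : w (k+1) (x+1) = w k x * ((x + k + 1) * (x + k + 2)) := by
  induction k with
  | zero => simp [w]; ring
  | succ k ih => rw [w_succ, ih, w_succ k]; push_cast; ring
lemma w_dn (k : ℕ) (x : K) : w (k+1) (x-1) = w k x * ((x - k - 1) * (x - k)) := by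
  induction k with
  | zero => simp [w]; ring
  | succ k ih => rw [w_succ, ih, w_succ k]; push_cast; ring
lemma w_big {k n : ℕ} (h : n < k) : w k (n : K) = 0 := by
  unfold w; apply prod_eq_zero (mem_range.mpr h); simp
lemma w_nat (k n : ℕ) : w k (n : K) = (n.choose k : K) * ((n+k).choose k : K) * (k.factorial : K)^2 := by
  induction k with
  | zero => simp [w]
  | succ k ih =>
    have h1 : (n.choose (k+1) : K) * (k+1) = (n.choose k : K) * (n - k) := by
      rcases le_or_gt k n with h | h
      · have := Nat.choose_succ_right_eq n k
        have h2 : ((n.choose (k+1) * (k+1) : ℕ) : K) = ((n.choose k * (n - k) : ℕ) : K) := by rw [this]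
        push_cast [Nat.cast_sub h] at h2; exact h2
      · rw [Nat.choose_eq_zero_of_lt h, Nat.choose_eq_zero_of_lt (by omega)]; simp
    have h3 : ((n+(k+1)).choose (k+1) : K) * (k+1) = ((n+k).choose k : K) * (n+k+1) := by
      have := Nat.add_one_mul_choose_eq (n+k) k
      have h2 : (((n+k+1) * (n+k).choose k : ℕ) : K) = (((n+k+1).choose (k+1) * (k+1) : ℕ) : K) := by rw [this]
      push_cast at h2; rw [← add_assoc, ← h2]; ring
    rw [w_succ, ih, Nat.factorial_succ]; push_cast
    linear_combination (-((n+(k+1)).choose (k+1) : K) * (k+1) * (k.factorial : K)^2) * h1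
      - ((n.choose k : K) * (n - k)) * (k.factorial : K)^2 * h3

def cc (k : ℕ) : K := ((3*k).factorial : K) / ((k.factorial : K)^3 * 27^k)
lemma fne (k : ℕ) : (k.factorial : K) ≠ 0 := by exact_mod_cast k.factorial_ne_zero
lemma sne (k : ℕ) : (k + 1 : K) ≠ 0 := by exact_mod_cast k.succ_ne_zero
lemma cc_succ (k : ℕ) : (cc (k+1) : K) * (k+1)^2 = cc k * ((k + 1/3) * (k + 2/3)) := by
  unfold cc
  rw [show 3*(k+1) = 3*k+1+1+1 by ring, Nat.factorial_succ, Nat.factorial_succ, Nat.factorial_succ, Nat.factorial_succ]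
  have := fne (K := K) k; have := sne (K := K) k
  push_cast; field_simp; ring
lemma cc_zero : (cc 0 : K) = 1 := by simp [cc]
lemma cc_ne (k : ℕ) : (cc k : K) ≠ 0 := by
  unfold cc; exact div_ne_zero (fne _) (mul_ne_zero (pow_ne_zero _ (fne _)) (pow_ne_zero _ (by norm_num)))
lemma cc_choose (k : ℕ) : (cc k : K) = ((2*k).choose k : K) * ((3*k).choose k : K) / 27^k := by
  unfold cc
  have h1 := Nat.choose_mul_factorial_mul_factorial (show k ≤ 2*k by omega)
  have h2 := Nat.choose_mul_factorial_mul_factorial (show k ≤ 3*k by omega)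
  rw [show 2*k-k = k by omega] at h1
  rw [show 3*k-k = 2*k by omega] at h2
  have h1' : ((2*k).choose k : K) * k.factorial * k.factorial = (2*k).factorial := by exact_mod_cast h1
  have h2' : ((3*k).choose k : K) * k.factorial * (2*k).factorial = (3*k).factorial := by exact_mod_cast h2
  have := fne (K := K) k
  rw [← h2', ← h1']; field_simp

def ga (k : ℕ) : K := cc k / (k.factorial : K)^2
lemma ga_succ (k : ℕ) : (ga (k+1) : K) * (k+1)^4 = ga k * ((k + 1/3) * (k + 2/3)) := by
  unfold ga
  have h := cc_succ (K := K) k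
  have := fne (K := K) k; have := sne (K := K) k
  rw [Nat.factorial_succ]; push_cast; field_simp
  field_simp at h; linear_combination h

lemma w_rec (k : ℕ) (x : K) :
    (x+1)^3 * w (k+1) (x+1) - (2*x+1) * ((x+1)*x + 5/9) * w (k+1) x + x^3 * w (k+1) (x-1)
    = (2*x+1) * (2*(k+1)^4 * w k x + 2*(k+4/3)*(k+5/3) * w (k+1) x) := by
  rw [w_up, w_dn, w_succ]; ring

lemma w_rec_sum (N : ℕ) (x : K) :
    ∑ k ∈ range (N+1), (-1)^k * ga k * ((x+1)^3 * w k (x+1) - (2*x+1) * ((x+1)*x + 5/9) * w k x + x^3 * w k (x-1))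
     = (2*x+1) * (-1)^N * 2 * ga N * ((N+1/3)*(N+2/3)) * w N x := by
  induction N with
  | zero => simp [w, ga, cc]; ring
  | succ N ih =>
    rw [sum_range_succ, ih, w_rec]; push_cast
    linear_combination -((2*x+1) * (-1)^N * 2 * w N x) * ga_succ (K := K) N

def v (n : ℕ) : K := ∑ k ∈ range (n+1), (-1)^k * ga k * w k (n : K)
lemma v_eq {n N : ℕ} (h : n ≤ N) : (v n : K) = ∑ k ∈ range (N+1), (-1)^k * ga k * w k (n : K) := by
  unfold v
  apply sum_subset
  · intro a; simp; omega
  · intro a _ ha; rw [w_big (by simpa using ha)]; simp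
lemma v_zero : (v 0 : K) = 1 := by simp [v, w, ga, cc]
lemma v_one : (v 1 : K) = 5/9 := by
  simp [v, w, ga, cc, sum_range_succ, Nat.factorial]; norm_num
lemma v_rec (n : ℕ) : ((n:K)+2)^3 * v (n+2) - (2*n+3)*((n+2)*(n+1)+5/9) * v (n+1) + (n+1)^3 * v n = 0 := by
  have h := w_rec_sum (K := K) (n+2) (n+1)
  rw [show ((n:K)+1) = ((n+1:ℕ):K) by push_cast; ring, w_big (show n+1 < n+2 by omega)] at h
  rw [v_eq (show n+2 ≤ n+2 by omega), v_eq (show n+1 ≤ n+2 by omega), v_eq (show n ≤ n+2 by omega)]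
  rw [mul_sum, mul_sum, mul_sum, ← sum_sub_distrib, ← sum_add_distrib]
  rw [mul_zero] at h; rw [← h]
  apply sum_congr rfl; intro k _
  push_cast
  rw [show ((n:K)+1-1) = n by ring, show ((n:K)+1+1) = n+2 by ring]; ring

/-- symmetric form: holds for all n≥1 -/
lemma v_rec' (n : ℕ) (hn : 1 ≤ n) : ((n:K)+1)^3 * v (n+1) - (2*n+1)*((n+1)*n+5/9) * v n + n^3 * v (n-1) = 0 := by
  obtain ⟨k, rfl⟩ : ∃ k, n = k+1 := ⟨n-1, by omega⟩
  have := v_rec (K := K) k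
  simp only [Nat.add_sub_cancel]; push_cast
  linear_combination this

/-- telescoping -/
lemma pieceI (N : ℕ) (t : K) : ∑ n ∈ range (N+1), v n * ((n:K)^3 * t^n - (2*n+1)*(n^2+n+5/9)*t^(n+1) + (n+1)^3*t^(n+2))
    = ((N:K)+1)^3 * (v N * t^(N+2) - v (N+1) * t^(N+1)) := by
  induction N with
  | zero => simp [v_zero, v_one]; ring
  | succ N ih =>
    rw [sum_range_succ, ih]
    have := v_rec (K := K) N
    push_cast
    linear_combination (t^(N+2)) * this

end generic

lemma seqV3_eq (n : ℕ) : seqV3 n = 27^n * v n := by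
  unfold seqV3 v
  rw [mul_sum]; apply sum_congr rfl; intro k hk
  have hk' : k ≤ n := by simpa [Nat.lt_succ_iff] using hk
  rw [w_nat, ga, cc_choose]
  have := fne (K := ℚ) k
  obtain ⟨d, rfl⟩ := Nat.exists_eq_add_of_le hk'
  rw [Nat.add_sub_cancel_left, pow_add]
  field_simp

lemma v_cast {K : Type*} [Field K] [CharZero K] (n : ℕ) : ((v n : ℚ) : K) = v n := by
  unfold v ga cc w; push_cast; rfl

lemma term_cast (n : ℕ) : seqV3 n / 243^n = v n * (1/9)^n := by
  rw [seqV3_eq, show (243:ℚ) = 27*9 by norm_num, mul_pow, div_pow]; field_simp; simp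
end S19

set_option linter.unusedSectionVars false
set_option linter.unusedSimpArgs false
namespace S19
open Finset Polynomial

section hecke
variable {K : Type*} [Field K] [CharZero K]

lemma C2' : (C 2 : K[X]) = 2 := rfl
/-- q = 1 - u^3 -/
noncomputable def qq : K[X] := 1 - X^3
noncomputable def D0 (f : K[X]) : K[X] := -(qq * X * derivative f)
/-- conjugation of 3 s θ by u -/
noncomputable def E3 (y : K[X]) : K[X] := D0 y + qq * y
lemma D0_add (f g : K[X]) : D0 (f+g) = D0 f + D0 g := by simp [D0]; ring
lemma D0_mul (f g : K[X]) : D0 (f*g) = D0 f * g + f * D0 g := by simp [D0]; ring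
lemma E3_add (f g : K[X]) : E3 (f+g) = E3 f + E3 g := by simp [E3, D0_add]; ring
lemma E3_mul (f g : K[X]) : E3 (f*g) = D0 f * g + f * E3 g := by simp [E3, D0_mul]; ring
lemma D0_C (a : K) : D0 (C a) = 0 := by simp [D0]
lemma E3_C (a : K) (g : K[X]) : E3 (C a * g) = C a * E3 g := by simp [E3_mul, D0_C]

noncomputable def M (P : K[X]) (y : K[X]) : K[X] :=
  E3 (E3 (E3 y)) - 9 * P * X^3 * E3 (E3 y)
   + (9*qq^2 - 10*qq + 27*P*qq*X^3 + 27*P^2*X^6) * E3 y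
   + (-27*P^3*X^9 - 81*P^2*qq*X^6 - P*X^3*(81*qq^2-57*qq) + X^3*(27*qq^2-15*qq)) * y
lemma M_add (P : K[X]) (f g : K[X]) : M P (f+g) = M P f + M P g := by
  simp only [M, E3_add]; ring
lemma M_C (P : K[X]) (a : K) (g : K[X]) : M P (C a * g) = C a * M P g := by
  simp only [M, E3_C]; ring
lemma M_zero (P : K[X]) : M P (0 : K[X]) = 0 := by
  have := M_C P (0:K) 0; simpa using this
lemma M_sum (P : K[X]) {ι : Type*} (s : Finset ι) (f : ι → K[X]) : M P (∑ i ∈ s, f i) = ∑ i ∈ s, M P (f i) := by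
  classical
  induction s using Finset.induction_on with
  | empty => simp [M_zero]
  | insert a s ha ih => rw [sum_insert ha, sum_insert ha, M_add, ih]

lemma D0_nat (n : ℕ) : D0 (n : K[X]) = 0 := by simp [D0]
lemma D0_X : D0 (X : K[X]) = -(qq * X) := by simp [D0]
lemma D0_pow (f : K[X]) (n : ℕ) : D0 (f^(n+1)) = ((n:K[X])+1) * f^n * D0 f := by
  simp [D0, derivative_pow_succ]; ring

/-- If `E3 z = f z`. -/
lemma M_eig (P : K[X]) (z f : K[X]) (h : E3 z = f * z) : M P z =
   ((D0 (D0 f) + 3 * f * D0 f + f^3) - 9 * P * X^3 * (D0 f + f^2)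
   + (9*qq^2 - 10*qq + 27*P*qq*X^3 + 27*P^2*X^6) * f
   + (-27*P^3*X^9 - 81*P^2*qq*X^6 - P*X^3*(81*qq^2-57*qq) + X^3*(27*qq^2-15*qq))) * z := by
  simp only [M, h, E3_mul, E3_add, D0_mul, D0_add]; ring

/-- If `g E3 z = f z`. -/
lemma M_eig' (P : K[X]) (z g f : K[X]) (h : g * E3 z = f * z) : g^3 * M P z =
   (g^2 * D0 (D0 f) + g * (2 * D0 f - D0 (D0 g)) * f + (f - 2 * D0 g) * (g * D0 f + (f - D0 g) * f)
     - 9 * P * X^3 * g * (g * D0 f + (f - D0 g) * f)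
   + (9*qq^2 - 10*qq + 27*P*qq*X^3 + 27*P^2*X^6) * g^2 * f
   + (-27*P^3*X^9 - 81*P^2*qq*X^6 - P*X^3*(81*qq^2-57*qq) + X^3*(27*qq^2-15*qq)) * g^3) * z := by
  have h2 : g * E3 (E3 z) = D0 f * z + (f - D0 g) * E3 z := by
    have := congrArg E3 h
    rw [E3_mul, E3_mul] at this
    linear_combination this
  have h3 : g * E3 (E3 (E3 z)) = D0 (D0 f) * z + (2 * D0 f - D0 (D0 g)) * E3 z + (f - 2 * D0 g) * E3 (E3 z) := by
    have := congrArg E3 h2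
    rw [E3_mul, E3_add, E3_mul, E3_mul] at this
    rw [show D0 (f - D0 g) = D0 f - D0 (D0 g) by simp [D0]; ring] at this
    linear_combination this
  unfold M
  linear_combination g^2 * h3 + (g * (f - 2 * D0 g) - 9 * P * X^3 * g^2) * h2
    + (g * (2 * D0 f - D0 (D0 g)) + (f - 2 * D0 g - 9 * P * X^3 * g) * (f - D0 g) 
       + g^2 * (9*qq^2 - 10*qq + 27*P*qq*X^3 + 27*P^2*X^6)) * h

/-- action on `u^j q^i` -/
lemma E3_mono (j i : ℕ) : E3 ((X:K[X])^j * qq^i) = (3 * (i:K[X]) * X^3 - ((j:K[X]) - 1) * qq) * (X^j * qq^i) := by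
  have h1 : X * derivative ((X:K[X])^j) = (j:K[X]) * X^j := by
    cases j with
    | zero => simp
    | succ j => simp [derivative_X_pow]; ring
  have h2 : qq * derivative ((qq:K[X])^i) = -(3 * (i:K[X]) * X^2) * qq^i := by
    cases i with
    | zero => simp
    | succ i =>
      rw [derivative_pow_succ]
      have : derivative (qq:K[X]) = -3 * X^2 := by simp [qq, derivative_X_pow, C2']; norm_num
      rw [this]; simp; ring
  simp only [E3, D0, derivative_mul]
  linear_combination (-qq * qq^i) * h1 - (X * X^j) * h2

lemma M_mono0 (P : K[X]) (i : ℕ) : M P ((qq:K[X])^i) = X^3 * (27 * ((i:K[X])-P)^3 - (6*((i:K[X])-P)+2)*(9*((i:K[X])-P)^2+6*((i:K[X])-P)+3) * qq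
    + (3*((i:K[X])-P)+2)^3 * qq^2) * qq^i := by
  have h := E3_mono (K := K) 0 i
  simp only [pow_zero, one_mul] at h
  rw [M_eig P _ _ h]
  congr 1
  simp [D0, qq, derivative_X_pow, C2']; ring
lemma M_mono1 (P : K[X]) (i : ℕ) : M P ((X:K[X]) * qq^i) = X^3 * (27 * ((i:K[X])-P)^3 - (2*((i:K[X])-P)+1)*(27*((i:K[X])-P)^2+27*((i:K[X])-P)+15) * qq
    + 27*(((i:K[X])-P)+1)^3 * qq^2) * (X * qq^i) := by
  have h := E3_mono (K := K) 1 i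
  simp only [pow_one] at h
  rw [M_eig P _ _ h]
  congr 1
  simp [D0, qq, derivative_X_pow, C2']; ring
lemma M_mono2 (P : K[X]) (i : ℕ) : M P ((X:K[X])^2 * qq^i) = X^3 * (27 * ((i:K[X])-P)^3 - (6*((i:K[X])-P)+4)*(9*((i:K[X])-P)^2+12*((i:K[X])-P)+6) * qq
    + (3*((i:K[X])-P)+4)^3 * qq^2) * (X^2 * qq^i) := by
  have h := E3_mono (K := K) 2 i
  rw [M_eig P _ _ h]
  congr 1
  simp [D0, qq, derivative_X_pow, C2']; ring

/-- basic polynomial -/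
noncomputable def YY (n e : ℕ) : K[X] := (1-X)^(4*n+1) * (2+X) * qq^e
lemma E3_YY (n e : ℕ) : (2+X) * E3 (YY n e : K[X]) =
   ((4*(n:K[X])+1)*X*(1+X+X^2)*(2+X) - X*qq + (3*X^3*(e:K[X])+qq)*(2+X)) * YY n e := by
  have h2 : qq * derivative ((qq:K[X])^e) = -(3 * (e:K[X]) * X^2) * qq^e := by
    cases e with
    | zero => simp
    | succ i =>
      rw [derivative_pow_succ]
      have : derivative (qq:K[X]) = -3 * X^2 := by simp [qq, derivative_X_pow, C2']; norm_num
      rw [this]; simp; ring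
  have h1 : derivative ((1-X:K[X])^(4*n+1)) = -(4*(n:K[X])+1) * (1-X)^(4*n) := by
    rw [derivative_pow_succ]; simp [show (C 4 : K[X]) = 4 from rfl]; ring
  have h3 : (qq : K[X]) = (1-X)*(1+X+X^2) := by simp only [qq]; ring
  unfold YY E3 D0
  rw [derivative_mul, derivative_mul, h1, pow_succ]
  simp only [derivative_add, derivative_X, derivative_ofNat, zero_add, mul_one]
  linear_combination (-(2+X) * X * (1-X)^(4*n) * (1-X) * (2+X)) * h2 + ((2+X)*(2+X)*X*(4*(n:K[X])+1)*(1-X)^(4*n)*qq^e) * h3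

lemma hecke1 (P : K[X]) (n e : ℕ) (hP : P = n + e + 1) : M P (YY n e : K[X]) =
    X^3 * (81 * (n:K[X])^3*(1+X+X^2)^2 - (2*(n:K[X])+1)*(9*(n:K[X])^2+9*(n:K[X])+5)*((1-X)^3*(1+X+X^2)) + ((n:K[X])+1)^3*(1-X)^6) * YY n e := by
  have h := M_eig' P _ _ _ (E3_YY (K := K) n e)
  have hne : ((2:K[X])+X)^3 ≠ 0 := by
    apply pow_ne_zero
    intro h0
    have := congrArg (eval 0) h0
    simp at this
  apply mul_left_cancel₀ hne
  rw [h, ← mul_assoc]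
  congr 1
  subst hP
  simp [D0, qq, derivative_X_pow, C2']; ring
end hecke
end S19

set_option linter.unusedSectionVars false
set_option linter.unusedSimpArgs false
namespace S19
open Finset Polynomial

section tri
variable {K : Type*} [Field K] [CharZero K]

lemma pieceI_hom (N : ℕ) (t s : K[X]) : ∑ n ∈ range (N+1), C (v n : K) * t^n * s^(N-n) *
     ((n:K[X])^3 * s^2 - (2*(n:K[X])+1)*((n:K[X])^2+(n:K[X])+C (5/9))*(t*s) + ((n:K[X])+1)^3*t^2)
    = ((N:K[X])+1)^3 * (C (v N) * t^(N+2) - C (v (N+1)) * t^(N+1) * s) := by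
  induction N with
  | zero => simp [v_zero, v_one]; ring
  | succ N ih =>
    rw [sum_range_succ]
    have h : ∀ n ∈ range (N+1), C (v n : K) * t^n * s^(N+1-n) *
     ((n:K[X])^3 * s^2 - (2*(n:K[X])+1)*((n:K[X])^2+(n:K[X])+C (5/9))*(t*s) + ((n:K[X])+1)^3*t^2)
       = s * (C (v n : K) * t^n * s^(N-n) *
     ((n:K[X])^3 * s^2 - (2*(n:K[X])+1)*((n:K[X])^2+(n:K[X])+C (5/9))*(t*s) + ((n:K[X])+1)^3*t^2)) := by
      intro n hn
      have : N + 1 - n = (N - n) + 1 := by simp at hn; omega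
      rw [this, pow_succ]; ring
    rw [sum_congr rfl h, ← mul_sum, ih]
    have hr := congrArg (C : K → K[X]) (v_rec (K := K) N)
    simp only [map_add, map_sub, map_mul, map_pow, map_natCast, map_ofNat, map_one, map_zero] at hr
    rw [Nat.sub_self]
    push_cast
    have hN : N + 1 + 1 = N + 2 := rfl
    rw [hN]
    linear_combination (t^(N+2) * s) * hr

/-- the Hecke-type polynomial -/
noncomputable def NN (P : ℕ) : K[X] := ∑ n ∈ range P, C (v n * (1/9)^n) * YY n (P-1-n)
noncomputable def RR (P : ℕ) : K[X] := (2+X) * (1-X)^(4*P-1) * C ((1/9)^P) *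
   (C (v (P-1) * (1/9)) * (1-X)^4 - C (v P) * qq)

lemma M_NN (P : ℕ) (hP : 1 ≤ P) : M (P : K[X]) (NN P) = X^3 * (81 * (P:K[X])^3 * RR P) := by
  obtain ⟨N, rfl⟩ : ∃ N, P = N + 1 := ⟨P - 1, by omega⟩
  have hne : (1 - X : K[X]) ≠ 0 := by
    intro h; have := congrArg (eval 0) h; simp at this
  have hq : (qq : K[X]) = (1-X)*(1+X+X^2) := by simp only [qq]; ring
  have hh := pieceI_hom (K := K) N (C (1/9) * (1-X)^4) qq
  have h59 : (C (5/9) : K[X]) * 9 = 5 := by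
    rw [show (9:K[X]) = C 9 from rfl, ← C_mul, show (5:K[X]) = C 5 from rfl]; congr 1; norm_num
  have h19 : (C (1/9) : K[X]) * 9 = 1 := by
    rw [show (9:K[X]) = C 9 from rfl, ← C_mul]; simp
  apply mul_left_cancel₀ hne
  unfold NN RR
  rw [M_sum, mul_sum, Nat.add_sub_cancel, show 4*(N+1)-1 = 4*N+3 by omega]
  have h : ∀ n ∈ range (N+1), (1-X) * M ((N+1:ℕ):K[X]) (C (v n * (1/9)^n : K) * YY n (N-n)) = 
     X^3 * (2+X) * 81 * ( C (v n : K) * (C (1/9) * (1-X)^4)^n * qq^(N-n) *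
     ((n:K[X])^3 * qq^2 - (2*(n:K[X])+1)*((n:K[X])^2+(n:K[X])+C (5/9))*((C (1/9) * (1-X)^4)*qq) + ((n:K[X])+1)^3*(C (1/9) * (1-X)^4)^2)) := by
    intro n hn
    have e : ((N+1:ℕ):K[X]) = n + ((N-n:ℕ):K[X]) + 1 := by
      have : N + 1 = n + (N-n) + 1 := by simp at hn; omega
      exact_mod_cast congrArg (Nat.cast : ℕ → K[X]) this
    rw [M_C, hecke1 _ n (N-n) e, YY, C_mul, C_pow, mul_pow, ← pow_mul]
    have h81 : (C (1/9) : K[X])^2 * 81 = 1 := by linear_combination (9 * C (1/9) + 1) * h19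
    have hb : 81 * ((n:K[X])^3 * qq^2 - (2*(n:K[X])+1)*((n:K[X])^2+(n:K[X])+C (5/9))*((C (1/9) * (1-X)^4)*qq) + ((n:K[X])+1)^3*(C (1/9) * (1-X)^4)^2) = (1-X)^2 * (81 * (n:K[X])^3*(1+X+X^2)^2 - (2*(n:K[X])+1)*(9*(n:K[X])^2+9*(n:K[X])+5)*((1-X)^3*(1+X+X^2)) + ((n:K[X])+1)^3*(1-X)^6) := by
      rw [hq]
      have h59' : (C (5/9) : K[X]) * (C (1/9)) * 81 = 5 := by linear_combination h59 + 9 * C (5/9) * h19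
      linear_combination ((n:K[X])+1)^3*(1-X)^8 * h81 - (2*(n:K[X])+1) * (1-X)^5*(1+X+X^2) * h59' - 9 * (2*(n:K[X])+1) * (1-X)^5*(1+X+X^2) * ((n:K[X])^2+(n:K[X])) * h19
    linear_combination (- X^3 * (2+X) * C (v n) * (C (1/9)^n) * (1-X)^(4*n) * qq^(N-n)) * hb
  rw [sum_congr rfl h, ← mul_sum, hh, mul_pow, mul_pow, ← pow_mul, ← pow_mul, C_mul, C_pow]
  push_cast
  rw [show 4*(N+2) = 4*N+3+5 by ring, show 4*(N+1) = 4*N+3+1 by ring]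
  ring

/-- trisection -/
noncomputable def tA (F : K[X]) : K[X] := (contract 3 F).comp (1-X)
noncomputable def tB (F : K[X]) : K[X] := (contract 3 (divX F)).comp (1-X)
noncomputable def tC (F : K[X]) : K[X] := (contract 3 (divX (divX F))).comp (1-X)

lemma comp_qq (f : K[X]) : f.comp qq = expand K 3 (f.comp (1-X)) := by
  rw [expand_eq_comp_X_pow, comp_assoc]; simp [qq]
lemma comp_comp1 (f : K[X]) : (f.comp (1-X)).comp (1-X) = f := by
  rw [comp_assoc]; simp

lemma tri_eq (F : K[X]) : F = (tA F).comp qq + X * (tB F).comp qq + X^2 * (tC F).comp qq := by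
  simp only [comp_qq, tA, tB, tC, comp_comp1]
  ext n
  have h3 : n % 3 = 0 ∨ n % 3 = 1 ∨ n % 3 = 2 := by omega
  have e : X^2 * expand K 3 (contract 3 F.divX.divX) = X * (X * expand K 3 (contract 3 F.divX.divX)) := by ring
  rw [e]
  simp only [coeff_add]
  rcases h3 with h | h | h
  · obtain ⟨k, rfl⟩ : ∃ k, n = 3 * k := ⟨n/3, by omega⟩
    rcases k with _ | k
    · simp [coeff_expand, coeff_contract]
    · rw [show 3 * (k+1) = 3*k+1+1+1 by ring]
      rw [coeff_X_mul, coeff_X_mul, coeff_X_mul]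
      simp only [coeff_expand (by norm_num : 0 < 3), coeff_contract (by norm_num : (3:ℕ) ≠ 0)]
      rw [if_pos (by omega), if_neg (by omega), if_neg (by omega), show (3*k+1+1+1)/3*3 = 3*k+1+1+1 by omega]
      simp
  · obtain ⟨k, rfl⟩ : ∃ k, n = 3 * k + 1 := ⟨n/3, by omega⟩
    rw [coeff_X_mul, coeff_X_mul]
    rcases k with _ | k
    · simp [coeff_expand, coeff_contract, coeff_divX]
    · rw [show 3 * (k+1) = 3*k+1+1+1 by ring, coeff_X_mul]
      simp only [coeff_expand (by norm_num : 0 < 3), coeff_contract (by norm_num : (3:ℕ) ≠ 0)]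
      rw [if_neg (by omega), if_pos (by omega), if_neg (by omega), show (3*k+1+1+1)/3*3 = 3*k+1+1+1 by omega, coeff_divX]
      simp
  · obtain ⟨k, rfl⟩ : ∃ k, n = 3 * k + 1 + 1 := ⟨n/3, by omega⟩
    rw [coeff_X_mul, coeff_X_mul, coeff_X_mul]
    simp only [coeff_expand (by norm_num : 0 < 3), coeff_contract (by norm_num : (3:ℕ) ≠ 0)]
    rw [if_neg (by omega), if_neg (by omega), if_pos (by omega), show (3*k)/3*3 = 3*k by omega, coeff_divX, coeff_divX]
    simp

lemma tA_uniq (A B D : K[X]) : tA (A.comp qq + X * B.comp qq + X^2 * D.comp qq) = A := by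
  have : contract 3 (A.comp qq + X * B.comp qq + X^2 * D.comp qq) = A.comp (1-X) := by
    simp only [comp_qq]
    ext n
    rw [coeff_contract (by norm_num), show X^2 * expand K 3 (D.comp (1-X)) = X * (X * expand K 3 (D.comp (1-X))) by ring]
    rcases n with _ | n
    · simp [coeff_expand]
    · rw [show (n+1)*3 = 3*n+1+1+1 by ring]
      simp only [coeff_add, coeff_X_mul, coeff_expand (by norm_num : 0 < 3)]
      rw [if_pos (by omega), if_neg (by omega), if_neg (by omega), show (3*n+1+1+1)/3 = n+1 by omega]; simp
  rw [tA, this, comp_comp1]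
lemma tB_uniq (A B D : K[X]) : tB (A.comp qq + X * B.comp qq + X^2 * D.comp qq) = B := by
  have : contract 3 (divX (A.comp qq + X * B.comp qq + X^2 * D.comp qq)) = B.comp (1-X) := by
    simp only [comp_qq]
    ext n
    rw [coeff_contract (by norm_num), coeff_divX, show X^2 * expand K 3 (D.comp (1-X)) = X * (X * expand K 3 (D.comp (1-X))) by ring]
    rcases n with _ | n
    · simp [coeff_expand]
    · rw [show (n+1)*3 = 3*n+1+1+1 by ring]
      simp only [coeff_add, coeff_X_mul, coeff_expand (by norm_num : 0 < 3)]
      rw [if_neg (by omega), if_pos (by omega), if_neg (by omega), show (3*n+1+1+1)/3 = n+1 by omega]; simp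
  rw [tB, this, comp_comp1]
lemma tC_uniq (A B D : K[X]) : tC (A.comp qq + X * B.comp qq + X^2 * D.comp qq) = D := by
  have : contract 3 (divX (divX (A.comp qq + X * B.comp qq + X^2 * D.comp qq))) = D.comp (1-X) := by
    simp only [comp_qq]
    ext n
    rw [coeff_contract (by norm_num), coeff_divX, coeff_divX, show X^2 * expand K 3 (D.comp (1-X)) = X * (X * expand K 3 (D.comp (1-X))) by ring]
    rcases n with _ | n
    · simp [coeff_expand]
    · rw [show (n+1)*3 = 3*n+1+1+1 by ring]
      simp only [coeff_add, coeff_X_mul, coeff_expand (by norm_num : 0 < 3)]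
      rw [if_neg (by omega), if_neg (by omega), if_pos (by omega), show (3*n+1+1+1)/3 = n+1 by omega]; simp
  rw [tC, this, comp_comp1]

/-- three-term operator on polynomials -/
noncomputable def Lg (f0 f1 f2 : K → K) (B : K[X]) : K[X] :=
  B.sum fun i b => C (b * f0 i) * X^i - C (b * f1 i) * X^(i+1) + C (b * f2 i) * X^(i+2)
lemma Lg_eq (f0 f1 f2 : K → K) (B : K[X]) {N : ℕ} (hN : B.natDegree < N) : Lg f0 f1 f2 B =
   ∑ i ∈ range N, (C (B.coeff i * f0 i) * X^i - C (B.coeff i * f1 i) * X^(i+1) + C (B.coeff i * f2 i) * X^(i+2)) := by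
  unfold Lg
  exact sum_over_range' _ (by simp) _ hN
lemma Lg_coeff (f0 f1 f2 : K → K) (B : K[X]) (k : ℕ) : (Lg f0 f1 f2 B).coeff k = 
    f0 k * B.coeff k - (if 1 ≤ k then f1 ((k-1:ℕ):K) * B.coeff (k-1) else 0) + (if 2 ≤ k then f2 ((k-2:ℕ):K) * B.coeff (k-2) else 0) := by
  rw [Lg_eq f0 f1 f2 B (N := max (B.natDegree+1) (k+1)) (by simp), finsetSum_coeff]
  simp only [coeff_add, coeff_sub, coeff_C_mul, coeff_X_pow, mul_ite, mul_one, mul_zero, sum_add_distrib, sum_sub_distrib]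
  have hk : k < max (B.natDegree+1) (k+1) := by simp
  congr 1
  · congr 1
    · rw [sum_ite_eq, if_pos (by simpa using hk)]; ring
    · split_ifs with h
      · rw [sum_eq_single (k-1)]
        · rw [if_pos (by omega)]; ring
        · intro b _ hb; rw [if_neg (by omega)]
        · intro hh; exact absurd (by simp only [mem_range]; omega) hh
      · apply sum_eq_zero; intro b _; rw [if_neg (by omega)]
  · split_ifs with h
    · rw [sum_eq_single (k-2)]
      · rw [if_pos (by omega)]; ring
      · intro b _ hb; rw [if_neg (by omega)]
      · intro hh; exact absurd (by simp only [mem_range]; omega) hh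
    · apply sum_eq_zero; intro b _; rw [if_neg (by omega)]

lemma M_comp (P : ℕ) (g : K[X]) (f0 f1 f2 : K → K) 
   (hm : ∀ i : ℕ, M (P:K[X]) (g * qq^i) = X^3 * (C (f0 i) - C (f1 i) * qq + C (f2 i) * qq^2) * (g * qq^i)) (B : K[X]) :
   M (P:K[X]) (g * B.comp qq) = X^3 * (g * (Lg f0 f1 f2 B).comp qq) := by
  have h1 : B.comp qq = ∑ i ∈ range (B.natDegree+1), C (B.coeff i) * qq^i := by
    rw [comp, eval₂_eq_sum_range]
  rw [h1, mul_sum, M_sum, Lg_eq f0 f1 f2 B (Nat.lt_succ_self _), ← coe_compRingHom_apply, map_sum, mul_sum, mul_sum]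
  apply sum_congr rfl
  intro i _
  rw [mul_left_comm, M_C, hm]
  simp only [coe_compRingHom_apply, add_comp, sub_comp, mul_comp, C_comp, pow_comp, X_comp, C_mul]
  ring

def a0 (P : ℕ) (i : K) : K := 27 * (i - P)^3
def a1 (P : ℕ) (i : K) : K := (6*(i-P)+2)*(9*(i-P)^2+6*(i-P)+3)
def a2 (P : ℕ) (i : K) : K := (3*(i-P)+2)^3
def b1 (P : ℕ) (i : K) : K := (2*(i-P)+1)*(27*(i-P)^2+27*(i-P)+15)
def b2 (P : ℕ) (i : K) : K := 27*(i-P+1)^3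
def c1 (P : ℕ) (i : K) : K := (6*(i-P)+4)*(9*(i-P)^2+12*(i-P)+6)
def c2 (P : ℕ) (i : K) : K := (3*(i-P)+4)^3

lemma tri_M (P : ℕ) (F R : K[X]) (h : M (P:K[X]) F = X^3 * R) :
    Lg (a0 P) (a1 P) (a2 P) (tA F) = tA R ∧ Lg (a0 P) (b1 P) (b2 P) (tB F) = tB R ∧ Lg (a0 P) (c1 P) (c2 P) (tC F) = tC R := by
  have h0 := M_comp (K := K) P 1 (a0 P) (a1 P) (a2 P) (by
    intro i; simp only [one_mul, M_mono0, a0, a1, a2, map_add, map_sub, map_mul, map_pow, map_natCast, map_ofNat]) (tA F)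
  have h1 := M_comp (K := K) P X (a0 P) (b1 P) (b2 P) (by
    intro i; simp only [M_mono1, a0, b1, b2, map_add, map_sub, map_mul, map_pow, map_natCast, map_ofNat, map_one]) (tB F)
  have h2 := M_comp (K := K) P (X^2) (a0 P) (c1 P) (c2 P) (by
    intro i; simp only [M_mono2, a0, c1, c2, map_add, map_sub, map_mul, map_pow, map_natCast, map_ofNat]) (tC F)
  rw [one_mul, one_mul] at h0
  have hR : R = (Lg (a0 P) (a1 P) (a2 P) (tA F)).comp qq + X * (Lg (a0 P) (b1 P) (b2 P) (tB F)).comp qq + X^2 * (Lg (a0 P) (c1 P) (c2 P) (tC F)).comp qq := by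
    have : (X:K[X])^3 ≠ 0 := pow_ne_zero _ X_ne_zero
    apply mul_left_cancel₀ this
    rw [← h]
    conv_lhs => rw [tri_eq F]
    rw [M_add, M_add, h0, h1, h2]; ring
  refine ⟨?_, ?_, ?_⟩
  · conv_rhs => rw [hR, tA_uniq]
  · conv_rhs => rw [hR, tB_uniq]
  · conv_rhs => rw [hR, tC_uniq]
end tri
end S19

set_option linter.unusedSectionVars false
set_option linter.unusedSimpArgs false
namespace S19
open Finset Polynomial

lemma ga_w {K : Type*} [Field K] [CharZero K] (k n : ℕ) : (ga k * w k (n:K) : K) = cc k * (n.choose k : K) * ((n+k).choose k : K) := by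
  rw [ga, w_nat]; field_simp [fne (K := K) k]
lemma v_choose {K : Type*} [Field K] [CharZero K] (n : ℕ) : (v n : K) = ∑ k ∈ range (n+1), (-1)^k * (cc k * (n.choose k : K) * ((n+k).choose k : K)) := by
  rw [v]; apply sum_congr rfl; intro k _; rw [mul_assoc, ga_w]

lemma sum_range_pred {K : Type*} [AddCommMonoid K] (f : ℕ → K) {n : ℕ} (h : 1 ≤ n) : ∑ k ∈ range n, f k = ∑ k ∈ range (n-1), f (k+1) + f 0 := by
  obtain ⟨m, rfl⟩ : ∃ m, n = m + 1 := ⟨n-1, by omega⟩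
  rw [sum_range_succ', Nat.add_sub_cancel]

variable {p : ℕ} [hp : Fact p.Prime]

lemma cg_int {a b : ℤ} {r : ℕ} (h : (p:ℤ)^r ∣ a - b) : Cg r (a : ℚ_[p]) b := by
  obtain ⟨c, hc⟩ := h
  unfold Cg
  rw [← Int.cast_sub, hc]; push_cast
  exact (Dv.pp r).mulr (Dv.int c)
lemma cg_nat {a b : ℕ} (h : a ≡ b [MOD p]) : Cg 1 (a : ℚ_[p]) b := by
  have := cg_int (p := p) (a := a) (b := b) (r := 1) (by
    rw [pow_one]; exact (Nat.modEq_iff_dvd.1 h.symm))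
  simpa using this
lemma cg_zmod {a b : ℤ} (h : (a : ZMod p) = b) : Cg 1 (a : ℚ_[p]) b := by
  apply cg_int; rw [pow_one]
  exact (ZMod.intCast_eq_intCast_iff_dvd_sub b a p).1 h.symm

lemma Dv.cast_lt {r : ℕ} {x : ℚ_[p]} (h : Dv r x) : Dv r x := h

lemma un_of_lt {n : ℕ} (h0 : 0 < n) (h : n < p) : Un (n : ℚ_[p]) :=
  Un.nat (fun hd => absurd (Nat.le_of_dvd h0 hd) (by omega))
lemma un_ofNat (h3 : 3 < p) : Un (2 : ℚ_[p]) ∧ Un (3 : ℚ_[p]) := by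
  constructor
  · exact_mod_cast un_of_lt (p := p) (n := 2) (by norm_num) (by omega)
  · exact_mod_cast un_of_lt (p := p) (n := 3) (by norm_num) (by omega)
lemma un2 (h3 : 3 < p) : Un (2 : ℚ_[p]) := (un_ofNat h3).1
lemma un3 (h3 : 3 < p) : Un (3 : ℚ_[p]) := (un_ofNat h3).2
lemma un9 (h3 : 3 < p) : Un (9 : ℚ_[p]) := by
  rw [show (9 : ℚ_[p]) = 3*3 by norm_num]; exact (un3 h3).mul (un3 h3)
lemma un27 (h3 : 3 < p) : Un (27 : ℚ_[p]) := by
  rw [show (27 : ℚ_[p]) = 3*9 by norm_num]; exact (un3 h3).mul (un9 h3)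
lemma un_inv9 (h3 : 3 < p) : Un (1/9 : ℚ_[p]) := by rw [one_div]; exact (un9 h3).inv

lemma dv_cc (h3 : 3 < p) (k : ℕ) : Dv 0 (cc k : ℚ_[p]) := by
  rw [cc_choose]
  exact ((Dv.nat _).mul (Dv.nat _)).div ((un27 h3).pow k)
lemma dv_v (h3 : 3 < p) (n : ℕ) : Dv 0 (v n : ℚ_[p]) := by
  rw [v_choose]
  apply Dv.sum; intro k _
  apply Dv.mul
  · exact (Dv.one.neg).pow k
  · exact ((dv_cc h3 k).mul (Dv.nat _)).mul (Dv.nat _)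

lemma dv1_nat {n : ℕ} (h : p ∣ n) : Dv 1 (n : ℚ_[p]) := by
  obtain ⟨c, rfl⟩ := h
  push_cast
  exact Dv.p1.mulr (Dv.nat c)

lemma v_pm1 (h3 : 3 < p) : Cg 1 (v (p-1) : ℚ_[p]) 1 := by
  rw [v_choose, Nat.sub_add_cancel (by omega), sum_range_pred _ (by omega)]
  simp only [pow_zero, one_mul, cc_zero, Nat.choose_zero_right, Nat.cast_one, mul_one]
  unfold Cg
  rw [add_sub_cancel_right]
  apply Dv.sum; intro k hk
  have hk : k < p - 1 := by simpa using hk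
  apply Dv.mul ((Dv.one.neg).pow _)
  apply Dv.mul ((dv_cc h3 _).mul (Dv.nat _))
  apply dv1_nat
  apply hp.out.dvd_choose <;> omega

lemma cg_choose_mul (a b : ℕ) : Cg 1 (((a*p).choose (b*p) : ℕ) : ℚ_[p]) ((a.choose b : ℕ) : ℚ_[p]) := by
  apply cg_nat
  have h := Choose.choose_modEq_choose_mod_mul_choose_div_nat (p := p) (n := a*p) (k := b*p)
  simpa [Nat.mul_div_cancel _ hp.out.pos] using h

lemma v_p (h3 : 3 < p) : Cg 1 (v p : ℚ_[p]) (5/9) := by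
  have hodd : Odd p := hp.out.odd_of_ne_two (by omega)
  have h27 : Cg 1 ((27:ℚ_[p])^p) 27 := by
    have := cg_zmod (p := p) (a := 27^p) (b := 27) (by push_cast; exact ZMod.pow_card _)
    exact_mod_cast this
  have hc : Cg 1 (cc p : ℚ_[p]) (6/27) := by
    rw [cc_choose]
    apply Cg.div _ h27 ((Dv.nat _).mul (Dv.nat _)) ((un27 h3).pow p) (un27 h3)
    have h1 := cg_choose_mul (p := p) 2 1
    have h2 := cg_choose_mul (p := p) 3 1
    simp at h1 h2
    have := h1.mul h2 (Dv.nat _) (by norm_num; exact Dv.ofNat 3)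
    norm_num at this ⊢
    exact this
  have hC : Cg 1 (((p+p).choose p : ℕ) : ℚ_[p]) 2 := by
    have h1 := cg_choose_mul (p := p) 2 1
    simp at h1
    rwa [← two_mul]
  rw [v_choose, sum_range_succ, sum_range_pred _ (by omega)]
  simp only [pow_zero, one_mul, cc_zero, Nat.choose_zero_right, Nat.cast_one, mul_one]
  have hs : Dv 1 (∑ k ∈ range (p-1), (-1:ℚ_[p])^(k+1) * (cc (k+1) * (p.choose (k+1) : ℚ_[p]) * ((p+(k+1)).choose (k+1) : ℚ_[p]))) := by
    apply Dv.sum; intro k hk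
    have hk : k < p - 1 := by simpa using hk
    apply Dv.mul ((Dv.one.neg).pow _)
    refine ((dv_cc h3 _).mul ?_).mulr (Dv.nat _)
    apply dv1_nat
    apply hp.out.dvd_choose_self <;> omega
  have h4 := hc.mul hC (dv_cc h3 p) (Dv.ofNat 2)
  rw [hodd.neg_one_pow, Nat.choose_self]
  unfold Cg at h4 ⊢
  have := hs.sub h4
  refine this.mono le_rfl |> fun h => ?_
  convert h using 1
  push_cast; ring
end S19

set_option linter.unusedSectionVars false
set_option linter.unusedSimpArgs false
namespace S19
open Finset Polynomial

variable {p : ℕ} [hp : Fact p.Prime]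
/-- all coefficients divisible by `p^r` -/
def PD (r : ℕ) (F : ℚ_[p][X]) : Prop := ∀ i, Dv r (F.coeff i)
lemma PD.add {r : ℕ} {F G : ℚ_[p][X]} (h : PD r F) (h' : PD r G) : PD r (F+G) := fun i => by
  rw [coeff_add]; exact (h i).add (h' i)
lemma PD.neg {r : ℕ} {F : ℚ_[p][X]} (h : PD r F) : PD r (-F) := fun i => by
  rw [coeff_neg]; exact (h i).neg
lemma PD.sub {r : ℕ} {F G : ℚ_[p][X]} (h : PD r F) (h' : PD r G) : PD r (F-G) := fun i => by
  rw [coeff_sub]; exact (h i).sub (h' i)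
lemma PD.mul' {r s : ℕ} {F G : ℚ_[p][X]} (h : PD r F) (h' : PD s G) : PD (r+s) (F*G) := fun i => by
  rw [coeff_mul]; exact Dv.sum fun x _ => (h _).mul' (h' _)
lemma PD.mul {r : ℕ} {F G : ℚ_[p][X]} (h : PD 0 F) (h' : PD r G) : PD r (F*G) := by
  have := h.mul' h'; rwa [zero_add] at this
lemma PD.mulr {r : ℕ} {F G : ℚ_[p][X]} (h : PD r F) (h' : PD 0 G) : PD r (F*G) := by
  have := h.mul' h'; rwa [add_zero] at this
lemma PD.C {r : ℕ} {a : ℚ_[p]} (h : Dv r a) : PD r (C a) := fun i => by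
  rw [coeff_C]; split_ifs
  · exact h
  · exact Dv.zero r
lemma PD.X : PD 0 (X : ℚ_[p][X]) := fun i => by
  rw [coeff_X]; split_ifs
  · exact Dv.one
  · exact Dv.zero 0
lemma PD.one : PD 0 (1 : ℚ_[p][X]) := by rw [← C_1]; exact PD.C Dv.one
lemma PD.nat (n : ℕ) : PD 0 (n : ℚ_[p][X]) := by rw [← C_eq_natCast]; exact PD.C (Dv.nat n)
lemma PD.ofNat (n : ℕ) [n.AtLeastTwo] : PD 0 (OfNat.ofNat n : ℚ_[p][X]) := PD.C (Dv.ofNat n)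
lemma PD.pow {F : ℚ_[p][X]} (h : PD 0 F) (n : ℕ) : PD 0 (F^n) := by
  induction n with
  | zero => rw [pow_zero]; exact PD.one
  | succ n ih => rw [pow_succ]; exact ih.mul h
lemma PD.zero (r : ℕ) : PD r (0 : ℚ_[p][X]) := fun i => by rw [coeff_zero]; exact Dv.zero r
lemma PD.sum {ι : Type*} {r : ℕ} {s : Finset ι} {f : ι → ℚ_[p][X]} (h : ∀ i ∈ s, PD r (f i)) : PD r (∑ i ∈ s, f i) := fun i => by
  rw [finsetSum_coeff]; exact Dv.sum fun x hx => h x hx i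
lemma PD.comp {r : ℕ} {F G : ℚ_[p][X]} (h : PD r F) (hG : PD 0 G) : PD r (F.comp G) := by
  rw [Polynomial.comp, eval₂_eq_sum_range]
  exact PD.sum fun i _ => (PD.C (h i)).mulr (hG.pow i)
lemma PD.eval {r : ℕ} {F : ℚ_[p][X]} (h : PD r F) {x : ℚ_[p]} (hx : Dv 0 x) : Dv r (F.eval x) := by
  rw [eval_eq_sum_range]
  exact Dv.sum fun i _ => (h i).mulr (hx.pow i)
lemma PD.divX {r : ℕ} {F : ℚ_[p][X]} (h : PD r F) : PD r F.divX := fun i => by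
  rw [coeff_divX]; exact h _
lemma PD.contract {r : ℕ} {F : ℚ_[p][X]} (h : PD r F) : PD r (contract 3 F) := fun i => by
  rw [coeff_contract (by norm_num)]; exact h _
lemma PD.omX : PD 0 (1 - Polynomial.X : ℚ_[p][X]) := PD.one.sub PD.X
lemma PD.qq : PD 0 (qq : ℚ_[p][X]) := PD.one.sub (PD.X.pow 3)
lemma PD.tA {r : ℕ} {F : ℚ_[p][X]} (h : PD r F) : PD r (tA F) := h.contract.comp PD.omX
lemma PD.tB {r : ℕ} {F : ℚ_[p][X]} (h : PD r F) : PD r (tB F) := h.divX.contract.comp PD.omX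
lemma PD.tC {r : ℕ} {F : ℚ_[p][X]} (h : PD r F) : PD r (tC F) := h.divX.divX.contract.comp PD.omX

lemma PD_YY (n e : ℕ) : PD 0 (YY n e : ℚ_[p][X]) :=
  ((PD.omX.pow _).mul ((PD.ofNat 2).add PD.X)).mul (PD.qq.pow _)
lemma PD_NN (h3 : 3 < p) (P : ℕ) : PD 0 (NN P : ℚ_[p][X]) :=
  PD.sum fun n _ => (PD.C ((dv_v h3 n).mul ((un_inv9 h3).dv.pow n))).mul (PD_YY _ _)
lemma PD_RR (h3 : 3 < p) (P : ℕ) : PD 0 (RR P : ℚ_[p][X]) := by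
  unfold RR
  refine ((((PD.ofNat 2).add PD.X).mul (PD.omX.pow _)).mul (PD.C ((un_inv9 h3).dv.pow _))).mul ?_
  exact ((PD.C ((dv_v h3 _).mul (un_inv9 h3).dv)).mul (PD.omX.pow _)).sub ((PD.C (dv_v h3 _)).mul PD.qq)

lemma natDeg_qq {K : Type*} [Field K] : (qq : K[X]).natDegree ≤ 3 := by
  unfold qq; compute_degree
lemma natDeg_omX {K : Type*} [Field K] : (1 - X : K[X]).natDegree ≤ 1 := by
  compute_degree
lemma natDeg_NN {K : Type*} [Field K] [CharZero K] {P : ℕ} (hP : 1 ≤ P) : (NN P : K[X]).natDegree ≤ 4*P-2 := by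
  unfold NN
  apply natDegree_sum_le_of_forall_le
  intro n hn
  have hn : n < P := by simpa using hn
  refine (natDegree_C_mul_le _ _).trans ?_
  unfold YY
  refine natDegree_mul_le.trans ?_
  have h1 : ((1-X:K[X])^(4*n+1)*(2+X)).natDegree ≤ 4*n+2 := by
    refine natDegree_mul_le.trans ?_
    have := natDegree_pow_le_of_le (4*n+1) (natDeg_omX (K := K))
    have : (2+X:K[X]).natDegree ≤ 1 := by compute_degree
    omega
  have := natDegree_pow_le_of_le (P-1-n) (natDeg_qq (K := K))
  omega
lemma natDeg_contract {K : Type*} [Field K] {F : K[X]} : (contract 3 F).natDegree ≤ F.natDegree / 3 := by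
  rw [natDegree_le_iff_coeff_eq_zero]
  intro N hN
  rw [coeff_contract (by norm_num)]
  apply coeff_eq_zero_of_natDegree_lt
  omega
lemma natDeg_comp1 {K : Type*} [Field K] {F : K[X]} {d : ℕ} (h : F.natDegree ≤ d) : (F.comp (1-X)).natDegree ≤ d := by
  refine natDegree_comp_le.trans ?_
  have := natDeg_omX (K := K)
  calc _ ≤ F.natDegree * 1 := Nat.mul_le_mul_left _ this
    _ ≤ d := by omega
lemma natDeg_tA {K : Type*} [Field K] [CharZero K] {F : K[X]} : (tA F).natDegree ≤ F.natDegree / 3 :=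
  natDeg_comp1 natDeg_contract
lemma natDeg_tB {K : Type*} [Field K] [CharZero K] {F : K[X]} : (tB F).natDegree ≤ (F.natDegree-1) / 3 := by
  apply natDeg_comp1
  have := natDeg_contract (F := F.divX)
  rwa [natDegree_divX_eq_natDegree_tsub_one] at this
lemma natDeg_tC {K : Type*} [Field K] [CharZero K] {F : K[X]} : (tC F).natDegree ≤ (F.natDegree-2) / 3 := by
  apply natDeg_comp1
  have := natDeg_contract (F := F.divX.divX)
  rwa [natDegree_divX_eq_natDegree_tsub_one, natDegree_divX_eq_natDegree_tsub_one, Nat.sub_sub] at this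

/-- values at q = 1 -/
lemma tA_eval1 {K : Type*} [Field K] [CharZero K] (F : K[X]) : (tA F).eval 1 = F.coeff 0 := by
  rw [tA, eval_comp]; simp [← coeff_zero_eq_eval_zero, coeff_contract]
lemma tB_eval1 {K : Type*} [Field K] [CharZero K] (F : K[X]) : (tB F).eval 1 = F.coeff 1 := by
  rw [tB, eval_comp]; simp [← coeff_zero_eq_eval_zero, coeff_contract, coeff_divX]
lemma tC_eval1 {K : Type*} [Field K] [CharZero K] (F : K[X]) : (tC F).eval 1 = F.coeff 2 := by
  rw [tC, eval_comp]; simp [← coeff_zero_eq_eval_zero, coeff_contract, coeff_divX]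

section coeffs
variable {K : Type*} [Field K] [CharZero K]
lemma coeff_omX_pow (n k : ℕ) : ((1 - X : K[X])^n).coeff k = (-1)^k * (n.choose k : K) := by
  have : (1 - X : K[X])^n = ((1 + X)^n).comp (-X) := by simp [sub_eq_add_neg]
  rw [this, show (-X : K[X]) = C (-1) * X by simp, comp_C_mul_X_coeff, coeff_one_add_X_pow]; ring
lemma qq_pow_cong (e : ℕ) : ∃ G : K[X], (qq:K[X])^e = 1 + X^3 * G := by
  have h := sub_dvd_pow_sub_pow (qq:K[X]) 1 e
  rw [one_pow] at h
  obtain ⟨G, hG⟩ := h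
  refine ⟨-G, ?_⟩
  rw [show (qq:K[X])^e = ((qq:K[X])^e - 1) + 1 by ring, hG, qq]; ring
lemma coeff_YY (n e : ℕ) : (YY n e : K[X]).coeff 0 = 2 ∧ (YY n e : K[X]).coeff 1 = -(8*n+1) ∧ (YY n e : K[X]).coeff 2 = 16*n^2-1 := by
  obtain ⟨G, hG⟩ := qq_pow_cong (K := K) e
  unfold YY
  rw [hG]
  have e : (1-X:K[X])^(4*n+1) * (2+X) * (1 + X^3 * G) = C 2 * (1-X)^(4*n+1) + X * (1-X)^(4*n+1) + X^3 * ((1-X:K[X])^(4*n+1) * (2+X) * G) := by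
    rw [show (C 2 : K[X]) = 2 from rfl]; ring
  have h3 : ∀ H : K[X], ∀ k < 3, (X^3 * H).coeff k = 0 := fun H k hk => by
    rw [coeff_X_pow_mul', if_neg (by omega)]
  have hc2 : ((4*n+1).choose 2 : K) = (4*n+1)*(4*n)/2 := by
    rw [Nat.cast_choose_two]; push_cast; ring
  rw [e]
  refine ⟨?_, ?_, ?_⟩
  · simp only [coeff_add, coeff_C_mul, coeff_omX_pow, coeff_X_mul_zero, h3 _ 0 (by norm_num)]; simp
  · simp only [coeff_add, coeff_C_mul, coeff_omX_pow, coeff_X_mul, h3 _ 1 (by norm_num)]; simp; ring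
  · simp only [coeff_add, coeff_C_mul, coeff_omX_pow, coeff_X_mul, h3 _ 2 (by norm_num), hc2]; simp; ring
/-- moments -/
def SS (P j : ℕ) : K := ∑ n ∈ range P, (n:K)^j * (v n * (1/9)^n)
lemma coeff_NN (P : ℕ) : (NN P : K[X]).coeff 0 = 2 * SS P 0 ∧ (NN P : K[X]).coeff 1 = -(8*SS P 1 + SS P 0) ∧
   (NN P : K[X]).coeff 2 = 16*SS P 2 - SS P 0 := by
  unfold NN SS
  simp only [finsetSum_coeff, coeff_C_mul, (coeff_YY _ _).1, (coeff_YY _ _).2.1, (coeff_YY _ _).2.2]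
  simp only [mul_sum, ← sum_add_distrib, ← sum_sub_distrib, ← sum_neg_distrib]
  refine ⟨?_, ?_, ?_⟩ <;> (apply sum_congr rfl; intro n _; ring)

end coeffs
end S19

set_option linter.unusedSectionVars false
set_option linter.unusedSimpArgs false
namespace S19
open Finset Polynomial

section coeffs
variable {K : Type*} [Field K] [CharZero K]

lemma tri_add (F G : K[X]) : tA (F+G) = tA F + tA G ∧ tB (F+G) = tB F + tB G ∧ tC (F+G) = tC F + tC G := by
  have : F + G = (tA F + tA G).comp qq + X * (tB F + tB G).comp qq + X^2 * (tC F + tC G).comp qq := by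
    conv_lhs => rw [tri_eq F, tri_eq G]
    simp only [add_comp]; ring
  refine ⟨?_, ?_, ?_⟩
  · conv_lhs => rw [this, tA_uniq]
  · conv_lhs => rw [this, tB_uniq]
  · conv_lhs => rw [this, tC_uniq]
lemma tri_qq (F : K[X]) (f : K[X]) : tA (f.comp qq * F) = f * tA F ∧ tB (f.comp qq * F) = f * tB F ∧ tC (f.comp qq * F) = f * tC F := by
  have : f.comp qq * F = (f * tA F).comp qq + X * (f * tB F).comp qq + X^2 * (f * tC F).comp qq := by
    conv_lhs => rw [tri_eq F]
    simp only [mul_comp]; ring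
  refine ⟨?_, ?_, ?_⟩
  · conv_lhs => rw [this, tA_uniq]
  · conv_lhs => rw [this, tB_uniq]
  · conv_lhs => rw [this, tC_uniq]
lemma tri_quad (a b c : K) : tA (C a + X * C b + X^2 * C c) = C a ∧ tB (C a + X * C b + X^2 * C c) = C b ∧ tC (C a + X * C b + X^2 * C c) = C c := by
  have : C a + X * C b + X^2 * C c = (C a).comp qq + X * (C b).comp qq + X^2 * (C c).comp qq := by
    simp
  rw [this]
  exact ⟨tA_uniq _ _ _, tB_uniq _ _ _, tC_uniq _ _ _⟩
lemma X3_comp (a : ℕ) : (X:K[X])^(3*a) = ((1-X)^a : K[X]).comp qq := by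
  simp [qq, pow_mul]

lemma omX_pow_mod (j : ℕ) : ∃ G : K[X], (1-X:K[X])^(2*j+1) = (-3*X)^j*(1-X) + qq * G := by
  induction j with
  | zero => exact ⟨0, by simp⟩
  | succ j ih =>
    obtain ⟨G, hG⟩ := ih
    refine ⟨(-3*X)^j + (1-X)^2 * G, ?_⟩
    rw [show 2*(j+1)+1 = 2*j+1+2 by ring, pow_add, hG, qq]; ring

lemma NN_mod (P : ℕ) (hP : 1 ≤ P) : ∃ G : K[X], (NN P : K[X]) = C (v (P-1)) * X^(2*(P-1)) * (2 - X - X^2) + qq * G := by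
  obtain ⟨N, rfl⟩ : ∃ N, P = N + 1 := ⟨P - 1, by omega⟩
  rw [Nat.add_sub_cancel]
  obtain ⟨G, hG⟩ := omX_pow_mod (K := K) (2*N)
  have h1 : ∃ H : K[X], ∑ n ∈ range N, C (v n * (1/9)^n : K) * YY n (N+1-1-n) = qq * H := by
    apply Finset.dvd_sum
    intro n hn
    have hn : n < N := by simpa using hn
    apply Dvd.dvd.mul_left
    unfold YY
    apply Dvd.dvd.mul_left
    exact dvd_pow_self _ (by omega)
  obtain ⟨H, hH⟩ := h1
  refine ⟨H + C (v N * (1/9)^N) * (2+X) * G, ?_⟩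
  unfold NN
  rw [sum_range_succ, hH, YY, show N+1-1-N = 0 by omega, show 4*N+1 = 2*(2*N)+1 by ring, hG]
  have h9 : (C ((1/9)^N) : K[X]) * (-3*X)^(2*N) = X^(2*N) := by
    rw [mul_pow, ← mul_assoc, pow_mul (-3 : K[X]), show ((-3:K[X])^2) = C 9 by norm_num; rfl, ← C_pow, ← C_mul, ← mul_pow]
    norm_num
  rw [C_mul]
  linear_combination (C (v N) * (1-X)*(2+X)) * h9

lemma NN_c0_1 (m : ℕ) : (tA (NN (3*m+1) : K[X])).coeff 0 = 2 * v (3*m) ∧ (tB (NN (3*m+1) : K[X])).coeff 0 = - v (3*m) ∧ (tC (NN (3*m+1) : K[X])).coeff 0 = - v (3*m) := by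
  obtain ⟨G, hG⟩ := NN_mod (K := K) (3*m+1) (by omega)
  have e : (NN (3*m+1) : K[X]) = ((1-X)^(2*m) : K[X]).comp qq * (C (2 * v (3*m)) + X * C (-v (3*m)) + X^2 * C (-v (3*m))) + (X:K[X]).comp qq * G := by
    rw [hG, Nat.add_sub_cancel, ← X3_comp, X_comp, C_neg, C_mul, show (C 2 : K[X]) = 2 from rfl, show 2*(3*m) = 3*(2*m) by ring]; ring
  rw [e, (tri_add _ _).1, (tri_add _ _).2.1, (tri_add _ _).2.2, (tri_qq _ _).1, (tri_qq _ _).2.1, (tri_qq _ _).2.2,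
    (tri_qq _ _).1, (tri_qq _ _).2.1, (tri_qq _ _).2.2, (tri_quad _ _ _).1, (tri_quad _ _ _).2.1, (tri_quad _ _ _).2.2]
  simp [coeff_zero_eq_eval_zero]
lemma NN_c0_2 (m : ℕ) : (tA (NN (3*m+2) : K[X])).coeff 0 = - v (3*m+1) ∧ (tB (NN (3*m+2) : K[X])).coeff 0 = - v (3*m+1) ∧ (tC (NN (3*m+2) : K[X])).coeff 0 = 2 * v (3*m+1) := by
  obtain ⟨G, hG⟩ := NN_mod (K := K) (3*m+2) (by omega)
  have e : (NN (3*m+2) : K[X]) = ((1-X)^(2*m) : K[X]).comp qq * (C 0 + X * C 0 + X^2 * C (2*v (3*m+1))) + (((1-X)^(2*m+1) : K[X]).comp qq * (C (-v (3*m+1)) + X * C (-v (3*m+1)) + X^2 * C 0) + (X:K[X]).comp qq * G) := by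
    rw [hG, show 3*m+2-1=3*m+1 by omega, ← X3_comp, ← X3_comp, X_comp, C_neg, C_mul, show (C 2 : K[X]) = 2 from rfl, C_0]; ring
  rw [e, (tri_add _ _).1, (tri_add _ _).2.1, (tri_add _ _).2.2, (tri_add _ _).1, (tri_add _ _).2.1, (tri_add _ _).2.2, (tri_qq _ _).1, (tri_qq _ _).2.1, (tri_qq _ _).2.2,
    (tri_qq _ _).1, (tri_qq _ _).2.1, (tri_qq _ _).2.2, (tri_qq _ _).1, (tri_qq _ _).2.1, (tri_qq _ _).2.2, (tri_quad _ _ _).1, (tri_quad _ _ _).2.1, (tri_quad _ _ _).2.2, (tri_quad _ _ _).1, (tri_quad _ _ _).2.1, (tri_quad _ _ _).2.2]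
  simp [coeff_zero_eq_eval_zero]
end coeffs

variable {p : ℕ} [hp : Fact p.Prime]

/-- forward recursion -/
lemma rec_fwd {r : ℕ} {f0 f1 f2 : ℚ_[p] → ℚ_[p]} {d : ℚ_[p][X]} {N : ℕ} (h0 : Dv r (d.coeff 0))
   (h1 : ∀ k : ℕ, Dv 0 (f1 k)) (h2 : ∀ k : ℕ, Dv 0 (f2 k)) (hu : ∀ k : ℕ, 1 ≤ k → k ≤ N → Un (f0 k))
   (hL : ∀ k ≤ N, Dv r ((Lg f0 f1 f2 d).coeff k)) : ∀ k ≤ N, Dv r (d.coeff k) := by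
  intro k
  induction k using Nat.strong_induction_on with
  | _ k ih =>
    intro hk
    rcases k with _ | k
    · exact h0
    · have h := hL (k+1) hk
      rw [Lg_coeff] at h
      refine Dv.of_mul (x := f0 ((k+1:ℕ):ℚ_[p])) ?_ (hu _ (by omega) hk)
      have h3 : Dv r (if 1 ≤ k+1 then f1 ((k+1-1:ℕ):ℚ_[p]) * d.coeff (k+1-1) else 0) := by
        rw [if_pos (by omega)]; exact (h1 _).mul (ih _ (by omega) (by omega))
      have h4 : Dv r (if 2 ≤ k+1 then f2 ((k+1-2:ℕ):ℚ_[p]) * d.coeff (k+1-2) else 0) := by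
        split_ifs
        · exact (h2 _).mul (ih _ (by omega) (by omega))
        · exact Dv.zero r
      convert (h.sub h4).add h3 using 1; ring
lemma rec_bwd {r : ℕ} {f0 f1 f2 : ℚ_[p] → ℚ_[p]} {d : ℚ_[p][X]} {D J : ℕ} (hD : d.natDegree ≤ D)
   (h0 : ∀ k : ℕ, Dv 0 (f0 k)) (h1 : ∀ k : ℕ, Dv 0 (f1 k)) (hu : ∀ k : ℕ, J ≤ k → k ≤ D → Un (f2 k))
   (hL : ∀ k, J ≤ k → Dv r ((Lg f0 f1 f2 d).coeff k)) : ∀ k, J ≤ k → Dv r (d.coeff k) := by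
  have key : ∀ n k, D < k + n → J ≤ k → Dv r (d.coeff k) := by
    intro n
    induction n with
    | zero => intro k hk _; rw [coeff_eq_zero_of_natDegree_lt (by omega)]; exact Dv.zero r
    | succ n ih =>
      intro k hk hJ
      by_cases hkD : k ≤ D
      · have h := hL (k+2) (by omega)
        rw [Lg_coeff, if_pos (by omega), if_pos (by omega)] at h
        simp only [show k+2-2 = k by omega, show k+2-1=k+1 by omega] at h
        refine Dv.of_mul (x := f2 (k:ℚ_[p])) ?_ (hu _ hJ hkD)
        have h3 := (h0 (k+2)).mul (ih (k+2) (by omega) (by omega))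
        have h4 := (h1 (k+1)).mul (ih (k+1) (by omega) (by omega))
        convert (h.sub h3).add h4 using 1; ring
      · rw [coeff_eq_zero_of_natDegree_lt (by omega)]; exact Dv.zero r
  intro k hk
  exact key (D+1) k (by omega) hk

lemma dv_ints {f : ℚ_[p] → ℚ_[p]} (g : ℤ → ℤ) (h : ∀ k : ℤ, f k = g k) (k : ℕ) : Dv 0 (f k) := by
  have := h k
  rw [Int.cast_natCast] at this
  rw [this]; exact Dv.int _
lemma dv_a0 (k : ℕ) : Dv 0 (a0 p k : ℚ_[p]) := dv_ints (fun i => 27 * (i - p)^3) (by intro k; simp [a0]) k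
lemma dv_a1 (k : ℕ) : Dv 0 (a1 p k : ℚ_[p]) := dv_ints (fun i => (6*(i-p)+2)*(9*(i-p)^2+6*(i-p)+3)) (by intro k; simp [a1]) k
lemma dv_a2 (k : ℕ) : Dv 0 (a2 p k : ℚ_[p]) := dv_ints (fun i => (3*(i-p)+2)^3) (by intro k; simp [a2]) k
lemma dv_b1 (k : ℕ) : Dv 0 (b1 p k : ℚ_[p]) := dv_ints (fun i => (2*(i-p)+1)*(27*(i-p)^2+27*(i-p)+15)) (by intro k; simp [b1]) k
lemma dv_b2 (k : ℕ) : Dv 0 (b2 p k : ℚ_[p]) := dv_ints (fun i => 27*(i-p+1)^3) (by intro k; simp [b2]) k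
lemma dv_c1 (k : ℕ) : Dv 0 (c1 p k : ℚ_[p]) := dv_ints (fun i => (6*(i-p)+4)*(9*(i-p)^2+12*(i-p)+6)) (by intro k; simp [c1]) k
lemma dv_c2 (k : ℕ) : Dv 0 (c2 p k : ℚ_[p]) := dv_ints (fun i => (3*(i-p)+4)^3) (by intro k; simp [c2]) k
lemma un_a0 (h3 : 3 < p) {k : ℕ} (h1 : 1 ≤ k) (hk : k < p) : Un (a0 p k : ℚ_[p]) := by
  unfold a0
  refine (un27 h3).mul (Un.pow ?_ 3)
  have := (un_of_lt (p := p) (n := p - k) (by omega) (by omega)).neg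
  rw [Nat.cast_sub hk.le] at this
  convert this using 1; ring

lemma tri_rec (h3 : 3 < p) : PD 3 (Lg (a0 p) (a1 p) (a2 p) (tA (NN p : ℚ_[p][X]))) ∧ PD 3 (Lg (a0 p) (c1 p) (c2 p) (tC (NN p : ℚ_[p][X]))) := by
  have h := tri_M p (NN p) _ (M_NN (K := ℚ_[p]) p (by omega))
  have hR : PD 3 (81 * (p:ℚ_[p][X])^3 * RR p) := by
    refine PD.mulr (PD.mul (PD.ofNat 81) ?_) (PD_RR h3 p)
    rw [← C_eq_natCast, ← C_pow]
    exact PD.C (Dv.pp 3)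
  rw [h.1, h.2.2]
  exact ⟨hR.tA, hR.tC⟩

lemma A_top {m : ℕ} (hm : p = 3*m+1) (h3 : 3 < p) {k : ℕ} (hk : 2*m < k) : Dv 3 ((tA (NN p : ℚ_[p][X])).coeff k) := by
  have hd : (tA (NN p : ℚ_[p][X])).natDegree ≤ 4*m := by
    have := natDeg_tA (F := (NN p : ℚ_[p][X]))
    have := natDeg_NN (K := ℚ_[p]) (P := p) (by omega)
    omega
  refine rec_bwd (J := 2*m+1) hd dv_a0 dv_a1 ?_ (fun k _ => (tri_rec h3).1 k) k hk
  intro k h1 h2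
  unfold a2
  apply Un.pow
  have := Un.int (p := p) (n := 3*(k-p)+2) (by
    intro hd
    have : (p:ℤ) ∣ 3*k+2 := by
      have h5 := dvd_add hd (dvd_mul_left (p:ℤ) 3)
      rw [show 3*((k:ℤ)-p)+2+3*p = 3*k+2 by ring] at h5; exact h5
    obtain ⟨c, hc⟩ := this
    have c1 : 2 < c := by by_contra hh; push Not at hh; nlinarith
    have c2 : c < 5 := by by_contra hh; push Not at hh; nlinarith
    have hpm : (p:ℤ) = 3*m+1 := by exact_mod_cast hm
    rw [hpm] at hc
    have : c = 3 ∨ c = 4 := by omega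
    rcases this with rfl | rfl <;> omega)
  push_cast at this
  exact this
lemma C_top {m : ℕ} (hm : p = 3*m+2) (h3 : 3 < p) {k : ℕ} (hk : 2*m < k) : Dv 3 ((tC (NN p : ℚ_[p][X])).coeff k) := by
  have hd : (tC (NN p : ℚ_[p][X])).natDegree ≤ 4*m+1 := by
    have := natDeg_tC (F := (NN p : ℚ_[p][X]))
    have := natDeg_NN (K := ℚ_[p]) (P := p) (by omega)
    omega
  refine rec_bwd (J := 2*m+1) hd dv_a0 dv_c1 ?_ (fun k _ => (tri_rec h3).2 k) k hk
  intro k h1 h2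
  unfold c2
  apply Un.pow
  have := Un.int (p := p) (n := 3*(k-p)+4) (by
    intro hd
    have : (p:ℤ) ∣ 3*k+4 := by
      have h5 := dvd_add hd (dvd_mul_left (p:ℤ) 3)
      rw [show 3*((k:ℤ)-p)+4+3*p = 3*k+4 by ring] at h5; exact h5
    obtain ⟨c, hc⟩ := this
    have c1 : 2 < c := by by_contra hh; push Not at hh; nlinarith
    have c2 : c < 5 := by by_contra hh; push Not at hh; nlinarith
    have hpm : (p:ℤ) = 3*m+2 := by exact_mod_cast hm
    rw [hpm] at hc
    have : c = 3 ∨ c = 4 := by omega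
    rcases this with rfl | rfl <;> omega)
  push_cast at this
  exact this

/-- reversed truncated series -/
noncomputable def WW (p : ℕ) {K : Type*} [Field K] [CharZero K] : K[X] := ∑ i ∈ range p, C (v (p-1-i)) * X^i
lemma WW_coeff {K : Type*} [Field K] [CharZero K] (P i : ℕ) : (WW P : K[X]).coeff i = if i < P then v (P-1-i) else 0 := by
  unfold WW
  rw [finsetSum_coeff]
  simp only [coeff_C_mul, coeff_X_pow, mul_ite, mul_one, mul_zero]
  rw [sum_ite_eq]; simp
lemma Lg_WW {K : Type*} [Field K] [CharZero K] {P : ℕ} (hP : 2 ≤ P) : Lg (a0 P) (b1 P) (b2 P) (WW P : K[X]) = C (27 * (P:K)^3) * (- C (v (P-1)) + C (v P) * X) := by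
  ext k
  rw [Lg_coeff]
  simp only [WW_coeff, coeff_C_mul, coeff_add, coeff_neg, coeff_C, coeff_X]
  have hc : k = 0 ∨ k = 1 ∨ (2 ≤ k ∧ k < P) ∨ k = P ∨ k = P + 1 ∨ P + 2 ≤ k := by omega
  rcases hc with rfl | rfl | ⟨h1, h2⟩ | rfl | rfl | h
  · simp [show 0 < P by omega, a0]; ring
  · obtain ⟨n, rfl⟩ : ∃ n, P = n + 2 := ⟨P-2, by omega⟩
    simp [a0, b1]
    have := v_rec (K := K) n
    push_cast at *
    linear_combination (-27) * this
  · obtain ⟨j, rfl⟩ : ∃ j, k = j + 2 := ⟨k-2, by omega⟩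
    obtain ⟨n, rfl⟩ : ∃ n, P = n + 1 + (j + 2) := ⟨P-1-(j+2), by omega⟩
    simp only [show n+1+(j+2)-1-(j+2) = n by omega, show n+1+(j+2)-1-(j+2-1) = n+1 by omega, show n+1+(j+2)-1-(j+2-2) = n+2 by omega, show j+2-1 = j+1 by omega, show j+2-2 = j by omega]
    simp [a0, b1, b2]
    rw [if_pos (by omega), if_pos (by omega), show n+1+(j+1)-j = n+2 by omega]
    have := v_rec (K := K) n
    push_cast at *
    linear_combination (-27) * this
  · obtain ⟨j, rfl⟩ : ∃ j, k = j + 2 := ⟨k-2, by omega⟩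
    simp [a0, b1, b2, v_zero, show j+2-1-j=1 by omega, v_one]
    norm_num
  · simp [a0, b1, b2, show P ≠ 0 by omega, show 2 ≤ P + 1 by omega, show P-1 < P by omega]
    left; rw [Nat.cast_sub (by omega)]; push_cast; ring
  · simp [show ¬ k < P by omega, show ¬ k - 1 < P by omega, show ¬ k - 2 < P by omega, show k ≠ 0 by omega, show (1:ℕ) ≠ k by omega]

lemma Lg_add {K : Type*} [Field K] [CharZero K] (f0 f1 f2 : K → K) (F G : K[X]) : Lg f0 f1 f2 (F+G) = Lg f0 f1 f2 F + Lg f0 f1 f2 G := by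
  ext k
  simp only [coeff_add, Lg_coeff]
  split_ifs <;> ring
lemma Lg_C {K : Type*} [Field K] [CharZero K] (f0 f1 f2 : K → K) (a : K) (G : K[X]) : Lg f0 f1 f2 (C a * G) = C a * Lg f0 f1 f2 G := by
  ext k
  simp only [coeff_C_mul, Lg_coeff]
  split_ifs <;> ring

/-- the defect polynomial -/
noncomputable def del (p : ℕ) {K : Type*} [Field K] [CharZero K] : K[X] := C ((p:K)^3)⁻¹ * (tB (NN p) + WW p)
lemma del_eq {K : Type*} [Field K] [CharZero K] {P : ℕ} (hP : P ≠ 0) : tB (NN P : K[X]) + WW P = C ((P:K)^3) * del P := by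
  have : ((P:K)^3) ≠ 0 := pow_ne_zero _ (by exact_mod_cast hP)
  rw [del, ← mul_assoc, ← C_mul, mul_inv_cancel₀ this]; simp
lemma Lg_del {K : Type*} [Field K] [CharZero K] {P : ℕ} (hP : 2 ≤ P) : Lg (a0 P) (b1 P) (b2 P) (del P : K[X]) =
    81 * tB (RR P) + 27 * (- C (v (P-1)) + C (v P) * X) := by
  have hne : ((P:K)^3) ≠ 0 := pow_ne_zero _ (by exact_mod_cast (by omega : P ≠ 0))
  have h := (tri_M P (NN P) _ (M_NN (K := K) P (by omega))).2.1
  have h2 : tB (81 * (P:K[X])^3 * RR P : K[X]) = C (81 * (P:K)^3) * tB (RR P) := by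
    have := (tri_qq (RR P : K[X]) (C (81 * (P:K)^3))).2.1
    rw [C_comp] at this
    rw [← this]; simp [show (C 81 : K[X]) = 81 from rfl]
  have hC : (C ((P:K)^3) : K[X]) ≠ 0 := by simpa using hne
  apply mul_left_cancel₀ hC
  rw [← Lg_C, ← del_eq (by omega), Lg_add, h, h2, Lg_WW hP]
  simp only [C_mul, show (C 81 : K[X]) = 81 from rfl, show (C 27 : K[X]) = 27 from rfl]; ring
lemma del_zero (h3 : 3 < p) : (del p : ℚ_[p][X]).coeff 0 = 0 := by
  have : (tB (NN p) + WW p : ℚ_[p][X]).coeff 0 = 0 := by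
    rw [coeff_add, WW_coeff, if_pos (by omega)]
    have : p % 3 ≠ 0 := by
      intro h
      have := (Nat.prime_dvd_prime_iff_eq Nat.prime_three hp.out).1 (Nat.dvd_of_mod_eq_zero h)
      omega
    have : p % 3 = 1 ∨ p % 3 = 2 := by omega
    rcases this with h | h
    · have h1 := (NN_c0_1 (K := ℚ_[p]) (p/3)).2.1
      rw [show 3*(p/3)+1 = p by omega, show 3*(p/3) = p-1 by omega] at h1
      rw [h1]; simp
    · have h1 := (NN_c0_2 (K := ℚ_[p]) (p/3)).2.1
      rw [show 3*(p/3)+2 = p by omega, show 3*(p/3)+1 = p-1 by omega] at h1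
      rw [h1]; simp
  rw [del, coeff_C_mul, this, mul_zero]
lemma PD_Ldel (h3 : 3 < p) : PD 0 (Lg (a0 p) (b1 p) (b2 p) (del p : ℚ_[p][X])) := by
  rw [Lg_del (by omega)]
  exact ((PD.ofNat 81).mul (PD_RR h3 p).tB).add ((PD.ofNat 27).mul ((PD.C (dv_v h3 _)).neg.add ((PD.C (dv_v h3 _)).mul PD.X)))
lemma natDeg_del (h3 : 3 < p) : (del p : ℚ_[p][X]).natDegree ≤ (4*p-3)/3 := by
  refine (natDegree_C_mul_le _ _).trans ?_
  apply natDegree_add_le_of_degree_le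
  · have := natDeg_tB (F := (NN p : ℚ_[p][X]))
    have := natDeg_NN (K := ℚ_[p]) (P := p) (by omega)
    omega
  · rw [natDegree_le_iff_coeff_eq_zero]
    intro N hN
    rw [WW_coeff, if_neg (by omega)]
lemma PD_del (h3 : 3 < p) : PD 0 (del p : ℚ_[p][X]) := by
  intro k
  by_cases hk : k < p
  · refine rec_fwd (N := p-1) ?_ dv_b1 dv_b2 ?_ (fun k _ => PD_Ldel h3 k) k (by omega)
    · rw [del_zero h3]; exact Dv.zero 0
    · intro k h1 h2; exact un_a0 h3 h1 (by omega)
  · refine rec_bwd (J := p) (natDeg_del h3) dv_a0 dv_b1 ?_ (fun k _ => PD_Ldel h3 k) k (by omega)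
    intro k h1 h2
    unfold b2
    refine (un27 h3).mul (Un.pow ?_ 3)
    have := un_of_lt (p := p) (n := k - p + 1) (by omega) (by omega)
    rw [Nat.cast_add, Nat.cast_sub h1] at this
    simpa using this
/-- R1 = G_p(1) - p^3 del(1) -/
lemma R1_eq (h3 : 3 < p) : (8 * SS p 1 + SS p 0 : ℚ_[p]) = (∑ n ∈ range p, v n) - (p:ℚ_[p])^3 * (del p).eval 1 := by
  have h1 := congrArg (eval 1) (del_eq (K := ℚ_[p]) (P := p) (by omega))
  rw [eval_add, tB_eval1, (coeff_NN p).2.1, eval_mul, eval_C] at h1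
  have hW : (WW p : ℚ_[p][X]).eval 1 = ∑ n ∈ range p, v n := by
    unfold WW; rw [eval_finsetSum, ← sum_range_reflect (fun n => (v n : ℚ_[p]))]
    apply sum_congr rfl; intro i _; simp
  rw [hW] at h1
  linear_combination -h1
end S19

set_option linter.unusedSectionVars false
set_option linter.unusedSimpArgs false
namespace S19
open Finset Polynomial

section gen
variable {K : Type*} [Field K] [CharZero K]
noncomputable def th (F : K[X]) : K[X] := X * derivative F
lemma th_coeff (F : K[X]) (k : ℕ) : (th F).coeff k = k * F.coeff k := by
  unfold th
  rcases k with _ | k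
  · simp
  · rw [coeff_X_mul, coeff_derivative]; push_cast; ring
noncomputable def L0 (F : K[X]) : K[X] := Lg (a0 0) (b1 0) (b2 0) F
lemma L0_eq (F : K[X]) : L0 F = 27 * th (th (th F)) - X * (54 * th (th (th F)) + 81 * th (th F) + 57 * th F + 15 * F)
    + X^2 * (27 * th (th (th F)) + 81 * th (th F) + 81 * th F + 27 * F) := by
  ext k
  unfold L0
  rw [Lg_coeff, show X^2 * (27 * th (th (th F)) + 81 * th (th F) + 81 * th F + 27 * F) = X * (X * (27 * th (th (th F)) + 81 * th (th F) + 81 * th F + 27 * F)) by ring]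
  rw [show (27 * th (th (th F))) = C 27 * th (th (th F)) from rfl, show (54 * th (th (th F))) = C 54 * th (th (th F)) from rfl,
    show (81 * th (th F)) = C 81 * th (th F) from rfl, show (57 * th F) = C 57 * th F from rfl, show (81 * th F) = C 81 * th F from rfl,
    show (15 * F) = C 15 * F from rfl, show (27 * F) = C 27 * F from rfl]
  rcases k with _ | _ | k
  · simp [th_coeff, a0]
  · simp only [coeff_add, coeff_sub, coeff_X_mul, coeff_C_mul, th_coeff, coeff_X_mul_zero]
    simp [a0, b1, th_coeff]
  · simp only [coeff_add, coeff_sub, coeff_X_mul, coeff_C_mul, th_coeff]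
    simp [a0, b1, b2]
    ring
lemma th_add (F G : K[X]) : th (F+G) = th F + th G := by unfold th; simp; ring
lemma th_mul (F G : K[X]) : th (F*G) = th F * G + F * th G := by unfold th; simp; ring
lemma th_s (n : ℕ) : th ((1-X:K[X])^(n+1)) = -((n:K[X])+1) * X * (1-X)^n := by
  unfold th; rw [derivative_pow_succ]; simp; ring
lemma th_X : th (X : K[X]) = X := by simp [th]
lemma th_nat (n : ℕ) : th (n : K[X]) = 0 := by simp [th]
lemma th_neg (F : K[X]) : th (-F) = - th F := by simp [th]
lemma L0_s (r : ℕ) : 9 * L0 ((1-X:K[X])^r) = 27 * (-(r:K[X])*(9*(r:K[X])^2-1)*(1-X)^(r-1) + (27*(r:K[X])^3+27*(r:K[X])^2+16*(r:K[X])+4)*(1-X)^r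
   - (27*(r:K[X])^3+54*(r:K[X])^2+44*(r:K[X])+13)*(1-X)^(r+1) + 9*((r:K[X])+1)^3*(1-X)^(r+2)) := by
  rw [L0_eq]
  rcases r with _ | _ | _ | n
  · simp [th]; ring
  · simp [th]; ring
  · have e1 : th ((1-X:K[X])^2) = -(2*X*(1-X)) := by
      have := th_s (K := K) 1; norm_num at this; rw [this]; try ring
    have e2 : th (-(2*X*(1-X:K[X]))) = -(2*X*(1-2*X)) := by
      rw [show -(2*X*(1-X:K[X])) = ((2:ℕ):K[X]) * (X * (X + -((1:ℕ):K[X]))) by push_cast; ring, th_mul, th_mul, th_add, th_neg, th_nat, th_nat, th_X]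
      push_cast; ring
    have e3 : th (-(2*X*(1-2*X:K[X]))) = -(2*X*(1-4*X)) := by
      rw [show -(2*X*(1-2*X:K[X])) = ((2:ℕ):K[X]) * (X * (((2:ℕ):K[X])*X + -((1:ℕ):K[X]))) by push_cast; ring, th_mul, th_mul, th_add, th_neg, th_mul, th_nat, th_nat, th_X]
      push_cast; ring
    rw [show 0+1+1=2 from rfl, e1, e2, e3]
    push_cast
    ring
  · have h1 : th ((1-X:K[X])^(n+3)) = -((n:K[X])+3) * (X * (1-X)^(n+2)) := by
      have := th_s (K := K) (n+2); push_cast at this; rw [this]; ring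
    have h2 : th ((1-X:K[X])^(n+2)) = -((n:K[X])+2) * (X * (1-X)^(n+1)) := by
      have := th_s (K := K) (n+1); push_cast at this; rw [this]; ring
    have h3 : th ((1-X:K[X])^(n+1)) = -((n:K[X])+1) * (X * (1-X)^n) := by
      have := th_s (K := K) n; rw [this]; ring
    have hc : ∀ j : ℕ, ∀ F : K[X], th (-((n:K[X])+(j:K[X])) * F) = -((n:K[X])+(j:K[X])) * th F := by
      intro j F; rw [th_mul]; simp [th]
    have h4 := hc 3; have h5 := hc 2; have h6 := hc 1
    push_cast at h4 h5 h6
    rw [show n+1+1+1 = n+3 by ring]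
    simp only [h1, h4, th_mul X, h2, h5, h3, h6, th_X, th_add]
    push_cast
    ring
lemma L0_add (F G : K[X]) : L0 (F+G) = L0 F + L0 G := Lg_add _ _ _ _ _
lemma L0_C (a : K) (F : K[X]) : L0 (C a * F) = C a * L0 F := Lg_C _ _ _ _ _
lemma L0_sum {ι : Type*} (s : Finset ι) (f : ι → K[X]) : L0 (∑ i ∈ s, f i) = ∑ i ∈ s, L0 (f i) := by
  classical
  induction s using Finset.induction_on with
  | empty => simp; have := L0_C (0:K) 0; simpa using this
  | insert a s ha ih => rw [sum_insert ha, sum_insert ha, L0_add, ih]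

/-- functional -/
def Lam (l : ℕ → K) (M : ℕ) (F : K[X]) : K := ∑ j ∈ range M, l j * F.coeff j
lemma Lam_add (l : ℕ → K) (M : ℕ) (F G : K[X]) : Lam l M (F+G) = Lam l M F + Lam l M G := by
  simp [Lam, mul_add, sum_add_distrib]
lemma Lam_C (l : ℕ → K) (M : ℕ) (a : K) (G : K[X]) : Lam l M (C a * G) = a * Lam l M G := by
  simp [Lam, mul_sum, mul_left_comm]
lemma Lam_sum (l : ℕ → K) (M : ℕ) {ι : Type*} (s : Finset ι) (f : ι → K[X]) : Lam l M (∑ i ∈ s, f i) = ∑ i ∈ s, Lam l M (f i) := by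
  simp only [Lam, finsetSum_coeff, mul_sum]; rw [sum_comm]
lemma Lam_X (l : ℕ → K) (M r : ℕ) : Lam l M (X^r) = if r < M then l r else 0 := by
  simp [Lam, coeff_X_pow]

/-- telescoping data -/
def uu (n r : ℕ) : K := (r+1) * ((r+2*n).choose n : K) / (r+n+1)
lemma tele (n r : ℕ) : -(r:K)*(9*(r:K)^2-1) * ((r+2*n).choose (n+1) : K) + (27*(r:K)^3+27*(r:K)^2+16*r+4)*((r+2*n+1).choose (n+1) : K)
   - (27*(r:K)^3+54*(r:K)^2+44*r+13) * ((r+2*n+2).choose (n+1) : K) + 9*((r:K)+1)^3*((r+2*n+3).choose (n+1) : K)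
   = 9*((n:K)+1)^3*uu (n+1) r - 2*(2*n+1)*(3*n+1)*(3*n+2)* uu n r := by
  have e1 : ((r+2*n).choose (n+1) : K) * (n+1) = ((r+2*n).choose n : K) * (r+n) := by
    have := Nat.choose_succ_right_eq (r+2*n) n
    rw [show r+2*n-n = r+n by omega] at this
    exact_mod_cast this
  have e2 : ((r+2*n+1).choose (n+1) : K) * (n+1) = ((r+2*n).choose n : K) * (r+2*n+1) := by
    have := Nat.add_one_mul_choose_eq (r+2*n) n
    have := congrArg (Nat.cast : ℕ → K) this
    push_cast at this; linear_combination -this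
  have e3 : ((r+2*n+2).choose (n+1) : K) * (r+n+1) = ((r+2*n+1).choose (n+1) : K) * (r+2*n+2) := by
    have := Nat.choose_mul_succ_eq (r+2*n+1) (n+1)
    rw [show r+2*n+1+1-(n+1) = r+n+1 by omega] at this
    have := congrArg (Nat.cast : ℕ → K) this
    push_cast at this; linear_combination -this
  have e4 : ((r+2*n+3).choose (n+1) : K) * (r+n+2) = ((r+2*n+2).choose (n+1) : K) * (r+2*n+3) := by
    have := Nat.choose_mul_succ_eq (r+2*n+2) (n+1)
    rw [show r+2*n+2+1-(n+1) = r+n+2 by omega] at this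
    have := congrArg (Nat.cast : ℕ → K) this
    push_cast at this; linear_combination -this
  have n1 : (n:K)+1 ≠ 0 := by exact_mod_cast n.succ_ne_zero
  have n2 : (r:K)+n+1 ≠ 0 := by exact_mod_cast (r+n).succ_ne_zero
  have n3 : (r:K)+n+2 ≠ 0 := by exact_mod_cast (r+n+1).succ_ne_zero
  have n4 : (r:K)+(n+1)+1 ≠ 0 := by exact_mod_cast (r+n+1).succ_ne_zero
  rw [← eq_div_iff n1] at e1 e2
  rw [← eq_div_iff n2] at e3
  rw [← eq_div_iff n3] at e4
  unfold uu
  rw [show r + 2*(n+1) = r+2*n+2 by ring]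
  push_cast
  rw [e4, e3, e2, e1]
  field_simp
  ring

/-- weights -/
def ph (k0 k : ℕ) : K := cc k0 / cc k / ((k:K)^3 * ((2*k).choose k : K))
lemma ph_succ (k0 k : ℕ) (hk : k ≠ 0) : (ph k0 (k+1) : K) * (2*(2*k+1)*(3*k+1)*(3*k+2)) = 9 * (ph k0 k * (k:K)^3) := by
  unfold ph
  have h1 : ((2*(k+1)).choose (k+1) : K) * (k+1) = 2 * (2*k+1) * ((2*k).choose k : K) := by
    have := Nat.succ_mul_centralBinom_succ k
    unfold Nat.centralBinom at this
    have := congrArg (Nat.cast : ℕ → K) this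
    push_cast at this; linear_combination this
  have n1 : (k:K)+1 ≠ 0 := by exact_mod_cast k.succ_ne_zero
  have n2 : ((2*k).choose k : K) ≠ 0 := by exact_mod_cast (Nat.choose_pos (by omega)).ne'
  have n3 : (k:K) ≠ 0 := by exact_mod_cast hk
  have n4 := cc_ne (K := K) k
  have n5 : (2*(k:K)+1) ≠ 0 := by exact_mod_cast (2*k).succ_ne_zero
  have n6 : (3*(k:K)+1) ≠ 0 := by exact_mod_cast (3*k).succ_ne_zero
  have n7 : (3*(k:K)+2) ≠ 0 := by exact_mod_cast (3*k+1).succ_ne_zero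
  have h2 := cc_succ (K := K) k
  rw [← eq_div_iff n1] at h1
  rw [← eq_div_iff (pow_ne_zero 2 n1)] at h2
  rw [h1, h2]
  have n6' : (k:K) + 1/3 ≠ 0 := by intro h; apply n6; linear_combination 3*h
  have n7' : (k:K) + 2/3 ≠ 0 := by intro h; apply n7; linear_combination 3*h
  push_cast
  have n8 : (k:K)*3+1 ≠ 0 := by intro h; apply n6; linear_combination h
  have n9 : (k:K)*3+2 ≠ 0 := by intro h; apply n7; linear_combination h
  have n10 : (k:K)*2+1 ≠ 0 := by intro h; apply n5; linear_combination h
  field_simp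
  norm_num

def lam (m k0 r : ℕ) : K := ∑ k ∈ Ico (m+1) (k0+1), ph k0 k * ((r+2*k-1).choose k : K)
/-- the adjoint recursion, in exact form -/
lemma lam_rec (m k0 : ℕ) (hm : m ≤ k0) (hm0 : m ≠ 0) (r : ℕ) :
   -(r:K)*(9*(r:K)^2-1) * lam m k0 (r-1) + (27*(r:K)^3+27*(r:K)^2+16*r+4)*lam m k0 r
   - (27*(r:K)^3+54*(r:K)^2+44*r+13) * lam m k0 (r+1) + 9*((r:K)+1)^3*lam m k0 (r+2)
   = 9 * (ph k0 k0 * (k0:K)^3 * uu k0 r) - 9 * (ph k0 m * (m:K)^3 * uu m r) := by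
  have key : ∀ k ∈ Ico (m+1) (k0+1), ph k0 k * (-(r:K)*(9*(r:K)^2-1) * ((r-1+2*k-1).choose k : K) + (27*(r:K)^3+27*(r:K)^2+16*r+4)*((r+2*k-1).choose k : K)
   - (27*(r:K)^3+54*(r:K)^2+44*r+13) * ((r+1+2*k-1).choose k : K) + 9*((r:K)+1)^3*((r+2+2*k-1).choose k : K)) 
     = 9 * (ph k0 k * (k:K)^3 * uu k r) - 9 * (ph k0 (k-1) * ((k-1:ℕ):K)^3 * uu (k-1) r) := by
    intro k hk
    rw [mem_Ico] at hk
    obtain ⟨n, rfl⟩ : ∃ n, k = n + 1 := ⟨k-1, by omega⟩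
    have h := tele (K := K) n r
    have hs := ph_succ (K := K) k0 n (by omega)
    rw [Nat.add_sub_cancel]
    rw [show r+2*(n+1)-1 = r+2*n+1 by omega, show r+1+2*(n+1)-1 = r+2*n+2 by omega, show r+2+2*(n+1)-1=r+2*n+3 by omega]
    have e : -(r:K)*(9*(r:K)^2-1) * ((r-1+2*(n+1)-1).choose (n+1) : K) = -(r:K)*(9*(r:K)^2-1) * ((r+2*n).choose (n+1) : K) := by
      rcases r with _ | r
      · simp
      · rw [show r+1-1+2*(n+1)-1 = r+1+2*n by omega]
    rw [e, h]
    push_cast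
    linear_combination (-uu n r) * hs
  have hs := sum_congr rfl key
  have ht : ∑ k ∈ Ico (m+1) (k0+1), (9 * (ph k0 k * (k:K)^3 * uu k r) - 9 * (ph k0 (k-1) * ((k-1:ℕ):K)^3 * uu (k-1) r)) = 9 * (ph k0 k0 * (k0:K)^3 * uu k0 r) - 9 * (ph k0 m * (m:K)^3 * uu m r) := by
    rw [sum_Ico_eq_sum_range, show k0+1-(m+1) = k0-m by omega]
    have := sum_range_sub (fun i => 9 * (ph k0 (m+i) * ((m+i:ℕ):K)^3 * uu (m+i) r)) (k0-m)
    rw [show m+(k0-m) = k0 by omega, add_zero] at this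
    rw [← this]
    apply sum_congr rfl
    intro i _
    rw [show m+1+i-1 = m+i by omega, show m+1+i = m+(i+1) by omega]
  rw [← ht, ← hs]
  unfold lam
  simp only [mul_sum, ← sum_add_distrib, ← sum_sub_distrib]
  apply sum_congr rfl; intro k _; ring
end gen
end S19

set_option linter.unusedSectionVars false
set_option linter.unusedSimpArgs false
namespace S19
open Finset Polynomial
variable {p : ℕ} [hp : Fact p.Prime]

lemma Lam_dv {r M : ℕ} {l : ℕ → ℚ_[p]} (hl : ∀ j < M, Dv 0 (l j)) {F : ℚ_[p][X]} (hF : PD r F) : Dv r (Lam l M F) := by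
  unfold Lam
  exact Dv.sum fun j hj => (hl j (mem_range.1 hj)).mul (hF j)

lemma Lg_L0 {D : ℚ_[p][X]} (hD : PD 0 D) : PD 1 (Lg (a0 p) (b1 p) (b2 p) D - L0 D) := by
  intro k
  have hp0 : (∀ k : ℕ, Dv 1 ((a0 p k : ℚ_[p]) - a0 0 (k:ℚ_[p]))) ∧ (∀ k : ℕ, Dv 1 ((b1 p k : ℚ_[p]) - b1 0 (k:ℚ_[p]))) ∧ (∀ k : ℕ, Dv 1 ((b2 p k : ℚ_[p]) - b2 0 (k:ℚ_[p]))) := by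
    refine ⟨fun k => ?_, fun k => ?_, fun k => ?_⟩
    · have : (a0 p k : ℚ_[p]) - a0 0 (k:ℚ_[p]) = p * ((27 * (-3*k^2+3*k*p-p^2) : ℤ) : ℚ_[p]) := by unfold a0; push_cast; ring
      rw [this]; exact Dv.p1.mulr (Dv.int _)
    · have : (b1 p k : ℚ_[p]) - b1 0 (k:ℚ_[p]) = p * ((-162*k^2 + 162*k*p - 162*k - 54*p^2 + 81*p - 57 : ℤ) : ℚ_[p]) := by unfold b1; push_cast; ring
      rw [this]; exact Dv.p1.mulr (Dv.int _)
    · have : (b2 p k : ℚ_[p]) - b2 0 (k:ℚ_[p]) = p * ((27 * (-3*(k+1)^2+3*(k+1)*p-p^2) : ℤ) : ℚ_[p]) := by unfold b2; push_cast; ring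
      rw [this]; exact Dv.p1.mulr (Dv.int _)
  obtain ⟨h0, h1, h2⟩ := hp0
  unfold L0
  rw [coeff_sub, Lg_coeff, Lg_coeff]
  have e : ∀ a a' b b' c c' : ℚ_[p], a - b + c - (a' - b' + c') = (a-a') - (b-b') + (c-c') := by intros; ring
  rw [e]
  refine (Dv.sub ?_ ?_).add ?_
  · rw [← sub_mul]; exact (h0 k).mulr (hD _)
  · split_ifs
    · rw [← sub_mul]; exact (h1 _).mulr (hD _)
    · simpa using Dv.zero 1
  · split_ifs
    · rw [← sub_mul]; exact (h2 _).mulr (hD _)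
    · simpa using Dv.zero 1

lemma dv_choose_mid {n k : ℕ} (h1 : n < p + k) (h2 : p ≤ n) (hk : k < p) : Dv 1 ((n.choose k : ℕ) : ℚ_[p]) := by
  apply dv1_nat
  by_cases hkn : k ≤ n
  · have h := Nat.choose_mul_factorial_mul_factorial hkn
    have hd : p ∣ n.choose k * k.factorial * (n-k).factorial := by rw [h]; exact (hp.out.dvd_factorial).2 h2
    rcases (Nat.Prime.dvd_mul hp.out).1 hd with hd | hd
    · rcases (Nat.Prime.dvd_mul hp.out).1 hd with hd | hd
      · exact hd
      · have := (hp.out.dvd_factorial).1 hd; omega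
    · have := (hp.out.dvd_factorial).1 hd; omega
  · rw [Nat.choose_eq_zero_of_lt (by omega)]; exact dvd_zero _

lemma un_choose {n k : ℕ} (hn : n < p) (hk : k ≤ n) : Un ((n.choose k : ℕ) : ℚ_[p]) := by
  apply Un.nat
  intro hd
  have h := Nat.choose_mul_factorial_mul_factorial hk
  have : p ∣ n.factorial := by rw [← h, mul_assoc]; exact hd.mul_right _
  have := (hp.out.dvd_factorial).1 this
  omega

lemma un_cc_div (h3 : 3 < p) {k0 k : ℕ} (hk : p / 3 < k) (hkk : k ≤ k0) (hk0 : 2 * k0 < p) : Un (cc k0 / cc k : ℚ_[p]) := by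
  induction k0, hkk using Nat.le_induction with
  | base => rw [div_self (cc_ne k)]; exact Un.one
  | succ j hj ih =>
    have h := cc_succ (K := ℚ_[p]) j
    have n1 : ((j:ℚ_[p])+1)^2 ≠ 0 := pow_ne_zero _ (by exact_mod_cast j.succ_ne_zero)
    rw [← eq_div_iff n1] at h
    have e : (cc (j+1) / cc k : ℚ_[p]) = cc j / cc k * ((((3*j+1 : ℕ) : ℚ_[p]) * ((3*j+2 : ℕ) : ℚ_[p])) / (9 * ((j+1:ℕ) : ℚ_[p])^2)) := by
      rw [h]; push_cast; field_simp; ring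
    rw [e]
    refine (ih (by omega)).mul (Un.div (Un.mul (Un.nat ?_) (Un.nat ?_)) ((un9 h3).mul ((Un.nat ?_).pow 2)))
    · intro hd; obtain ⟨c, hc⟩ := hd
      have : c < 2 := by by_contra hh; have : p * 2 ≤ p * c := Nat.mul_le_mul_left _ (by omega); omega
      interval_cases c <;> omega
    · intro hd; obtain ⟨c, hc⟩ := hd
      have : c < 2 := by by_contra hh; have : p * 2 ≤ p * c := Nat.mul_le_mul_left _ (by omega); omega
      interval_cases c <;> omega
    · intro hd; have := Nat.le_of_dvd (by omega) hd; omega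

lemma dv_ph (h3 : 3 < p) {k0 k : ℕ} (hk : p / 3 < k) (hkk : k ≤ k0) (hk0 : 2 * k0 < p) : Dv 0 (ph k0 k : ℚ_[p]) := by
  unfold ph
  refine ((un_cc_div h3 hk hkk hk0).div (Un.mul ((un_of_lt (by omega) (by omega)).pow 3) (un_choose (by omega) (by omega)))).dv

lemma dv_lam (h3 : 3 < p) {k0 : ℕ} (hk0 : 2 * k0 < p) (r : ℕ) : Dv 0 (lam (p/3) k0 r : ℚ_[p]) := by
  unfold lam
  apply Dv.sum; intro k hk; rw [mem_Ico] at hk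
  exact (dv_ph h3 (by omega) (by omega) hk0).mul (Dv.nat _)

lemma dv_lam1 (h3 : 3 < p) {k0 : ℕ} (hk0 : 2 * k0 < p) {r : ℕ} (h1 : (p+1)/3 ≤ r) (h2 : r + k0 ≤ p) : Dv 1 (lam (p/3) k0 r : ℚ_[p]) := by
  unfold lam
  apply Dv.sum; intro k hk; rw [mem_Ico] at hk
  have hpm : p % 3 ≠ 0 := fun h => by
    have := (Nat.prime_dvd_prime_iff_eq Nat.prime_three hp.out).1 (Nat.dvd_of_mod_eq_zero h); omega
  exact (dv_ph h3 (by omega) (by omega) hk0).mul (dv_choose_mid (by omega) (by omega) (by omega))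

lemma Lam_Xr (h3 : 3 < p) {k0 r : ℕ} (hk0 : 2 * k0 + 1 = p) (hr : r ≤ (p+1)/3 + 1) : Cg 1 (Lam (lam (p/3) k0) ((p+1)/3) (X^r : ℚ_[p][X])) (lam (p/3) k0 r) := by
  rw [Lam_X]
  split_ifs with h
  · exact Cg.refl _ _
  · apply Cg.symm; unfold Cg; rw [sub_zero]; exact dv_lam1 h3 (by omega) (by omega) (by omega)

lemma L0_s_comp (r : ℕ) : (L0 ((1-X)^r : ℚ_[p][X])).comp (1-X) = C (-3*(r:ℚ_[p])*(9*(r:ℚ_[p])^2-1)) * X^(r-1) + C (3*(27*(r:ℚ_[p])^3+27*(r:ℚ_[p])^2+16*(r:ℚ_[p])+4))*X^r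
   + C (-3*(27*(r:ℚ_[p])^3+54*(r:ℚ_[p])^2+44*(r:ℚ_[p])+13))*X^(r+1) + C (27*((r:ℚ_[p])+1)^3) * X^(r+2) := by
  have h := L0_s (K := ℚ_[p]) r
  have h9 : (9 : ℚ_[p][X]) ≠ 0 := by
    have : (C 9 : ℚ_[p][X]) ≠ 0 := by rw [Ne, C_eq_zero]; norm_num
    exact this
  have h' : L0 ((1-X)^r : ℚ_[p][X]) = C (-3*(r:ℚ_[p])*(9*(r:ℚ_[p])^2-1)) * (1-X)^(r-1) + C (3*(27*(r:ℚ_[p])^3+27*(r:ℚ_[p])^2+16*(r:ℚ_[p])+4))*(1-X)^r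
   + C (-3*(27*(r:ℚ_[p])^3+54*(r:ℚ_[p])^2+44*(r:ℚ_[p])+13))*(1-X)^(r+1) + C (27*((r:ℚ_[p])+1)^3) * (1-X)^(r+2) := by
    apply mul_left_cancel₀ h9
    rw [h]
    simp only [map_mul, map_add, map_sub, map_pow, map_natCast, map_neg, map_ofNat, map_one]
    ring
  rw [h']
  simp

lemma Lam_L0s (h3 : 3 < p) {k0 : ℕ} (hk0 : 2 * k0 + 1 = p) (r : ℕ) :
    Cg 1 (Lam (lam (p/3) k0) ((p+1)/3) ((L0 ((1-X)^r : ℚ_[p][X])).comp (1-X))) (if r = 0 then 54 else 0) := by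
  have hpm : p % 3 ≠ 0 := fun h => by
    have := (Nat.prime_dvd_prime_iff_eq Nat.prime_three hp.out).1 (Nat.dvd_of_mod_eq_zero h); omega
  rw [L0_s_comp, Lam_add, Lam_add, Lam_add, Lam_C, Lam_C, Lam_C, Lam_C]
  have hd : ∀ z : ℤ, Dv 0 (z : ℚ_[p]) := fun z => Dv.int z
  rcases lt_trichotomy r ((p+1)/3) with hr | hr | hr
  · have hm0 : p/3 ≠ 0 := by omega
    have hrec := lam_rec (K := ℚ_[p]) (p/3) k0 (by omega) hm0 r
    have hs := ph_succ (K := ℚ_[p]) k0 (p/3) hm0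
    have hc : Cg 1 (-3*(r:ℚ_[p])*(9*(r:ℚ_[p])^2-1) * Lam (lam (p/3) k0) ((p+1)/3) (X^(r-1) : ℚ_[p][X]) + (3*(27*(r:ℚ_[p])^3+27*(r:ℚ_[p])^2+16*(r:ℚ_[p])+4))*Lam (lam (p/3) k0) ((p+1)/3) (X^r : ℚ_[p][X])
       + (-3*(27*(r:ℚ_[p])^3+54*(r:ℚ_[p])^2+44*(r:ℚ_[p])+13))*Lam (lam (p/3) k0) ((p+1)/3) (X^(r+1) : ℚ_[p][X]) + (27*((r:ℚ_[p])+1)^3) * Lam (lam (p/3) k0) ((p+1)/3) (X^(r+2) : ℚ_[p][X]))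
        (-3*(r:ℚ_[p])*(9*(r:ℚ_[p])^2-1) * lam (p/3) k0 (r-1) + (3*(27*(r:ℚ_[p])^3+27*(r:ℚ_[p])^2+16*(r:ℚ_[p])+4))*lam (p/3) k0 r
       + (-3*(27*(r:ℚ_[p])^3+54*(r:ℚ_[p])^2+44*(r:ℚ_[p])+13))*lam (p/3) k0 (r+1) + (27*((r:ℚ_[p])+1)^3) * lam (p/3) k0 (r+2)) := by
      refine (((Cg.mul_left (Lam_Xr h3 hk0 (by omega)) ?_).add (Cg.mul_left (Lam_Xr h3 hk0 (by omega)) ?_)).add (Cg.mul_left (Lam_Xr h3 hk0 (by omega)) ?_)).add (Cg.mul_left (Lam_Xr h3 hk0 (by omega)) ?_)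
      · have hz := hd (-3*(r:ℤ)*(9*(r:ℤ)^2-1)); push_cast at hz; exact hz
      · have hz := hd (3*(27*(r:ℤ)^3+27*(r:ℤ)^2+16*(r:ℤ)+4)); push_cast at hz; exact hz
      · have hz := hd (-3*(27*(r:ℤ)^3+54*(r:ℤ)^2+44*(r:ℤ)+13)); push_cast at hz; exact hz
      · have hz := hd (27*((r:ℤ)+1)^3); push_cast at hz; exact hz
    refine hc.trans ?_
    have e : (-3*(r:ℚ_[p])*(9*(r:ℚ_[p])^2-1) * lam (p/3) k0 (r-1) + (3*(27*(r:ℚ_[p])^3+27*(r:ℚ_[p])^2+16*(r:ℚ_[p])+4))*lam (p/3) k0 r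
       + (-3*(27*(r:ℚ_[p])^3+54*(r:ℚ_[p])^2+44*(r:ℚ_[p])+13))*lam (p/3) k0 (r+1) + (27*((r:ℚ_[p])+1)^3) * lam (p/3) k0 (r+2))
       = 27 * (ph k0 k0 * (k0:ℚ_[p])^3 * uu k0 r) - 3 * (ph k0 (p/3+1) * (2*(2*((p/3:ℕ):ℚ_[p])+1)*(3*((p/3:ℕ):ℚ_[p])+1)*(3*((p/3:ℕ):ℚ_[p])+2)) * uu (p/3) r) := by
      rw [hs]; linear_combination 3 * hrec
    rw [e]
    have hu : ∀ n : ℕ, n ≤ k0 → Dv 0 (uu n r : ℚ_[p]) := by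
      intro n hn
      unfold uu
      have : Un ((r:ℚ_[p]) + (n:ℚ_[p]) + 1) := by
        have := un_of_lt (p := p) (n := r+n+1) (by omega) (by omega)
        exact_mod_cast this
      refine Dv.div (Dv.mul ?_ (Dv.nat _)) this
      exact_mod_cast Dv.nat (p := p) (r+1)
    have h2 : Dv 1 (3 * (ph k0 (p/3+1) * (2*(2*((p/3:ℕ):ℚ_[p])+1)*(3*((p/3:ℕ):ℚ_[p])+1)*(3*((p/3:ℕ):ℚ_[p])+2)) * uu (p/3) r)) := by
      refine (Dv.ofNat 3).mul (Dv.mulr (Dv.mul (dv_ph h3 (by omega) (by omega) (by omega)) ?_) (hu _ (by omega)))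
      have : Dv 1 ((2*(2*(p/3)+1)*(3*(p/3)+1)*(3*(p/3)+2) : ℕ) : ℚ_[p]) := by
        apply dv1_nat
        rcases (by omega : p % 3 = 1 ∨ p % 3 = 2) with h | h
        · exact Dvd.dvd.mul_right (Dvd.dvd.mul_left (dvd_of_eq (by omega)) _) _
        · exact (Dvd.dvd.mul_left (dvd_of_eq (by omega)) _)
      exact_mod_cast this
    have hp1 : (ph k0 k0 * (k0:ℚ_[p])^3 : ℚ_[p]) = 1 / ((2*k0).choose k0 : ℚ_[p]) := by
      have hk : (k0:ℚ_[p]) ≠ 0 := by exact_mod_cast (by omega : k0 ≠ 0)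
      unfold ph; rw [div_self (cc_ne k0)]; field_simp
    have h1 : Cg 1 (27 * (ph k0 k0 * (k0:ℚ_[p])^3 * uu k0 r)) (if r = 0 then 54 else 0) := by
      rw [hp1]
      have huc := un_choose (p := p) (n := 2*k0) (k := k0) (by omega) (by omega)
      split_ifs with h0
      · subst h0
        have hk1 : Un ((k0:ℚ_[p])+1) := by
          have := un_of_lt (p := p) (n := k0+1) (by omega) (by omega)
          exact_mod_cast this
        have hc := huc.ne
        have e2 : (27 * (1 / ((2*k0).choose k0 : ℚ_[p]) * uu k0 0)) - 54 = p * (-27 / (k0+1)) := by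
          unfold uu
          have hpk : (p:ℚ_[p]) = 2*(k0:ℚ_[p])+1 := by exact_mod_cast hk0.symm
          rw [hpk]
          have := hk1.ne
          rw [zero_add]
          push_cast
          field_simp
          ring
        unfold Cg; rw [e2]
        refine Dv.p1.mulr (Dv.div ?_ hk1)
        exact_mod_cast hd (-27)
      · unfold Cg; rw [sub_zero]
        refine (Dv.ofNat 27).mul (Dv.mul (Dv.div Dv.one huc) ?_)
        unfold uu
        have : Un ((r:ℚ_[p]) + (k0:ℚ_[p]) + 1) := by
          have := un_of_lt (p := p) (n := r+k0+1) (by omega) (by omega)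
          exact_mod_cast this
        refine Dv.div (Dv.mul ?_ (dv_choose_mid (by omega) (by omega) (by omega))) this
        exact_mod_cast Dv.nat (p := p) (r+1)
    have := h1.sub (show Cg 1 _ 0 by unfold Cg; rw [sub_zero]; exact h2)
    rwa [sub_zero] at this
  · rw [Lam_X, Lam_X, Lam_X, Lam_X, if_pos (by omega), if_neg (by omega), if_neg (by omega), if_neg (by omega), if_neg (by omega)]
    unfold Cg
    simp only [mul_zero, add_zero, sub_zero]
    refine Dv.mulr ?_ (dv_lam h3 (by omega) _)
    have : Dv 1 (((-3*(r:ℤ)*(9*(r:ℤ)^2-1) : ℤ)) : ℚ_[p]) := by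
      have hdv : (p:ℤ) ∣ 9*(r:ℤ)^2-1 := by
        rcases (by omega : p % 3 = 1 ∨ p % 3 = 2) with h | h
        · have : (p:ℤ) = 3*r+1 := by omega
          exact ⟨3*r-1, by rw [this]; ring⟩
        · have : (p:ℤ) = 3*r-1 := by omega
          exact ⟨3*r+1, by rw [this]; ring⟩
      obtain ⟨c, hc⟩ := hdv
      rw [hc]; push_cast
      rw [show -3 * (r:ℚ_[p]) * (p * c) = p * (((-3 * r * c : ℤ)) : ℚ_[p]) by push_cast; ring]
      exact Dv.p1.mulr (Dv.int _)
    push_cast at this; exact this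
  · rw [Lam_X, Lam_X, Lam_X, Lam_X, if_neg (by omega), if_neg (by omega), if_neg (by omega), if_neg (by omega), if_neg (by omega)]
    simp [Cg, Dv.zero]
end S19

set_option linter.unusedSectionVars false
set_option linter.unusedSimpArgs false
namespace S19
open Finset Polynomial
variable {p : ℕ} [hp : Fact p.Prime]

lemma Lam_L0 (h3 : 3 < p) {k0 : ℕ} (hk0 : 2 * k0 + 1 = p) {D : ℚ_[p][X]} (hD : PD 0 D) :
    Cg 1 (Lam (lam (p/3) k0) ((p+1)/3) ((L0 D).comp (1-X))) (54 * D.eval 1) := by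
  have hE : D = (∑ r ∈ range ((D.comp (1-X)).natDegree+1), C ((D.comp (1-X)).coeff r) * (1-X)^r) := by
    conv_lhs => rw [← comp_comp1 D]
    exact eval₂_eq_sum_range (p := D.comp (1-X)) (f := C) (1-X)
  have h1 : D.eval 1 = (D.comp (1-X)).coeff 0 := by
    rw [coeff_zero_eq_eval_zero, eval_comp]; simp
  have hI := hD.comp PD.omX
  rw [h1]
  generalize hEE : D.comp (1-X) = E at *
  rw [hE, L0_sum]
  have e : (∑ r ∈ range (E.natDegree+1), L0 (C (E.coeff r) * (1-X)^r)).comp (1-X) = ∑ r ∈ range (E.natDegree+1), C (E.coeff r) * (L0 ((1-X)^r)).comp (1-X) := by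
    rw [Polynomial.sum_comp]
    apply sum_congr rfl; intro r _; rw [L0_C, mul_comp, C_comp]
  rw [e, Lam_sum]
  have h54 : 54 * E.coeff 0 = ∑ r ∈ range (E.natDegree+1), E.coeff r * (if r = 0 then 54 else 0) := by
    rw [sum_eq_single 0]
    · simp; ring
    · intro b _ hb; simp [hb]
    · simp
  rw [h54]
  apply Cg.sum; intro r _
  rw [Lam_C]
  exact (Lam_L0s h3 hk0 r).mul_left (hI r)

lemma fermat9 (h3 : 3 < p) : Cg 1 (((1/9:ℚ_[p]))^p) (1/9) := by
  have h : Cg 1 ((9:ℚ_[p])^p) 9 := by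
    have := cg_zmod (p := p) (a := 9^p) (b := 9) (by push_cast; rw [ZMod.pow_card])
    push_cast at this; exact this
  rw [one_div, inv_pow]
  exact h.inv ((un9 h3).pow _) (un9 h3)

lemma PDcg_C {a b : ℚ_[p]} (h : Cg 1 a b) : PD 1 (C a - C b) := by
  rw [← C_sub]; exact PD.C h

lemma RR_cg (h3 : 3 < p) : PD 1 (81 * RR p - (C (-8) + C (-20) * X + C (-12) * X^2 + C (-4) * X^3 + C (-1)*X^4) * (1-X)^(4*p) : ℚ_[p][X]) := by
  have h9 := PDcg_C (fermat9 h3)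
  have hv1 := PDcg_C (v_pm1 h3)
  have hv2 := PDcg_C (v_p h3)
  have e : (81 * RR p - (C (-8) + C (-20) * X + C (-12) * X^2 + C (-4) * X^3 + C (-1)*X^4) * (1-X)^(4*p) : ℚ_[p][X])
     = (2+X) * (1-X)^(4*p-1) * (81 * ((C ((1/9:ℚ_[p])^p) - C (1/9)) * (C (v (p-1) * (1/9)) * (1-X)^4 - C (v p) * qq)
        + C (1/9) * ((C (v (p-1)) - C 1) * C (1/9) * (1-X)^4 - (C (v p) - C (5/9)) * qq))) := by
    unfold RR
    rw [show 4*p = (4*p-1)+1 by omega, pow_succ, Nat.add_sub_cancel]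
    have c9 : (C (1/9) : ℚ_[p][X]) * 9 = 1 := by rw [show (9:ℚ_[p][X]) = C 9 from rfl, ← C_mul]; norm_num
    have c5 : (C (5/9) : ℚ_[p][X]) = 5 * C (1/9) := by rw [show (5:ℚ_[p][X]) = C 5 from rfl, ← C_mul]; norm_num
    rw [c5]
    simp only [C_mul, C_neg, C_1, qq]
    rw [show (C 8 : ℚ_[p][X]) = 8 from rfl, show (C 20 : ℚ_[p][X]) = 20 from rfl, show (C 12 : ℚ_[p][X]) = 12 from rfl, show (C 4 : ℚ_[p][X]) = 4 from rfl]
    linear_combination ((1-X)^(4*p-1)*(1-X)*(2+X)*((1-X)^3 - 5*(1+X+X^2))*(9 * C (1/9) + 1)) * c9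
  rw [e]
  refine (((PD.ofNat 2).add PD.X).mul (PD.omX.pow _)).mul ((PD.ofNat 81).mul (PD.add ?_ ?_))
  · exact h9.mulr (((PD.C ((dv_v h3 _).mul (un_inv9 h3).dv)).mul (PD.omX.pow _)).sub ((PD.C (dv_v h3 _)).mul PD.qq))
  · exact (PD.C (un_inv9 h3).dv).mul (((hv1.mulr (PD.C (un_inv9 h3).dv)).mulr (PD.omX.pow _)).sub (hv2.mulr PD.qq))

lemma coeff_mul_4p (Q : ℚ_[p][X]) (hQ : PD 0 Q) {n : ℕ} (hn : n < p) : Cg 1 ((Q * (1-X)^(4*p)).coeff n) (Q.coeff n) := by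
  have h := coeff_mul Q ((1-X)^(4*p)) n
  have e : Q.coeff n = ∑ x ∈ antidiagonal n, Q.coeff x.1 * (if x.2 = 0 then 1 else 0) := by
    have := coeff_mul Q 1 n
    rw [mul_one] at this; rw [this]
    apply sum_congr rfl; intro x _; rw [coeff_one]
  rw [h, e]
  apply Cg.sum; intro x hx
  apply Cg.mul_left _ (hQ _)
  rw [HasAntidiagonal.mem_antidiagonal] at hx
  rw [coeff_omX_pow]
  split_ifs with h0
  · rw [h0]; simp [Cg, Dv.zero]
  · unfold Cg; rw [sub_zero]
    apply Dv.mul ((Dv.one.neg).pow _)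
    apply dv1_nat
    have h4 := Choose.choose_modEq_choose_mod_mul_choose_div_nat (p := p) (n := 4*p) (k := x.2)
    rw [Nat.mul_mod_left, Nat.mod_eq_of_lt (by omega : x.2 < p), Nat.choose_eq_zero_of_lt (by omega : 0 < x.2), zero_mul] at h4
    exact (Nat.modEq_zero_iff_dvd).1 h4

lemma coeff_quart (a b c d e : ℚ_[p]) (n : ℕ) : (C a + C b * X + C c * X^2 + C d * X^3 + C e*X^4 : ℚ_[p][X]).coeff n = if n = 0 then a else if n = 1 then b else if n = 2 then c else if n = 3 then d else if n = 4 then e else 0 := by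
  simp only [coeff_add, coeff_C_mul, coeff_X_pow, coeff_C, coeff_X]
  rcases n with _ | _ | _ | _ | _ | n <;> simp

lemma RR_coeff (h3 : 3 < p) {n : ℕ} (hn : n < p) : Cg 1 (81 * (RR p : ℚ_[p][X]).coeff n) (if n = 0 then -8 else if n = 1 then -20 else if n = 2 then -12 else if n = 3 then -4 else if n = 4 then -1 else 0) := by
  have h := RR_cg h3 n
  rw [coeff_sub, show (81 * RR p : ℚ_[p][X]) = C 81 * RR p from rfl, coeff_C_mul] at h
  rw [← coeff_quart]
  refine Cg.trans h (coeff_mul_4p _ ?_ hn)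
  have hd : ∀ z : ℤ, PD 0 (C (z : ℚ_[p])) := fun z => PD.C (Dv.int z)
  have h1 := hd (-8); have h2 := hd (-20); have h3 := hd (-12); have h4 := hd (-4); have h5 := hd (-1)
  push_cast at h1 h2 h3 h4 h5
  exact (((h1.add (h2.mul PD.X)).add (h3.mul (PD.X.pow 2))).add (h4.mul (PD.X.pow 3))).add (h5.mul (PD.X.pow 4))

def TT (p k0 : ℕ) {K : Type*} [Field K] [CharZero K] : K := ∑ k ∈ Ico (p/3+1) (k0+1), cc k0 / cc k / (k:K)^3

lemma del_eval (h3 : 3 < p) {k0 : ℕ} (hk0 : 2 * k0 + 1 = p) : Cg 1 ((del p : ℚ_[p][X]).eval 1) (-(16/27) * TT p k0) := by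
  have hpm : p % 3 ≠ 0 := fun h => by
    have := (Nat.prime_dvd_prime_iff_eq Nat.prime_three hp.out).1 (Nat.dvd_of_mod_eq_zero h); omega
  have hl : ∀ j < (p+1)/3, Dv 0 (lam (p/3) k0 j : ℚ_[p]) := fun j _ => dv_lam h3 (by omega) j
  have h1 := Lam_L0 h3 hk0 (PD_del h3)
  have h2 : Cg 1 (Lam (lam (p/3) k0) ((p+1)/3) ((Lg (a0 p) (b1 p) (b2 p) (del p)).comp (1-X)) : ℚ_[p]) (Lam (lam (p/3) k0) ((p+1)/3) ((L0 (del p)).comp (1-X))) := by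
    have := Lam_dv hl ((Lg_L0 (PD_del h3)).comp PD.omX)
    rw [sub_comp] at this
    unfold Cg
    have e : ∀ F G : ℚ_[p][X], Lam (lam (p/3) k0) ((p+1)/3) (F - G) = Lam (lam (p/3) k0) ((p+1)/3) F - Lam (lam (p/3) k0) ((p+1)/3) G := by
      intro F G; simp [Lam, mul_sub, sum_sub_distrib]
    rwa [e] at this
  rw [Lg_del (by omega)] at h2
  have h4 : Cg 1 (Lam (lam (p/3) k0) ((p+1)/3) ((81 * tB (RR p) + 27 * (- C (v (p-1)) + C (v p) * X)).comp (1-X)) : ℚ_[p])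
     (Lam (lam (p/3) k0) ((p+1)/3) (C (-32) + C (-16) * X)) := by
    unfold Lam
    apply Cg.sum; intro j hj
    apply Cg.mul_left _ (hl j (mem_range.1 hj))
    have hj := mem_range.1 hj
    have e1 : ((81 * tB (RR p) + 27 * (- C (v (p-1)) + C (v p) * X)).comp (1-X) : ℚ_[p][X]).coeff j = 81 * (RR p : ℚ_[p][X]).coeff (3*j+1) + (if j = 0 then 27 * (v p - v (p-1)) else if j = 1 then -27 * v p else 0) := by
      have : ((81 * tB (RR p) + 27 * (- C (v (p-1)) + C (v p) * X)).comp (1-X) : ℚ_[p][X]) = C 81 * contract 3 (divX (RR p)) + (C (27 * (v p - v (p-1))) + C (-27 * v p) * X) := by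
        unfold tB
        rw [add_comp, show (81:ℚ_[p][X]) = C 81 from rfl, show (27:ℚ_[p][X]) = C 27 from rfl, mul_comp, comp_comp1]
        simp only [C_comp, mul_comp, add_comp, neg_comp, X_comp, C_mul, C_sub, C_neg]
        ring
      rw [this, coeff_add, coeff_C_mul, coeff_contract (by norm_num), coeff_divX, coeff_add, coeff_C, coeff_C_mul, coeff_X, mul_comm j 3]
      rcases j with _ | _ | j <;> simp
    rw [e1, coeff_add, coeff_C, coeff_C_mul, coeff_X]
    have hR := RR_coeff h3 (n := 3*j+1) (by omega)
    rcases j with _ | _ | j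
    · simp only [mul_zero, zero_add, if_true] at hR ⊢
      norm_num at hR ⊢
      have hv := ((v_p h3).sub (v_pm1 h3)).mul_left (Dv.ofNat 27)
      have := hR.add hv
      refine this.trans (Cg.of_eq ?_)
      norm_num
    · norm_num at hR ⊢
      have hv := ((v_p h3).mul_left (Dv.ofNat 27)).neg
      have := hR.add hv
      refine this.trans (Cg.of_eq ?_)
      norm_num
    · rw [if_neg (by omega), if_neg (by omega), if_neg (by omega), if_neg (by omega), if_neg (by omega)] at hR
      simp only [if_neg (show ¬ (j+1+1 = 0) by omega), if_neg (show ¬ (j+1+1 = 1) by omega), if_neg (show ¬ (1 = j+1+1) by omega), add_zero, mul_zero]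
      exact hR
  have h5 : (Lam (lam (p/3) k0) ((p+1)/3) (C (-32) + C (-16) * X) : ℚ_[p]) = -32 * lam (p/3) k0 0 - 16 * lam (p/3) k0 1 := by
    have e := Lam_X (lam (p/3) k0 : ℕ → ℚ_[p]) ((p+1)/3) 0
    have e' := Lam_X (lam (p/3) k0 : ℕ → ℚ_[p]) ((p+1)/3) 1
    rw [Lam_add, ← mul_one (C (-32)), ← pow_zero X, ← pow_one X, Lam_C, pow_one, Lam_C, e]
    rw [pow_one] at e'
    rw [e', if_pos (by omega), if_pos (by omega)]; ring
  have h6 : (-32 * lam (p/3) k0 0 - 16 * lam (p/3) k0 1 : ℚ_[p]) = -32 * TT p k0 := by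
    unfold lam TT
    simp only [mul_sum, ← sum_sub_distrib]
    apply sum_congr rfl
    intro k hk; rw [mem_Ico] at hk
    obtain ⟨j, rfl⟩ : ∃ j, k = j+1 := ⟨k-1, by omega⟩
    have hc : ((2*(j+1)).choose (j+1) : ℚ_[p]) = 2 * ((0+2*(j+1)-1).choose (j+1) : ℚ_[p]) := by
      have := Nat.centralBinom_eq_two_mul_choose (j+1)
      have h := Nat.succ_mul_centralBinom_succ j
      have e1 : 2*(j+1) = (2*j+1)+1 := by ring
      rw [e1, Nat.choose_succ_succ, show 0 + (2*j+1+1)-1 = 2*j+1 by omega]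
      have : (2*j+1).choose j = (2*j+1).choose (j+1) := by
        rw [← Nat.choose_symm_of_eq_add]; omega
      rw [this]; push_cast; ring
    have hne : ((0+2*(j+1)-1).choose (j+1) : ℚ_[p]) ≠ 0 := by
      have : (0+2*(j+1)-1).choose (j+1) ≠ 0 := (Nat.choose_pos (by omega)).ne'
      exact_mod_cast this
    have hk0 : ((j+1:ℕ):ℚ_[p]) ≠ 0 := by exact_mod_cast j.succ_ne_zero
    rw [show 1+2*(j+1)-1 = 2*(j+1) by omega]
    unfold ph
    rw [hc]
    field_simp
    ring
  rw [h5, h6] at h4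
  have h7 := (h1.symm.trans h2.symm).trans h4
  have h8 := h7.mul_left (z := 1/54) (by
    have : Un (54:ℚ_[p]) := by
      have := (un2 h3).mul (un27 h3)
      norm_num at this; exact this
    rw [one_div]; exact this.dvi)
  refine Cg.trans (Cg.of_eq ?_) (h8.trans (Cg.of_eq ?_)) <;> ring
end S19

set_option linter.unusedSectionVars false
set_option linter.unusedSimpArgs false
namespace S19
open Finset
/-- harmonic sums -/
def HH {K : Type*} [Field K] (r n : ℕ) : K := ∑ i ∈ range n, 1 / ((i:K)+1)^r
lemma HH_succ {K : Type*} [Field K] (r n : ℕ) : (HH r (n+1) : K) = HH r n + 1/((n:K)+1)^r := by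
  unfold HH; rw [sum_range_succ]
lemma HH_zero {K : Type*} [Field K] (r : ℕ) : (HH r 0 : K) = 0 := by simp [HH]

lemma sum_split_reflect {K : Type*} [AddCommMonoid K] (f : ℕ → K) {n q : ℕ} (h : n < q) :
    ∑ i ∈ range (q-1), f (i+1) = ∑ i ∈ range n, f (i+1) + ∑ i ∈ range (q-1-n), f (q-(i+1)) := by
  obtain ⟨d, rfl⟩ : ∃ d, q = n + d + 1 := ⟨q-n-1, by omega⟩
  rw [show n+d+1-1 = n+d by omega, show n+d-n = d by omega, sum_range_add]
  congr 1
  rw [← sum_range_reflect (fun i => f (n+i+1))]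
  apply sum_congr rfl; intro i hi; have := mem_range.1 hi
  congr 1; omega

variable {p : ℕ} [hp : Fact p.Prime]
lemma un_succ {i n : ℕ} (hi : i < n) (hn : n < p) : Un ((i:ℚ_[p])+1) := by
  have := un_of_lt (p := p) (n := i+1) (by omega) (by omega)
  exact_mod_cast this
lemma dv_HH (r : ℕ) {n : ℕ} (hn : n < p) : Dv 0 (HH r n : ℚ_[p]) := by
  unfold HH; apply Dv.sum; intro i hi
  exact Dv.div Dv.one ((un_succ (mem_range.1 hi) hn).pow r)

lemma cg_inv_sq (h3 : 3 < p) {j : ℕ} (h0 : 0 < j) (hj : j < p) : Cg 1 (1/(j:ℚ_[p])^2) ((j:ℚ_[p])^(p-3)) := by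
  have hu := un_of_lt h0 hj
  have h1 : Cg 1 ((j:ℚ_[p])^(p-1)) 1 := by
    have := cg_zmod (p := p) (a := (j:ℤ)^(p-1)) (b := 1) (by
      push_cast; apply ZMod.pow_card_sub_one_eq_one
      rw [Ne, ZMod.natCast_eq_zero_iff]; exact fun h => by have := Nat.le_of_dvd h0 h; omega)
    push_cast at this; exact this
  have h2 := h1.mul_left (z := 1/(j:ℚ_[p])^2) (Dv.div Dv.one (hu.pow 2))
  rw [mul_one] at h2
  refine h2.symm.trans (Cg.of_eq ?_)
  rw [show p-1 = (p-3)+2 by omega, pow_add]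
  have := hu.ne
  field_simp

/-- power sums vanish -/
lemma power_sum {n : ℕ} (hn : n < p-1) : Cg 1 (∑ j ∈ range p, (j:ℚ_[p])^n) 0 := by
  have h := cg_zmod (p := p) (a := ∑ j ∈ range p, (j:ℤ)^n) (b := 0) (by
    push_cast
    have h1 := FiniteField.sum_pow_lt_card_sub_one (K := ZMod p) n (by rw [ZMod.card]; exact hn)
    rw [← h1]
    have hpos : 0 < p := hp.out.pos
    symm
    have : NeZero p := ⟨hpos.ne'⟩
    refine sum_bij (fun x _ => ZMod.val x) ?_ ?_ ?_ ?_
    · intro a _; exact mem_range.2 (ZMod.val_lt a)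
    · intro a _ b _ hab; exact ZMod.val_injective p hab
    · intro b hb; exact ⟨(b : ZMod p), mem_univ _, ZMod.val_cast_of_lt (mem_range.1 hb)⟩
    · intro a _; rw [ZMod.natCast_zmod_val])
  push_cast at h; exact h

lemma HH2_top (h3 : 3 < p) : Dv 1 (HH 2 (p-1) : ℚ_[p]) := by
  have h := power_sum (p := p) (n := p-3) (by omega)
  rw [sum_range_pred _ (by omega)] at h
  rw [Nat.cast_zero, zero_pow (by omega), add_zero] at h
  unfold HH
  have h2 : Cg 1 (∑ i ∈ range (p-1), 1/((i:ℚ_[p])+1)^2) (∑ i ∈ range (p-1), ((i+1:ℕ):ℚ_[p])^(p-3)) := by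
    apply Cg.sum; intro i hi
    have := cg_inv_sq h3 (j := i+1) (by omega) (by have := mem_range.1 hi; omega)
    push_cast at this ⊢; exact this
  have := h2.trans h
  unfold Cg at this; rwa [sub_zero] at this

lemma cg_refl1 {i n : ℕ} (hi : i < n) (hn : n < p) : Cg 2 (1/(((p-(i+1):ℕ)):ℚ_[p])) (-(1/((i:ℚ_[p])+1)) - (p:ℚ_[p]) * (1/((i:ℚ_[p])+1)^2)) := by
  have hu := un_succ hi hn
  have hu2 : Un ((p-(i+1):ℕ):ℚ_[p]) := un_of_lt (by omega) (by omega)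
  have e : ((p-(i+1):ℕ):ℚ_[p]) = p - (i+1) := by push_cast [Nat.cast_sub (show i+1 ≤ p by omega)]; ring
  unfold Cg
  have := hu.ne; have h2 := hu2.ne
  rw [e] at h2 hu2 ⊢
  have e2 : 1/((p:ℚ_[p])-(i+1)) - (-(1/((i:ℚ_[p])+1)) - p * (1/((i:ℚ_[p])+1)^2)) = p^2 * (1/(((p:ℚ_[p])-(i+1))*((i:ℚ_[p])+1)^2)) := by
    field_simp; ring
  rw [e2]
  exact (Dv.pp 2).mulr (Dv.div Dv.one (hu2.mul (hu.pow 2)))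

lemma HH1_top (h3 : 3 < p) : Dv 2 (HH 1 (p-1) : ℚ_[p]) := by
  have h := sum_split_reflect (fun i => 1/(i:ℚ_[p])) (n := 0) hp.out.pos
  simp only [range_zero, sum_empty, zero_add, Nat.sub_zero] at h
  have h1 : (HH 1 (p-1) : ℚ_[p]) = ∑ i ∈ range (p-1), 1/((i+1:ℕ):ℚ_[p]) := by simp [HH]
  have h2 : Cg 2 (HH 1 (p-1) : ℚ_[p]) (-(HH 1 (p-1)) - (p:ℚ_[p]) * HH 2 (p-1)) := by
    conv_lhs => rw [h1, h]
    unfold HH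
    rw [mul_sum, ← sum_neg_distrib, ← sum_sub_distrib]
    apply Cg.sum; intro i hi; rw [pow_one]
    exact cg_refl1 (n := p-1) (mem_range.1 hi) (by omega)
  have h4 : Dv 2 ((p:ℚ_[p]) * HH 2 (p-1)) := Dv.p1.mul' (HH2_top h3)
  unfold Cg at h2
  apply Dv.of_mul (x := 2) _ (un2 h3)
  have := h2.sub h4
  convert this using 1; ring

lemma HH1_refl (h3 : 3 < p) {n n' : ℕ} (h : n + n' + 1 = p) : Cg 2 (HH 1 n - HH 1 n' : ℚ_[p]) (-(p:ℚ_[p]) * HH 2 n) := by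
  have hs := sum_split_reflect (fun i => 1/(i:ℚ_[p])) (n := n') (q := p) (by omega)
  have h1 : (HH 1 (p-1) : ℚ_[p]) = ∑ i ∈ range (p-1), 1/((i+1:ℕ):ℚ_[p]) := by simp [HH]
  have h1' : (HH 1 n' : ℚ_[p]) = ∑ i ∈ range n', 1/((i+1:ℕ):ℚ_[p]) := by simp [HH]
  rw [show p-1-n' = n by omega, ← h1, ← h1'] at hs
  have h2 : Cg 2 (∑ i ∈ range n, 1/(((p-(i+1):ℕ)):ℚ_[p])) (-(HH 1 n) - (p:ℚ_[p]) * HH 2 n) := by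
    unfold HH
    rw [mul_sum, ← sum_neg_distrib, ← sum_sub_distrib]
    apply Cg.sum; intro i hi; rw [pow_one]
    exact cg_refl1 (n := n) (mem_range.1 hi) (by omega)
  have h4 := HH1_top h3
  rw [hs] at h4
  unfold Cg at *
  have := h4.neg.add h2
  convert this using 1; ring

lemma HH2_refl (h3 : 3 < p) {n n' : ℕ} (h : n + n' + 1 = p) : Cg 1 (HH 2 n' : ℚ_[p]) (-HH 2 n) := by
  have hs := sum_split_reflect (fun i => 1/(i:ℚ_[p])^2) (n := n') (q := p) (by omega)
  have h1 : (HH 2 (p-1) : ℚ_[p]) = ∑ i ∈ range (p-1), 1/((i+1:ℕ):ℚ_[p])^2 := by simp [HH]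
  have h1' : (HH 2 n' : ℚ_[p]) = ∑ i ∈ range n', 1/((i+1:ℕ):ℚ_[p])^2 := by simp [HH]
  rw [show p-1-n' = n by omega, ← h1, ← h1'] at hs
  have h2 : Cg 1 (∑ i ∈ range n, 1/(((p-(i+1):ℕ)):ℚ_[p])^2) (HH 2 n) := by
    unfold HH
    apply Cg.sum; intro i hi
    have hi := mem_range.1 hi
    have hu := un_succ (p := p) hi (by omega)
    have hu2 : Un ((p-(i+1):ℕ):ℚ_[p]) := un_of_lt (by omega) (by omega)
    have e : ((p-(i+1):ℕ):ℚ_[p]) = p - (i+1) := by push_cast [Nat.cast_sub (show i+1 ≤ p by omega)]; ring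
    refine (Cg.refl 1 1).div ?_ Dv.one (hu2.pow 2) (hu.pow 2)
    rw [e]; unfold Cg
    rw [show ((p:ℚ_[p])-(i+1))^2 - ((i:ℚ_[p])+1)^2 = p * (p - 2*((i:ℚ_[p])+1)) by ring]
    exact Dv.p1.mulr ((Dv.nat p).sub ((Dv.ofNat 2).mul hu.dv))
  have h4 := HH2_top h3
  rw [hs] at h4
  unfold Cg at *
  have := h4.sub h2
  convert this using 1; ring

/-- second-order product expansion -/
lemma prod_exp (h3 : 3 < p) {ι : Type*} (s : Finset ι) (f a b : ι → ℚ_[p]) (hf : ∀ i ∈ s, Cg 3 (f i) (1 + (p:ℚ_[p]) * a i + (p:ℚ_[p])^2 * b i))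
    (ha : ∀ i ∈ s, Dv 0 (a i)) (hb : ∀ i ∈ s, Dv 0 (b i)) :
    Cg 3 (∏ i ∈ s, f i) (1 + (p:ℚ_[p]) * ∑ i ∈ s, a i + (p:ℚ_[p])^2 * (∑ i ∈ s, b i + ((∑ i ∈ s, a i)^2 - ∑ i ∈ s, (a i)^2)/2)) := by
  classical
  induction s using Finset.induction_on with
  | empty => simp [Cg, Dv.zero]
  | insert j s hj ih =>
    have ih := ih (fun i hi => hf i (mem_insert_of_mem hi)) (fun i hi => ha i (mem_insert_of_mem hi)) (fun i hi => hb i (mem_insert_of_mem hi))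
    have hA : Dv 0 (∑ i ∈ s, a i) := Dv.sum fun i hi => ha i (mem_insert_of_mem hi)
    have hA2 : Dv 0 (∑ i ∈ s, (a i)^2) := Dv.sum fun i hi => (ha i (mem_insert_of_mem hi)).pow 2
    have hB : Dv 0 (∑ i ∈ s, b i) := Dv.sum fun i hi => hb i (mem_insert_of_mem hi)
    have hj1 := ha j (mem_insert_self _ _); have hj2 := hb j (mem_insert_self _ _)
    rw [prod_insert hj, sum_insert hj, sum_insert hj, sum_insert hj]
    generalize ∑ i ∈ s, a i = A at *
    generalize ∑ i ∈ s, (a i)^2 = A2 at *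
    generalize ∑ i ∈ s, b i = B at *
    have hD : Dv 0 (B + (A^2-A2)/2) := hB.add (Dv.div ((hA.pow 2).sub hA2) (un2 h3))
    have hd1 : Dv 0 (1 + (p:ℚ_[p]) * a j + (p:ℚ_[p])^2 * b j) := (Dv.one.add ((Dv.nat p).mul hj1)).add (((Dv.nat p).pow 2).mul hj2)
    have hd2 : Dv 0 (1 + (p:ℚ_[p]) * A + (p:ℚ_[p])^2 * (B + (A^2-A2)/2)) := (Dv.one.add ((Dv.nat p).mul hA)).add (((Dv.nat p).pow 2).mul hD)
    have hfd : Dv 0 (f j) := (hf j (mem_insert_self _ _)).dv (by omega) hd1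
    have h := (hf j (mem_insert_self _ _)).mul ih hfd hd2
    refine h.trans ?_
    unfold Cg
    have e : (1 + (p:ℚ_[p]) * a j + (p:ℚ_[p])^2 * b j) * (1 + (p:ℚ_[p]) * A + (p:ℚ_[p])^2 * (B + (A^2-A2)/2)) - (1 + (p:ℚ_[p]) * (a j + A) + (p:ℚ_[p])^2 * (b j + B + ((a j + A)^2 - ((a j)^2 + A2))/2))
      = (p:ℚ_[p])^3 * (a j * (B + (A^2-A2)/2) + b j * A + p * (b j * (B + (A^2-A2)/2))) := by
      ring
    rw [e]
    exact (Dv.pp 3).mulr (((hj1.mul hD).add (hj2.mul hA)).add ((Dv.nat p).mul (hj2.mul hD)))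
end S19

set_option linter.unusedSectionVars false
set_option linter.unusedSimpArgs false
namespace S19
open Finset Polynomial

/-- umbral functional `X^n ↦ U_n` -/
noncomputable def EU : ℚ[X] →ₗ[ℚ] ℚ := (Polynomial.basisMonomials ℚ).constr ℚ seqU
lemma EU_X (n : ℕ) : EU (X^n) = seqU n := by
  unfold EU
  have := (Polynomial.basisMonomials ℚ).constr_basis ℚ seqU n
  rw [coe_basisMonomials] at this
  rwa [← monomial_one_right_eq_X_pow]
lemma seqU_succ (n : ℕ) : seqU (n+1) = -2 * ∑ j ∈ Finset.range ((n+1)/2),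
      ((n+1).choose (2*(j+1)) : ℚ) * seqU (n - 1 - 2*j) := by rw [seqU]
lemma seqU_zero : seqU 0 = 1 := by rw [seqU]

lemma sum_even_aux (f : ℕ → ℚ) (n : ℕ) : ∑ k ∈ range (n+1), (1 + (-1)^k) * f k = 2 * ∑ j ∈ range (n/2+1), f (2*j) := by
  induction n with
  | zero => simp; norm_num
  | succ n ih =>
    rw [sum_range_succ, ih]
    rcases Nat.even_or_odd' n with ⟨a, rfl | rfl⟩
    · rw [show (2*a+1)/2 = a by omega, show 2*a/2 = a by omega]
      have : (-1:ℚ)^(2*a+1) = -1 := by rw [pow_succ, pow_mul]; norm_num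
      rw [this]; ring
    · rw [show (2*a+1+1)/2 = a+1 by omega, show (2*a+1)/2 = a by omega, sum_range_succ _ (a+1)]
      have : (-1:ℚ)^(2*a+1+1) = 1 := by rw [show 2*a+1+1 = 2*(a+1) by ring, pow_mul]; norm_num
      rw [this, show 2*(a+1) = 2*a+1+1 by ring]; ring

lemma EU_shift (c : ℚ) (n : ℕ) : EU ((X + C c)^n) = ∑ k ∈ range (n+1), c^k * ((n.choose k : ℚ) * seqU (n-k)) := by
  rw [add_comm, add_pow, map_sum]
  apply sum_congr rfl; intro k _
  rw [show (C c)^k * X^(n-k) * ((n.choose k : ℕ) : ℚ[X]) = (c^k * (n.choose k : ℚ)) • X^(n-k) by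
    rw [smul_eq_C_mul]; simp; ring, map_smul, EU_X, smul_eq_mul, mul_assoc]

lemma EU_mono (n : ℕ) : EU ((X+1)^n) + EU ((X-1)^n) - EU (X^n) = if n = 0 then 1 else 0 := by
  have h1 := EU_shift 1 n
  have h2 := EU_shift (-1) n
  rw [map_one] at h1
  rw [map_neg, map_one, ← sub_eq_add_neg] at h2
  rw [h1, h2, ← sum_add_distrib]
  simp_rw [← add_mul, one_pow]
  rw [sum_even_aux (fun k => (n.choose k : ℚ) * seqU (n-k)), EU_X]
  cases n with
  | zero => simp [seqU_zero]; norm_num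
  | succ n =>
    rw [sum_range_succ', seqU_succ, if_neg (by omega)]
    simp only [mul_zero, Nat.sub_zero, Nat.choose_zero_right, Nat.cast_one, one_mul]
    have : ∀ j, n + 1 - 2*(j+1) = n - 1 - 2*j := by intro j; omega
    simp_rw [this]
    conv_lhs => rw [seqU_succ]
    ring

lemma EU_func (q : ℚ[X]) : EU (q.comp (X+1)) - EU q + EU (q.comp (X-1)) = q.eval 0 := by
  induction q using Polynomial.induction_on' with
  | add q r hq hr => simp only [add_comp, map_add, eval_add]; rw [← hq, ← hr]; ring
  | monomial n a =>
    have h := EU_mono n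
    rw [← C_mul_X_pow_eq_monomial]
    simp only [mul_comp, C_comp, X_pow_comp]
    simp only [← smul_eq_C_mul, map_smul]
    rw [eval_smul, eval_pow, eval_X]
    simp only [smul_eq_mul]
    rw [zero_pow_eq, ← h]; ring

/-- Appell polynomial values -/
noncomputable def WU (n : ℕ) (y : ℚ) : ℚ := EU ((X + C y)^n)
lemma WU_rec (n : ℕ) (y : ℚ) : WU n (y+1) - WU n y + WU n (y-1) = y^n := by
  have h := EU_func ((X + C y)^n)
  simp only [pow_comp, add_comp, X_comp, C_comp, eval_pow, eval_add, eval_X, eval_C, zero_add] at h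
  rw [← h]; unfold WU
  rw [show (X + C (y+1) : ℚ[X]) = X + 1 + C y by rw [map_add, map_one]; ring,
    show (X + C (y-1) : ℚ[X]) = X - 1 + C y by rw [map_sub, map_one]; ring]
lemma WU_rec3 (n : ℕ) (y : ℚ) : WU n (y+3) = -WU n y + ((y+1)^n + (y+2)^n) := by
  have h1 := WU_rec n (y+1)
  have h2 := WU_rec n (y+2)
  rw [show y+1+1 = y+2 by ring, show y+1-1=y by ring] at h1
  rw [show y+2+1 = y+3 by ring, show y+2-1=y+1 by ring] at h2
  linarith
lemma WU_iter (n : ℕ) (r : ℚ) (M : ℕ) : (-1)^M * WU n (r+3*M) = WU n r - ∑ j ∈ range M, (-1)^j * ((r+3*j+1)^n + (r+3*j+2)^n) := by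
  induction M with
  | zero => simp
  | succ M ih =>
    rw [sum_range_succ, ← sub_sub, ← ih, Nat.cast_succ, show r + 3*((M:ℚ)+1) = r+3*M+3 by ring, WU_rec3]
    ring
lemma WU_zero (n : ℕ) : WU n 0 = seqU n := by unfold WU; simp [EU_X]
lemma seqU_odd (n : ℕ) : seqU (2*n+1) = 0 := by
  induction n using Nat.strong_induction_on with
  | _ n ih =>
    rw [seqU_succ, sum_eq_zero]
    · simp
    intro j hj; have := mem_range.1 hj
    rw [show 2*n-1-2*j = 2*(n-1-j)+1 by omega, ih _ (by omega), mul_zero]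
lemma WU_one {n : ℕ} (hn : 0 < n) (he : Even n) : WU n 1 = seqU n / 2 := by
  have h := EU_mono n
  rw [if_neg (by omega), EU_X] at h
  have h1 : EU ((X+1)^n) = WU n 1 := by unfold WU; rw [map_one]
  have h2 : EU ((X-1)^n) = WU n 1 := by
    have e1 := EU_shift 1 n
    have e2 := EU_shift (-1) n
    rw [map_neg, map_one, ← sub_eq_add_neg] at e2
    unfold WU; rw [e2, e1]
    apply sum_congr rfl; intro k hk; have := mem_range.1 hk
    obtain ⟨a, ha⟩ := he
    rcases Nat.even_or_odd' k with ⟨b, rfl | rfl⟩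
    · rw [pow_mul]; norm_num
    · rw [show n - (2*b+1) = 2*(a-b-1)+1 by omega, seqU_odd]; simp
  rw [h1, h2] at h; linarith

lemma seqU_int (n : ℕ) : ∃ z : ℤ, seqU n = z := by
  induction n using Nat.strong_induction_on with
  | _ n ih =>
    cases n with
    | zero => exact ⟨1, by simp [seqU_zero]⟩
    | succ n =>
      rw [seqU_succ]
      have h : ∀ j, j < (n+1)/2 → ∃ z : ℤ, seqU (n-1-2*j) = z := fun j hj => ih _ (by omega)
      choose! z hz using h
      refine ⟨-2 * ∑ j ∈ range ((n+1)/2), ((n+1).choose (2*(j+1)) : ℤ) * z j, ?_⟩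
      push_cast; congr 1
      apply sum_congr rfl; intro j hj; rw [hz j (mem_range.1 hj)]

variable {p : ℕ} [hp : Fact p.Prime]
lemma dv_seqU (n : ℕ) : Dv 0 ((seqU n : ℚ) : ℚ_[p]) := by
  obtain ⟨z, hz⟩ := seqU_int n
  rw [hz, Rat.cast_intCast]; exact Dv.int z
lemma WU_p (n : ℕ) : Cg 1 ((WU n p : ℚ) : ℚ_[p]) ((seqU n : ℚ) : ℚ_[p]) := by
  unfold WU; rw [EU_shift, sum_range_succ']
  push_cast
  simp only [pow_zero, Nat.choose_zero_right, Nat.cast_one, one_mul, Nat.sub_zero]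
  unfold Cg; rw [add_sub_cancel_right]
  apply Dv.sum; intro k _
  rw [pow_succ, mul_assoc]
  exact ((Dv.nat p).pow k).mul (Dv.p1.mulr ((Dv.nat _).mul (dv_seqU _)))

/-- antisymmetric alternating sum vanishes -/
lemma alt_anti (h3 : 3 < p) {n N r : ℕ} (he : Even n) (hN : Even N) (h : 2*r + 3*N = p + 3) :
    Cg 1 (∑ j ∈ range N, (-1:ℚ_[p])^j * ((r:ℚ_[p]) + 3*(j:ℚ_[p]))^n) 0 := by
  have h1 : Cg 1 (∑ j ∈ range N, (-1:ℚ_[p])^j * ((r:ℚ_[p]) + 3*(j:ℚ_[p]))^n) (-∑ j ∈ range N, (-1:ℚ_[p])^j * ((r:ℚ_[p]) + 3*(j:ℚ_[p]))^n) := by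
    conv_lhs => rw [← sum_range_reflect]
    rw [← sum_neg_distrib]
    apply Cg.sum; intro j hj; have hj := mem_range.1 hj
    obtain ⟨a, ha⟩ := hN
    have hs : (-1:ℚ_[p])^(N-1-j) = -(-1)^j := by
      have : (-1:ℚ_[p])^(N-1-j) * (-1)^(j+1) = 1 := by
        rw [← pow_add, show N-1-j+(j+1) = 2*a by omega, pow_mul]; norm_num
      have h2 : (-1:ℚ_[p])^j * (-1)^j = 1 := by rw [← pow_add, ← two_mul, pow_mul]; norm_num
      rw [pow_succ] at this
      linear_combination (-(-1:ℚ_[p])^j) * this + (-(-1:ℚ_[p])^(N-1-j)) * h2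
    rw [hs, ← neg_mul]
    apply Cg.mul_left _ (((Dv.one.neg).pow j).neg)
    have hd : Dv 0 ((r:ℚ_[p]) + 3*(j:ℚ_[p])) := (Dv.nat r).add ((Dv.ofNat 3).mul (Dv.nat j))
    have : (((r:ℚ_[p])+3*(j:ℚ_[p])))^n = (-((r:ℚ_[p])+3*(j:ℚ_[p])))^n := by rw [he.neg_pow]
    rw [this]
    refine Cg.pow ?_ hd.neg n
    have e : ((N-1-j:ℕ):ℚ_[p]) = N - 1 - j := by rw [Nat.cast_sub (by omega), Nat.cast_sub (by omega)]; simp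
    have hc : (2*(r:ℚ_[p]) + 3*N) = p + 3 := by exact_mod_cast h
    unfold Cg; rw [e, show (r:ℚ_[p]) + 3*(N-1-j) - -(r+3*j) = p by linear_combination hc]
    exact Dv.p1
  unfold Cg at *; rw [sub_zero]
  apply Dv.of_mul (x := 2) _ (un2 h3)
  convert h1 using 1; ring

/-- odd part of the sum of inverse squares -/
def OO {K : Type*} [Field K] (n : ℕ) : K := ∑ l ∈ range n, 1 / (2*(l:K)+1)^2
lemma OO_succ {K : Type*} [Field K] (n : ℕ) : (OO (n+1) : K) = OO n + 1/(2*(n:K)+1)^2 := by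
  unfold OO; rw [sum_range_succ]
lemma HH_even (a : ℕ) : (HH 2 (2*a) : ℚ_[p]) = OO a + 1/4 * HH 2 a := by
  induction a with
  | zero => simp [HH, OO]
  | succ a ih =>
    rw [show 2*(a+1) = 2*a+1+1 by ring, HH_succ, HH_succ, HH_succ, OO_succ, ih]
    have : ((a:ℚ_[p])+1) ≠ 0 := by exact_mod_cast Nat.succ_ne_zero a
    have h2 : (2*(a:ℚ_[p])+1) ≠ 0 := by exact_mod_cast Nat.succ_ne_zero (2*a)
    have h3 : (2*(a:ℚ_[p])+1+1) ≠ 0 := by exact_mod_cast Nat.succ_ne_zero (2*a+1)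
    push_cast
    rw [show (2*(a:ℚ_[p])+1+1) = 2*((a:ℚ_[p])+1) by ring]
    field_simp; ring
lemma HH_odd (a : ℕ) : (HH 2 (2*a+1) : ℚ_[p]) = OO (a+1) + 1/4 * HH 2 a := by
  rw [HH_succ, HH_even, OO_succ]; push_cast; ring
noncomputable def AA (n : ℕ) : ℚ_[p] := ∑ j ∈ range n, (-1)^j / ((j:ℚ_[p])+1)^2
lemma AA_even (a : ℕ) : (AA (2*a) : ℚ_[p]) = OO a - 1/4 * HH 2 a := by
  unfold AA
  induction a with
  | zero => simp [HH, OO]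
  | succ a ih =>
    rw [show 2*(a+1) = 2*a+1+1 by ring, sum_range_succ, sum_range_succ, HH_succ, OO_succ, ih]
    have : ((a:ℚ_[p])+1) ≠ 0 := by exact_mod_cast Nat.succ_ne_zero a
    have h2 : (2*(a:ℚ_[p])+1) ≠ 0 := by exact_mod_cast Nat.succ_ne_zero (2*a)
    have h3 : (-1:ℚ_[p])^(2*a) = 1 := by rw [pow_mul]; norm_num
    have h4 : (-1:ℚ_[p])^(2*a+1) = -1 := by rw [pow_succ, h3]; ring
    rw [h4, h3]
    push_cast
    rw [show (2*(a:ℚ_[p])+1+1) = 2*((a:ℚ_[p])+1) by ring]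
    field_simp; ring
lemma AA_odd (a : ℕ) : (AA (2*a+1) : ℚ_[p]) = OO (a+1) - 1/4 * HH 2 a := by
  have h3 : (-1:ℚ_[p])^(2*a) = 1 := by rw [pow_mul]; norm_num
  have := AA_even (p := p) a
  unfold AA at *
  rw [sum_range_succ, this, OO_succ, h3]; push_cast; ring
end S19

set_option linter.unusedSectionVars false
set_option linter.unusedSimpArgs false
namespace S19
open Finset Polynomial
variable {p : ℕ} [hp : Fact p.Prime]

lemma cgd {r : ℕ} {x y z : ℚ_[p]} (h : Dv r z) (e : x - y = z) : Cg r x y := by unfold Cg; rwa [e]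
/-- shape of a prime: `m = ⌊p/3⌋`, `e = (p/3)`. -/
def Shp (p q m : ℕ) (e : ℚ) : Prop := (p = 6*q+1 ∧ m = 2*q ∧ e = 1) ∨ (p+1 = 6*q ∧ m+1 = 2*q ∧ e = -1)
lemma Shp.ex (h3 : 3 < p) : ∃ q m e, Shp p q m e := by
  have h2 : ¬ 2 ∣ p := fun h => by
    have := (Nat.prime_dvd_prime_iff_eq Nat.prime_two hp.out).1 h; omega
  have h3' : ¬ 3 ∣ p := fun h => by
    have := (Nat.prime_dvd_prime_iff_eq Nat.prime_three hp.out).1 h; omega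
  by_cases h : p % 6 = 1
  · exact ⟨p/6, p/3, 1, Or.inl ⟨by omega, by omega, rfl⟩⟩
  · have h5 : p % 6 = 5 := by
      have a := Nat.mod_lt p (show 0 < 6 by norm_num)
      have b1 : p % 3 = p % 6 % 3 := by omega
      have b2 : p % 2 = p % 6 % 2 := by omega
      interval_cases hh : p % 6 <;> omega
    exact ⟨(p+1)/6, p/3, -1, Or.inr ⟨by omega, by omega, rfl⟩⟩

lemma un4 (h3 : 3 < p) : Un (4:ℚ_[p]) := by
  have := (un2 (p := p) h3).mul (un2 h3); norm_num at this; exact this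
lemma dv_OO (h3 : 3 < p) {n : ℕ} (hn : 2*n ≤ p) : Dv 0 (OO n : ℚ_[p]) := by
  unfold OO; apply Dv.sum; intro l hl; have := mem_range.1 hl
  have := un_of_lt (p := p) (n := 2*l+1) (by omega) (by omega)
  push_cast at this
  exact Dv.div Dv.one (this.pow 2)

/-- the half sum vanishes, and odd part reflects -/
lemma OO_refl (h3 : 3 < p) {q m : ℕ} {e : ℚ} (h : Shp p q m e) : Cg 1 (OO (2*q) : ℚ_[p]) (-(1/4) * HH 2 (m/2)) := by
  obtain ⟨k0, hk0⟩ : ∃ k0, 2*k0+1 = p := ⟨(p-1)/2, by unfold Shp at h; omega⟩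
  have hh := HH2_refl h3 (n := k0) (n' := k0) (by omega)
  have h0 : Dv 1 (HH 2 k0 : ℚ_[p]) := by
    apply Dv.of_mul (x := 2) _ (un2 h3)
    unfold Cg at hh; convert hh using 1; ring
  have hsplit : (HH 2 k0 : ℚ_[p]) = HH 2 (m/2) + ∑ l ∈ range (2*q), 1/((k0-l:ℕ):ℚ_[p])^2 := by
    have e1 : k0 = m/2 + 2*q := by unfold Shp at h; omega
    conv_lhs => rw [HH, e1, sum_range_add]
    congr 1
    rw [← sum_range_reflect]
    apply sum_congr rfl; intro l hl; have := mem_range.1 hl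
    rw [show k0 - l = m/2 + (2*q-1-l) + 1 by omega]; push_cast; ring
  have hc : Cg 1 (OO (2*q) : ℚ_[p]) (1/4 * ∑ l ∈ range (2*q), 1/((k0-l:ℕ):ℚ_[p])^2) := by
    unfold OO; rw [mul_sum]; apply Cg.sum; intro l hl; have hl := mem_range.1 hl
    have hlk : l < k0 := by unfold Shp at h; omega
    have hu1 := un_of_lt (p := p) (n := 2*l+1) (by omega) (by omega)
    have hu2 := un_of_lt (p := p) (n := k0-l) (by omega) (by omega)
    rw [show 1/4 * (1/((k0-l:ℕ):ℚ_[p])^2) = 1/(2*((k0-l:ℕ):ℚ_[p]))^2 by have := hu2.ne; field_simp; ring]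
    push_cast at hu1
    refine (Cg.refl 1 1).div ?_ Dv.one (hu1.pow 2) (((un2 h3).mul hu2).pow 2)
    have ec : (p:ℚ_[p]) = 2*k0+1 := by exact_mod_cast hk0.symm
    have ek : ((k0-l:ℕ):ℚ_[p]) = k0 - l := by rw [Nat.cast_sub (by omega)]
    unfold Cg
    rw [ek, show (2*(l:ℚ_[p])+1)^2 - (2*((k0:ℚ_[p])-l))^2 = p*(2*(l:ℚ_[p])+1 - 2*((k0:ℚ_[p])-l)) by rw [ec]; ring]
    exact Dv.p1.mulr (hu1.dv.sub ((Dv.ofNat 2).mul ((Dv.nat _).sub (Dv.nat _))))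
  rw [hsplit] at h0
  unfold Cg at *
  have h4 : Dv 0 (1/4 : ℚ_[p]) := Dv.div Dv.one (un4 h3)
  have := hc.add (h4.mul h0)
  convert this using 1; ring

lemma OO_H2 (h3 : 3 < p) {q m : ℕ} {e : ℚ} (h : Shp p q m e) : Cg 1 (OO q : ℚ_[p]) (-(1/4) * HH 2 m) ∧
    Cg 1 (AA m : ℚ_[p]) (-(3/2) * HH 2 m) := by
  have h1 := OO_refl h3 h
  have hm := HH2_refl h3 (n := m) (n' := p-1-m) (by unfold Shp at h; omega)
  have e1 : (HH 2 (p-1-m) : ℚ_[p]) = OO (2*q) + 1/4 * HH 2 m := by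
    rcases h with ⟨a, b, _⟩ | ⟨a, b, _⟩
    · rw [show p-1-m = 2*(2*q) by omega, HH_even, show 2*q = m by omega]
    · rw [show p-1-m = 2*(2*q-1)+1 by omega, HH_odd, show 2*q-1+1 = 2*q by omega, show 2*q-1=m by omega]
  have e2 : (HH 2 m : ℚ_[p]) = OO q + 1/4 * HH 2 (m/2) := by
    rcases h with ⟨a, b, _⟩ | ⟨a, b, _⟩
    · rw [show m/2 = q by omega, ← HH_even, show 2*q = m by omega]
    · rw [show m/2 = q-1 by omega, show OO q = (OO (q-1+1) : ℚ_[p]) by rw [show q-1+1=q by omega], ← HH_odd, show 2*(q-1)+1 = m by omega]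
  have e3 : (AA m : ℚ_[p]) = OO q - 1/4 * HH 2 (m/2) := by
    rcases h with ⟨a, b, _⟩ | ⟨a, b, _⟩
    · rw [show m/2 = q by omega, ← AA_even, show 2*q = m by omega]
    · rw [show m/2 = q-1 by omega, show OO q = (OO (q-1+1) : ℚ_[p]) by rw [show q-1+1=q by omega], ← AA_odd, show 2*(q-1)+1 = m by omega]
  have h5 : Cg 1 (HH 2 (m/2) : ℚ_[p]) (5 * HH 2 m) := by
    rw [e1] at hm
    unfold Cg at *
    have := ((Dv.ofNat 4).mul (h1.sub hm))
    convert this using 1; ring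
  have h4 : Dv 0 (1/4 : ℚ_[p]) := Dv.div Dv.one (un4 h3)
  constructor
  · have h6 := h4.mul h5.neg
    exact cgd h6 (by linear_combination -e2)
  · have h6 := (Dv.ofNat 2).mul (h4.mul h5.neg)
    exact cgd h6 (by linear_combination e3 - e2)

/-- alternating power sums -/
lemma alt_AA (h3 : 3 < p) {m : ℕ} (hm : 3*m < p) : Cg 1 (∑ j ∈ range m, (-1:ℚ_[p])^j * ((3:ℚ_[p]) + 3*(j:ℚ_[p]))^(p-3)) (1/9 * AA m) := by
  unfold AA; rw [mul_sum]; apply Cg.sum; intro j hj; have := mem_range.1 hj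
  have h := (cg_inv_sq h3 (j := 3*(j+1)) (by omega) (by omega)).symm
  have hu := un_of_lt (p := p) (n := j+1) (by omega) (by omega)
  have h2 := h.mul_left (z := (-1:ℚ_[p])^j) ((Dv.one.neg).pow j)
  push_cast at h2 hu
  have := hu.ne
  rw [show (3:ℚ_[p]) + 3*(j:ℚ_[p]) = 3*((j:ℚ_[p])+1) by ring]
  refine h2.trans (Cg.of_eq ?_)
  field_simp; norm_num

lemma U_H2 (h3 : 3 < p) {q m : ℕ} {e : ℚ} (h : Shp p q m e) : Cg 1 ((seqU (p-3) : ℚ) : ℚ_[p]) (1/3 * (e:ℚ_[p]) * HH 2 m) := by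
  have hA := (OO_H2 h3 h).2
  have hn : 0 < p-3 := by omega
  have he : Even (p-3) := by
    rcases h with ⟨a, b, _⟩ | ⟨a, b, _⟩
    · exact ⟨3*q-1, by omega⟩
    · exact ⟨3*q-2, by omega⟩
  have hW1 := WU_one hn he
  have hWp := WU_p (p := p) (p-3)
  have hAA := alt_AA h3 (m := m) (by unfold Shp at h; omega)
  set n := p-3 with hnd
  rcases h with ⟨a, b, rfl⟩ | ⟨a, b, rfl⟩
  · have hit := WU_iter n 1 m
    have hm1 : (-1:ℚ)^m = 1 := by rw [b, pow_mul]; norm_num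
    rw [hm1, one_mul, show (1:ℚ) + 3*m = p by rw [b, a]; push_cast; ring, hW1] at hit
    have han := alt_anti h3 (n := n) (N := m) (r := 2) he ⟨q, by omega⟩ (by omega)
    have hit2 : ((WU n p : ℚ) : ℚ_[p]) = (seqU n : ℚ)/2 - ((∑ j ∈ range m, (-1:ℚ_[p])^j * (((2:ℕ):ℚ_[p]) + 3*(j:ℚ_[p]))^n) + ∑ j ∈ range m, (-1:ℚ_[p])^j * ((3:ℚ_[p]) + 3*(j:ℚ_[p]))^n) := by
      rw [hit]; push_cast; rw [← sum_add_distrib]; congr 1; apply sum_congr rfl; intro j _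
      rw [show (1:ℚ_[p])+3*j+1 = 2+3*j by ring, show (1:ℚ_[p])+3*j+2 = 3+3*j by ring]; ring
    rw [hit2] at hWp
    generalize (seqU n : ℚ_[p]) = U at *
    have := ((Dv.ofNat 2).mul ((hWp.add han).add hAA)).neg
    have h9 : Dv 0 (2/9 : ℚ_[p]) := (Dv.ofNat 2).div (un9 h3)
    have := this.sub (h9.mul hA)
    exact cgd this (by push_cast; ring)
  · have hit := WU_iter n 2 m
    have hW2 := WU_rec n 1
    rw [show (1:ℚ)+1 = 2 by norm_num, sub_self, WU_zero, hW1, one_pow] at hW2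
    have hm1 : (-1:ℚ)^m = -1 := by rw [show m = 2*(q-1)+1 by omega, pow_succ, pow_mul]; norm_num
    have ec : (2:ℚ) + 3*m = p := by
      have : 2 + 3*m = p := by omega
      exact_mod_cast this
    rw [hm1, ec, show WU n 2 = 1 - seqU n / 2 by linarith] at hit
    have han := alt_anti h3 (n := n) (N := m+1) (r := 1) he ⟨q, by omega⟩ (by omega)
    have hit2 : -((WU n p : ℚ) : ℚ_[p]) = 1 - (seqU n : ℚ)/2 - (1 - (∑ j ∈ range (m+1), (-1:ℚ_[p])^j * (((1:ℕ):ℚ_[p]) + 3*(j:ℚ_[p]))^n) + ∑ j ∈ range m, (-1:ℚ_[p])^j * ((3:ℚ_[p]) + 3*(j:ℚ_[p]))^n) := by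
      have : (WU n p) = -(1 - seqU n / 2 - ∑ j ∈ range m, (-1)^j * ((2+3*(j:ℚ)+1)^n + (2+3*j+2)^n)) := by linarith
      rw [this]; push_cast
      rw [sum_range_succ']
      have e2 : ∑ j ∈ range m, (-1:ℚ_[p])^j * ((2+3*(j:ℚ_[p])+1)^n + (2+3*j+2)^n) = -(∑ j ∈ range m, (-1:ℚ_[p])^(j+1) * (1 + 3*((j+1:ℕ):ℚ_[p]))^n) + ∑ j ∈ range m, (-1:ℚ_[p])^j * ((3:ℚ_[p]) + 3*(j:ℚ_[p]))^n := by
        rw [← sum_neg_distrib, ← sum_add_distrib]; apply sum_congr rfl; intro j _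
        push_cast
        rw [show (2:ℚ_[p])+3*j+1 = 3+3*j by ring, show (2:ℚ_[p])+3*j+2 = 1+3*(j+1) by ring]; ring
      rw [e2]; push_cast; simp
    have hWp := hWp.neg
    rw [hit2] at hWp
    generalize (seqU n : ℚ_[p]) = U at *
    have := ((Dv.ofNat 2).mul ((hWp.sub han).add hAA))
    have h9 : Dv 0 (2/9 : ℚ_[p]) := (Dv.ofNat 2).div (un9 h3)
    have := this.add (h9.mul hA)
    exact cgd this (by push_cast; ring)
end S19

set_option linter.unusedSectionVars false
set_option linter.unusedSimpArgs false
namespace S19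
open Finset Polynomial
variable {p : ℕ} [hp : Fact p.Prime]

section ident
variable {K : Type*} [Field K] [CharZero K]
noncomputable def pt (q : K) (i : ℕ) : K := ∏ j ∈ range i, ((j:K)-q)*((j:K)+q+1)
noncomputable def pd (i : ℕ) : K := ∏ j ∈ range i, ((j:K)+3/2)^2
noncomputable def pf (q : K) (i : ℕ) : K := ∏ j ∈ range i, (((j:K)+1)^2-q^2)
lemma pf1 (q : K) (i : ℕ) : (q+1) * pf (q+1) i = (q+i+1) * pt q i := by
  unfold pf pt
  induction i with
  | zero => simp
  | succ i ih => rw [prod_range_succ, ← mul_assoc, ih, prod_range_succ]; push_cast; ring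
lemma pf2 (q : K) (i : ℕ) : q * pf q i = (q-i) * pt q i := by
  unfold pf pt
  induction i with
  | zero => simp
  | succ i ih => rw [prod_range_succ, ← mul_assoc, ih, prod_range_succ]; push_cast; ring
lemma half_ne (j : ℕ) : ((j:K)+1/2) ≠ 0 := by
  intro h
  have : ((2*j+1:ℕ):K) = 0 := by push_cast; linear_combination 2*h
  rw [Nat.cast_eq_zero] at this; omega
lemma half3_ne (j : ℕ) : ((j:K)+3/2) ≠ 0 := by
  have := half_ne (K := K) (j+1); push_cast at this
  rwa [show (j:K)+1+1/2 = j+3/2 by ring] at this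
lemma odd_ne (j : ℕ) : (2*(j:K)+1) ≠ 0 := by
  exact_mod_cast (Nat.succ_ne_zero (2*j))
lemma pd_ne (i : ℕ) : (pd i : K) ≠ 0 := prod_ne_zero_iff.2 fun j _ => pow_ne_zero 2 (half3_ne j)
lemma sum_pt (q : K) (N : ℕ) : (q+1/2)^2 * ∑ i ∈ range N, pt q i / pd i = 1/4 - ((N:K)+1/2)^2 * (pt q N / pd N) := by
  induction N with
  | zero => simp [pt, pd]; norm_num
  | succ N ih =>
    rw [sum_range_succ, mul_add, ih]
    have h1 : pt q (N+1) = pt q N * (((N:K)-q)*((N:K)+q+1)) := by unfold pt; rw [prod_range_succ]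
    have h2 : (pd (N+1) : K) = pd N * ((N:K)+3/2)^2 := by unfold pd; rw [prod_range_succ]
    rw [h1, h2]
    have := pd_ne (K := K) N; have h3 := half3_ne (K := K) N
    push_cast
    rw [show (N:K)+1+1/2 = N+3/2 by ring, ← mul_div_assoc (((N:K)+3/2)^2), mul_comm (pd N), mul_div_mul_left _ _ (pow_ne_zero 2 h3)]
    ring
lemma sumF (q : ℕ) : (q:K) * ∑ i ∈ range q, pf (q:K) i / (pd i * (2*(i:K)+1)) = OO q := by
  induction q with
  | zero => simp [OO]
  | succ q ih =>
    have hz : (q:K) * (pf (q:K) q / (pd q * (2*(q:K)+1))) = 0 := by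
      rw [← mul_div_assoc, pf2]; simp
    have e : (q:K) * ∑ i ∈ range (q+1), pf (q:K) i / (pd i * (2*(i:K)+1)) = OO q := by
      rw [sum_range_succ, mul_add, hz, ih, add_zero]
    have h := sum_pt (q:K) (q+1)
    have hz2 : pt (q:K) (q+1) = 0 := by unfold pt; rw [prod_range_succ]; simp
    rw [hz2, zero_div, mul_zero, sub_zero] at h
    have hd : ((q+1:ℕ):K) * ∑ i ∈ range (q+1), pf ((q+1:ℕ):K) i / (pd i * (2*(i:K)+1)) - (q:K) * ∑ i ∈ range (q+1), pf (q:K) i / (pd i * (2*(i:K)+1)) = ∑ i ∈ range (q+1), pt (q:K) i / pd i := by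
      rw [mul_sum, mul_sum, ← sum_sub_distrib]
      apply sum_congr rfl; intro i _
      push_cast
      rw [← mul_div_assoc, ← mul_div_assoc, pf1, pf2]
      have h1 := pd_ne (K := K) i; have h2 := odd_ne (K := K) i
      rw [← sub_div, div_eq_div_iff (mul_ne_zero h1 h2) h1]; ring
    rw [e] at hd
    rw [OO_succ, ← sub_eq_iff_eq_add', hd]
    have h2 := odd_ne (K := K) q
    field_simp
    linear_combination 4*h
end ident

lemma un_half (h3 : 3 < p) {j : ℕ} (h : 2*j+1 < p) : Un ((j:ℚ_[p])+1/2) := by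
  have h1 := (un_of_lt (p := p) (n := 2*j+1) (by omega) h).div (un2 h3)
  push_cast at h1
  rwa [show (2*(j:ℚ_[p])+1)/2 = j+1/2 by ring] at h1

lemma cc_ratio (h3 : 3 < p) {q m k0 : ℕ} {e : ℚ} (h : Shp p q m e) (hk0 : 2*k0+1 = p) {i : ℕ} (hi : i < q) :
    Cg 1 (cc k0 / cc (k0-i) : ℚ_[p]) (∏ j ∈ range i, (((j:ℚ_[p])+1)^2-(q:ℚ_[p])^2)/((j:ℚ_[p])+1/2)^2) := by
  have ec : (p:ℚ_[p]) = 2*k0+1 := by exact_mod_cast hk0.symm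
  have hqk : q ≤ k0 := by unfold Shp at h; omega
  have hun : ∀ j, j < q → Un ((j:ℚ_[p])+1/2) := fun j hj => un_half h3 (by unfold Shp at h; omega)
  have hd2 : Dv 0 (1/2 : ℚ_[p]) := Dv.div Dv.one (un2 h3)
  have h36 : Cg 1 ((q:ℚ_[p])^2) (1/36) := by
    have h36u : Un (36:ℚ_[p]) := by have := (un4 (p:=p) h3).mul (un9 h3); norm_num at this; exact this
    rcases h with ⟨a, b, _⟩ | ⟨a, b, _⟩
    · have ea : (p:ℚ_[p]) = 6*q+1 := by exact_mod_cast a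
      refine cgd (Dv.div ((Dv.p1 (p := p)).mulr (((Dv.ofNat 6).mul (Dv.nat q)).sub Dv.one)) h36u) ?_
      rw [ea]; norm_num; ring
    · have ea : (p:ℚ_[p]) = 6*q-1 := by rw [eq_sub_iff_add_eq]; exact_mod_cast a
      refine cgd (Dv.div ((Dv.p1 (p := p)).mulr (((Dv.ofNat 6).mul (Dv.nat q)).add Dv.one)) h36u) ?_
      rw [ea]; norm_num; ring
  induction i with
  | zero => simp [div_self (cc_ne (K := ℚ_[p]) k0), Cg.refl]
  | succ i ih =>
    have ih := ih (by omega)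
    rw [prod_range_succ]
    have hcc := cc_succ (K := ℚ_[p]) (k0-(i+1))
    rw [show k0-(i+1)+1 = k0-i by omega] at hcc
    have ek : ((k0-(i+1):ℕ):ℚ_[p]) = k0 - i - 1 := by rw [Nat.cast_sub (by omega)]; push_cast; ring
    rw [ek] at hcc
    have hn1 := cc_ne (K := ℚ_[p]) (k0-(i+1)); have hn2 := cc_ne (K := ℚ_[p]) (k0-i)
    have huk : Un ((k0:ℚ_[p]) - (i:ℚ_[p])) := by
      have := un_of_lt (p := p) (n := k0-i) (by omega) (by omega)
      rwa [Nat.cast_sub (by omega)] at this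
    have er : (cc k0 / cc (k0-(i+1)) : ℚ_[p]) = cc k0 / cc (k0-i) * ((((k0:ℚ_[p]) - (i:ℚ_[p]))-2/3)*(((k0:ℚ_[p]) - (i:ℚ_[p]))-1/3)/((k0:ℚ_[p]) - (i:ℚ_[p]))^2) := by
      have := huk.ne
      rw [div_mul_div_comm, div_eq_div_iff hn1 (mul_ne_zero hn2 (pow_ne_zero 2 this))]
      linear_combination (cc k0) * hcc
    rw [er]
    have hgd : ∀ j ∈ range i, Dv 0 ((((j:ℚ_[p])+1)^2-(q:ℚ_[p])^2)/((j:ℚ_[p])+1/2)^2) := by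
      intro j hj; have := mem_range.1 hj
      exact Dv.div (((((Dv.nat j).add Dv.one)).pow 2).sub ((Dv.nat q).pow 2)) ((hun j (by omega)).pow 2)
    have hk : Cg 1 ((k0:ℚ_[p]) - (i:ℚ_[p])) (-((i:ℚ_[p])+1/2)) := by
      refine cgd (Dv.p1.mulr hd2) ?_
      rw [ec]; ring
    have hun0 := hun i (by omega)
    have h13 : Dv 0 (1/3:ℚ_[p]) := Dv.div Dv.one (un3 h3)
    have h23 : Dv 0 (2/3:ℚ_[p]) := Dv.div (Dv.ofNat 2) (un3 h3)
    refine ih.mul ?_ (ih.dv (by omega) (Dv.prod hgd)) (Dv.div (((((Dv.nat i).add Dv.one)).pow 2).sub ((Dv.nat q).pow 2)) (hun0.pow 2))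
    have hden : Cg 1 (((k0:ℚ_[p]) - (i:ℚ_[p]))^2) (((i:ℚ_[p])+1/2)^2) := by
      have := hk.pow hun0.dv.neg 2; rwa [neg_sq] at this
    refine Cg.div ?_ hden ((huk.dv.sub h23).mul (huk.dv.sub h13)) (huk.pow 2) (hun0.pow 2)
    have h1 := (hk.sub (Cg.refl 1 (2/3))).mul (hk.sub (Cg.refl 1 (1/3))) (huk.dv.sub h23) (hun0.dv.neg.sub h13)
    refine h1.trans ?_
    have := h36.symm
    exact cgd this.neg (by ring)

/-- Step 5 -/
lemma TT_H2 (h3 : 3 < p) {q m k0 : ℕ} {e : ℚ} (h : Shp p q m e) (hk0 : 2*k0+1 = p) :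
    Cg 1 (TT p k0 : ℚ_[p]) (-12 * (e:ℚ_[p]) * HH 2 m) := by
  have ec : (p:ℚ_[p]) = 2*k0+1 := by exact_mod_cast hk0.symm
  have hqk : q ≤ k0 := by unfold Shp at h; omega
  have hun : ∀ j, j < q → Un ((j:ℚ_[p])+1/2) := fun j hj => un_half h3 (by unfold Shp at h; omega)
  have hd2 : Dv 0 (1/2 : ℚ_[p]) := Dv.div Dv.one (un2 h3)
  have e1 : (TT p k0 : ℚ_[p]) = ∑ i ∈ range q, cc k0 / cc (k0-i) / ((k0-i:ℕ):ℚ_[p])^3 := by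
    unfold TT
    rw [sum_Ico_eq_sum_range, show k0+1-(p/3+1) = q by unfold Shp at h; omega, ← sum_range_reflect]
    apply sum_congr rfl; intro i hi; have := mem_range.1 hi
    rw [show p/3+1+(q-1-i) = k0-i by unfold Shp at h; omega]
  have e2 : Cg 1 (TT p k0 : ℚ_[p]) (∑ i ∈ range q, -8 * (pf (q:ℚ_[p]) i / (pd i * (2*(i:ℚ_[p])+1)))) := by
    rw [e1]; apply Cg.sum; intro i hi; have hi := mem_range.1 hi
    have hr := cc_ratio h3 h hk0 hi
    have huk : Un ((k0-i:ℕ):ℚ_[p]) := un_of_lt (p := p) (n := k0-i) (by omega) (by omega)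
    have hk : Cg 1 (((k0-i:ℕ):ℚ_[p])) (-((i:ℚ_[p])+1/2)) := by
      rw [Nat.cast_sub (by omega)]
      refine cgd (Dv.p1.mulr hd2) ?_
      rw [ec]; ring
    have hgd : ∀ j ∈ range i, Dv 0 ((((j:ℚ_[p])+1)^2-(q:ℚ_[p])^2)/((j:ℚ_[p])+1/2)^2) := by
      intro j hj; have := mem_range.1 hj
      exact Dv.div (((((Dv.nat j).add Dv.one)).pow 2).sub ((Dv.nat q).pow 2)) ((hun j (by omega)).pow 2)
    have := hr.div (hk.pow (hun i hi).dv.neg 3) (hr.dv (by omega) (Dv.prod hgd)) (huk.pow 3) ((hun i hi).neg.pow 3)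
    refine this.trans (Cg.of_eq ?_)
    rw [prod_div_distrib]
    have hp1 : ∀ i, (∏ j ∈ range i, ((j:ℚ_[p])+1/2)^2) * ((i:ℚ_[p])+1/2)^2 = 1/4 * pd i := by
      intro i; rw [← prod_range_succ (fun j => ((j:ℚ_[p])+1/2)^2), prod_range_succ']
      unfold pd
      rw [mul_comm]; congr 1
      · simp; norm_num
      · apply prod_congr rfl; intro j _; push_cast; ring
    have hp1 := hp1 i
    have hne : (∏ j ∈ range i, ((j:ℚ_[p])+1/2)^2) ≠ 0 := prod_ne_zero_iff.2 fun j _ => pow_ne_zero 2 (half_ne j)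
    have h4 := half_ne (K := ℚ_[p]) i
    have h5 := odd_ne (K := ℚ_[p]) i
    have h6 := pd_ne (K := ℚ_[p]) i
    change pf (q:ℚ_[p]) i / _ / _ = _
    rw [div_div, ← mul_div_assoc, div_eq_div_iff (mul_ne_zero hne (pow_ne_zero 3 (neg_ne_zero.2 h4))) (mul_ne_zero h6 h5)]
    linear_combination (-8 * pf (q:ℚ_[p]) i * ((i:ℚ_[p])+1/2)) * hp1
  rw [← mul_sum] at e2
  have hF := sumF (K := ℚ_[p]) q
  have hO := (OO_H2 h3 h).1
  have hH : Dv 0 (HH 2 m : ℚ_[p]) := dv_HH 2 (by unfold Shp at h; omega)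
  have hFd : Dv 0 (∑ i ∈ range q, pf (q:ℚ_[p]) i / (pd i * (2*(i:ℚ_[p])+1))) := by
    apply Dv.sum; intro i hi; have hi := mem_range.1 hi
    refine Dv.div (Dv.prod fun j hj => (((((Dv.nat j).add Dv.one)).pow 2).sub ((Dv.nat q).pow 2))) (Un.mul (Un.prod fun j hj => ?_) ?_)
    · have hj := mem_range.1 hj
      have := un_half (p := p) h3 (j := j+1) (by unfold Shp at h; omega)
      push_cast at this; rw [show (j:ℚ_[p])+1+1/2 = j+3/2 by ring] at this; exact this.pow 2
    · have := un_of_lt (p := p) (n := 2*i+1) (by omega) (by unfold Shp at h; omega)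
      push_cast at this; exact this
  generalize (∑ i ∈ range q, pf (q:ℚ_[p]) i / (pd i * (2*(i:ℚ_[p])+1))) = F at *
  rw [← hF] at hO
  refine e2.trans ?_
  unfold Cg at hO
  have h48 : Dv 0 (48 : ℚ_[p]) := Dv.ofNat 48
  rcases h with ⟨a, b, rfl⟩ | ⟨a, b, rfl⟩
  · have ea : (p:ℚ_[p]) = 6*q+1 := by exact_mod_cast a
    refine cgd ((h48.mul hO).sub ((Dv.ofNat 8).mul (Dv.p1.mulr hFd))) ?_
    rw [ea]; push_cast; ring
  · have ea : (p:ℚ_[p]) = 6*q-1 := by rw [eq_sub_iff_add_eq]; exact_mod_cast a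
    refine cgd ((h48.mul hO).neg.add ((Dv.ofNat 8).mul (Dv.p1.mulr hFd))) ?_
    rw [ea]; push_cast; ring
end S19

set_option linter.unusedSectionVars false
set_option linter.unusedSimpArgs false
namespace S19
open Finset Polynomial

section ident
variable {K : Type*} [Field K] [CharZero K]
lemma pt_succ (x : K) (k : ℕ) : pt x (k+1) = pt x k * (((k:K)-x)*((k:K)+x+1)) := by unfold pt; rw [prod_range_succ]
lemma pf_succ (x : K) (k : ℕ) : pf x (k+1) = pf x k * (((k:K)+1)^2-x^2) := by unfold pf; rw [prod_range_succ]
lemma pt_zero (x : K) : pt x 0 = 1 := by simp [pt]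
lemma pf_zero (x : K) : pf x 0 = 1 := by simp [pf]
lemma pt_refl (x : K) (k : ℕ) : pt (-1-x) k = pt x k := by
  unfold pt; apply prod_congr rfl; intro j _; ring
lemma pt_w (x : K) (k : ℕ) : (-1)^k * w k x = pt x k := by
  unfold pt w
  rw [← card_range k, ← prod_const, card_range, ← prod_mul_distrib]; apply prod_congr rfl; intro j _; ring
lemma cc_pt (k : ℕ) : (cc k : K) = pt (-1/3) k / (k.factorial:K)^2 := by
  induction k with
  | zero => simp [pt, cc]
  | succ k ih =>
    have h := cc_succ (K := K) k
    have h2 := sne (K := K) k; have h3 := fne (K := K) k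
    rw [ih] at h
    rw [pt_succ, Nat.factorial_succ]
    push_cast
    rw [eq_div_iff (pow_ne_zero 2 (mul_ne_zero h2 h3))]
    have e : pt (-1/3:K) k / (k.factorial:K)^2 * (k.factorial:K)^2 = pt (-1/3:K) k := div_mul_cancel₀ _ (pow_ne_zero 2 h3)
    linear_combination (k.factorial:K)^2 * h + (k+1/3)*(k+2/3) * e
noncomputable def ut (x : K) (k : ℕ) : K := ∏ j ∈ range k, ((j:K)^2-x^2)
lemma ut_succ (x : K) (k : ℕ) : ut x (k+1) = ut x k * ((k:K)^2-x^2) := by unfold ut; rw [prod_range_succ]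
lemma ut1 (x : K) (k : ℕ) : x * pt x k = (x+k) * ut x k := by
  induction k with
  | zero => simp [pt, ut]
  | succ k ih => rw [pt_succ, ← mul_assoc, ih, ut_succ]; push_cast; ring
lemma ut2 (x : K) (k : ℕ) : x * pt (x-1) k = (x-k) * ut x k := by
  induction k with
  | zero => simp [pt, ut]
  | succ k ih => rw [pt_succ, ← mul_assoc, ih, ut_succ]; push_cast; ring
lemma ut_rel {x : K} (hx : x ≠ 0) (k : ℕ) : (2*x+1) * pt x k - (2*x-1) * pt (x-1) k = 2*(2*(k:K)+1) * ut x k := by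
  apply mul_left_cancel₀ hx
  linear_combination (2*x+1) * ut1 x k - (2*x-1) * ut2 x k
lemma ut_pf (x : K) (k : ℕ) : ut x (k+1) = -x^2 * pf x k := by
  unfold ut pf; rw [prod_range_succ']; push_cast; ring
/-- normalized product -/
noncomputable def qf (x : K) (k : ℕ) : K := pf x k / (k.factorial:K)^2
lemma qf_succ (x : K) (k : ℕ) : qf x (k+1) = qf x k * (1 - x^2/((k:K)+1)^2) := by
  unfold qf; rw [pf_succ, Nat.factorial_succ]; push_cast
  have h2 := sne (K := K) k; have h3 := fne (K := K) k
  field_simp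
lemma ut_div (x : K) (k : ℕ) : ut x (k+1) / ((k+1).factorial:K)^2 = -(x^2/((k:K)+1)^2) * qf x k := by
  rw [ut_pf, qf, Nat.factorial_succ]; push_cast
  have h2 := sne (K := K) k; have h3 := fne (K := K) k
  field_simp
lemma sum_ut (x : K) (N : ℕ) : ∑ k ∈ range (N+1), ut x k / (k.factorial:K)^2 = qf x N := by
  induction N with
  | zero => simp [ut, qf, pf]
  | succ N ih => rw [sum_range_succ, ih, ut_div, qf_succ]; ring
lemma sum_utH (x : K) (N : ℕ) : x^2 * ∑ k ∈ range (N+1), ut x k / (k.factorial:K)^2 * HH 2 k = x^2 * HH 2 N * qf x N + qf x N - 1 := by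
  induction N with
  | zero => simp [ut, qf, pf, HH]
  | succ N ih => rw [sum_range_succ, mul_add, ih, ut_div, qf_succ, HH_succ]; ring
/-- `B_m` -/
lemma BB_sum (m : ℕ) : (2*(m:K)+1) * ∑ k ∈ range (m+1), pt (m:K) k / (k.factorial:K)^2 * HH 2 k / (2*(k:K)+1) = -2 * HH 2 m := by
  induction m with
  | zero => simp [HH]
  | succ m ih =>
    have hz : pt (m:K) (m+1) = 0 := by rw [pt_succ]; simp
    have e1 : (2*(m:K)+1) * ∑ k ∈ range (m+1+1), pt (m:K) k / (k.factorial:K)^2 * HH 2 k / (2*(k:K)+1) = -2 * HH 2 m := by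
      rw [sum_range_succ, hz, ← ih]; simp
    have hm := sne (K := K) m
    have hd : (2*((m+1:ℕ):K)+1) * ∑ k ∈ range (m+1+1), pt ((m+1:ℕ):K) k / (k.factorial:K)^2 * HH 2 k / (2*(k:K)+1) - (2*(m:K)+1) * ∑ k ∈ range (m+1+1), pt (m:K) k / (k.factorial:K)^2 * HH 2 k / (2*(k:K)+1) = 2 * ∑ k ∈ range (m+1+1), ut ((m:K)+1) k / (k.factorial:K)^2 * HH 2 k := by
      rw [mul_sum, mul_sum, mul_sum, ← sum_sub_distrib]
      apply sum_congr rfl; intro k _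
      have h := ut_rel hm k
      rw [add_sub_cancel_right] at h
      push_cast
      have h1 := odd_ne (K := K) k; have h2 := pow_ne_zero 2 (fne (K := K) k)
      rw [show ut ((m:K)+1) k = ((2*((m:K)+1)+1) * pt ((m:K)+1) k - (2*((m:K)+1)-1) * pt (m:K) k)/(2*(2*(k:K)+1)) by rw [h]; field_simp]
      generalize 2*(k:K)+1 = d at *
      field_simp; ring
    rw [e1] at hd
    have hs := sum_utH ((m:K)+1) (m+1)
    have hq : qf ((m:K)+1) (m+1) = 0 := by rw [qf, pf_succ]; simp
    rw [hq] at hs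
    rw [HH_succ, sub_eq_iff_eq_add.1 hd]
    have : ((m:K)+1)^2 ≠ 0 := pow_ne_zero 2 hm
    generalize (∑ k ∈ range (m+1+1), ut ((m:K)+1) k / (k.factorial:K)^2 * HH 2 k) = S at *
    rw [show S = -1/((m:K)+1)^2 by rw [eq_div_iff this]; linear_combination hs]
    ring
/-- `s(x)` -/
noncomputable def sx (N : ℕ) (x : K) : K := (2*x+1) * ∑ k ∈ range N, pt x k / (k.factorial:K)^2 / (2*(k:K)+1)
lemma sx_diff {x : K} (hx : x ≠ 0) (N : ℕ) : sx (N+1) x - sx (N+1) (x-1) = 2 * qf x N := by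
  unfold sx
  rw [← sum_ut, mul_sum, mul_sum, mul_sum, ← sum_sub_distrib]
  apply sum_congr rfl; intro k _
  have h := ut_rel hx k
  have h1 := odd_ne (K := K) k; have h2 := pow_ne_zero 2 (fne (K := K) k)
  rw [show ut x k = ((2*x+1) * pt x k - (2*x-1) * pt (x-1) k)/(2*(2*(k:K)+1)) by rw [h]; field_simp]
  generalize 2*(k:K)+1 = d at *
  field_simp; ring
/-- the sum of the `v n` -/
lemma sum_v (N : ℕ) : ∑ n ∈ range N, (v n : K) = (N:K) * ∑ k ∈ range N, cc k * qf (N:K) k / (2*(k:K)+1) := by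
  have key : ∀ k n : ℕ, ∑ i ∈ range n, pt (i:K) k = (n:K) * pf (n:K) k / (2*(k:K)+1) := by
    intro k n
    have h1 := odd_ne (K := K) k
    induction n with
    | zero => simp
    | succ n ih =>
      rw [sum_range_succ, ih, eq_div_iff h1, add_mul, div_mul_cancel₀ _ h1]
      push_cast
      linear_combination pf2 (n:K) k - pf1 (n:K) k
  have e : ∀ n ∈ range N, (v n : K) = ∑ k ∈ range N, ga k * pt (n:K) k := by
    intro n hn; have := mem_range.1 hn
    rw [v_eq (N := N-1) (by omega), show N-1+1 = N by omega]
    apply sum_congr rfl; intro k _; rw [← pt_w]; ring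
  rw [sum_congr rfl e, sum_comm, mul_sum]
  apply sum_congr rfl; intro k _
  rw [← mul_sum, key, qf, ga]; ring
end ident

variable {p : ℕ} [hp : Fact p.Prime]
lemma un_fact {k : ℕ} (h : k < p) : Un ((k.factorial:ℕ):ℚ_[p]) := by
  apply Un.nat; intro hd
  have := (hp.out.dvd_factorial).1 hd; omega
lemma qf_exp {x : ℚ_[p]} (hx : Dv 1 x) {k : ℕ} (h : k < p) : Cg 4 (qf x k) (1 - x^2 * HH 2 k) := by
  induction k with
  | zero => simp [qf, pf, HH, Cg.refl]
  | succ k ih =>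
    have ih := ih (by omega)
    have hu := un_succ (p := p) (i := k) (n := k+1) (by omega) (by omega)
    have hd0 : Dv 0 x := hx.mono (by omega)
    have h1 : Dv 0 (1 - x^2/((k:ℚ_[p])+1)^2) := Dv.one.sub ((hd0.pow 2).div (hu.pow 2))
    rw [qf_succ, mul_comm, HH_succ]
    refine (ih.mul_left h1).trans ?_
    have h4 : Dv 4 (x^2 * x^2) := by
      have h2 : Dv 2 (x^2) := by rw [sq]; exact hx.mul' hx
      exact h2.mul' h2
    refine cgd ((h4.mulr (dv_HH 2 (n := k) (by omega))).div (hu.pow 2)) ?_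
    ring
end S19

set_option linter.unusedSectionVars false
set_option linter.unusedSimpArgs false
namespace S19
open Finset Polynomial
variable {p : ℕ} [hp : Fact p.Prime]

lemma eps_dv (h3 : 3 < p) : Dv 1 ((p:ℚ_[p])/3) := Dv.p1.div (un3 h3)

/-- the difference terms -/
lemma qf_top (h3 : 3 < p) {i : ℕ} (hi : i + 1 < p) :
    Cg 3 (qf ((i:ℚ_[p])+1-(p:ℚ_[p])/3) (p-1)) (-(2/9) * (p:ℚ_[p])^2/((i:ℚ_[p])+1)^2) := by
  obtain ⟨d, hd⟩ : ∃ d, p = i + d + 2 := ⟨p-2-i, by omega⟩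
  have ec : (p:ℚ_[p]) = i + d + 2 := by exact_mod_cast hd
  set ε : ℚ_[p] := (p:ℚ_[p])/3 with hε
  have hεd : Dv 1 ε := eps_dv h3
  have hε0 : Dv 0 ε := hεd.mono (by omega)
  set x := (i:ℚ_[p])+1-ε with hx
  have epf : pf x (p-1) = (∏ j ∈ range (p-1), ((j:ℚ_[p])+1-x)) * ∏ j ∈ range (p-1), ((j:ℚ_[p])+1+x) := by
    unfold pf; rw [← prod_mul_distrib]; apply prod_congr rfl; intro j _; ring
  have e1 : ∏ j ∈ range (p-1), ((j:ℚ_[p])+1-x) = ε * ((∏ j ∈ range i, (-((j:ℚ_[p])+1)+ε)) * ∏ j ∈ range d, ((j:ℚ_[p])+1+ε)) := by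
    rw [show p-1 = i+1+d by omega, prod_range_add, prod_range_succ, ← prod_range_reflect]
    rw [show ((i:ℚ_[p])+1-x) = ε by rw [hx]; ring, mul_comm _ ε, mul_assoc]
    congr 2
    · apply prod_congr rfl; intro j hj; have := mem_range.1 hj
      rw [Nat.sub_sub, Nat.cast_sub (by omega), hx]; push_cast; ring
    · apply prod_congr rfl; intro j hj; rw [hx]; push_cast; ring
  have e2 : ∏ j ∈ range (p-1), ((j:ℚ_[p])+1+x) = ((p:ℚ_[p])-ε) * ((∏ j ∈ range d, ((i+2+j:ℕ)-ε)) * ∏ j ∈ range i, ((j:ℚ_[p])+1+((p:ℚ_[p])-ε))) := by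
    rw [show p-1 = d+1+i by omega, prod_range_add, prod_range_succ]
    rw [show ((d:ℚ_[p])+1+x) = (p:ℚ_[p])-ε by rw [hx, ec]; ring, mul_comm _ ((p:ℚ_[p])-ε), mul_assoc]
    congr 2
    · apply prod_congr rfl; intro j hj; rw [hx]; push_cast; ring
    · apply prod_congr rfl; intro j hj; rw [hx, ec]; push_cast; ring
  have fac : ∀ n : ℕ, ((n.factorial:ℕ):ℚ_[p]) = ∏ j ∈ range n, ((j:ℚ_[p])+1) := by
    intro n; rw [← prod_range_add_one_eq_factorial]; push_cast; rfl
  have hj1 : ∀ j : ℕ, Dv 0 ((j:ℚ_[p])+1) := fun j => (Dv.nat j).add Dv.one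
  have c1 : Cg 1 (∏ j ∈ range i, (-((j:ℚ_[p])+1)+ε)) ((-1)^i * (i.factorial:ℕ)) := by
    have : ((-1:ℚ_[p])^i * (i.factorial:ℕ)) = ∏ j ∈ range i, (-((j:ℚ_[p])+1)) := by
      rw [fac, prod_neg, card_range]
    rw [this]
    exact Cg.prod (fun j _ => cgd hεd (by ring)) (fun j _ => (hj1 j).neg)
  have c2 : Cg 1 (∏ j ∈ range d, ((j:ℚ_[p])+1+ε)) (d.factorial:ℕ) := by
    rw [fac]; exact Cg.prod (fun j _ => cgd hεd (by ring)) (fun j _ => (hj1 j))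
  have c3 : Cg 1 (∏ j ∈ range d, (((i+2+j:ℕ):ℚ_[p])-ε)) (((p-1).factorial:ℕ)/((i+1).factorial:ℕ)) := by
    have : (((p-1).factorial:ℕ)/((i+1).factorial:ℕ) : ℚ_[p]) = ∏ j ∈ range d, ((i+2+j:ℕ):ℚ_[p]) := by
      rw [div_eq_iff (fne _), fac, fac, show p-1 = i+1+d by omega, prod_range_add, mul_comm]
      congr 1; apply prod_congr rfl; intro j _; push_cast; ring
    rw [this]
    exact Cg.prod (fun j _ => cgd hεd.neg (by ring)) (fun j _ => Dv.nat _)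
  have c4 : Cg 1 (∏ j ∈ range i, ((j:ℚ_[p])+1+((p:ℚ_[p])-ε))) (i.factorial:ℕ) := by
    rw [fac]; exact Cg.prod (fun j _ => cgd (Dv.p1.sub hεd) (by ring)) (fun j _ => (hj1 j))
  have c5 : Cg 1 (((p-1).factorial:ℕ):ℚ_[p]) (((d.factorial:ℕ):ℚ_[p]) * ((-1:ℚ_[p])^(i+1) * (((i+1).factorial:ℕ):ℚ_[p]))) := by
    have a1 : (((p-1).factorial:ℕ):ℚ_[p]) = (d.factorial:ℕ) * ∏ j ∈ range (i+1), ((p:ℚ_[p]) - ((j:ℚ_[p])+1)) := by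
      rw [fac, show p-1 = d+(i+1) by omega, prod_range_add, ← fac]
      congr 1
      rw [← prod_range_reflect]
      apply prod_congr rfl; intro j hj; have := mem_range.1 hj
      rw [Nat.sub_sub, Nat.cast_add, Nat.cast_sub (by omega), ec]; push_cast; ring
    rw [a1]
    apply Cg.mul_left _ (Dv.nat _)
    have : ((-1:ℚ_[p])^(i+1) * (((i+1).factorial:ℕ):ℚ_[p])) = ∏ j ∈ range (i+1), (-((j:ℚ_[p])+1)) := by
      rw [fac, prod_neg, card_range]
    rw [this]
    exact Cg.prod (fun j _ => cgd Dv.p1 (by ring)) (fun j _ => (hj1 j).neg)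
  have uP := un_fact (p := p) (k := p-1) (by omega)
  have ui1 := un_fact (p := p) (k := i+1) (by omega)
  have ui := un_fact (p := p) (k := i) (by omega)
  have ud := un_fact (p := p) (k := d) (by omega)
  have uii := un_succ (p := p) (i := i) (n := i+1) (by omega) (by omega)
  have hfi : (((i+1).factorial:ℕ):ℚ_[p]) = ((i:ℚ_[p])+1) * (i.factorial:ℕ) := by rw [Nat.factorial_succ]; push_cast; ring
  have dm1 : ∀ n, Dv 0 ((-1:ℚ_[p])^n) := fun n => Dv.one.neg.pow n
  have dP := uP.dv.div ui1
  have m1 := c1.mul c2 (c1.dv (by omega) ((dm1 i).mul ui.dv)) ud.dv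
  have m2 := c3.mul c4 (c3.dv (by omega) dP) ui.dv
  have m3 := m1.mul m2 (m1.dv (by omega) (((dm1 i).mul ui.dv).mul ud.dv)) (dP.mul ui.dv)
  have m4 := m3.div (Cg.refl 1 ((((p-1).factorial:ℕ):ℚ_[p])^2)) (m3.dv (by omega) ((((dm1 i).mul ui.dv).mul ud.dv).mul (dP.mul ui.dv))) (uP.pow 2) (uP.pow 2)
  have m5 : Cg 1 (((-1:ℚ_[p])^i * ((i.factorial:ℕ):ℚ_[p]) * ((d.factorial:ℕ):ℚ_[p]) * ((((p-1).factorial:ℕ):ℚ_[p])/(((i+1).factorial:ℕ):ℚ_[p]) * ((i.factorial:ℕ):ℚ_[p]))) / (((p-1).factorial:ℕ):ℚ_[p])^2) (-(1:ℚ_[p])/((i:ℚ_[p])+1)^2) := by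
    have c6 := (c5.div (Cg.refl 1 ((((p-1).factorial:ℕ):ℚ_[p]))) uP.dv uP uP).neg
    have c7 := c6.mul_left (z := 1/((i:ℚ_[p])+1)^2) (Dv.one.div (uii.pow 2))
    have n1 := uP.ne; have n2 := ui.ne; have n3 := uii.ne
    refine Cg.symm ?_
    convert c7 using 1
    · field_simp
    · rw [hfi, show (-1:ℚ_[p])^(i+1) = -(-1)^i by ring]
      generalize (-1:ℚ_[p])^i = s
      field_simp
  have m6 := m4.trans m5
  unfold Cg at m6
  have h29 : Dv 2 ((2/9) * (p:ℚ_[p])^2) := ((Dv.ofNat 2).div (un9 h3)).mul (Dv.pp 2)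
  refine cgd (h29.mul' m6) ?_
  rw [qf, epf, e1, e2, show (p:ℚ_[p]) - ε = 2/3 * p by rw [hε]; ring, hε]
  ring
lemma half_HH2 (h3 : 3 < p) {k0 : ℕ} (hk0 : 2*k0+1 = p) : Dv 1 (HH 2 k0 : ℚ_[p]) := by
  have hh := HH2_refl h3 (n := k0) (n' := k0) (by omega)
  apply Dv.of_mul (x := 2) _ (un2 h3)
  unfold Cg at hh; convert hh using 1; ring

/-- odd reciprocals -/
lemma odd_recip (h3 : 3 < p) {k0 : ℕ} (hk0 : 2*k0+1 = p) :
    Dv 2 (∑ k ∈ range p, 1/(2*(k:ℚ_[p])+1) - 1/(p:ℚ_[p])) := by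
  have ec : (p:ℚ_[p]) = 2*k0+1 := by exact_mod_cast hk0.symm
  have e1 : ∑ k ∈ range p, 1/(2*(k:ℚ_[p])+1) - 1/(p:ℚ_[p]) = ∑ l ∈ range k0, 1/(2*(l:ℚ_[p])+1) + ∑ l ∈ range k0, 1/((p:ℚ_[p])+2*((l:ℚ_[p])+1)) := by
    have : ∑ k ∈ range p, 1/(2*(k:ℚ_[p])+1) = ∑ k ∈ range (k0+1+k0), 1/(2*(k:ℚ_[p])+1) := by congr 2; omega
    rw [this, sum_range_add, sum_range_succ, ← ec]
    have : ∑ x ∈ range k0, 1/(2*((k0+1+x:ℕ):ℚ_[p])+1) = ∑ l ∈ range k0, 1/((p:ℚ_[p])+2*((l:ℚ_[p])+1)) := by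
      apply sum_congr rfl; intro l _; rw [ec]; push_cast; congr 1; ring
    rw [this]; ring
  have e2 : ∀ a : ℕ, (HH 1 (2*a) : ℚ_[p]) = ∑ l ∈ range a, 1/(2*(l:ℚ_[p])+1) + ∑ l ∈ range a, 1/(2*((l:ℚ_[p])+1)) := by
    intro a
    induction a with
    | zero => simp [HH]
    | succ a ih => rw [show 2*(a+1)=2*a+1+1 by ring, HH_succ, HH_succ, ih, sum_range_succ, sum_range_succ]; push_cast; ring
  have c : Cg 2 (∑ l ∈ range k0, 1/((p:ℚ_[p])+2*((l:ℚ_[p])+1))) (∑ l ∈ range k0, 1/(2*((l:ℚ_[p])+1)) - (p:ℚ_[p])/4 * HH 2 k0) := by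
    unfold HH; rw [mul_sum, ← sum_sub_distrib]; apply Cg.sum; intro l hl; have := mem_range.1 hl
    have hu := un_succ (p := p) (i := l) (n := l+1) (by omega) (by omega)
    have hu2 : Un ((p:ℚ_[p])+2*((l:ℚ_[p])+1)) := by
      refine Un.of_sub ((un2 h3).mul hu) (cgd Dv.p1.neg ?_); ring
    refine cgd (((Dv.pp 2).div (hu.pow 2)).div (hu2.mul (un4 h3))) ?_
    have n1 := hu.ne; have n2 := hu2.ne
    field_simp; ring
  have h4 : Dv 2 ((p:ℚ_[p])/4 * HH 2 k0) := (Dv.p1.div (un4 h3)).mul' (half_HH2 h3 hk0)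
  have h5 := HH1_top (p := p) h3
  rw [show p-1 = 2*k0 by omega, e2] at h5
  rw [e1]
  unfold Cg at c
  have := (c.sub h4).add h5
  convert this using 1; ring
end S19

set_option linter.unusedSectionVars false
set_option linter.unusedSimpArgs false
namespace S19
open Finset Polynomial
variable {p : ℕ} [hp : Fact p.Prime]

lemma pt_shift {K : Type*} [Field K] [CharZero K] (x : K) (i : ℕ) : pt (-x) (i+1) = x*((i:K)+1-x) * pf x i := by
  induction i with
  | zero => rw [pt_succ, pt_zero, pf_zero]; push_cast; ring
  | succ i ih => rw [pt_succ, ih, pf_succ]; push_cast; ring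

lemma un_odd (h3 : 3 < p) {k : ℕ} (hk : k < p) (h : 2*k+1 ≠ p) : Un (2*(k:ℚ_[p])+1) := by
  have : Un ((2*k+1:ℕ):ℚ_[p]) := by
    apply Un.nat
    rintro ⟨c, hc⟩
    have : c < 2 := by
      by_contra hh
      have : p * 2 ≤ p * c := Nat.mul_le_mul_left _ (by omega)
      omega
    interval_cases c <;> omega
  exact_mod_cast this

lemma sx_eps (h3 : 3 < p) : Cg 3 (sx p (-((p:ℚ_[p])/3))) (1/3) := by
  have hodd : p % 2 = 1 := Nat.odd_iff.1 (hp.out.odd_of_ne_two (by omega))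
  obtain ⟨i0, hi0⟩ : ∃ i0, 2*(i0+1)+1 = p := ⟨(p-1)/2-1, by omega⟩
  have hO := odd_recip h3 hi0
  have hH1 := HH1_top (p := p) h3
  have hH2 := HH2_top (p := p) h3
  have hK2 := half_HH2 h3 hi0
  have ec : (p:ℚ_[p]) = 2*((i0:ℚ_[p])+1)+1 := by exact_mod_cast hi0.symm
  have hpn := ppne (p := p)
  set ε : ℚ_[p] := (p:ℚ_[p])/3 with hε
  have hεd : Dv 1 ε := eps_dv h3
  have hε0 : Dv 0 ε := hεd.mono (by omega)
  have hε2 : Dv 2 (ε^2) := by rw [sq]; exact hεd.mul' hεd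
  have hε3 : Dv 3 (ε^3) := by rw [show ε^3 = ε^2*ε by ring]; exact hε2.mul' hεd
  have ep : (p:ℚ_[p]) = 3*ε := by rw [hε]; ring
  set O : ℚ_[p] := ∑ k ∈ range p, 1/(2*(k:ℚ_[p])+1) with hOdef
  set g : ℕ → ℚ_[p] := fun i => ε*((1+2*ε)*(1/((i:ℚ_[p])+1)^1) - ε*(1/((i:ℚ_[p])+1)^2) - (2+4*ε)*(1/(2*((i+1:ℕ):ℚ_[p])+1))) with hg
  have hsum : ∑ i ∈ range (p-1), g i = ε*((1+2*ε)*HH 1 (p-1) - ε*HH 2 (p-1) - (2+4*ε)*(O-1)) := by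
    have : O - 1 = ∑ i ∈ range (p-1), 1/(2*((i+1:ℕ):ℚ_[p])+1) := by
      rw [hOdef, sum_range_pred _ (by omega)]; simp
    rw [this]; unfold HH; simp only [hg, mul_sum, ← sum_sub_distrib]
  have hF : ∀ i ∈ range (p-1), Cg 3 (pt (-ε) (i+1) / (((i+1).factorial:ℕ):ℚ_[p])^2 / (2*((i+1:ℕ):ℚ_[p])+1)) (g i + if i = i0 then -(8/3)*ε^2 else 0) := by
    intro i hi
    have hi' := mem_range.1 hi
    have ui := un_succ (p := p) (i := i) (n := i+1) (by omega) (by omega)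
    have n1 := ui.ne
    have n2 : (2*((i:ℚ_[p])+1)+1) ≠ 0 := by have := odd_ne (K := ℚ_[p]) (i+1); push_cast at this; exact this
    have n3 := fne (K := ℚ_[p]) i
    have e1 : pt (-ε) (i+1) / (((i+1).factorial:ℕ):ℚ_[p])^2 / (2*((i+1:ℕ):ℚ_[p])+1) = g i * qf ε i := by
      rw [pt_shift, qf, hg, Nat.factorial_succ]; push_cast
      generalize hd : 2*((i:ℚ_[p])+1)+1 = d at *
      have : (i:ℚ_[p])+1 = (d-1)/2 := by rw [← hd]; ring
      rw [this] at n1 ⊢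
      have n4 : d - 1 ≠ 0 := fun h => n1 (by rw [h]; simp)
      field_simp; ring
    have e2 : g i = ε*(1/((i:ℚ_[p])+1) - ε/((i:ℚ_[p])+1)^2)/(2*((i:ℚ_[p])+1)+1) := by
      rw [hg]; push_cast
      generalize hd : 2*((i:ℚ_[p])+1)+1 = d at *
      have : (i:ℚ_[p])+1 = (d-1)/2 := by rw [← hd]; ring
      rw [this] at n1 ⊢
      have n4 : d - 1 ≠ 0 := fun h => n1 (by rw [h]; simp)
      field_simp; ring
    rw [e1]
    have hq := qf_exp hεd (k := i) (by omega)
    have d1 : Dv 0 (1/((i:ℚ_[p])+1) - ε/((i:ℚ_[p])+1)^2) := (Dv.one.div ui).sub (hε0.div (ui.pow 2))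
    split_ifs with h
    · subst h
      have e3 : g i = 1/3*(1/((i:ℚ_[p])+1) - ε/((i:ℚ_[p])+1)^2) := by
        rw [e2, ← ec, ep]; rw [ep] at hpn
        have : ε ≠ 0 := fun h => hpn (by rw [h]; simp)
        field_simp
      have hg0 : Dv 0 (g i) := by rw [e3]; exact (Dv.one.div (un3 h3)).mul d1
      have e4 : ((i:ℚ_[p])+1) = (3*ε-1)/2 := by linear_combination (1/2)*ep - (1/2)*ec
      have u31 : Un (3*ε-1) := by
        refine Un.of_sub (x := -1) Un.one.neg ?_
        rw [show -1-(3*ε-1) = -(3*ε) by ring]; exact ((Dv.ofNat 3).mul hεd).neg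
      have n5 := u31.ne
      have c1 : Cg 1 (g i) (-(2/3)) := by
        refine cgd (z := (ε*2/(3*ε-1) - ε*((4/3)/(3*ε-1)^2))) ?_ ?_
        · exact ((hεd.mulr (Dv.ofNat 2)).div u31).sub (hεd.mulr (((Dv.ofNat 4).div (un3 h3)).div (u31.pow 2)))
        · rw [e3, e4]; field_simp; ring
      have c2 : Cg 1 (HH 2 i : ℚ_[p]) (-4) := by
        refine cgd (z := HH 2 (i+1) - 4*(ε*(6-9*ε)/(3*ε-1)^2)) ?_ ?_
        · refine hK2.sub ((Dv.ofNat 4).mul ((hεd.mulr ?_).div (u31.pow 2)))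
          exact (Dv.ofNat 6).sub ((Dv.ofNat 9).mul hε0)
        · rw [HH_succ, e4]; field_simp; ring
      have c3 := c1.mul c2 hg0 (Dv.ofNat 4).neg
      have hq3 : Cg 3 (g i * qf ε i) (g i * (1 - ε^2*HH 2 i)) := (hq.mono (by omega)).mul_left hg0
      refine hq3.trans (cgd (hε2.mul' (Dv.neg c3)) (by ring))
    · have uo : Un (2*((i:ℚ_[p])+1)+1) := by
        have := un_odd (p := p) h3 (k := i+1) (by omega) (by omega); push_cast at this; exact this
      have hg1 : Dv 1 (g i) := by rw [e2]; exact (hεd.mulr d1).div uo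
      have hq2 : Dv 2 (qf ε i - 1) := by
        have h1 : Dv 2 (qf ε i - (1 - ε^2*HH 2 i)) := Dv.mono hq (by omega)
        have := h1.sub (hε2.mulr (dv_HH 2 (n := i) (by omega)))
        convert this using 1; ring
      exact cgd (hg1.mul' hq2) (by ring)
  have hS : Cg 3 (∑ k ∈ range p, pt (-ε) k / ((k.factorial:ℕ):ℚ_[p])^2 / (2*(k:ℚ_[p])+1)) (1/3+(2/3)*ε+(4/3)*ε^2) := by
    rw [sum_range_pred _ (by omega)]
    have h1 := Cg.sum hF
    rw [sum_add_distrib, hsum, sum_ite_eq' (range (p-1)) i0, if_pos (mem_range.2 (by omega))] at h1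
    have h2 : Dv 3 (ε*((1+2*ε)*HH 1 (p-1) - ε*HH 2 (p-1) - (2+4*ε)*(O-1/(p:ℚ_[p])))) := by
      have a1 : Dv 0 (1+2*ε) := Dv.one.add ((Dv.ofNat 2).mul hε0)
      have a2 : Dv 0 (2+4*ε) := (Dv.ofNat 2).add ((Dv.ofNat 4).mul hε0)
      exact hεd.mul' (((a1.mul hH1).sub (hεd.mul' hH2)).sub (a2.mul hO))
    unfold Cg at h1
    refine cgd (h1.add h2) ?_
    simp only [pt_zero, Nat.factorial_zero, Nat.cast_one, Nat.cast_zero]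
    have : ε ≠ 0 := fun h => hpn (by rw [ep, h]; simp)
    rw [ep]
    field_simp; ring
  have h12 : Dv 0 (1-2*ε) := Dv.one.sub ((Dv.ofNat 2).mul hε0)
  have := hS.mul_left h12
  unfold sx
  unfold Cg at this
  refine cgd (this.sub (((Dv.ofNat 8).div (un3 h3)).mul hε3)) ?_
  ring
end S19

set_option linter.unusedSectionVars false
set_option linter.unusedSimpArgs false
namespace S19
open Finset Polynomial
variable {p : ℕ} [hp : Fact p.Prime]

lemma sx_iter (h3 : 3 < p) {n : ℕ} (hn : n < p) : Cg 3 (sx p ((n:ℚ_[p])-(p:ℚ_[p])/3)) (1/3 - 4/9*(p:ℚ_[p])^2*HH 2 n) := by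
  induction n with
  | zero => rw [HH_zero, Nat.cast_zero, zero_sub, mul_zero, sub_zero]; exact sx_eps h3
  | succ n ih =>
    have hx : Un ((n:ℚ_[p])+1-(p:ℚ_[p])/3) := by
      refine Un.of_sub (un_succ (p := p) (i := n) (n := n+1) (by omega) (by omega)) ?_
      rw [sub_sub_cancel]; exact eps_dv h3
    have h1 := sx_diff hx.ne (p-1)
    rw [Nat.sub_add_cancel (by omega)] at h1
    have h2 := (ih (by omega)).add ((qf_top h3 (i := n) hn).mul_left (Dv.ofNat 2))
    rw [← h1] at h2
    rw [show (((n+1:ℕ):ℚ_[p])-(p:ℚ_[p])/3) = ((n:ℚ_[p])+1-(p:ℚ_[p])/3) by push_cast; ring]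
    rw [HH_succ]
    unfold Cg at h2
    refine cgd h2 ?_
    rw [show ((n:ℚ_[p])+1-(p:ℚ_[p])/3 - 1) = (n:ℚ_[p])-(p:ℚ_[p])/3 by ring]
    ring

lemma Shp.e2 {q m : ℕ} {e : ℚ} (h : Shp p q m e) : (e:ℚ_[p])*(e:ℚ_[p]) = 1 := by
  rcases h with ⟨_,_,rfl⟩ | ⟨_,_,rfl⟩ <;> simp
lemma Shp.de {q m : ℕ} {e : ℚ} (h : Shp p q m e) : Dv 0 (e:ℚ_[p]) := by
  rcases h with ⟨_,_,rfl⟩ | ⟨_,_,rfl⟩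
  · simpa using Dv.one
  · simpa using Dv.one.neg
lemma Shp.pt {q m : ℕ} {e : ℚ} (h : Shp p q m e) (k : ℕ) : pt ((m:ℚ_[p])-(p:ℚ_[p])/3) k = pt (-1/3) k := by
  rcases h with ⟨h1,h2,rfl⟩ | ⟨h1,h2,rfl⟩
  · have : (p:ℚ_[p]) = 3*(m:ℚ_[p])+1 := by exact_mod_cast (show p = 3*m+1 by omega)
    rw [show (m:ℚ_[p])-(p:ℚ_[p])/3 = -1/3 by linear_combination (-1/3)*this]
  · have : (p:ℚ_[p]) = 3*(m:ℚ_[p])+2 := by exact_mod_cast (show p = 3*m+2 by omega)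
    rw [show (m:ℚ_[p])-(p:ℚ_[p])/3 = -1-(-1/3) by linear_combination (-1/3)*this, pt_refl]
lemma Shp.tw {q m : ℕ} {e : ℚ} (h : Shp p q m e) : 3*(2*(m:ℚ_[p])+1) = 2*(p:ℚ_[p]) + e := by
  rcases h with ⟨h1,h2,rfl⟩ | ⟨h1,h2,rfl⟩
  · have : (p:ℚ_[p]) = 3*(m:ℚ_[p])+1 := by exact_mod_cast (show p = 3*m+1 by omega)
    push_cast; linear_combination (-2)*this
  · have : (p:ℚ_[p]) = 3*(m:ℚ_[p])+2 := by exact_mod_cast (show p = 3*m+2 by omega)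
    push_cast; linear_combination (-2)*this
lemma Shp.lt {q m : ℕ} {e : ℚ} (h3 : 3 < p) (h : Shp p q m e) : 2*m+1 < p := by
  rcases h with ⟨h1,h2,_⟩ | ⟨h1,h2,_⟩ <;> omega

lemma hh_sum (h3 : 3 < p) {q m : ℕ} {e : ℚ} (h : Shp p q m e) :
    Cg 3 (∑ k ∈ range p, cc k/(2*(k:ℚ_[p])+1)) ((e:ℚ_[p])*(1-4/3*(p:ℚ_[p])^2*HH 2 m)) := by
  have h1 := sx_iter h3 (n := m) (by have := h.lt h3; omega)
  have e1 : sx p ((m:ℚ_[p])-(p:ℚ_[p])/3) = (e:ℚ_[p])/3 * ∑ k ∈ range p, cc k/(2*(k:ℚ_[p])+1) := by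
    unfold sx
    congr 1
    · have := h.tw; linear_combination (1/3)*this
    · apply sum_congr rfl; intro k _; rw [h.pt, cc_pt]
  rw [e1] at h1
  have h2 := h1.mul_left ((Dv.ofNat 3).mul h.de)
  unfold Cg at h2
  refine cgd h2 ?_
  linear_combination (-∑ k ∈ range p, cc k/(2*(k:ℚ_[p])+1)) * h.e2

lemma cc_p (h3 : 3 < p) {q m : ℕ} {e : ℚ} (h : Shp p q m e) {k : ℕ} (hk : m < k) (hkp : k < p) : Dv 1 (cc k : ℚ_[p]) := by
  rw [cc_pt, ← h.pt]
  refine Dv.div ?_ ((un_fact hkp).pow 2)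
  unfold S19.pt
  rw [← mul_prod_erase _ _ (mem_range.2 hk)]
  have he := eps_dv h3
  have he0 := he.mono (s := 0) (by omega)
  refine (Dv.mulr ?_ ?_).mulr (Dv.prod fun j _ => ?_)
  · rw [sub_sub_cancel]; exact he
  · exact ((Dv.nat _).add ((Dv.nat _).sub he0)).add Dv.one
  · exact ((Dv.nat _).sub ((Dv.nat _).sub he0)).mul (((Dv.nat _).add ((Dv.nat _).sub he0)).add Dv.one)

lemma cc_pt_cg (h3 : 3 < p) {q m : ℕ} {e : ℚ} (h : Shp p q m e) {k : ℕ} (hkp : k < p) :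
    Cg 1 (cc k : ℚ_[p]) (pt (m:ℚ_[p]) k / ((k.factorial:ℕ):ℚ_[p])^2) := by
  rw [cc_pt, ← h.pt]
  have he := eps_dv h3
  have he0 := he.mono (s := 0) (by omega)
  have d0 : ∀ j : ℕ, Dv 0 (((j:ℚ_[p])-(m:ℚ_[p]))*((j:ℚ_[p])+(m:ℚ_[p])+1)) := fun j =>
    ((Dv.nat _).sub (Dv.nat _)).mul (((Dv.nat _).add (Dv.nat _)).add Dv.one)
  have hc : Cg 1 (pt ((m:ℚ_[p])-(p:ℚ_[p])/3) k) (pt (m:ℚ_[p]) k) := by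
    unfold S19.pt
    refine Cg.prod (fun j _ => ?_) (fun j _ => d0 j)
    refine cgd (he.mulr (y := 2*(m:ℚ_[p])+1-(p:ℚ_[p])/3) ?_) (by ring)
    exact (((Dv.ofNat 2).mul (Dv.nat _)).add Dv.one).sub he0
  have hu := (un_fact hkp).pow 2
  have hd : Dv 0 (S19.pt (m:ℚ_[p]) k) := Dv.prod fun j _ => d0 j
  exact hc.div (Cg.refl _ _) (hc.dv (by omega) hd) hu hu

lemma cc_odd (h3 : 3 < p) {q m : ℕ} {e : ℚ} (h : Shp p q m e) {k : ℕ} (hkp : k < p) : Dv 0 (cc k/(2*(k:ℚ_[p])+1)) := by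
  by_cases hk : 2*k+1 = p
  · have h1 := cc_p h3 h (k := k) (by have := h.lt h3; omega) hkp
    have : (2*(k:ℚ_[p])+1) = (p:ℚ_[p]) := by exact_mod_cast hk
    rw [this]
    apply Dv.cancel (r := 1)
    have hp := ppne (p := p)
    rw [pow_one, mul_div_cancel₀ _ hp]; exact h1
  · exact (dv_cc h3 k).div (un_odd h3 hkp hk)

lemma BB_cg (h3 : 3 < p) {q m : ℕ} {e : ℚ} (h : Shp p q m e) :
    Cg 1 (∑ k ∈ range p, cc k/(2*(k:ℚ_[p])+1) * HH 2 k) (-6*(e:ℚ_[p])*HH 2 m) := by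
  have hm := h.lt h3
  have h1 : Cg 1 (∑ k ∈ range p, cc k/(2*(k:ℚ_[p])+1) * HH 2 k) (∑ k ∈ range (m+1), S19.pt (m:ℚ_[p]) k / ((k.factorial:ℕ):ℚ_[p])^2 * HH 2 k / (2*(k:ℚ_[p])+1)) := by
    obtain ⟨d, hd⟩ : ∃ d, p = m+1+d := ⟨p-(m+1), by omega⟩
    have : ∑ k ∈ range p, cc k/(2*(k:ℚ_[p])+1) * HH 2 k = ∑ k ∈ range (m+1+d), cc k/(2*(k:ℚ_[p])+1) * HH 2 k := by congr 2
    rw [this, sum_range_add]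
    have a1 : Cg 1 (∑ k ∈ range (m+1), cc k/(2*(k:ℚ_[p])+1) * HH 2 k) (∑ k ∈ range (m+1), S19.pt (m:ℚ_[p]) k / ((k.factorial:ℕ):ℚ_[p])^2 * HH 2 k / (2*(k:ℚ_[p])+1)) := by
      apply Cg.sum; intro k hk; have hk' := mem_range.1 hk
      have uo := un_odd h3 (k := k) (by omega) (by omega)
      have hc := cc_pt_cg h3 h (k := k) (by omega)
      unfold Cg at hc
      exact cgd (hc.mulr ((dv_HH 2 (n := k) (by omega)).div uo)) (by ring)
    have a2 : Dv 1 (∑ x ∈ range d, cc (m+1+x)/(2*((m+1+x:ℕ):ℚ_[p])+1) * HH 2 (m+1+x)) := by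
      apply Dv.sum; intro k hk; have hk' := mem_range.1 hk
      by_cases hh : 2*(m+1+k)+1 = p
      · exact (cc_odd h3 h (by omega)).mul (half_HH2 h3 hh)
      · exact ((cc_p h3 h (by omega) (by omega)).div (un_odd h3 (by omega) hh)).mulr (dv_HH 2 (by omega))
    unfold Cg at a1
    exact cgd (a1.add a2) (by ring)
  have h2 := BB_sum (K := ℚ_[p]) m
  set Z := ∑ k ∈ range (m+1), S19.pt (m:ℚ_[p]) k / ((k.factorial:ℕ):ℚ_[p])^2 * HH 2 k / (2*(k:ℚ_[p])+1) with hZ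
  have dZ : Dv 0 Z := by
    refine h1.symm.dv (by omega) (Dv.sum fun k hk => ?_)
    exact (cc_odd h3 h (mem_range.1 hk)).mul (dv_HH 2 (mem_range.1 hk))
  refine h1.trans (cgd (z := -(p:ℚ_[p])*(2*(e:ℚ_[p])*Z)) (Dv.p1.neg.mulr (((Dv.ofNat 2).mul h.de).mul dZ)) ?_)
  have h4 := h.tw; have h5 := h.e2
  linear_combination (-Z)*h5 - (e:ℚ_[p])*Z*h4 + 3*(e:ℚ_[p])*h2

lemma G_val (h3 : 3 < p) {q m : ℕ} {e : ℚ} (h : Shp p q m e) :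
    Cg 4 (∑ n ∈ range p, (v n : ℚ_[p])) ((e:ℚ_[p])*(p:ℚ_[p]) + 14/3*(e:ℚ_[p])*(p:ℚ_[p])^3*HH 2 m) := by
  rw [sum_v]
  have h1 := hh_sum h3 h
  have h2 := BB_cg h3 h
  have h0 : Cg 3 (∑ k ∈ range p, cc k * qf (p:ℚ_[p]) k / (2*(k:ℚ_[p])+1)) (∑ k ∈ range p, cc k/(2*(k:ℚ_[p])+1) - (p:ℚ_[p])^2*∑ k ∈ range p, cc k/(2*(k:ℚ_[p])+1) * HH 2 k) := by
    rw [mul_sum, ← sum_sub_distrib]; apply Cg.sum; intro k hk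
    have hq := qf_exp (p := p) Dv.p1 (mem_range.1 hk)
    unfold Cg at hq
    exact cgd ((cc_odd h3 h (mem_range.1 hk)).mul (hq.mono (by omega : 3 ≤ 4))) (by ring)
  unfold Cg at h0 h1 h2
  have := Dv.p1.mul' ((h0.add h1).sub ((Dv.pp 2).mul' h2))
  refine cgd (this.mono (by omega)) ?_
  ring
lemma R1_val (h3 : 3 < p) {q m : ℕ} {e : ℚ} (h : Shp p q m e) :
    Cg 4 (8 * SS p 1 + SS p 0 : ℚ_[p]) ((e:ℚ_[p])*(p:ℚ_[p]) - 22/3*(p:ℚ_[p])^3*((seqU (p-3):ℚ):ℚ_[p])) := by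
  have hodd : p % 2 = 1 := Nat.odd_iff.1 (hp.out.odd_of_ne_two (by omega))
  obtain ⟨k0, hk0⟩ : ∃ k0, 2*k0+1 = p := ⟨(p-1)/2, by omega⟩
  rw [R1_eq h3]
  have h1 := G_val h3 h
  have h2 := (del_eval h3 hk0).trans ((TT_H2 h3 h hk0).mul_left (z := -(16/27)) ((Dv.ofNat 16).div (un27 h3)).neg)
  have h4 := U_H2 h3 h
  unfold Cg at h1 h2 h4
  refine cgd ((h1.sub ((Dv.pp 3).mul' h2)).add (((Dv.ofNat 22).div (un3 h3)).mul ((Dv.pp 3).mul' h4))) ?_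
  ring
end S19

set_option linter.unusedSectionVars false
set_option linter.unusedSimpArgs false
namespace S19
open Finset Polynomial
variable {p : ℕ} [hp : Fact p.Prime]

lemma SS_cast (j : ℕ) : ((∑ n ∈ range p, (n:ℚ)^j * seqV3 n / 243^n : ℚ) : ℚ_[p]) = SS p j := by
  unfold SS
  have : ∀ n ∈ range p, (n:ℚ)^j * seqV3 n / 243^n = (n:ℚ)^j * (v n * (1/9)^n) := by
    intro n _; rw [mul_div_assoc, term_cast]
  rw [sum_congr rfl this]; push_cast
  apply sum_congr rfl; intro n _; rw [v_cast]

lemma leg (h3 : 3 < p) {q m : ℕ} {e : ℚ} (h : Shp p q m e) : ((legendreSym 3 (p:ℤ) : ℤ) : ℚ) = e := by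
  rw [legendreSym.mod]
  rcases h with ⟨h1,h2,rfl⟩ | ⟨h1,h2,rfl⟩
  · have : ((p:ℤ) % ((3:ℕ):ℤ)) = 1 := by omega
    rw [this, legendreSym.at_one]; simp
  · have : ((p:ℤ) % ((3:ℕ):ℤ)) = 2 := by omega
    rw [this]
    have : legendreSym 3 2 = -1 := by decide
    rw [this]; simp

lemma third (h3 : 3 < p) : ratCongr p 4 (∑ n ∈ Finset.range p, (8*(n:ℚ)+1) * seqV3 n / 243^n)
      ((legendreSym 3 p : ℚ)*(p:ℚ) - 22/3*(p:ℚ)^3*seqU (p-3)) := by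
  obtain ⟨q, m, e, h⟩ := Shp.ex (p := p) h3
  apply ratCongr_of_cg
  have h1 := R1_val h3 h
  rw [leg h3 h]
  have : ∑ n ∈ Finset.range p, (8*(n:ℚ)+1) * seqV3 n / 243^n = 8 * (∑ n ∈ Finset.range p, (n:ℚ)^1 * seqV3 n / 243^n) + ∑ n ∈ Finset.range p, (n:ℚ)^0 * seqV3 n / 243^n := by
    rw [mul_sum, ← sum_add_distrib]; apply sum_congr rfl; intro n _; ring
  rw [this, Rat.cast_add, Rat.cast_mul, SS_cast, SS_cast]
  push_cast
  exact h1

lemma dv_SS (h3 : 3 < p) (j : ℕ) : Dv 0 (SS p j : ℚ_[p]) := by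
  unfold SS; exact Dv.sum fun n _ => ((Dv.nat n).pow j).mul ((dv_v h3 n).mul ((un_inv9 h3).dv.pow n))

/-- S3 in terms of the others -/
lemma S3_val (h3 : 3 < p) : Cg 3 (16 * SS p 3 : ℚ_[p]) (6 * SS p 2 + 4 * SS p 1 + SS p 0) := by
  have h := pieceI (K := ℚ_[p]) (p-1) (1/9)
  rw [Nat.sub_add_cancel (by omega)] at h
  have e1 : ((p-1:ℕ):ℚ_[p]) + 1 = p := by rw [Nat.cast_sub (by omega)]; simp
  rw [e1] at h
  have h2 : 4/81 * (16 * SS p 3 - (6 * SS p 2 + 4 * SS p 1 + SS p 0)) = (p:ℚ_[p])^3 * (v (p-1) * (1/9)^(p-1+2) - v p * (1/9)^p) := by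
    rw [← h]; unfold SS
    simp only [mul_sum, ← sum_add_distrib, ← sum_sub_distrib]
    apply sum_congr rfl; intro n _; rw [pow_succ, pow_succ]; ring
  have h4 : Dv 3 (4/81 * (16 * SS p 3 - (6 * SS p 2 + 4 * SS p 1 + SS p 0)) : ℚ_[p]) := by
    rw [h2]
    have u := (un_inv9 h3).dv
    exact (Dv.pp 3).mulr (((dv_v h3 _).mul (u.pow _)).sub ((dv_v h3 _).mul (u.pow _)))
  refine Dv.of_mul h4 ((un4 h3).div ?_)
  have := (un9 h3).mul (un9 h3); norm_num at this; exact this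

section Q
variable {K : Type*} [Field K] [CharZero K]
noncomputable def yy (P j : ℕ) : K[X] := ∑ n ∈ range P, C ((n:K)^j * v n) * X^n
lemma yy_coeff (P j n : ℕ) : (yy P j : K[X]).coeff n = if n < P then (n:K)^j * v n else 0 := by
  unfold yy; rw [finsetSum_coeff]; simp only [coeff_C_mul, coeff_X_pow, mul_ite, mul_one, mul_zero]
  rw [sum_ite_eq]; simp
lemma yy_der (P j : ℕ) : X * derivative (yy P j : K[X]) = yy P (j+1) := by
  unfold yy; rw [derivative_sum, mul_sum]; apply sum_congr rfl; intro n _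
  rw [derivative_C_mul_X_pow]
  cases n with
  | zero => simp
  | succ n => rw [Nat.add_sub_cancel, mul_comm X, mul_assoc, ← pow_succ, pow_succ]; congr 2; push_cast; ring
lemma yy_eval (P j : ℕ) : (yy P j : K[X]).eval (1/9) = SS P j := by
  unfold yy SS; rw [eval_finsetSum]; apply sum_congr rfl; intro n _; simp; ring
noncomputable def QQ (P : ℕ) : K[X] := (1-2*X+X^2) * (yy P 0 * yy P 2 - C (1/2) * yy P 1^2) + (-X+X^2) * (yy P 0 * yy P 1)
   + (-(C (5/9) * X) + C (1/2) * X^2) * yy P 0^2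
lemma QQ_der (N : ℕ) : X * derivative (QQ (N+1) : K[X]) = ((N:K[X])+1)^3 * (C (v N) * (yy (N+1) 0 * X^(N+2)) - C (v (N+1)) * (yy (N+1) 0 * X^(N+1))) := by
  have h := pieceI_hom (K := K) N X 1
  have h2 : yy (N+1) 3 - X * (2 * yy (N+1) 3 + 3 * yy (N+1) 2 + (1+2*C (5/9)) * yy (N+1) 1 + C (5/9) * yy (N+1) 0) + X^2 * (yy (N+1) 3 + 3*yy (N+1) 2 + 3 * yy (N+1) 1 + yy (N+1) 0) = ((N:K[X])+1)^3 * (C (v N) * X^(N+2) - C (v (N+1)) * X^(N+1) * 1) := by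
    rw [← h]; unfold yy; simp only [mul_sum, ← sum_add_distrib, ← sum_sub_distrib]
    apply sum_congr rfl; intro n _
    simp only [C_mul, map_pow, map_natCast, one_pow]; ring
  have e0 := yy_der (K := K) (N+1) 0
  have e1 := yy_der (K := K) (N+1) 1
  have e2 := yy_der (K := K) (N+1) 2
  have c2 : (C (1/2) : K[X]) * 2 = 1 := by rw [show (2:K[X]) = C 2 from rfl, ← C_mul]; simp
  have c5 : (C (5/9) : K[X]) * 9 = 5 := by
    rw [show (9:K[X]) = C 9 from rfl, ← C_mul, show (5:K[X]) = C 5 from rfl]; congr 1; norm_num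
  have : X * derivative (QQ (N+1) : K[X]) = yy (N+1) 0 * (yy (N+1) 3 - X * (2 * yy (N+1) 3 + 3 * yy (N+1) 2 + (1+2*C (5/9)) * yy (N+1) 1 + C (5/9) * yy (N+1) 0) + X^2 * (yy (N+1) 3 + 3*yy (N+1) 2 + 3 * yy (N+1) 1 + yy (N+1) 0)) := by
    unfold QQ
    simp only [derivative_add, derivative_sub, derivative_mul, derivative_neg, derivative_X, derivative_C, derivative_pow, derivative_one, derivative_ofNat, map_natCast]
    simp only [zero_add] at e0 e1 e2
    simp only [Nat.reduceAdd] at e0 e1 e2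
    simp only [Nat.cast_ofNat, Nat.reduceSub, pow_one]
    generalize (yy (N+1) 0 : K[X]) = y0 at *
    generalize (yy (N+1) 1 : K[X]) = y1 at *
    generalize (yy (N+1) 2 : K[X]) = y2 at *
    generalize (yy (N+1) 3 : K[X]) = y3 at *
    generalize (C (1/2) : K[X]) = h at *
    linear_combination ((1-2*X+X^2)*y2 + (-X+X^2)*y1 + (-(C (5/9)*X)+h*X^2)*2*y0) * e0 + (-(1-2*X+X^2)*2*h*y1 + (-X+X^2)*y0) * e1 + (1-2*X+X^2)*y0 * e2 + (X*(1-X)*y1^2 - (1-2*X+X^2)*y1*y2 + X^2*y0^2 + X^2*y0*y1) * c2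
  rw [this, h2]; ring
lemma QQ_eval (P : ℕ) : (QQ P : K[X]).eval (1/9) = 64/81*(SS P 0 * SS P 2 - 1/2 * SS P 1^2) - 8/81 * (SS P 0 * SS P 1) - 1/18 * SS P 0^2 := by
  unfold QQ; simp only [eval_add, eval_sub, eval_mul, eval_pow, eval_neg, eval_C, eval_X, eval_one, eval_ofNat, yy_eval]; ring
lemma natDeg_yy (P j : ℕ) : (yy (P+1) j : K[X]).natDegree ≤ P := by
  rw [natDegree_le_iff_coeff_eq_zero]; intro N hN; rw [yy_coeff, if_neg (by omega)]
lemma natDeg_QQ (P : ℕ) : (QQ (P+1) : K[X]).natDegree ≤ 2*P+2 := by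
  have h0 := natDeg_yy (K := K) P 0
  have h1 := natDeg_yy (K := K) P 1
  have h2 := natDeg_yy (K := K) P 2
  have a1 : (1-2*X+X^2 : K[X]).natDegree ≤ 2 := by compute_degree
  have a2 : (-X+X^2 : K[X]).natDegree ≤ 2 := by compute_degree
  have a3 : (-(C (5/9) * X) + C (1/2) * X^2 : K[X]).natDegree ≤ 2 := by compute_degree
  unfold QQ
  refine natDegree_add_le_of_degree_le (natDegree_add_le_of_degree_le ?_ ?_) ?_
  · refine (natDegree_mul_le_of_le a1 (n := 2*P) ((natDegree_sub_le _ _).trans (max_le ?_ ?_))).trans (by omega)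
    · exact (natDegree_mul_le_of_le h0 h2).trans (by omega)
    · exact (natDegree_C_mul_le _ _).trans ((natDegree_pow_le_of_le 2 h1).trans (by omega))
  · exact (natDegree_mul_le_of_le a2 (natDegree_mul_le_of_le h0 h1)).trans (by omega)
  · exact (natDegree_mul_le_of_le a3 (natDegree_pow_le_of_le 2 h0)).trans (by omega)
lemma QQ_zero (P : ℕ) : (QQ P : K[X]).coeff 0 = 0 := by
  rw [coeff_zero_eq_eval_zero]
  have h : ∀ j, 0 < j → (yy P j : K[X]).eval 0 = 0 := fun j hj => by
    rw [← coeff_zero_eq_eval_zero, yy_coeff]; simp; intro _; left; omega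
  unfold QQ; simp [h]
lemma QQ_coeff (N n : ℕ) : (n:K) * (QQ (N+1) : K[X]).coeff n = ((N:K)+1)^3 * (v N * (if N+2 ≤ n ∧ n < 2*N+3 then v (n-(N+2)) else 0) - v (N+1) * (if N+1 ≤ n ∧ n < 2*N+2 then v (n-(N+1)) else 0)) := by
  have h := congrArg (fun f => f.coeff n) (QQ_der (K := K) N)
  rw [show ((N:K[X])+1)^3 = C (((N:K)+1)^3) by simp, coeff_C_mul, coeff_sub, coeff_C_mul, coeff_C_mul, coeff_mul_X_pow', coeff_mul_X_pow', yy_coeff, yy_coeff] at h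
  have e : (X * derivative (QQ (N+1) : K[X])).coeff n = (n:K) * (QQ (N+1) : K[X]).coeff n := by
    cases n with
    | zero => simp
    | succ n => rw [coeff_X_mul, coeff_derivative]; push_cast; ring
  rw [← e, h]
  congr 2
  · congr 1
    by_cases h1 : N+2 ≤ n <;> by_cases h2 : n < 2*N+3 <;> simp [h1, h2, show n-(N+2) < N+1 ↔ n < 2*N+3 by omega]
  · congr 1
    by_cases h1 : N+1 ≤ n <;> by_cases h2 : n < 2*N+2 <;> simp [h1, h2, show n-(N+1) < N+1 ↔ n < 2*N+2 by omega]
end Q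

lemma cg_pow9 (h3 : 3 < p) : Cg 1 ((1/9:ℚ_[p])^p) (1/9) := by
  have h : Cg 1 (((9:ℤ)^p : ℤ) : ℚ_[p]) ((9:ℤ):ℚ_[p]) := by
    apply cg_zmod; push_cast; exact ZMod.pow_card _
  push_cast at h
  have := (Cg.refl 1 (1:ℚ_[p])).div h Dv.one ((un9 h3).pow p) (un9 h3)
  rwa [div_pow, one_pow]

lemma Q_val (h3 : 3 < p) : Cg 3 ((QQ p : ℚ_[p][X]).eval (1/9)) (-(1/18)*(p:ℚ_[p])^2) := by
  obtain ⟨N, hN⟩ : ∃ N, p = N+1 := ⟨p-1, by omega⟩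
  have ec : (N:ℚ_[p]) + 1 = p := by exact_mod_cast hN.symm
  have hc : ∀ n : ℕ, (n:ℚ_[p]) * (QQ p : ℚ_[p][X]).coeff n = (p:ℚ_[p])^3 * (v N * (if N+2 ≤ n ∧ n < 2*N+3 then v (n-(N+2)) else 0) - v (N+1) * (if N+1 ≤ n ∧ n < 2*N+2 then v (n-(N+1)) else 0)) := by
    intro n; have := QQ_coeff (K := ℚ_[p]) N n; rw [ec] at this; rw [← this]; congr 3
  have hd : (QQ p : ℚ_[p][X]).natDegree < 2*p+1 := by
    have := natDeg_QQ (K := ℚ_[p]) N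
    rw [← hN] at this; omega
  have hpn := ppne (p := p)
  have u9 := (un_inv9 h3).dv
  have h9 := cg_pow9 h3
  have hvp := v_p h3
  have hv1 := v_pm1 h3
  have hNp : p - 1 = N := by omega
  rw [hNp] at hv1
  have c1 : (QQ p : ℚ_[p][X]).coeff p = -(p:ℚ_[p])^2 * v p := by
    have := hc p
    rw [if_neg (by omega), if_pos (by omega), ← hN, Nat.sub_self, v_zero] at this
    apply mul_left_cancel₀ hpn; rw [this]; ring
  have c2 : (QQ p : ℚ_[p][X]).coeff (2*p) = (p:ℚ_[p])^2 * (v N^2/2) := by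
    have := hc (2*p)
    rw [if_pos (by omega), if_neg (by omega), show 2*p-(N+2) = N by omega] at this
    push_cast at this
    apply mul_left_cancel₀ hpn; linear_combination (1/2)*this
  have c3 : ∀ n ∈ range (2*p+1), Cg 3 ((QQ p : ℚ_[p][X]).coeff n * (1/9)^n) ((if n = p then -(p:ℚ_[p])^2 * (5/81) else 0) + (if n = 2*p then (p:ℚ_[p])^2 * (1/162) else 0)) := by
    intro n hn; have hn' := mem_range.1 hn
    by_cases h1 : n = p
    · rw [if_pos h1, if_neg (by omega), h1, c1]
      have := hvp.mul h9 (dv_v h3 _) u9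
      unfold Cg at this
      exact cgd ((Dv.pp 2).neg.mul' this) (by ring)
    by_cases h2 : n = 2*p
    · rw [if_neg h1, if_pos h2, h2, c2]
      have := ((hv1.pow Dv.one 2).mul (h9.pow u9 2) ((dv_v h3 _).pow 2) (u9.pow 2)).mul_left (z := 1/2) (Dv.one.div (un2 h3))
      unfold Cg at this
      exact cgd ((Dv.pp 2).mul' this) (by rw [mul_comm 2 p, pow_mul]; ring)
    rw [if_neg h1, if_neg h2, add_zero]
    refine cgd (z := (QQ p : ℚ_[p][X]).coeff n * (1/9)^n) (Dv.mulr ?_ (u9.pow _)) (by ring)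
    by_cases h0 : n = 0
    · rw [h0, QQ_zero]; exact Dv.zero _
    have hu : Un (n:ℚ_[p]) := by
      apply Un.nat
      rintro ⟨c, hc⟩
      have : c < 3 := by
        by_contra hh
        have : p * 3 ≤ p * c := Nat.mul_le_mul_left _ (by omega)
        omega
      interval_cases c <;> omega
    apply Dv.of_mul (x := (n:ℚ_[p])) _ hu
    rw [hc]
    refine (Dv.pp 3).mulr (((dv_v h3 _).mul ?_).sub ((dv_v h3 _).mul ?_))
    · split_ifs; exact dv_v h3 _; exact Dv.zero _
    · split_ifs; exact dv_v h3 _; exact Dv.zero _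
  rw [eval_eq_sum_range' hd]
  have := Cg.sum c3
  rw [sum_add_distrib, sum_ite_eq' (range (2*p+1)) p, sum_ite_eq' (range (2*p+1)) (2*p), if_pos (mem_range.2 (by omega)), if_pos (mem_range.2 (by omega))] at this
  refine this.trans (Cg.of_eq (by ring))

/-- S0 * N -/
lemma S0N (h3 : 3 < p) : Cg 3 (SS p 0 * (16 * SS p 2 - SS p 0) : ℚ_[p]) (-(p:ℚ_[p])^2) := by
  obtain ⟨q, m, e, h⟩ := Shp.ex (p := p) h3
  have h1 := Q_val h3
  rw [QQ_eval] at h1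
  have h2 : Cg 3 (8 * SS p 1 + SS p 0 : ℚ_[p]) ((e:ℚ_[p])*(p:ℚ_[p])) := by
    have h2 := R1_val h3 h
    have d : Dv 3 (22/3*(p:ℚ_[p])^3*((seqU (p-3):ℚ):ℚ_[p])) := by
      have h4 := (U_H2 h3 h).dv (s := 0) (by omega) (((Dv.one.div (un3 h3)).mul h.de).mul (dv_HH 2 (by have := h.lt h3; omega)))
      exact (((Dv.ofNat 22).div (un3 h3)).mul (Dv.pp 3)).mulr h4
    unfold Cg at h2
    exact cgd ((h2.mono (by omega : 3 ≤ 4)).sub d) (by ring)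
  have h4 := h2.pow (h.de.mul (Dv.nat _)) 2
  unfold Cg at h1 h4
  have u8 : Un (8:ℚ_[p]) := by have := (un2 h3).mul (un4 h3); norm_num at this; exact this
  refine cgd ((((Dv.ofNat 81).div (un4 h3)).mul h1).add ((Dv.one.div u8).mul h4)) ?_
  have := h.e2
  linear_combination (1/8*(p:ℚ_[p])^2)*this
end S19

set_option linter.unusedSectionVars false
set_option linter.unusedSimpArgs false
namespace S19
open Finset Polynomial

section gen
variable {K : Type*} [Field K] [CharZero K]
noncomputable def MM (s a c u : K) (F : K[X]) : K[X] :=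
  (th (th (th F)) - C (3*s) * th (th F) + C (3*s^2) * th F - C (s^3) * F)
  - X * (C 2 * (th (th (th F)) - C (3*a) * th (th F) + C (3*a^2-c) * th F - C (a^3-a*c) * F))
  + X * (X * (th (th (th F)) - C (3*u) * th (th F) + C (3*u^2) * th F - C (u^3) * F))
lemma Lg_MM (f0 f1 f2 : K → K) (s a c u : K) (h0 : ∀ i, f0 i = 27*(i-s)^3) (h1 : ∀ i, f1 i = 27*(2*((i-a)^3-c*(i-a))))
   (h2 : ∀ i, f2 i = 27*(i-u)^3) (F : K[X]) : Lg f0 f1 f2 F = C 27 * MM s a c u F := by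
  ext k
  rw [Lg_coeff, coeff_C_mul]
  unfold MM
  rcases k with _ | _ | k
  · simp only [coeff_add, coeff_sub, coeff_X_mul_zero, coeff_C_mul, th_coeff]; simp [h0]; ring
  · simp only [coeff_add, coeff_sub, coeff_X_mul, coeff_C_mul, th_coeff, coeff_X_mul_zero]
    simp [h0, h1, th_coeff]; ring
  · simp only [coeff_add, coeff_sub, coeff_X_mul, coeff_C_mul, th_coeff]
    simp [h0, h1, h2]
    ring
lemma th_sub (F G : K[X]) : th (F-G) = th F - th G := by unfold th; simp; ring
lemma th_C (a : K) : th (C a) = 0 := by simp [th]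
lemma th_Cmul (a : K) (F : K[X]) : th (C a * F) = C a * th F := by rw [th_mul, th_C]; ring
lemma th_sq (F : K[X]) : th (F^2) = 2 * F * th F := by rw [pow_two, th_mul]; ring
lemma MM_add (s a c u : K) (F G : K[X]) : MM s a c u (F+G) = MM s a c u F + MM s a c u G := by
  unfold MM; simp only [th_add]; ring
lemma MM_C (s a c u b : K) (F : K[X]) : MM s a c u (C b * F) = C b * MM s a c u F := by
  unfold MM; simp only [th_Cmul]; ring
lemma MM_sub (s a c u : K) (F G : K[X]) : MM s a c u (F-G) = MM s a c u F - MM s a c u G := by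
  unfold MM; simp only [th_sub]; ring

noncomputable def fc (m b c : K) (k : ℕ) : K := ∏ j ∈ range k, ((j:K)-m)*((j:K)-m+b)/(((j:K)+1+c)*((j:K)+1))
noncomputable def ff (m : ℕ) (b c : K) : K[X] := ∑ k ∈ range (m+1), C (fc (m:K) b c k) * X^k
lemma fc_zero (m b c : K) : fc m b c 0 = 1 := by simp [fc]
lemma fc_succ (m b c : K) (k : ℕ) : fc m b c (k+1) = fc m b c k * (((k:K)-m)*((k:K)-m+b)/(((k:K)+1+c)*((k:K)+1))) := prod_range_succ _ _
lemma fc_top (m : ℕ) (b c : K) {k : ℕ} (h : m < k) : fc (m:K) b c k = 0 := by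
  unfold fc
  exact prod_eq_zero (mem_range.2 h) (by simp)
lemma ff_coeff (m : ℕ) (b c : K) (k : ℕ) : (ff m b c).coeff k = fc (m:K) b c k := by
  unfold ff
  rw [finsetSum_coeff]
  simp only [coeff_C_mul, coeff_X_pow, mul_ite, mul_one, mul_zero]
  rw [sum_ite_eq]
  split_ifs with h
  · rfl
  · rw [fc_top]; simpa using h
lemma ff_ode (m : ℕ) (b c : K) (hc : ∀ k : ℕ, k < m → (k:K)+1+c ≠ 0) :
   th (th (ff m b c)) + C c * th (ff m b c) = X * (th (th (ff m b c)) - C (2*m-b) * th (ff m b c) + C (m*(m-b)) * ff m b c) := by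
  ext k
  rcases k with _ | k
  · simp [th_coeff]
  · simp only [coeff_add, coeff_sub, coeff_X_mul, coeff_C_mul, th_coeff, ff_coeff]
    rcases lt_or_ge k m with h | h
    · rw [fc_succ]
      have h1 := hc k h
      have h2 : (k:K)+1 ≠ 0 := by exact_mod_cast Nat.succ_ne_zero k
      push_cast
      field_simp
      ring
    · rw [fc_top m b c (k := k+1) (by omega)]
      rcases h.eq_or_lt with rfl | h
      · ring
      · rw [fc_top m b c h]; ring
lemma ff_ode1 (m : ℕ) (b c : K) (hc : ∀ k : ℕ, k < m → (k:K)+1+c ≠ 0) :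
   th (th (th (ff m b c))) + C c * th (th (ff m b c)) = X * (th (th (ff m b c)) - C (2*m-b) * th (ff m b c) + C (m*(m-b)) * ff m b c)
    + X * (th (th (th (ff m b c))) - C (2*m-b) * th (th (ff m b c)) + C (m*(m-b)) * th (ff m b c)) := by
  have := congrArg th (ff_ode m b c hc)
  simpa only [th_add, th_sub, th_mul, th_X, th_C, zero_mul, zero_add] using this
lemma E1_eq (m : ℕ) (e : K) (hc : ∀ k : ℕ, k < m → (k:K)+1-3*e ≠ 0) :
    MM (3*e) (m+2*e) ((m-e)*(m+1-e)) (2*m+e) (ff m (-e) (-3*e) ^ 2) =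
      C (e^2) * ((1-X)*(9-X)*th (ff m (-e) (-3*e) ^ 2) + (2*C (m:K)*X*(9-X)+4*X) * ff m (-e) (-3*e) ^ 2) - C (e^3) * ((27-12*X+X^2) * ff m (-e) (-3*e) ^ 2) := by
  have hc' : ∀ k : ℕ, k < m → (k:K)+1+(-3*e) ≠ 0 := fun k hk => by have := hc k hk; rwa [neg_mul, ← sub_eq_add_neg]
  have o := ff_ode m (-e) (-3*e) hc'
  have o1 := ff_ode1 m (-e) (-3*e) hc'
  set y := ff m (-e) (-3*e)
  unfold MM
  simp only [th_sq, th_mul, th_add, show th (2:K[X]) = 0 from th_nat 2, zero_mul, zero_add]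
  generalize th (th (th y)) = y3 at *
  generalize th (th y) = y2 at *
  generalize th y = y1 at *
  simp only [C_add, C_sub, C_mul, C_pow, C_neg, C_1, show (C 2 : K[X]) = 2 from rfl, show (C 3 : K[X]) = 3 from rfl] at *
  generalize (C e : K[X]) = E at *
  generalize (C (m:K) : K[X]) = m at *
  linear_combination (2*(1-X)*y)*o1 + (6*(1-X)*y1+4*(-3*E+X*(2*m+E))*y+2*X*y)*o
end gen
end S19

set_option linter.unusedSectionVars false
set_option linter.unusedSimpArgs false
namespace S19
open Finset Polynomial

section gen
variable {K : Type*} [Field K] [CharZero K]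
noncomputable def G1 (m : ℕ) (e : K) (i : K) : K := 27*(2*((i-(m+2*e))^3-((m-e)*(m+1-e))*(i-(m+2*e))))
noncomputable def G2 (m : ℕ) (e : K) (i : K) : K := 27*(i-(2*m+e))^3
noncomputable def G0 (e : K) (i : K) : K := 27*(i-3*e)^3
noncomputable def MP (m : ℕ) (e : K) (F : K[X]) : K[X] := MM (3*e) (m+2*e) ((m-e)*(m+1-e)) (2*m+e) F
lemma Lg_MP (m : ℕ) (e : K) (F : K[X]) : Lg (G0 e) (G1 m e) (G2 m e) F = C 27 * MP m e F :=
  Lg_MM _ _ _ _ _ _ _ (fun _ => rfl) (fun _ => rfl) (fun _ => rfl) F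
lemma LgA {P m : ℕ} (hm : P = 3*m+1) : (a0 P : K → K) = G0 ((P:K)/3) ∧ (a1 P : K → K) = G1 m ((P:K)/3) ∧ (a2 P : K → K) = G2 m ((P:K)/3) := by
  refine ⟨?_, ?_, ?_⟩ <;> funext i
  · unfold a0 G0; ring
  · unfold a1 G1; rw [hm]; push_cast; ring
  · unfold a2 G2; rw [hm]; push_cast; ring
lemma LgC {P m : ℕ} (hm : P = 3*m+2) : (a0 P : K → K) = G0 ((P:K)/3) ∧ (c1 P : K → K) = G1 m ((P:K)/3) ∧ (c2 P : K → K) = G2 m ((P:K)/3) := by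
  refine ⟨?_, ?_, ?_⟩ <;> funext i
  · unfold a0 G0; ring
  · unfold c1 G1; rw [hm]; push_cast; ring
  · unfold c2 G2; rw [hm]; push_cast; ring
/-- terminating Chu–Vandermonde -/
lemma vander (m : ℕ) : ∀ (B c : K), (∀ k : ℕ, k < m → (k:K)+1+c ≠ 0) →
   ∑ k ∈ range (m+1), ∏ j ∈ range k, ((j:K)-m)*((j:K)+B)/(((j:K)+1+c)*((j:K)+1)) = ∏ j ∈ range m, ((j:K)+1+c-B)/((j:K)+1+c) := by
  induction m with
  | zero => intro B c _; simp
  | succ m ih =>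
    intro B c hc
    have i1 := ih B c (fun k hk => hc k (by omega))
    have i2 := ih (B+1) (c+1) (fun k hk => by have := hc (k+1) (by omega); push_cast at this; convert this using 1; ring)
    have c0 : 1 + c ≠ 0 := by simpa using hc 0 (by omega)
    -- the contiguous relation termwise
    have key : ∀ k : ℕ, ∏ j ∈ range (k+1), ((j:K)-(m+1:ℕ))*((j:K)+B)/(((j:K)+1+c)*((j:K)+1)) = 
        ∏ j ∈ range (k+1), ((j:K)-m)*((j:K)+B)/(((j:K)+1+c)*((j:K)+1)) - B/(1+c) * ∏ j ∈ range k, ((j:K)-m)*((j:K)+(B+1))/(((j:K)+1+(c+1))*((j:K)+1)) := by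
      intro k
      simp only [prod_div_distrib, prod_mul_distrib]
      have e1 : ∏ j ∈ range (k+1), ((j:K)-(m+1:ℕ)) = (-(m:K)-1) * ∏ j ∈ range k, ((j:K)-m) := by
        rw [prod_range_succ']; push_cast
        rw [mul_comm]; congr 1
        · ring
        · apply prod_congr rfl; intro j _; ring
      have e2 : ∏ j ∈ range (k+1), ((j:K)+B) = B * ∏ j ∈ range k, ((j:K)+(B+1)) := by
        rw [prod_range_succ']; push_cast
        rw [mul_comm]; congr 1
        · ring
        · apply prod_congr rfl; intro j _; ring
      have e3 : ∏ j ∈ range (k+1), ((j:K)+1+c) = (1+c) * ∏ j ∈ range k, ((j:K)+1+(c+1)) := by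
        rw [prod_range_succ']; push_cast
        rw [mul_comm]; congr 1
        · ring
        · apply prod_congr rfl; intro j _; ring
      rw [e1, e2, e3, prod_range_succ (fun j : ℕ => (j:K)-m), prod_range_succ (fun j : ℕ => (j:K)+1)]
      have k0 : (k:K)+1 ≠ 0 := by exact_mod_cast Nat.succ_ne_zero k
      have p0 : ∏ j ∈ range k, ((j:K)+1) ≠ 0 := prod_ne_zero_iff.2 (fun j _ => by exact_mod_cast Nat.succ_ne_zero j)
      by_cases hq : ∏ j ∈ range k, ((j:K)+1+(c+1)) = 0
      · rw [hq]; simp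
      · field_simp; ring
    rw [sum_range_succ', sum_congr rfl (fun k _ => key k), sum_sub_distrib, ← mul_sum, i2]
    have e : ∑ k ∈ range (m+1), ∏ j ∈ range (k+1), ((j:K)-m)*((j:K)+B)/(((j:K)+1+c)*((j:K)+1)) + 1
        = ∏ j ∈ range m, ((j:K)+1+c-B)/((j:K)+1+c) := by
      rw [← i1, sum_range_succ, prod_range_succ, sum_range_succ']; simp
    rw [prod_range_zero]
    have g1 : ∏ j ∈ range m, ((j:K)+1+(c+1)-(B+1))/((j:K)+1+(c+1)) = (∏ j ∈ range m, ((j:K)+1+c-B)/((j:K)+1+c)) * ((1+c)/((m:K)+1+c)) := by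
      have hx : ∏ j ∈ range m, ((j:K)+1+(c+1)) = (∏ j ∈ range m, ((j:K)+1+c)) * (((m:K)+1+c)/(1+c)) := by
        have h1 : ∏ j ∈ range (m+1), ((j:K)+1+c) = (1+c) * ∏ j ∈ range m, ((j:K)+1+(c+1)) := by
          rw [prod_range_succ']; push_cast
          rw [mul_comm]; congr 1
          · ring
          · apply prod_congr rfl; intro j _; ring
        rw [prod_range_succ] at h1
        field_simp; rw [h1]; ring
      simp only [prod_div_distrib]
      rw [hx, prod_congr rfl (fun (j:ℕ) _ => show (j:K)+1+(c+1)-(B+1) = (j:K)+1+c-B by ring)]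
      have : (m:K)+1+c ≠ 0 := hc m (by omega)
      by_cases hq : ∏ j ∈ range m, ((j:K)+1+c) = 0
      · rw [hq]; simp
      · field_simp
    rw [g1, prod_range_succ]
    have : (m:K)+1+c ≠ 0 := hc m (by omega)
    rw [show ∀ a b d : K, a - b + d = (a + d) - b by intros; ring, e]
    field_simp
lemma ff_eval (m : ℕ) (b c : K) (hc : ∀ k : ℕ, k < m → (k:K)+1+c ≠ 0) :
   (ff m b c).eval 1 = ∏ j ∈ range m, ((j:K)+1+m+c-b)/((j:K)+1+c) := by
  have := vander m (b-m) c hc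
  unfold ff fc
  rw [eval_finset_sum]
  simp only [eval_mul, eval_C, eval_pow, eval_X, one_pow, mul_one]
  convert this using 1
  · apply sum_congr rfl; intro k _; apply prod_congr rfl; intro j _; congr 2; ring
  · apply prod_congr rfl; intro j _; congr 1; ring
/-- product family -/
lemma K_eq (m : ℕ) (h : K) (hc : ∀ k : ℕ, k < m → (k:K)+1+h ≠ 0) (hc' : ∀ k : ℕ, k < m → (k:K)+1-h ≠ 0) :
    MM 0 (m:K) (m*(m+1)) (2*m) (ff m h h * ff m (-h) (-h)) =
      C (h^2) * ((1-X)*((1-X)*th (ff m h h * ff m (-h) (-h)) + 2*C (m:K)*X*(ff m h h * ff m (-h) (-h)))) := by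
  have o := ff_ode m h h hc
  have o1 := ff_ode1 m h h hc
  have r := ff_ode m (-h) (-h) (fun k hk => by have := hc' k hk; rwa [← sub_eq_add_neg])
  have r1 := ff_ode1 m (-h) (-h) (fun k hk => by have := hc' k hk; rwa [← sub_eq_add_neg])
  set y := ff m h h
  set z := ff m (-h) (-h)
  unfold MM
  simp only [th_mul, th_add]
  generalize th (th (th y)) = y3 at *
  generalize th (th y) = y2 at *
  generalize th y = y1 at *
  generalize th (th (th z)) = z3 at *
  generalize th (th z) = z2 at *
  generalize th z = z1 at *
  simp only [C_add, C_sub, C_mul, C_pow, C_neg, C_1, C_0, show (C 2 : K[X]) = 2 from rfl, show (C 3 : K[X]) = 3 from rfl] at *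
  generalize (C h : K[X]) = h at *
  generalize (C (m:K) : K[X]) = m at *
  linear_combination (1-X)*z*o1 + (1-X)*y*r1 + ((6*m*X+X-h*(1-X)-2*m*X)*z+3*(1-X)*z1)*o + ((6*m*X+X+h*(1-X)-2*m*X)*y+3*(1-X)*y1)*r
end gen
end S19

set_option linter.unusedSectionVars false
set_option linter.unusedSimpArgs false
namespace S19
open Finset Polynomial
variable {p : ℕ} [hp : Fact p.Prime]

lemma PD.th {r : ℕ} {F : ℚ_[p][X]} (h : PD r F) : PD r (th F) := fun i => by
  rw [th_coeff]; exact Dv.mul (Dv.nat i) (h i)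
lemma PD.Cm {r : ℕ} {a : ℚ_[p]} {F : ℚ_[p][X]} (ha : Dv 0 a) (h : PD r F) : PD r (Polynomial.C a * F) := PD.mul (PD.C ha) h
lemma PD.MM {r : ℕ} {F : ℚ_[p][X]} {s a c u : ℚ_[p]} (hs : Dv 0 s) (ha : Dv 0 a) (hc : Dv 0 c) (hu : Dv 0 u) (h : PD r F) : PD r (MM s a c u F) := by
  have d3 : Dv 0 (3:ℚ_[p]) := Dv.ofNat 3
  have hs2 : Dv 0 (s^2) := by simpa [pow_two] using hs.mul hs
  have ha2 : Dv 0 (a^2) := by simpa [pow_two] using ha.mul ha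
  have hu2 : Dv 0 (u^2) := by simpa [pow_two] using hu.mul hu
  have hs3 : Dv 0 (s^3) := by rw [pow_succ]; exact hs2.mul hs
  have ha3 : Dv 0 (a^3) := by rw [pow_succ]; exact ha2.mul ha
  have hu3 : Dv 0 (u^3) := by rw [pow_succ]; exact hu2.mul hu
  unfold S19.MM
  refine PD.add (PD.sub (PD.sub (PD.add (PD.sub h.th.th.th ?_) ?_) ?_) (PD.X.mul (PD.Cm (Dv.ofNat 2) (PD.sub (PD.add (PD.sub h.th.th.th ?_) ?_) ?_)))) (PD.X.mul (PD.X.mul (PD.sub (PD.add (PD.sub h.th.th.th ?_) ?_) ?_)))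
  · exact PD.Cm (d3.mul hs) h.th.th
  · exact PD.Cm (d3.mul hs2) h.th
  · exact PD.Cm hs3 h
  · exact PD.Cm (d3.mul ha) h.th.th
  · exact PD.Cm ((d3.mul ha2).sub hc) h.th
  · exact PD.Cm (ha3.sub (ha.mul hc)) h
  · exact PD.Cm (d3.mul hu) h.th.th
  · exact PD.Cm (d3.mul hu2) h.th
  · exact PD.Cm hu3 h
lemma PD_ff {m : ℕ} (hm : m < p) {b c : ℚ_[p]} (hb : Dv 0 b) (hc : ∀ k : ℕ, k < m → Un ((k:ℚ_[p])+1+c)) : PD 0 (ff m b c) := by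
  intro k
  rw [ff_coeff]
  rcases lt_or_ge m k with h | h
  · rw [fc_top m b c h]; exact Dv.zero 0
  · unfold fc
    refine Dv.prod (fun j hj => ?_)
    have hj := mem_range.1 hj
    have hU : Un (((j:ℚ_[p])+1+c)*((j:ℚ_[p])+1)) := (hc j (by omega)).mul (by
      have := un_of_lt (p := p) (n := j+1) (by omega) (by omega); simpa using this)
    rw [div_eq_mul_inv]
    refine Dv.mul (Dv.mul ?_ ?_) hU.dvi
    · exact (Dv.nat j).sub (Dv.nat m)
    · exact ((Dv.nat j).sub (Dv.nat m)).add hb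
lemma ff_deg {K : Type*} [Field K] [CharZero K] (m : ℕ) (b c : K) : (ff m b c).natDegree ≤ m := by
  rw [natDegree_le_iff_coeff_eq_zero]
  intro k hk
  rw [ff_coeff, fc_top m b c hk]
lemma ep0 (h3 : 3 < p) : Dv 0 ((p:ℚ_[p])/3) := (eps_dv h3).mono (by omega)
lemma un_kp {k : ℕ} (hk : k + 1 < p) : Un ((k:ℚ_[p])+1+(-3*((p:ℚ_[p])/3))) := by
  have := (un_of_lt (p := p) (n := p-(k+1)) (by omega) (by omega)).neg
  rw [Nat.cast_sub hk.le] at this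
  convert this using 1; push_cast; ring
lemma fwdMP (h3 : 3 < p) {m r : ℕ} (hm : 2*m < p) {d : ℚ_[p][X]} (h0 : Dv r (d.coeff 0))
   (hL : ∀ k ≤ 2*m, Dv r ((MP m ((p:ℚ_[p])/3) d).coeff k)) (ht : ∀ k, 2*m < k → Dv r (d.coeff k)) : PD r d := by
  intro k
  rcases lt_or_ge (2*m) k with h | h
  · exact ht k h
  have he := ep0 (p := p) h3
  refine rec_fwd (f0 := G0 ((p:ℚ_[p])/3)) (f1 := G1 m ((p:ℚ_[p])/3)) (f2 := G2 m ((p:ℚ_[p])/3)) (N := 2*m) h0 ?_ ?_ ?_ ?_ k h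
  · intro k
    unfold G1
    have hx : Dv 0 ((k:ℚ_[p])-((m:ℚ_[p])+2*((p:ℚ_[p])/3))) := (Dv.nat k).sub ((Dv.nat m).add ((Dv.ofNat 2).mul he))
    refine (Dv.ofNat 27).mul ((Dv.ofNat 2).mul (Dv.sub ?_ (Dv.mul (Dv.mul ((Dv.nat m).sub he) (((Dv.nat m).add Dv.one).sub he)) hx)))
    rw [pow_succ, pow_two]; exact (hx.mul hx).mul hx
  · intro k
    unfold G2
    have hx : Dv 0 ((k:ℚ_[p])-(2*(m:ℚ_[p])+((p:ℚ_[p])/3))) := (Dv.nat k).sub (((Dv.ofNat 2).mul (Dv.nat m)).add he)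
    refine (Dv.ofNat 27).mul ?_
    rw [pow_succ, pow_two]; exact (hx.mul hx).mul hx
  · intro k h1 h2
    have := un_a0 h3 h1 (show k < p by omega)
    convert this using 1
    unfold a0 G0; ring
  · intro k hk
    rw [Lg_MP, coeff_C_mul]
    exact (Dv.ofNat 27).mul (hL k hk)
lemma MP_sub {K : Type*} [Field K] [CharZero K] (m : ℕ) (e : K) (F G : K[X]) : MP m e (F-G) = MP m e F - MP m e G := MM_sub _ _ _ _ _ _
lemma MP_add {K : Type*} [Field K] [CharZero K] (m : ℕ) (e : K) (F G : K[X]) : MP m e (F+G) = MP m e F + MP m e G := MM_add _ _ _ _ _ _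
lemma MP_C {K : Type*} [Field K] [CharZero K] (m : ℕ) (e b : K) (F : K[X]) : MP m e (C b * F) = C b * MP m e F := MM_C _ _ _ _ _ _
lemma PD_MP (h3 : 3 < p) {m r : ℕ} {F : ℚ_[p][X]} (h : PD r F) : PD r (MP m ((p:ℚ_[p])/3) F) := by
  have he := ep0 (p := p) h3
  exact PD.MM ((Dv.ofNat 3).mul he) ((Dv.nat m).add ((Dv.ofNat 2).mul he)) (((Dv.nat m).sub he).mul (((Dv.nat m).add Dv.one).sub he)) (((Dv.ofNat 2).mul (Dv.nat m)).add he) h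
lemma PD_MP_of (h3 : 3 < p) {m r : ℕ} {F : ℚ_[p][X]} (h : PD r (C 27 * MP m ((p:ℚ_[p])/3) F)) : PD r (MP m ((p:ℚ_[p])/3) F) := by
  intro k
  have := h k
  rw [coeff_C_mul] at this
  exact Dv.of_mul this (un27 h3)
lemma tri_MP1 {m : ℕ} (hm : p = 3*m+1) (h3 : 3 < p) : PD 3 (MP m ((p:ℚ_[p])/3) (tA (NN p : ℚ_[p][X]))) := by
  have := (tri_rec h3).1
  rw [(LgA hm).1, (LgA hm).2.1, (LgA hm).2.2, Lg_MP] at this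
  exact PD_MP_of h3 this
lemma tri_MP2 {m : ℕ} (hm : p = 3*m+2) (h3 : 3 < p) : PD 3 (MP m ((p:ℚ_[p])/3) (tC (NN p : ℚ_[p][X]))) := by
  have := (tri_rec h3).2
  rw [(LgC hm).1, (LgC hm).2.1, (LgC hm).2.2, Lg_MP] at this
  exact PD_MP_of h3 this
lemma PD_E1 {m : ℕ} (hm : m < p) (h3 : 3 < p) : PD 0 (ff m (-((p:ℚ_[p])/3)) (-3*((p:ℚ_[p])/3))) := 
  PD_ff hm (ep0 h3).neg (fun k hk => un_kp (by omega))
lemma ffsq_top {K : Type*} [Field K] [CharZero K] (m : ℕ) (b c b' c' : K) {k : ℕ} (hk : 2*m < k) : (ff m b c * ff m b' c').coeff k = 0 := by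
  apply coeff_eq_zero_of_natDegree_lt
  have := natDegree_mul_le (p := ff m b c) (q := ff m b' c')
  have := ff_deg m b c
  have := ff_deg m b' c'
  omega
lemma ff_c0 {K : Type*} [Field K] [CharZero K] (m : ℕ) (b c : K) : (ff m b c).coeff 0 = 1 := by rw [ff_coeff, fc_zero]
lemma block2 {m : ℕ} (hm : p = 3*m+2) (h3 : 3 < p) : Cg 2 ((tC (NN p : ℚ_[p][X])).eval 1)
    (2 * v (p-1) * (∏ j ∈ range m, ((j:ℚ_[p])+1+m-2*((p:ℚ_[p])/3))/((j:ℚ_[p])+1-p))^2) := by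
  have hc : ∀ k : ℕ, k < m → (k:ℚ_[p])+1-3*((p:ℚ_[p])/3) ≠ 0 := fun k hk => by
    have := (un_kp (p := p) (k := k) (by omega)).ne; rw [neg_mul] at this; rwa [sub_eq_add_neg]
  have hE := E1_eq m ((p:ℚ_[p])/3) hc
  have hP := PD_E1 (p := p) (m := m) (by omega) h3
  have hev := ff_eval m (-((p:ℚ_[p])/3)) (-3*((p:ℚ_[p])/3)) (fun k hk => (un_kp (p := p) (k := k) (by omega)).ne)
  set φ := ff m (-((p:ℚ_[p])/3)) (-3*((p:ℚ_[p])/3)) with hφ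
  have he1 := eps_dv (p := p) h3
  have he := ep0 (p := p) h3
  have hP2 : PD 0 (φ^2) := hP.pow 2
  have key : PD 2 (MP m ((p:ℚ_[p])/3) (φ^2)) := by
    unfold MP
    rw [hE]
    refine PD.sub (PD.mulr (PD.C ?_) ?_) (PD.mulr (PD.C ?_) ?_)
    · rw [pow_two]; exact he1.mul' he1
    · have o9 : PD 0 (9 - X : ℚ_[p][X]) := (PD.ofNat 9).sub PD.X
      refine PD.add ((PD.omX.mul o9).mul hP2.th) (PD.mul (PD.add (((PD.mul (PD.ofNat 2) (PD.C (Dv.nat m))).mul PD.X).mul o9) ((PD.ofNat 4).mul PD.X)) hP2)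
    · rw [pow_succ, pow_two]; exact ((he1.mul' he1).mul' he1).mono (by omega)
    · exact PD.mul (((PD.ofNat 27).sub ((PD.ofNat 12).mul PD.X)).add (PD.X.pow 2)) hP2
  have hd : PD 2 (tC (NN p : ℚ_[p][X]) - C (2 * v (p-1)) * φ^2) := by
    refine fwdMP h3 (m := m) (by omega) ?_ (fun k _ => ?_) (fun k hk => ?_)
    · have h1 := (NN_c0_2 (K := ℚ_[p]) m).2.2
      rw [← hm, show 3*m+1 = p-1 by omega] at h1
      rw [coeff_sub, h1, coeff_C_mul, pow_two, mul_coeff_zero, hφ, ff_c0]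
      simpa using Dv.zero 2
    · rw [MP_sub, MP_C]
      refine PD.sub (fun k => (tri_MP2 hm h3 k).mono (by omega)) (PD.Cm ((Dv.ofNat 2).mul (dv_v h3 _)) key) k
    · rw [coeff_sub, coeff_C_mul, pow_two, hφ, ffsq_top _ _ _ _ _ hk, mul_zero, sub_zero]
      exact (C_top hm h3 hk).mono (by omega)
  have := hd.eval (x := 1) Dv.one
  rw [eval_sub, eval_mul, eval_C, eval_pow, hev] at this
  unfold Cg
  convert this using 4
  apply prod_congr rfl; intro j _
  congr 1 <;> ring
end S19

set_option linter.unusedSectionVars false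
set_option linter.unusedSimpArgs false
namespace S19
open Finset Polynomial
section gen
variable {K : Type*} [Field K] [CharZero K]
noncomputable def fz (N : ℕ) (x z : K) : K := ∑ k ∈ range N, pt x k / (k.factorial:K)^2 * (z/((k:K)+z))
lemma pt_ut (x : K) (k : ℕ) : x * pt x k = (x+k) * ut x k ∧ x * pt (x-1) k = (x-k) * ut x k := by
  induction k with
  | zero => simp [pt, ut]
  | succ k ih =>
    rw [pt_succ, pt_succ]
    have : ut x (k+1) = ut x k * ((k:K)^2-x^2) := by unfold ut; rw [prod_range_succ]
    rw [this]; push_cast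
    constructor
    · linear_combination ((k:K)-x)*((k:K)+x+1)*ih.1
    · linear_combination ((k:K)-(x-1))*((k:K)+(x-1)+1)*ih.2
lemma fz_diff {x z : K} (hx : x ≠ 0) (N : ℕ) (hz : ∀ k : ℕ, k ≤ N → (k:K)+z ≠ 0) :
    (x+z) * fz (N+1) x z - (x-z) * fz (N+1) (x-1) z = 2 * z * qf x N := by
  unfold fz
  rw [← sum_ut, mul_sum, mul_sum, mul_sum, ← sum_sub_distrib]
  apply sum_congr rfl; intro k hk
  have hz := hz k (by have := mem_range.1 hk; omega)
  obtain ⟨h1, h2⟩ := pt_ut x k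
  have h3 := pow_ne_zero 2 (fne (K := K) k)
  rw [show pt x k = (x+k) * ut x k / x by rw [← h1]; field_simp, show pt (x-1) k = (x-k) * ut x k / x by rw [← h2]; field_simp]
  field_simp; ring
end gen
variable {p : ℕ} [hp : Fact p.Prime]
lemma un_kz {k : ℕ} (h0 : 0 < k) (hk : k < p) {z : ℚ_[p]} (hz : Dv 1 z) : Un ((k:ℚ_[p])+z) :=
  Un.of_sub (un_of_lt h0 hk) (by rw [show (k:ℚ_[p]) - (k + z) = -z by ring]; exact hz.neg) 
/-- `v (p-1)` as a value of `fz` -/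
lemma v_fz (h3 : 3 < p) {q m : ℕ} {e : ℚ} (h : Shp p q m e) : Cg 3 (v (p-1) : ℚ_[p]) (fz p ((m:ℚ_[p])-(p:ℚ_[p])/3) (p:ℚ_[p])) := by
  have h0 : (v (p-1) : ℚ_[p]) = ∑ k ∈ range p, cc k * (pt (-(p:ℚ_[p])) k / ((k.factorial:ℕ):ℚ_[p])^2) := by
    rw [v_eq (N := p-1) le_rfl, Nat.sub_add_cancel (by omega)]
    apply sum_congr rfl; intro k _
    rw [mul_right_comm, pt_w, Nat.cast_sub (by omega), ← pt_refl, ga]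
    rw [show -1 - ((p:ℚ_[p]) - (1:ℕ)) = -(p:ℚ_[p]) by push_cast; ring]; ring
  rw [h0]; unfold fz
  refine Cg.sum (fun k hk => ?_)
  have hk := mem_range.1 hk
  rw [h.pt, ← cc_pt]
  refine Cg.mul_left ?_ (dv_cc h3 k)
  rcases k with _ | k
  · simp only [pt_zero]; push_cast
    rw [zero_add, div_self (ppne)]; simp [Cg.refl]
  · have hq := (qf_exp (p := p) (x := p) Dv.p1 (k := k) (by omega))
    have hU := un_of_lt (p := p) (n := k+1) (by omega) hk
    have hU2 := un_kz (p := p) (k := k+1) (by omega) hk (Dv.p1)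
    rw [pt_shift]
    set s := ((k+1:ℕ):ℚ_[p]) with hs
    have e1 : (p:ℚ_[p]) * ((k:ℚ_[p])+1-p) * pf (p:ℚ_[p]) k / (((k+1).factorial:ℕ):ℚ_[p])^2 = (p:ℚ_[p]) * (s-(p:ℚ_[p]))/s^2 * qf (p:ℚ_[p]) k := by
      rw [qf, Nat.factorial_succ, Nat.cast_mul, ← hs, show (k:ℚ_[p])+1 = s by rw [hs]; push_cast; ring]
      have := hU.ne; have := fne (K := ℚ_[p]) k
      field_simp
    rw [e1]
    have d1 : Dv 1 ((p:ℚ_[p]) * (s-(p:ℚ_[p]))/s^2) := (Dv.p1.mulr ((Dv.nat _).sub (Dv.nat p))).div (hU.pow 2)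
    have c1 : Cg 3 ((p:ℚ_[p]) * (s-(p:ℚ_[p]))/s^2 * qf (p:ℚ_[p]) k) ((p:ℚ_[p]) * (s-(p:ℚ_[p]))/s^2) := by
      have : Cg 2 (qf (p:ℚ_[p]) k) 1 := (hq.mono (by omega)).trans (cgd (z := -((p:ℚ_[p])^2 * HH 2 k)) ((Dv.pp 2).mulr (dv_HH 2 (by omega))).neg (by ring))
      refine cgd (d1.mul' this) ?_
      ring
    refine c1.trans ?_
    refine cgd (z := (p:ℚ_[p])^3 * (-1/(s^2*(s+(p:ℚ_[p]))))) ((Dv.pp 3).mulr (Dv.div Dv.one.neg ((hU.pow 2).mul hU2))) ?_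
    have := hU.ne; have := hU2.ne
    field_simp; ring
lemma dv_fz (h3 : 3 < p) {x : ℚ_[p]} (hx : Dv 0 x) : Dv 0 (fz p x (p:ℚ_[p])) := by
  unfold fz
  refine Dv.sum (fun k hk => ?_)
  have hk := mem_range.1 hk
  refine Dv.mul (Dv.div ?_ ((un_fact hk).pow 2)) ?_
  · unfold pt; refine Dv.prod (fun j _ => ((Dv.nat j).sub hx).mul (((Dv.nat j).add hx).add Dv.one))
  · rcases Nat.eq_zero_or_pos k with rfl | h
    · simp only [Nat.cast_zero, zero_add]; rw [div_self ppne]; exact Dv.one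
    · exact (Dv.nat p).div (un_kz h hk Dv.p1)
lemma fz_base (h3 : 3 < p) : Cg 3 (fz p (-((p:ℚ_[p])/3)) (p:ℚ_[p])) 1 := by
  unfold fz
  rw [sum_range_pred _ (by omega)]
  simp only [pt_zero, Nat.factorial_zero, Nat.cast_zero, zero_add, Nat.cast_one, one_pow, div_one]
  rw [div_self ppne, mul_one]
  have he := eps_dv (p := p) h3
  refine cgd (z := ∑ k ∈ range (p-1), pt (-((p:ℚ_[p])/3)) (k+1) / (((k+1).factorial:ℕ):ℚ_[p])^2 * ((p:ℚ_[p])/(((k+1:ℕ):ℚ_[p])+(p:ℚ_[p])))) ?_ (by ring)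
  have : Cg 3 (∑ k ∈ range (p-1), pt (-((p:ℚ_[p])/3)) (k+1) / (((k+1).factorial:ℕ):ℚ_[p])^2 * ((p:ℚ_[p])/(((k+1:ℕ):ℚ_[p])+(p:ℚ_[p]))))
      (∑ k ∈ range (p-1), (p:ℚ_[p])^2/3 * (1/((k:ℚ_[p])+1)^2)) := by
    refine Cg.sum (fun k hk => ?_)
    have hk := mem_range.1 hk
    have hq := (qf_exp (p := p) he (k := k) (by omega))
    have hU := un_of_lt (p := p) (n := k+1) (by omega) (by omega)
    have hU2 := un_kz (p := p) (k := k+1) (by omega) (by omega) (Dv.p1)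
    have hq1 : Cg 1 (qf ((p:ℚ_[p])/3) k) 1 := (hq.mono (by omega)).trans (cgd (z := -(((p:ℚ_[p])/3)^2 * HH 2 k)) (Dv.mulr (by rw [pow_two]; exact he.mulr (ep0 h3)) (dv_HH 2 (by omega))).neg (by ring))
    rw [pt_shift]
    set s := ((k+1:ℕ):ℚ_[p]) with hs
    rw [show (k:ℚ_[p])+1 = s by rw [hs]; push_cast; ring]
    have e1 : (p:ℚ_[p])/3 * (s-(p:ℚ_[p])/3) * pf ((p:ℚ_[p])/3) k / (((k+1).factorial:ℕ):ℚ_[p])^2 * ((p:ℚ_[p])/(s+(p:ℚ_[p]))) = (p:ℚ_[p])^2 * ((s-(p:ℚ_[p])/3)/(3*s^2*(s+(p:ℚ_[p]))) * qf ((p:ℚ_[p])/3) k) := by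
      rw [qf, Nat.factorial_succ, Nat.cast_mul, ← hs]
      have := hU.ne; have := hU2.ne; have := fne (K := ℚ_[p]) k
      field_simp
    rw [e1]
    have hd : Dv 0 ((s-(p:ℚ_[p])/3)/(3*s^2*(s+(p:ℚ_[p])))) := Dv.div ((Dv.nat _).sub (ep0 h3)) (((un3 h3).mul (hU.pow 2)).mul hU2)
    have h1 : Cg 1 ((s-(p:ℚ_[p])/3)/(3*s^2*(s+(p:ℚ_[p]))) * qf ((p:ℚ_[p])/3) k) (1/3*(1/s^2)) := by
      refine (hq1.mul_left hd).trans ?_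
      refine cgd (z := (p:ℚ_[p]) * (-4/(9*s^2*(s+(p:ℚ_[p]))))) (Dv.p1.mulr (Dv.div (Dv.ofNat 4).neg (((un9 h3).mul (hU.pow 2)).mul hU2))) ?_
      have := hU.ne; have := hU2.ne
      field_simp; ring
    refine cgd ((Dv.pp 2).mul' h1) ?_
    ring
  rw [← mul_sum] at this
  have h2 : Dv 3 ((p:ℚ_[p])^2/3 * ∑ k ∈ range (p-1), 1/((k:ℚ_[p])+1)^2) := ((Dv.pp 2).div (un3 h3)).mul' (HH2_top h3)
  unfold Cg at this
  have := this.add h2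
  rwa [sub_add_cancel] at this
lemma fz_iter (h3 : 3 < p) (n : ℕ) (hn : n + 1 < p) : Cg 3 (fz p ((n:ℚ_[p])-(p:ℚ_[p])/3) (p:ℚ_[p])) 
    (∏ j ∈ range n, ((j:ℚ_[p])+1-4*((p:ℚ_[p])/3))/((j:ℚ_[p])+1+2*((p:ℚ_[p])/3))) := by
  have he := eps_dv (p := p) h3
  induction n with
  | zero => simpa using fz_base h3
  | succ n ih =>
    have ih := ih (by omega)
    rw [prod_range_succ]
    set x := (n:ℚ_[p])+1-(p:ℚ_[p])/3 with hx
    have hUn := un_of_lt (p := p) (n := n+1) (by omega) (by omega)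
    have hUx : Un x := by
      have := un_kz (p := p) (k := n+1) (by omega) (by omega) he.neg
      rw [hx]; convert this using 1; push_cast; ring
    have hU2 : Un ((n:ℚ_[p])+1+2*((p:ℚ_[p])/3)) := by
      have := un_kz (p := p) (k := n+1) (by omega) (by omega) ((Dv.ofNat 2).mul he)
      push_cast at this; exact this
    have hd := fz_diff hUx.ne (z := (p:ℚ_[p])) (p-1) (fun k hk => by
      rcases Nat.eq_zero_or_pos k with rfl | h
      · simpa using ppne
      · exact (un_kz h (by omega) Dv.p1).ne)
    rw [Nat.sub_add_cancel (by omega)] at hd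
    have hx1 : x - 1 = (n:ℚ_[p])-(p:ℚ_[p])/3 := by rw [hx]; ring
    rw [hx1] at hd
    rw [show (((n+1:ℕ):ℚ_[p])-(p:ℚ_[p])/3) = x by rw [hx]; push_cast; ring]
    have hq : Dv 2 (qf x (p-1)) := by
      have := (qf_top h3 (i := n) (by omega)).mono (s := 2) (by omega)
      have h2 : Dv 2 (-(2/9) * (p:ℚ_[p])^2/((n:ℚ_[p])+1)^2) := by
        refine Dv.div (Dv.mul (Dv.div (Dv.ofNat 2) (un9 h3)).neg (Dv.pp 2)) ?_
        have := hUn.pow 2; push_cast at this; exact this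
      have := Dv.add this h2
      rwa [sub_add_cancel] at this
    have h4 : x + p = (n:ℚ_[p])+1+2*((p:ℚ_[p])/3) := by rw [hx]; ring
    have h5 : x - p = (n:ℚ_[p])+1-4*((p:ℚ_[p])/3) := by rw [hx]; ring
    rw [← h4, ← h5]; rw [← h4] at hU2
    have h6 : Cg 3 (fz p x (p:ℚ_[p])) ((x-p)/(x+p) * fz p ((n:ℚ_[p])-(p:ℚ_[p])/3) (p:ℚ_[p])) := by
      refine cgd (z := 2*(p:ℚ_[p]) * qf x (p-1) / (x+p)) (Dv.div (Dv.mul' (r := 1) ((Dv.ofNat 2).mul Dv.p1) hq) hU2) ?_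
      rw [← hd]; have := hU2.ne; field_simp
    rw [mul_comm]
    exact h6.trans (ih.mul_left (Dv.div (hUx.dv.sub (Dv.nat p)) hU2))
/-- `v (p-1)` modulo `p^3` -/
lemma v_top (h3 : 3 < p) {q m : ℕ} {e : ℚ} (h : Shp p q m e) : Cg 3 (v (p-1) : ℚ_[p]) 
    (∏ j ∈ range m, ((j:ℚ_[p])+1-4*((p:ℚ_[p])/3))/((j:ℚ_[p])+1+2*((p:ℚ_[p])/3))) :=
  (v_fz h3 h).trans (fz_iter h3 m (by have := h.lt h3; omega))
end S19

set_option linter.unusedSectionVars false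
set_option linter.unusedSimpArgs false
namespace S19
open Finset Polynomial
lemma choose_prod {K : Type*} [Field K] [CharZero K] (m : ℕ) : ((2*m).choose m : K) = ∏ j ∈ range m, ((j:K)+1+m)/((j:K)+1) := by
  rw [prod_div_distrib]
  have h1 : ∏ j ∈ range m, ((j:K)+1) = (m.factorial : K) := by
    rw [← Finset.prod_range_add_one_eq_factorial]; push_cast; rfl
  have h2 : ∏ j ∈ range m, ((j:K)+1+m) = (m.factorial : K) * ((2*m).choose m : K) := by
    have := Nat.ascFactorial_eq_factorial_mul_choose m m
    rw [Nat.ascFactorial_eq_prod_range, ← two_mul] at this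
    rw [← Nat.cast_mul, ← this]; push_cast
    apply prod_congr rfl; intro j _; ring
  rw [h1, h2]; field_simp [fne (K := K) m]
lemma HH_shift {K : Type*} [Field K] [CharZero K] (r m : ℕ) : ∑ j ∈ range m, 1/((j:K)+1+m)^r = HH r (2*m) - HH r m := by
  unfold HH
  rw [two_mul, sum_range_add, add_sub_cancel_left]
  apply sum_congr rfl; intro j _; congr 2; push_cast; ring
variable {p : ℕ} [hp : Fact p.Prime]
lemma Un_1d {u : ℚ_[p]} (hu : Dv 1 u) : Un (1+u) := Un.of_sub Un.one (by rw [show 1 - (1+u) = -u by ring]; exact hu.neg)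
lemma fac_exp {u w : ℚ_[p]} (hu : Dv 1 u) (hw : Dv 1 w) : Cg 3 ((1-4*u)/(1+2*u)*((1-2*w)/(1-3*u))^2) (1-4*w+4*w^2+3*u^2) := by
  have u1 : Un (1+2*u) := Un_1d ((Dv.ofNat 2).mul hu)
  have u2 : Un (1-3*u) := by rw [sub_eq_add_neg]; exact Un_1d ((Dv.ofNat 3).mul hu).neg
  have u0 : Dv 0 u := hu.mono (by omega)
  have w0 : Dv 0 w := hw.mono (by omega)
  refine cgd (z := (u*u*w*(-12+12*w)+u*u*u*(-18*(1-2*w)*(1-2*w)+12+9*u-54*(u*u)))/((1+2*u)*(1-3*u)^2)) (Dv.div (Dv.add ?_ ?_) (u1.mul (u2.pow 2))) ?_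
  · exact Dv.mulr ((hu.mul' hu).mul' hw) ((Dv.ofNat 12).neg.add ((Dv.ofNat 12).mul w0))
  · refine Dv.mulr ((hu.mul' hu).mul' hu) ?_
    have hW : Dv 0 (1-2*w) := Dv.one.sub ((Dv.ofNat 2).mul w0)
    exact (((((Dv.ofNat 18).neg.mul hW).mul hW).add (Dv.ofNat 12)).add ((Dv.ofNat 9).mul u0)).sub ((Dv.ofNat 54).mul (u0.mul u0))
  · have ha := div_mul_cancel₀ (1-4*u) u1.ne
    have hb := div_mul_cancel₀ (1-2*w) u2.ne
    generalize (1-4*u)/(1+2*u) = a at *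
    generalize (1-2*w)/(1-3*u) = b at *
    rw [eq_div_iff (mul_ne_zero u1.ne (pow_ne_zero 2 u2.ne))]
    linear_combination b^2*(1-3*u)^2*ha + (1-4*u)*(b*(1-3*u)+(1-2*w))*hb
lemma vV (h3 : 3 < p) {m : ℕ} (hm : 2*m < p) : Cg 3 ((∏ j ∈ range m, ((j:ℚ_[p])+1-4*((p:ℚ_[p])/3))/((j:ℚ_[p])+1+2*((p:ℚ_[p])/3))) *
     (∏ j ∈ range m, ((j:ℚ_[p])+1+(m:ℚ_[p])-2*((p:ℚ_[p])/3))/((j:ℚ_[p])+1-p))^2)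
   (((2*m).choose m : ℚ_[p])^2 * (1 + (p:ℚ_[p]) * (-(4/3)*(HH 1 (2*m) - HH 1 m)) + (p:ℚ_[p])^2 * ((4/9)*(HH 2 (2*m) - HH 2 m) + (1/3) * HH 2 m
     + ((-(4/3)*(HH 1 (2*m) - HH 1 m))^2 - (16/9)*(HH 2 (2*m) - HH 2 m))/2))) := by
  have he := eps_dv (p := p) h3
  have uJ : ∀ j ∈ range m, Un ((j:ℚ_[p])+1) := fun j hj => un_succ (mem_range.1 hj) (by omega)
  have uM : ∀ j ∈ range m, Un ((j:ℚ_[p])+1+(m:ℚ_[p])) := fun j hj => by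
    have := mem_range.1 hj
    have := un_of_lt (p := p) (n := j+1+m) (by omega) (by omega); push_cast at this; exact this
  set f : ℕ → ℚ_[p] := fun j => (1-4*(p/3/((j:ℚ_[p])+1)))/(1+2*(p/3/((j:ℚ_[p])+1)))*((1-2*(p/3/((j:ℚ_[p])+1+(m:ℚ_[p]))))/(1-3*(p/3/((j:ℚ_[p])+1))))^2 with hf
  have hdJ : ∀ j ∈ range m, Dv 1 ((p:ℚ_[p])/3/((j:ℚ_[p])+1)) := fun j hj => he.div (uJ j hj)
  have e1 : (∏ j ∈ range m, ((j:ℚ_[p])+1-4*((p:ℚ_[p])/3))/((j:ℚ_[p])+1+2*((p:ℚ_[p])/3))) *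
     (∏ j ∈ range m, ((j:ℚ_[p])+1+(m:ℚ_[p])-2*((p:ℚ_[p])/3))/((j:ℚ_[p])+1-p))^2 = ((2*m).choose m : ℚ_[p])^2 * ∏ j ∈ range m, f j := by
    rw [choose_prod, ← prod_pow, ← prod_pow, ← prod_mul_distrib, ← prod_mul_distrib]
    apply prod_congr rfl; intro j hj
    simp only [hf]
    have n1 := (uJ j hj).ne; have n2 := (uM j hj).ne
    have n3 := (Un_1d ((Dv.ofNat 2).mul (hdJ j hj))).ne
    have n4 := (Un_1d ((Dv.ofNat 3).mul (hdJ j hj)).neg).ne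
    set J := (j:ℚ_[p])+1
    set M := J + m
    have n5 : J + 2*((p:ℚ_[p])/3) ≠ 0 := by
      intro h0; apply n3
      have : J * (1 + 2*((p:ℚ_[p])/3/J)) = 0 := by rw [← h0]; field_simp
      exact (mul_eq_zero.1 this).resolve_left n1
    have n6 : J - p ≠ 0 := by
      intro h0; apply n4
      have : J * (1 + -(3*((p:ℚ_[p])/3/J))) = 0 := by rw [← h0]; field_simp; ring
      exact (mul_eq_zero.1 this).resolve_left n1
    have a1 : 1 - 4*((p:ℚ_[p])/3/J) = (J-4*((p:ℚ_[p])/3))/J := by field_simp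
    have a2 : 1 + 2*((p:ℚ_[p])/3/J) = (J+2*((p:ℚ_[p])/3))/J := by field_simp
    have a3 : 1 - 2*((p:ℚ_[p])/3/M) = (M-2*((p:ℚ_[p])/3))/M := by field_simp
    have a4 : 1 - 3*((p:ℚ_[p])/3/J) = (J-p)/J := by field_simp
    simp only [a1, a2, a3, a4]
    generalize J+2*((p:ℚ_[p])/3) = A at *
    generalize J-(p:ℚ_[p]) = B at *
    generalize J-4*((p:ℚ_[p])/3) = A' at *
    generalize M-2*((p:ℚ_[p])/3) = B' at *
    field_simp
  rw [e1]
  refine Cg.mul_left ?_ ((Dv.nat _).pow 2)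
  have h := prod_exp h3 (range m) f (fun j => -(4/3) * (1/((j:ℚ_[p])+1+(m:ℚ_[p]))^1)) (fun j => (4/9) * (1/((j:ℚ_[p])+1+(m:ℚ_[p]))^2) + (1/3) * (1/((j:ℚ_[p])+1)^2)) ?_ ?_ ?_
  · rw [← mul_sum, sum_add_distrib, ← mul_sum, ← mul_sum, HH_shift, HH_shift] at h
    have e2 : ∑ i ∈ range m, (-(4/3) * (1/((i:ℚ_[p])+1+(m:ℚ_[p]))^1))^2 = 16/9 * (HH 2 (2*m) - HH 2 m) := by
      rw [← HH_shift, mul_sum]; apply sum_congr rfl; intro j hj; field_simp; ring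
    rw [e2] at h
    exact h
  · intro j hj
    have := fac_exp (hdJ j hj) (he.div (uM j hj))
    refine this.trans (Cg.of_eq ?_)
    field_simp; ring
  · intro j hj
    exact Dv.mul (Dv.div (Dv.ofNat 4) (un3 h3)).neg (Dv.div Dv.one ((uM j hj).pow 1))
  · intro j hj
    exact Dv.add (Dv.mul (Dv.div (Dv.ofNat 4) (un9 h3)) (Dv.div Dv.one ((uM j hj).pow 2))) (Dv.mul (Dv.div Dv.one (un3 h3)) (Dv.div Dv.one ((uJ j hj).pow 2)))
end S19

set_option linter.unusedSectionVars false
set_option linter.unusedSimpArgs false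
namespace S19
open Finset Polynomial
variable {p : ℕ} [hp : Fact p.Prime]

lemma R1_val3 (h3 : 3 < p) {q m : ℕ} {e : ℚ} (h : Shp p q m e) : Cg 3 (8 * SS p 1 + SS p 0 : ℚ_[p]) ((e:ℚ_[p])*(p:ℚ_[p])) := by
  have h2 := R1_val h3 h
  have d : Dv 3 (22/3*(p:ℚ_[p])^3*((seqU (p-3):ℚ):ℚ_[p])) := by
    have h4 := (U_H2 h3 h).dv (s := 0) (by omega) (((Dv.one.div (un3 h3)).mul h.de).mul (dv_HH 2 (by have := h.lt h3; omega)))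
    exact (((Dv.ofNat 22).div (un3 h3)).mul (Dv.pp 3)).mulr h4
  unfold Cg at h2
  exact cgd ((h2.mono (by omega : 3 ≤ 4)).sub d) (by ring)

lemma N_val2 {m : ℕ} (hm : p = 3*m+2) (h3 : 3 < p) : Cg 2 (16 * SS p 2 - SS p 0 : ℚ_[p])
    (2*(2*(p:ℚ_[p])+1)*((2*m+1).choose m : ℚ_[p])^2) := by
  obtain ⟨q, m', e, h⟩ := Shp.ex (p := p) h3
  have hmm : m' = m := by unfold Shp at h; omega
  subst hmm
  have b := block2 hm h3
  rw [tC_eval1, (coeff_NN (K := ℚ_[p]) p).2.2] at b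
  refine b.trans ?_
  have hv := v_top h3 h
  have hV := (vV (p := p) h3 (m := m') (by omega)).mono (s := 2) (by omega)
  set V := (∏ j ∈ range m', ((j:ℚ_[p])+1+(m':ℚ_[p])-2*((p:ℚ_[p])/3))/((j:ℚ_[p])+1-p)) with hVd
  have dV : Dv 0 V := Dv.prod fun j hj => by
    have := mem_range.1 hj
    refine Dv.div (((((Dv.nat j).add Dv.one).add (Dv.nat m')).sub ((Dv.ofNat 2).mul (ep0 h3)))) ?_
    have := un_kp (p := p) (k := j) (by omega)
    convert this using 1; ring
  have s1 : Cg 2 (v (p-1) * V^2) (((2*m').choose m' : ℚ_[p])^2 * (1-4*(p:ℚ_[p]))) := by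
    refine (Cg.trans ?_ hV).trans ?_
    · have := (hv.mono (s := 2) (by omega)).mul_left (dV.pow 2)
      rw [mul_comm, mul_comm _ (V^2)]; exact this
    · refine Cg.mul_left ?_ ((Dv.nat _).pow 2)
      have d1 : ∀ r n : ℕ, n < p → Dv 0 (HH r n : ℚ_[p]) := fun r n hn => dv_HH r hn
      have r := (HH1_refl (p := p) h3 (n := 2*m'+1) (n' := m') (by omega))
      rw [HH_succ] at r
      have u21 := un_of_lt (p := p) (n := 2*m'+1) (by omega) (by omega)
      have hdp : Dv 1 (HH 1 (2*m') - HH 1 m' - 3 : ℚ_[p]) := by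
        have r2 := r.mono (s := 1) (by omega)
        unfold Cg at r2
        have e3 : HH 1 (2*m') - HH 1 m' - 3 = (HH 1 (2*m') + 1 / (((2*m':ℕ):ℚ_[p]) + 1)^1 - HH 1 m' - -(p:ℚ_[p]) * HH 2 (2*m'+1)) - (p:ℚ_[p]) * (HH 2 (2*m'+1) + 2/((2*m'+1:ℕ):ℚ_[p])) := by
          have hu := u21.ne
          have hpp : (p:ℚ_[p]) = (3*((2*m'+1:ℕ):ℚ_[p])+1)/2 := by
            have : (p:ℚ_[p]) = 3*m'+2 := by exact_mod_cast congrArg (Nat.cast : ℕ → ℚ_[p]) hm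
            rw [this]; push_cast; ring
          have e4 : ((2*m':ℕ):ℚ_[p]) + 1 = ((2*m'+1:ℕ):ℚ_[p]) := by push_cast; ring
          rw [e4]
          generalize ((2*m'+1:ℕ):ℚ_[p]) = Y at *
          generalize (HH 2 (2*m'+1) : ℚ_[p]) = Z
          rw [pow_one]
          field_simp
          linear_combination 2*hpp
        rw [e3]
        refine r2.sub (Dv.p1.mulr ?_)
        exact (d1 _ _ (by omega)).add ((Dv.ofNat 2).div u21)
      have hd0 : Dv 0 (HH 1 (2*m') - HH 1 m' : ℚ_[p]) := (d1 _ _ (by omega)).sub (d1 _ _ (by omega))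
      have hd02 : Dv 0 (HH 2 (2*m') - HH 2 m' : ℚ_[p]) := (d1 _ _ (by omega)).sub (d1 _ _ (by omega))
      have hd03 : Dv 0 (HH 2 m' : ℚ_[p]) := (d1 _ _ (by omega))
      generalize (HH 1 (2*m') - HH 1 m' : ℚ_[p]) = A at *
      generalize (HH 2 (2*m') - HH 2 m' : ℚ_[p]) = B at *
      generalize (HH 2 m' : ℚ_[p]) = D at *
      have i3 : Dv 0 (1/3 : ℚ_[p]) := Dv.div Dv.one (un3 h3)
      have i9 : Dv 0 (1/9 : ℚ_[p]) := Dv.div Dv.one (un9 h3)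
      have z1 : Dv 2 ((p:ℚ_[p]) * (A-3) * (-(4*(1/3)))) := by
        exact (Dv.p1.mul' hdp).mulr ((Dv.ofNat 4).mul i3).neg
      have z2 : Dv 2 ((p:ℚ_[p])^2 * (4*(1/9)*B + (1/3)*D + 8*(1/9)*(A^2-B))) := 
        (Dv.pp 2).mulr (((((Dv.ofNat 4).mul i9).mul hd02).add (i3.mul hd03)).add (((Dv.ofNat 8).mul i9).mul ((hd0.pow 2).sub hd02)))
      refine cgd (z1.add z2) ?_
      ring
  have s2 : Cg 2 (((2*m').choose m' : ℚ_[p])^2 * (1-4*(p:ℚ_[p]))) ((2*(p:ℚ_[p])+1)*((2*m'+1).choose m' : ℚ_[p])^2) := by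
    have hc : ((2*m'+1).choose m' : ℚ_[p]) * ((p:ℚ_[p])+1) = ((2*m').choose m') * (2*(p:ℚ_[p])-1) := by
      have h1 : (2*m'+1).choose m' * (m'+1) = (2*m').choose m' * (2*m'+1) := by
        have := Nat.choose_mul_succ_eq (2*m') m'
        rw [show 2*m'+1-m' = m'+1 by omega] at this
        omega
      have h2 : ((2*m'+1).choose m' : ℚ_[p]) * (m'+1) = ((2*m').choose m') * (2*m'+1) := by exact_mod_cast h1
      have : (p:ℚ_[p]) = 3*m'+2 := by exact_mod_cast congrArg (Nat.cast : ℕ → ℚ_[p]) hm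
      rw [this]; linear_combination 3*h2
    have hu : Un ((p:ℚ_[p])+1) := by
      have := Un_1d (Dv.p1 (p := p)); rwa [add_comm] at this
    refine Dv.of_mul (x := ((p:ℚ_[p])+1)^2) ?_ (hu.pow 2)
    have : ((p:ℚ_[p])+1)^2 * (((2*m').choose m' : ℚ_[p])^2 * (1-4*(p:ℚ_[p])) - (2*(p:ℚ_[p])+1)*((2*m'+1).choose m' : ℚ_[p])^2) = (p:ℚ_[p])^2 * (-((2*m').choose m' : ℚ_[p])^2 * (3+12*p)) := by
      linear_combination (-(2*(p:ℚ_[p])+1)) * (((2*m'+1).choose m' : ℚ_[p])*(p+1) + ((2*m').choose m') * (2*p-1)) * hc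
    rw [this]
    refine (Dv.pp 2).mulr (((Dv.nat _).pow 2).neg.mul ((Dv.ofNat 3).add ((Dv.ofNat 12).mul (Dv.nat _))))
  have := (s1.trans s2).mul_left (Dv.ofNat 2)
  rw [← mul_assoc, ← mul_assoc] at this
  convert this using 1
  

lemma second {m : ℕ} (hm : p = 3*m+2) (h3 : 3 < p) :
    Cg 2 (SS p 2 : ℚ_[p]) (1/8*(2*(p:ℚ_[p])+1)*((2*m+1).choose m : ℚ_[p])^2) ∧
    Cg 2 (SS p 3 : ℚ_[p]) (3/64*(2*(p:ℚ_[p])+1)*((2*m+1).choose m : ℚ_[p])^2 - p/32) := by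
  have hN := N_val2 hm h3
  have hS := (S0N (p := p) h3).mono (s := 2) (by omega)
  have hT := (S3_val (p := p) h3).mono (s := 2) (by omega)
  obtain ⟨q, m', e, h⟩ := Shp.ex (p := p) h3
  have he : e = -1 := by
    rcases h with ⟨h1, _, _⟩ | ⟨_, _, h⟩
    · omega
    · exact h
  subst he
  have hR : Cg 2 (8 * SS p 1 + SS p 0 : ℚ_[p]) (-(p:ℚ_[p])) := by
    have := (R1_val3 h3 h).mono (s := 2) (by omega)
    simpa using this
  have uB : Un ((2*m+1).choose m : ℚ_[p]) := by
    apply Un.nat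
    intro hd
    have h2 : (2*m+1).choose m ∣ (2*m+1).factorial := by
      have := Nat.choose_mul_factorial_mul_factorial (n := 2*m+1) (k := m) (by omega)
      exact ⟨_, by rw [← this, mul_assoc]⟩
    have := (hp.out.dvd_factorial).1 (hd.trans h2)
    omega
  have u2p : Un (2*(p:ℚ_[p])+1) := by
    have := Un_1d ((Dv.ofNat 2).mul (Dv.p1 (p := p))); rwa [add_comm] at this
  have uN : Un (16 * SS p 2 - SS p 0 : ℚ_[p]) := by
    refine Un.of_sub ((((un2 h3).mul u2p).mul (uB.pow 2))) ?_
    have := hN.symm.mono (s := 1) (by omega); exact this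
  have hS0 : Dv 2 (SS p 0 : ℚ_[p]) := by
    refine Dv.of_mul (x := (16 * SS p 2 - SS p 0 : ℚ_[p])) ?_ uN
    rw [mul_comm]
    have := Dv.sub hS (Dv.pp 2)
    convert this using 1; ring
  set B := 2*(2*(p:ℚ_[p])+1)*((2*m+1).choose m : ℚ_[p])^2 with hB
  have i2 : Dv 0 (1/2:ℚ_[p]) := Dv.div Dv.one (un2 h3)
  have g2 : Cg 2 (SS p 2 : ℚ_[p]) (B/16) := by
    refine cgd (((Dv.add hN hS0)).mulr (i2.pow 4)) ?_
    ring
  refine ⟨g2.trans (Cg.of_eq (by rw [hB]; ring)), ?_⟩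
  have g3 : Cg 2 (SS p 3 : ℚ_[p]) (3/8*SS p 2 - p/32) := by
    refine cgd ((((Dv.mulr hT (i2.pow 4)).add (Dv.mulr hR (i2.pow 5))).add (hS0.mulr (i2.pow 5)))) ?_
    ring
  refine g3.trans ?_
  refine (cgd (Dv.mulr g2 ((Dv.ofNat 3).mul (i2.pow 3))) ?_)
  rw [hB]; ring
end S19

set_option linter.unusedSectionVars false
set_option linter.unusedSimpArgs false
namespace S19
open Finset Polynomial

section gen
variable {K : Type*} [Field K] [CharZero K]
noncomputable def dq (m : ℕ) : ℕ → K
  | 0 => 0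
  | (j+1) => (((j:K)-m)^2 * dq m j + fc (m:K) 0 0 j)/((j:K)+1)^2
/-- truncation -/
noncomputable def tru (N : ℕ) (f : ℕ → K) : K[X] := ∑ k ∈ range (N+1), C (f k) * X^k
lemma tru_coeff (N : ℕ) (f : ℕ → K) (k : ℕ) : (tru N f).coeff k = if k ≤ N then f k else 0 := by
  unfold tru
  rw [finsetSum_coeff]
  simp only [coeff_C_mul, coeff_X_pow, mul_ite, mul_one, mul_zero]
  rw [sum_ite_eq]
  simp
lemma dq_ode (m N : ℕ) : ∃ c : K, th (th (tru N (dq m : ℕ → K))) = X * (th (th (tru N (dq m : ℕ → K))) - C (2*m:K) * th (tru N (dq m : ℕ → K)) + C (m^2:K) * tru N (dq m : ℕ → K))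
    + (X * tru N (fc (m:K) 0 0) + X^(N+1) * C c) := by
  refine ⟨-(((N:K)-m)^2*dq m N + fc (m:K) 0 0 N), ?_⟩
  ext k
  rcases k with _ | k
  · simp [th_coeff]
  · simp only [coeff_add, coeff_sub, coeff_X_mul, coeff_C_mul, th_coeff, tru_coeff, coeff_mul_C, coeff_X_pow]
    have h1 : (k:K)+1 ≠ 0 := by exact_mod_cast Nat.succ_ne_zero k
    rcases lt_trichotomy k N with h | h | h
    · simp only [if_pos (show k + 1 ≤ N by omega), if_pos (show k ≤ N by omega), if_neg (show ¬ k + 1 = N + 1 by omega), dq]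
      push_cast; field_simp; ring
    · subst h
      simp; ring
    · simp only [if_neg (show ¬ k + 1 ≤ N by omega), if_neg (show ¬ k ≤ N by omega), if_neg (show ¬ k + 1 = N + 1 by omega)]; simp
noncomputable def M0 (m : ℕ) (F : K[X]) : K[X] := MM 0 (m:K) (m*(m+1)) (2*m) F
noncomputable def Psi (m : ℕ) : K[X] := ff m 0 0 * ff m 0 0
noncomputable def Zp (m : ℕ) : K[X] := 2*X*(1-X)*th (Psi m) + X*(1+4*C (m:K)*X)*Psi m
lemma trufc (m N : ℕ) (h : m ≤ N) : tru N (fc (m:K) 0 0) = ff m 0 0 := by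
  ext k
  rw [tru_coeff, ff_coeff]
  split_ifs with h1
  · rfl
  · rw [fc_top]; omega
lemma M0_T (m : ℕ) : ∃ Q : K[X], M0 m (ff m 0 0 * tru (2*m) (dq m)) = Zp m + X^(2*m+1) * Q := by
  have hc : ∀ k : ℕ, k < m → (k:K)+1+0 ≠ 0 := fun k _ => by rw [add_zero]; exact_mod_cast Nat.succ_ne_zero k
  have o := ff_ode m (0:K) 0 hc
  have o1 := ff_ode1 m (0:K) 0 hc
  obtain ⟨c, r⟩ := dq_ode (K := K) m (2*m)
  rw [trufc m (2*m) (by omega)] at r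
  have thp : ∀ n : ℕ, th (X^n : K[X]) = C (n:K) * X^n := by
    intro n; ext k; rw [th_coeff, coeff_C_mul, coeff_X_pow]; split_ifs with h <;> simp [h]
  have r1 := congrArg th r
  simp only [th_add, th_sub, th_mul, th_X, th_C, thp, zero_mul, zero_add, mul_zero, add_zero] at r1
  set y : K[X] := ff m 0 0
  set z : K[X] := tru (2*m) (dq m)
  refine ⟨(1-X)*y*C (((2*m+1:ℕ):K)) * C c + ((4*C (m:K)*X+X)*y+3*(1-X)*th y)*C c, ?_⟩
  unfold M0 Zp MM Psi
  rw [← show y = ff m 0 0 from rfl]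
  simp only [th_mul, th_add]
  generalize th (th (th y)) = y3 at *
  generalize th (th y) = y2 at *
  generalize th y = y1 at *
  generalize th (th (th z)) = z3 at *
  generalize th (th z) = z2 at *
  generalize th z = z1 at *
  simp only [C_add, C_sub, C_mul, C_pow, C_neg, C_1, C_0, show (C 2 : K[X]) = 2 from rfl, show (C 3 : K[X]) = 3 from rfl] at *
  generalize (C (m:K) : K[X]) = m' at *
  generalize (C ((2*m+1:ℕ):K) : K[X]) = n' at *
  generalize (X^(2*m+1) : K[X]) = w at *
  linear_combination (1-X)*z*o1 + (1-X)*y*r1 + ((6*m'*X+X-2*m'*X)*z+3*(1-X)*z1)*o + ((6*m'*X+X-2*m'*X)*y+3*(1-X)*y1)*r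
/-- coefficients of M0 -/
lemma M0_coeff (m : ℕ) (F : K[X]) (k : ℕ) : (M0 m F).coeff (k+2) = ((k:K)+2)^3 * F.coeff (k+2)
    - 2*(((k:K)+1-m)^3-m*(m+1)*((k:K)+1-m)) * F.coeff (k+1) + ((k:K)-2*m)^3 * F.coeff k := by
  unfold M0 MM
  simp only [coeff_add, coeff_sub, coeff_X_mul, coeff_C_mul, th_coeff]
  push_cast; ring
lemma M0_coeff1 (m : ℕ) (F : K[X]) : (M0 m F).coeff 1 = F.coeff 1
    - 2*((0-(m:K))^3-m*(m+1)*(0-m)) * F.coeff 0 := by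
  unfold M0 MM
  simp only [coeff_add, coeff_sub, coeff_X_mul, coeff_C_mul, th_coeff, coeff_X_mul_zero]
  push_cast; simp [th_coeff]; ring
lemma M0_coeff0 (m : ℕ) (F : K[X]) : (M0 m F).coeff 0 = 0 := by
  unfold M0 MM
  simp only [coeff_add, coeff_sub, coeff_X_mul, coeff_C_mul, th_coeff, coeff_X_mul_zero]
  simp [th_coeff]
noncomputable def Tp (m : ℕ) : K[X] := tru (2*m) (fun k => (ff m 0 0 * tru (2*m) (dq m) : K[X]).coeff k)
lemma Tp_coeff (m k : ℕ) (h : k ≤ 2*m) : (Tp m : K[X]).coeff k = (ff m 0 0 * tru (2*m) (dq m) : K[X]).coeff k := by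
  unfold Tp; rw [tru_coeff, if_pos h]
lemma Tp_top (m k : ℕ) (h : 2*m < k) : (Tp m : K[X]).coeff k = 0 := by
  unfold Tp; rw [tru_coeff, if_neg (by omega)]
lemma Tp_zero (m : ℕ) : (Tp m : K[X]).coeff 0 = 0 := by
  rw [Tp_coeff m 0 (by omega), mul_coeff_zero, tru_coeff]; simp [dq]
lemma M0_TT (m k : ℕ) (h : k ≤ 2*m) : (M0 m (Tp m) : K[X]).coeff k = (Zp m : K[X]).coeff k := by
  obtain ⟨Q, hQ⟩ := M0_T (K := K) m
  have h1 : (M0 m (Tp m) : K[X]).coeff k = (M0 m (ff m 0 0 * tru (2*m) (dq m)) : K[X]).coeff k := by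
    rcases k with _ | _ | k
    · rw [M0_coeff0, M0_coeff0]
    · rw [M0_coeff1, M0_coeff1, Tp_coeff m _ (by omega), Tp_coeff m _ (by omega)]
    · rw [M0_coeff, M0_coeff, Tp_coeff m _ (by omega), Tp_coeff m _ (by omega), Tp_coeff m _ (by omega)]
  rw [h1, hQ, coeff_add, coeff_X_pow_mul', if_neg (by omega), add_zero]
lemma fc_pal (m k : ℕ) (h : k ≤ m) : fc (m:K) 0 0 k = ((m.choose k : ℕ) : K)^2 := by
  induction k with
  | zero => simp [fc_zero]
  | succ k ih =>
    rw [fc_succ, ih (by omega)]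
    have h1 : (k:K)+1 ≠ 0 := by exact_mod_cast Nat.succ_ne_zero k
    have h2 : ((m.choose (k+1) : ℕ):K) * ((k:K)+1) = (m.choose k : ℕ) * ((m:K)-k) := by
      have := Nat.choose_succ_right_eq m k
      rw [← Nat.cast_sub (by omega : k ≤ m)]; exact_mod_cast this
    have h4 : ((m.choose (k+1) : ℕ):K) = (m.choose k : ℕ) * ((m:K)-k) / ((k:K)+1) := by rw [← h2]; field_simp
    rw [h4]; field_simp; ring
lemma Psi_reflect (m : ℕ) : reflect (2*m) (Psi m : K[X]) = Psi m := by
  unfold Psi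
  rw [two_mul, reflect_mul _ _ (ff_deg m 0 0) (ff_deg m 0 0)]
  have : reflect m (ff m 0 0 : K[X]) = ff m 0 0 := by
    ext k
    rw [coeff_reflect]
    rcases le_or_gt k m with h | h
    · rw [revAt_le h, ff_coeff, ff_coeff, fc_pal m _ (by omega), fc_pal m _ h, Nat.choose_symm h]
    · rw [revAt_eq_self_of_lt h]
  rw [this]
lemma Psi_pal (m k : ℕ) (h : k ≤ 2*m) : (Psi m : K[X]).coeff (2*m-k) = (Psi m : K[X]).coeff k := by
  conv_rhs => rw [← Psi_reflect, coeff_reflect, revAt_le h]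
lemma Psi_top (m : ℕ) {k : ℕ} (h : 2*m < k) : (Psi m : K[X]).coeff k = 0 := ffsq_top m 0 0 0 0 h
noncomputable def TS (m : ℕ) : K[X] := reflect (2*m) (Tp m)
lemma TS_coeff (m k : ℕ) (h : k ≤ 2*m) : (TS m : K[X]).coeff k = (Tp m : K[X]).coeff (2*m-k) := by
  unfold TS; rw [coeff_reflect, revAt_le h]
lemma TS_top (m k : ℕ) (h : 2*m < k) : (TS m : K[X]).coeff k = 0 := by
  unfold TS; rw [coeff_reflect, revAt_eq_self_of_lt h, Tp_top _ _ h]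
lemma M0_TS (m k : ℕ) (h : k ≤ 2*m) : (M0 m (TS m) : K[X]).coeff k = -(M0 m (Tp m) : K[X]).coeff (2*m+2-k) := by
  rcases k with _ | _ | k
  · rw [M0_coeff0, show 2*m+2-0 = 2*m+2 by omega, M0_coeff, Tp_top _ _ (by omega), Tp_top _ _ (by omega)]
    push_cast; ring
  · rw [zero_add, M0_coeff1, show 2*m+2-1 = (2*m-1)+2 by omega, M0_coeff, Tp_top _ _ (by omega), TS_coeff m _ (by omega), TS_coeff m _ (by omega),
      show 2*m-1+1 = 2*m by omega, Nat.cast_sub (by omega), Nat.sub_zero]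
    push_cast; ring
  · obtain ⟨l, hl⟩ : ∃ l, 2*m = k+2+l := ⟨2*m-(k+2), by omega⟩
    rw [M0_coeff, show 2*m+2-(k+2) = l+2 by omega, M0_coeff, TS_coeff m _ (by omega), TS_coeff m _ (by omega), TS_coeff m _ (by omega),
      show 2*m-(k+2) = l by omega, show 2*m-(k+1) = l+1 by omega, show 2*m-k = l+2 by omega]
    have hm : (2*m:K) = k+2+l := by exact_mod_cast congrArg (Nat.cast : ℕ → K) hl
    have hm2 : (m:K) = (k+2+l)/2 := by rw [← hm]; ring
    rw [hm2]; ring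
lemma Zp_coeff (m k : ℕ) : (Zp m : K[X]).coeff (k+2) = (2*(k:K)+3)*(Psi m).coeff (k+1) + (4*m-2*k) * (Psi m).coeff k := by
  have : (Zp m : K[X]) = X * (C 2 * th (Psi m) + Psi m) + X * (X * (C (4*m:K) * Psi m - C 2 * th (Psi m))) := by
    unfold Zp; simp only [C_mul, show (C 2 : K[X]) = 2 from rfl, show (C 4 : K[X]) = 4 from rfl]; ring
  rw [this]
  simp only [coeff_add, coeff_sub, coeff_X_mul, coeff_C_mul, th_coeff]
  push_cast; ring
lemma Zp_coeff1 (m : ℕ) : (Zp m : K[X]).coeff 1 = (Psi m).coeff 0 := by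
  have : (Zp m : K[X]) = X * (C 2 * th (Psi m) + Psi m) + X * (X * (C (4*m:K) * Psi m - C 2 * th (Psi m))) := by
    unfold Zp; simp only [C_mul, show (C 2 : K[X]) = 2 from rfl, show (C 4 : K[X]) = 4 from rfl]; ring
  rw [this]
  simp only [coeff_add, coeff_sub, coeff_X_mul, coeff_C_mul, th_coeff, coeff_X_mul_zero]
  push_cast; ring
lemma Zp_coeff0 (m : ℕ) : (Zp m : K[X]).coeff 0 = 0 := by
  unfold Zp; simp [mul_coeff_zero]
noncomputable def Kq (m : ℕ) (F : K[X]) : K[X] := (1-X)*((1-X)*th F + 2*C (m:K)*X*F)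
lemma Kq_eq (m : ℕ) (F : K[X]) : Kq m F = th F - X * (C 2 * th F - C (2*m:K) * F) + X * (X * (th F - C (2*m:K)*F)) := by
  unfold Kq; simp only [C_mul, show (C 2 : K[X]) = 2 from rfl]; ring
lemma Z_sym (m k : ℕ) (h : k ≤ 2*m) : (Zp m : K[X]).coeff k - (Zp m : K[X]).coeff (2*m+2-k) + 2 * (Kq m (Psi m)).coeff k = 0 := by
  rw [Kq_eq]
  rcases k with _ | _ | k
  · rw [Zp_coeff0, show 2*m+2-0 = 2*m+2 by omega, Zp_coeff, Psi_top m (by omega)]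
    simp [th_coeff]
    left; ring
  · obtain ⟨l, hl⟩ : ∃ l, 2*m = l+1 := ⟨2*m-1, by omega⟩
    rw [zero_add, Zp_coeff1, show 2*m+2-1 = l+2 by omega, Zp_coeff]
    simp only [coeff_add, coeff_sub, coeff_X_mul, coeff_C_mul, th_coeff, coeff_X_mul_zero]
    have e1 := Psi_pal (K := K) m 0 (by omega)
    have e2 := Psi_pal (K := K) m 1 (by omega)
    rw [show 2*m-0 = l+1 by omega] at e1
    rw [show 2*m-1 = l by omega] at e2
    simp only [coeff_add, coeff_sub, coeff_X_mul, coeff_C_mul, th_coeff, coeff_X_mul_zero, e1, e2]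
    have hm : (2*m:K) = l+1 := by exact_mod_cast congrArg (Nat.cast : ℕ → K) hl
    have hm2 : (m:K) = (l+1)/2 := by rw [← hm]; ring
    rw [hm2]; push_cast; ring
  · obtain ⟨l, hl⟩ : ∃ l, 2*m = k+2+l := ⟨2*m-(k+2), by omega⟩
    have e1 := Psi_pal (K := K) m (k+1) (by omega)
    have e2 := Psi_pal (K := K) m (k+2) (by omega)
    rw [show 2*m-(k+1) = l+1 by omega] at e1
    rw [show 2*m-(k+2) = l by omega] at e2
    rw [show 2*m+2-(k+2) = l+2 by omega, Zp_coeff, Zp_coeff, e1, e2]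
    simp only [coeff_add, coeff_sub, coeff_X_mul, coeff_C_mul, th_coeff]
    have hm : (2*m:K) = k+2+l := by exact_mod_cast congrArg (Nat.cast : ℕ → K) hl
    have hm2 : (m:K) = (k+2+l)/2 := by rw [← hm]; ring
    rw [hm2]; push_cast; ring
end gen
end S19

set_option linter.unusedSectionVars false
set_option linter.unusedSimpArgs false
namespace S19
open Finset Polynomial

section gen
variable {K : Type*} [Field K] [CharZero K]
lemma MP_M0 (m : ℕ) (e : K) (G : K[X]) : MP m e G - M0 m G = C e * 
   ((C (27*e) * th G - C 9 * th (th G) - C (27*e^2) * G)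
    - X * (C 2 * (C (14*m+1+11*e) * th G - C 6 * th (th G) - C (6*m^2-m+e*(15*m+2)+6*e^2) * G))
    + X * (X * (C (12*m+3*e) * th G - C 3 * th (th G) - C (12*m^2+6*m*e+e^2) * G))) := by
  unfold MP M0 MM
  simp only [C_add, C_sub, C_mul, C_pow, C_neg, C_1, C_0, C_ofNat]
  ring
lemma M0_sub (m : ℕ) (F G : K[X]) : M0 m (F-G) = M0 m F - M0 m G := MM_sub _ _ _ _ _ _
lemma M0_add (m : ℕ) (F G : K[X]) : M0 m (F+G) = M0 m F + M0 m G := MM_add _ _ _ _ _ _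
lemma M0_C (m : ℕ) (b : K) (F : K[X]) : M0 m (C b * F) = C b * M0 m F := MM_C _ _ _ _ _ _
lemma M0_Psi (m : ℕ) : M0 m (Psi m : K[X]) = 0 := by
  have hc : ∀ k : ℕ, k < m → (k:K)+1 ≠ 0 := fun k _ => by exact_mod_cast Nat.succ_ne_zero k
  have := K_eq (K := K) m 0 (fun k hk => by simpa using hc k hk) (fun k hk => by simpa using hc k hk)
  unfold M0 Psi
  simpa using this
end gen
variable {p : ℕ} [hp : Fact p.Prime]
lemma MP_diff (h3 : 3 < p) {m r : ℕ} {G : ℚ_[p][X]} (h : PD r G) : PD (r+1) (MP m ((p:ℚ_[p])/3) G - M0 m G) := by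
  rw [MP_M0, add_comm]
  have he := ep0 (p := p) h3
  have hm : Dv 0 (m:ℚ_[p]) := Dv.nat m
  refine PD.mul' (PD.C (eps_dv h3)) (PD.add (PD.sub (PD.sub (PD.sub ?_ ?_) ?_) (PD.X.mul (PD.Cm (Dv.ofNat 2) (PD.sub (PD.sub ?_ ?_) ?_)))) (PD.X.mul (PD.X.mul (PD.sub (PD.sub ?_ ?_) ?_))))
  · exact PD.Cm ((Dv.ofNat 27).mul he) h.th
  · exact PD.Cm (Dv.ofNat 9) h.th.th
  · exact PD.Cm ((Dv.ofNat 27).mul (he.pow 2)) h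
  · exact PD.Cm ((((Dv.ofNat 14).mul hm).add Dv.one).add ((Dv.ofNat 11).mul he)) h.th
  · exact PD.Cm (Dv.ofNat 6) h.th.th
  · exact PD.Cm (((((Dv.ofNat 6).mul (hm.pow 2)).sub hm).add (he.mul (((Dv.ofNat 15).mul hm).add (Dv.ofNat 2)))).add ((Dv.ofNat 6).mul (he.pow 2))) h
  · exact PD.Cm (((Dv.ofNat 12).mul hm).add ((Dv.ofNat 3).mul he)) h.th
  · exact PD.Cm (Dv.ofNat 3) h.th.th
  · exact PD.Cm ((((Dv.ofNat 12).mul (hm.pow 2)).add (((Dv.ofNat 6).mul hm).mul he)).add (he.pow 2)) h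
lemma PD_M0 {m r : ℕ} {F : ℚ_[p][X]} (h : PD r F) : PD r (M0 m F) := by
  have hm : Dv 0 (m:ℚ_[p]) := Dv.nat m
  exact PD.MM (Dv.zero 0) hm (hm.mul (hm.add Dv.one)) ((Dv.ofNat 2).mul hm) h
lemma PD_Kq {m r : ℕ} {F : ℚ_[p][X]} (h : PD r F) : PD r (Kq m F) := by
  unfold Kq
  exact PD.omX.mul ((PD.omX.mul h.th).add (PD.mul (((PD.ofNat 2).mul (PD.C (Dv.nat m))).mul PD.X) h))
lemma fwdM0 (h3 : 3 < p) {m r : ℕ} (hm : 2*m < p) {d : ℚ_[p][X]} (h0 : Dv r (d.coeff 0))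
   (hL : ∀ k ≤ 2*m, Dv r ((M0 m d).coeff k)) (ht : ∀ k, 2*m < k → Dv r (d.coeff k)) : PD r d := by
  intro k
  rcases lt_or_ge (2*m) k with h | h
  · exact ht k h
  have hmm : Dv 0 (m:ℚ_[p]) := Dv.nat m
  refine rec_fwd (f0 := fun i => 27*(i-0)^3) (f1 := fun i => 27*(2*((i-m)^3-(m*(m+1))*(i-m)))) (f2 := fun i => 27*(i-2*m)^3) (N := 2*m) h0 ?_ ?_ ?_ ?_ k h
  · intro k
    have hx : Dv 0 ((k:ℚ_[p])-(m:ℚ_[p])) := (Dv.nat k).sub hmm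
    exact (Dv.ofNat 27).mul ((Dv.ofNat 2).mul (Dv.sub (hx.pow 3) ((hmm.mul (hmm.add Dv.one)).mul hx)))
  · intro k
    exact (Dv.ofNat 27).mul (((Dv.nat k).sub ((Dv.ofNat 2).mul hmm)).pow 3)
  · intro k h1 h2
    simp only [sub_zero]
    exact (un27 h3).mul ((un_of_lt (by omega) (by omega)).pow 3)
  · intro k hk
    rw [Lg_MM _ _ _ 0 (m:ℚ_[p]) (m*(m+1)) (2*m) (fun _ => rfl) (fun _ => rfl) (fun _ => rfl), coeff_C_mul]
    exact (Dv.ofNat 27).mul (hL k hk)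
lemma dv_dq {m : ℕ} : ∀ j : ℕ, j < p → Dv 0 (dq m j : ℚ_[p]) := by
  intro j
  induction j with
  | zero => intro _; exact Dv.zero 0
  | succ j ih =>
    intro hj
    rw [dq]
    have hu : Un ((j:ℚ_[p])+1) := un_succ (Nat.lt_succ_self j) (by omega)
    refine Dv.div (Dv.add (((((Dv.nat j).sub (Dv.nat m)).pow 2)).mul (ih (by omega))) ?_) (hu.pow 2)
    rcases le_or_gt j m with h | h
    · rw [fc_pal m j h]; exact (Dv.nat _).pow 2
    · rw [fc_top m _ _ h]; exact Dv.zero 0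
lemma PD_f0 {m : ℕ} : PD 0 (ff m 0 0 : ℚ_[p][X]) := fun k => by
  rw [ff_coeff]
  rcases le_or_gt k m with h | h
  · rw [fc_pal m k h]; exact (Dv.nat _).pow 2
  · rw [fc_top m _ _ h]; exact Dv.zero 0
lemma PD_Psi {m : ℕ} : PD 0 (Psi m : ℚ_[p][X]) := PD_f0.mul PD_f0
lemma PD_Tp {m : ℕ} (hm : 2*m < p) : PD 0 (Tp m : ℚ_[p][X]) := fun k => by
  rcases le_or_gt k (2*m) with h | h
  · rw [Tp_coeff m k h]
    refine PD.mul PD_f0 (fun k => ?_) k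
    rw [tru_coeff]
    split_ifs with h
    · exact dv_dq k (by omega)
    · exact Dv.zero 0
  · rw [Tp_top m k h]; exact Dv.zero 0
lemma Psi_c0 {K : Type*} [Field K] [CharZero K] (m : ℕ) : (Psi m : K[X]).coeff 0 = 1 := by
  unfold Psi; rw [mul_coeff_zero, ff_c0]; simp
end S19

set_option linter.unusedSectionVars false
set_option linter.unusedSimpArgs false
namespace S19
open Finset Polynomial
variable {p : ℕ} [hp : Fact p.Prime]

noncomputable def KK (p m : ℕ) [Fact p.Prime] : ℚ_[p][X] := ff m (p:ℚ_[p]) (p:ℚ_[p]) * ff m (-(p:ℚ_[p])) (-(p:ℚ_[p]))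
lemma un_pp {k : ℕ} (hk : k + 1 < p) : Un ((k:ℚ_[p])+1+(p:ℚ_[p])) ∧ Un ((k:ℚ_[p])+1-(p:ℚ_[p])) := by
  have hu : Un ((k:ℚ_[p])+1) := un_succ (Nat.lt_succ_self k) (by omega)
  refine ⟨Un.of_sub hu ?_, Un.of_sub hu ?_⟩
  · convert (Dv.p1 (p := p)).neg using 1; ring
  · convert (Dv.p1 (p := p)) using 1; ring
lemma KK_eq {m : ℕ} (hm : m < p) : M0 m (KK p m) = C ((p:ℚ_[p])^2) * Kq m (KK p m) :=
  K_eq m (p:ℚ_[p]) (fun k hk => (un_pp (by omega)).1.ne) (fun k hk => (un_pp (by omega)).2.ne)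
lemma PD_KK {m : ℕ} (hm : m < p) : PD 0 (KK p m) := by
  refine PD.mul (PD_ff hm (Dv.nat p) (fun k hk => (un_pp (by omega)).1)) (PD_ff hm (Dv.nat p).neg (fun k hk => ?_))
  have := (un_pp (p := p) (k := k) (by omega)).2
  rwa [← sub_eq_add_neg]
lemma KK_Psi (h3 : 3 < p) {m : ℕ} (hm : 2*m < p) : PD 2 (KK p m - Psi m) := by
  refine fwdM0 h3 hm ?_ (fun k _ => ?_) (fun k hk => ?_)
  · rw [coeff_sub, Psi_c0]; unfold KK; rw [mul_coeff_zero, ff_c0, ff_c0]; simpa using Dv.zero 2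
  · rw [M0_sub, M0_Psi, sub_zero, KK_eq (by omega)]
    exact PD.mulr (PD.C (Dv.pp 2)) (PD_Kq (PD_KK (by omega))) k
  · rw [coeff_sub, Psi_top m hk]; unfold KK; rw [ffsq_top _ _ _ _ _ hk]; simpa using Dv.zero 2
noncomputable def EE (p m : ℕ) [Fact p.Prime] : ℚ_[p][X] := ff m (-((p:ℚ_[p])/3)) (-3*((p:ℚ_[p])/3)) ^ 2
lemma EE_eq {m : ℕ} (hm : m < p) : MP m ((p:ℚ_[p])/3) (EE p m) =
      C (((p:ℚ_[p])/3)^2) * ((1-X)*(9-X)*th (EE p m) + (2*C (m:ℚ_[p])*X*(9-X)+4*X) * EE p m) - C (((p:ℚ_[p])/3)^3) * ((27-12*X+X^2) * EE p m) :=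
  E1_eq m ((p:ℚ_[p])/3) (fun k hk => by
    have := (un_kp (p := p) (k := k) (by omega)).ne; rw [neg_mul] at this; rwa [sub_eq_add_neg])
lemma PD_EE (h3 : 3 < p) {m : ℕ} (hm : m < p) : PD 0 (EE p m) := (PD_E1 hm h3).pow 2
lemma PD_eop {r m : ℕ} {F : ℚ_[p][X]} (h : PD r F) : PD r ((1-X)*(9-X)*th F + (2*C (m:ℚ_[p])*X*(9-X)+4*X) * F) := by
  have o9 : PD 0 (9 - X : ℚ_[p][X]) := (PD.ofNat 9).sub PD.X
  exact PD.add ((PD.omX.mul o9).mul h.th) (PD.mul (PD.add (((PD.mul (PD.ofNat 2) (PD.C (Dv.nat m))).mul PD.X).mul o9) ((PD.ofNat 4).mul PD.X)) h)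
lemma e2dv (h3 : 3 < p) : Dv 2 (((p:ℚ_[p])/3)^2) := by rw [pow_two]; exact (eps_dv h3).mul' (eps_dv h3)
lemma e3dv (h3 : 3 < p) : Dv 3 (((p:ℚ_[p])/3)^3) := by rw [pow_succ]; exact (e2dv h3).mul' (eps_dv h3)
lemma EE_c0 {m : ℕ} : (EE p m).coeff 0 = 1 := by unfold EE; rw [pow_two, mul_coeff_zero, ff_c0]; simp
lemma EE_top {m k : ℕ} (hk : 2*m < k) : (EE p m).coeff k = 0 := by unfold EE; rw [pow_two, ffsq_top _ _ _ _ _ hk]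
lemma PD.mono {r s : ℕ} {F : ℚ_[p][X]} (h : PD r F) (hs : s ≤ r) : PD s F := fun k => (h k).mono hs
lemma EE_tail (h3 : 3 < p) {m : ℕ} (hm : m < p) : PD 3 (C (((p:ℚ_[p])/3)^3) * ((27-12*X+X^2) * EE p m)) :=
  PD.mulr (PD.C (e3dv h3)) (PD.mul (((PD.ofNat 27).sub ((PD.ofNat 12).mul PD.X)).add (PD.X.pow 2)) (PD_EE h3 hm))
lemma EE_Psi (h3 : 3 < p) {m : ℕ} (hm : 2*m < p) : PD 1 (EE p m - Psi m) := by
  have hE := PD_EE (p := p) h3 (m := m) (by omega)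
  refine fwdM0 h3 hm ?_ (fun k _ => ?_) (fun k hk => ?_)
  · rw [coeff_sub, Psi_c0, EE_c0]; simpa using Dv.zero 1
  · rw [M0_sub, M0_Psi, sub_zero]
    have h1 := MP_diff h3 (m := m) hE
    have h2 : PD 1 (MP m ((p:ℚ_[p])/3) (EE p m)) := by
      rw [EE_eq (by omega)]
      exact PD.sub ((PD.mulr (PD.C (e2dv h3)) (PD_eop hE)).mono (by omega)) ((EE_tail h3 (by omega)).mono (by omega))
    have := h2.sub h1
    rw [sub_sub_cancel] at this
    exact this k
  · rw [coeff_sub, Psi_top m hk, EE_top hk]; simpa using Dv.zero 1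
noncomputable def FF (p m : ℕ) [Fact p.Prime] : ℚ_[p][X] := EE p m - (KK p m - Psi m) - C (4*((p:ℚ_[p])/3)^2) * Tp m
lemma MP_FF (h3 : 3 < p) {m : ℕ} (hm : 2*m < p) : PD 3 (MP m ((p:ℚ_[p])/3) (FF p m) - C (4*((p:ℚ_[p])/3)^2) * (Zp m - M0 m (Tp m))) := by
  have hEP := EE_Psi h3 hm
  have hKP := KK_Psi h3 hm
  have a1 : PD 3 (C (((p:ℚ_[p])/3)^2) * ((1-X)*(9-X)*th (EE p m - Psi m) + (2*C (m:ℚ_[p])*X*(9-X)+4*X) * (EE p m - Psi m))) :=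
    PD.mul' (PD.C (e2dv h3)) (PD_eop hEP)
  have a2 := EE_tail (p := p) h3 (m := m) (by omega)
  have a3 := MP_diff h3 (m := m) hKP
  have a4 : PD 3 (C ((p:ℚ_[p])^2) * Kq m (KK p m - Psi m)) := (PD.mul' (PD.C (Dv.pp 2)) (PD_Kq hKP)).mono (by omega)
  have a5 : PD 3 (C (4*((p:ℚ_[p])/3)^2) * (MP m ((p:ℚ_[p])/3) (Tp m) - M0 m (Tp m))) :=
    PD.mul' (PD.C ((Dv.ofNat 4).mul (e2dv h3))) (MP_diff h3 (PD_Tp hm))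
  have := (((a1.sub a2).sub a3).sub a4).sub a5
  convert this using 1
  have hpe : (p:ℚ_[p])^2 = 9*((p:ℚ_[p])/3)^2 := by ring
  have e1 := EE_eq (p := p) (m := m) (by omega)
  have e2 := KK_eq (p := p) (m := m) (by omega)
  unfold FF
  rw [MP_sub, MP_sub, MP_C, M0_sub, M0_Psi, sub_zero, e1, e2, hpe]
  unfold Kq Zp
  simp only [th_sub, C_mul, C_ofNat]
  ring
lemma tA_FF {m : ℕ} (hm : p = 3*m+1) (h3 : 3 < p) : PD 3 (tA (NN p : ℚ_[p][X]) - C (2 * v (p-1)) * FF p m) := by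
  have hv : Dv 0 (2 * v (p-1) : ℚ_[p]) := (Dv.ofNat 2).mul (dv_v h3 _)
  refine fwdMP h3 (m := m) (by omega) ?_ (fun k hk => ?_) (fun k hk => ?_)
  · have h1 := (NN_c0_1 (K := ℚ_[p]) m).1
    rw [← hm, show 3*m = p-1 by omega] at h1
    have : (FF p m).coeff 0 = 1 := by
      unfold FF
      rw [coeff_sub, coeff_sub, coeff_sub, coeff_C_mul, Tp_zero, EE_c0, Psi_c0]
      unfold KK; rw [mul_coeff_zero, ff_c0, ff_c0]; ring
    rw [coeff_sub, h1, coeff_C_mul, this]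
    simpa using Dv.zero 3
  · rw [MP_sub, MP_C]
    rw [coeff_sub, coeff_C_mul]
    refine (tri_MP1 hm h3 k).sub (hv.mul ?_)
    have := MP_FF (p := p) h3 (m := m) (by omega) k
    rwa [coeff_sub, coeff_C_mul, coeff_sub, M0_TT _ _ hk, sub_self, mul_zero, sub_zero] at this
  · rw [coeff_sub, coeff_C_mul]
    refine (A_top hm h3 hk).sub (hv.mul ?_)
    unfold FF
    rw [coeff_sub, coeff_sub, coeff_sub, coeff_C_mul, Tp_top _ _ hk, EE_top hk, Psi_top _ hk]
    unfold KK; rw [ffsq_top _ _ _ _ _ hk]; simpa using Dv.zero 3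
lemma un_v (h3 : 3 < p) : Un (v (p-1) : ℚ_[p]) := Un.of_sub Un.one (v_pm1 h3).symm
lemma ZM {m : ℕ} (hm : p = 3*m+1) (h3 : 3 < p) : PD 1 (Zp m - M0 m (Tp m) : ℚ_[p][X]) := by
  have h1 := PD_MP h3 (m := m) (tA_FF hm h3)
  have h2 := tri_MP1 hm h3
  have hF : PD 3 (MP m ((p:ℚ_[p])/3) (FF p m)) := fun k => by
    have h4 := (h2.sub h1) k
    rw [MP_sub, MP_C, sub_sub_cancel, coeff_C_mul] at h4
    exact Dv.of_mul h4 ((un2 h3).mul (un_v h3))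
  have h5 := hF.sub (MP_FF h3 (m := m) (by omega))
  rw [sub_sub_cancel] at h5
  intro k
  have h6 := h5 k
  rw [coeff_C_mul] at h6
  have u : Un (4/9 : ℚ_[p]) := by
    have := ((un2 h3).mul (un2 h3)).div (un9 h3); norm_num at this; exact this
  refine Dv.of_mul (x := (4/9:ℚ_[p])) (Dv.cancel (r := 2) (s := 1) ?_) u
  convert h6 using 1; ring
/-- the symmetrised identity -/
lemma GG {m : ℕ} (hm : p = 3*m+1) (h3 : 3 < p) : PD 3 (C ((p:ℚ_[p])^2) * (Tp m + TS m - C ((Tp m : ℚ_[p][X]).coeff (2*m)) * Psi m) + C 2 * (KK p m - Psi m)) := by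
  have hKP := KK_Psi (p := p) h3 (m := m) (by omega)
  refine fwdM0 h3 (m := m) (by omega) ?_ (fun k hk => ?_) (fun k hk => ?_)
  · rw [coeff_add, coeff_C_mul, coeff_C_mul, coeff_sub, coeff_sub, coeff_add, coeff_C_mul, Psi_c0, Tp_zero, TS_coeff _ _ (by omega)]
    unfold KK; rw [mul_coeff_zero, ff_c0, ff_c0]; simpa using Dv.zero 3
  · rw [M0_add, M0_C, M0_C, M0_sub, M0_add, M0_C, M0_sub, M0_Psi, KK_eq (by omega)]
    have a4 : Dv 3 ((C ((p:ℚ_[p])^2) * Kq m (KK p m - Psi m)).coeff k) := (PD.mul' (PD.C (Dv.pp 2)) (PD_Kq hKP)).mono (by omega) k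
    have z1 := M0_TT (K := ℚ_[p]) m k hk
    have z2 := M0_TS (K := ℚ_[p]) m k hk
    have z3 := ZM hm h3 (2*m+2-k)
    have z4 := Z_sym (K := ℚ_[p]) m k hk
    have lin : Kq m (KK p m - Psi m) = Kq m (KK p m) - Kq m (Psi m) := by unfold Kq; rw [th_sub]; ring
    rw [lin] at a4
    have a5 : Dv 3 ((p:ℚ_[p])^2 * (Zp m - M0 m (Tp m) : ℚ_[p][X]).coeff (2*m+2-k)) := (Dv.pp 2).mul' z3
    have := (((Dv.ofNat 2).mul a4).add a5)
    convert this using 1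
    simp only [coeff_add, coeff_sub, coeff_C_mul, mul_zero, sub_zero] at *
    rw [z1, z2]
    linear_combination (p:ℚ_[p])^2*z4
  · rw [coeff_add, coeff_C_mul, coeff_C_mul, coeff_sub, coeff_sub, coeff_add, coeff_C_mul, Psi_top _ hk, Tp_top _ _ hk, TS_top _ _ hk]
    unfold KK; rw [ffsq_top _ _ _ _ _ hk]; simpa using Dv.zero 3
end S19

set_option linter.unusedSectionVars false
set_option linter.unusedSimpArgs false
namespace S19
open Finset Polynomial

section gen
variable {K : Type*} [Field K] [CharZero K]
lemma dq_low (m j : ℕ) (h : j ≤ m) : (dq m j : K) = ((m.choose j : ℕ):K)^2 * (HH 2 m - HH 2 (m-j)) := by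
  induction j with
  | zero => simp [dq]
  | succ j ih =>
    rw [dq, ih (by omega), fc_pal m j (by omega)]
    obtain ⟨l, hl⟩ : ∃ l, m = j+1+l := ⟨m-(j+1), by omega⟩
    have h1 : (j:K)+1 ≠ 0 := by exact_mod_cast Nat.succ_ne_zero j
    have h5 : (l:K)+1 ≠ 0 := by exact_mod_cast Nat.succ_ne_zero l
    have h2 : ((m.choose (j+1) : ℕ):K) * ((j:K)+1) = (m.choose j : ℕ) * ((m:K)-j) := by
      have := Nat.choose_succ_right_eq m j
      rw [← Nat.cast_sub (by omega : j ≤ m)]; exact_mod_cast this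
    have h4 : ((m.choose (j+1) : ℕ):K) = (m.choose j : ℕ) * ((l:K)+1) / ((j:K)+1) := by 
      rw [eq_div_iff h1, h2, hl]; push_cast; ring
    rw [h4, show m - j = l+1 by omega, show m - (j+1) = l by omega, HH_succ]
    have hm : (m:K) = j+1+l := by rw [hl]; push_cast; ring
    generalize (m.choose j : ℕ) = cc
    generalize (HH 2 m : K) = A
    rw [hm]
    field_simp
    ring
lemma dq_high (m j : ℕ) : (dq m (m+j+1) : K) = (((m.factorial:ℕ):K) * ((j.factorial:ℕ):K) / (((m+j+1).factorial:ℕ):K))^2 := by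
  induction j with
  | zero =>
    rw [add_zero, dq, fc_pal m m le_rfl, Nat.factorial_succ]
    have h1 : (m:K)+1 ≠ 0 := by exact_mod_cast Nat.succ_ne_zero m
    have h2 : ((m.factorial:ℕ):K) ≠ 0 := by exact_mod_cast Nat.factorial_ne_zero m
    push_cast
    simp
    field_simp
  | succ j ih =>
    rw [show m+(j+1)+1 = (m+j+1)+1 by ring, dq, ih, fc_top m _ _ (by omega), Nat.factorial_succ (m+j+1), Nat.factorial_succ j]
    have h1 : ((m+j+1:ℕ):K)+1 ≠ 0 := by exact_mod_cast Nat.succ_ne_zero (m+j+1)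
    have h2 : (((m+j+1).factorial:ℕ):K) ≠ 0 := by exact_mod_cast Nat.factorial_ne_zero _
    push_cast at *
    generalize (((m+j+1).factorial:ℕ):K) = A at *
    field_simp
    ring
lemma tau_eq (m : ℕ) : (Tp m : K[X]).coeff (2*m) = HH 2 m + ∑ i ∈ range m, (((m.choose (i+1) : ℕ):K) * (((m.factorial:ℕ):K) * ((i.factorial:ℕ):K) / (((m+i+1).factorial:ℕ):K)))^2 := by
  rw [Tp_coeff m _ le_rfl, coeff_mul, Finset.Nat.sum_antidiagonal_eq_sum_range_succ (fun i j => (ff m 0 0 : K[X]).coeff i * (tru (2*m) (dq m) : K[X]).coeff j)]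
  have e1 : ∑ k ∈ range (2*m).succ, (ff m 0 0 : K[X]).coeff k * (tru (2*m) (dq m) : K[X]).coeff (2*m-k) = 
     ∑ k ∈ range (m+1), (ff m 0 0 : K[X]).coeff k * (tru (2*m) (dq m) : K[X]).coeff (2*m-k) := by
    symm
    apply sum_subset
    · intro x; simp only [mem_range]; omega
    · intro x _ hx
      rw [ff_coeff, fc_top, zero_mul]
      simp only [mem_range] at hx; omega
  rw [e1, ← sum_range_reflect, sum_range_succ']
  rw [add_comm]
  congr 1
  · rw [show m+1-1-0 = m by omega, show 2*m-m = m by omega, ff_coeff, tru_coeff, if_pos (by omega), fc_pal m m le_rfl, dq_low m m le_rfl]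
    simp [HH_zero]
  · apply sum_congr rfl
    intro i hi
    have hi := mem_range.1 hi
    rw [show m+1-1-(i+1) = m-(i+1) by omega, show 2*m-(m-(i+1)) = m+i+1 by omega, ff_coeff, tru_coeff, if_pos (by omega), fc_pal m _ (by omega), dq_high, Nat.choose_symm (by omega)]
    ring
/-- elementary symmetric bookkeeping -/
lemma prodX (m : ℕ) (a : ℕ → K) : (∏ i ∈ range m, (1 - C (a i) * X : K[X])).coeff 0 = 1 ∧ 
   (∏ i ∈ range m, (1 - C (a i) * X : K[X])).coeff 1 = -∑ i ∈ range m, a i ∧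
   2*(∏ i ∈ range m, (1 - C (a i) * X : K[X])).coeff 2 = (∑ i ∈ range m, a i)^2 - ∑ i ∈ range m, (a i)^2 ∧
   (∏ i ∈ range m, (1 - C (a i) * X : K[X])).natDegree ≤ m := by
  induction m with
  | zero => simp [coeff_one]
  | succ m ih =>
    obtain ⟨h0, h1, h2, h3⟩ := ih
    rw [prod_range_succ, sum_range_succ, sum_range_succ]
    generalize (∏ i ∈ range m, (1 - C (a i) * X : K[X])) = P at *
    have e : P * (1 - C (a m) * X) = P - X * (C (a m) * P) := by ring
    refine ⟨?_, ?_, ?_, ?_⟩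
    · rw [e, coeff_sub, coeff_X_mul_zero, h0]; ring
    · rw [e, coeff_sub, show (1:ℕ) = 0+1 by rfl, coeff_X_mul, coeff_C_mul, h0, zero_add, h1]; ring
    · rw [e, coeff_sub, show (2:ℕ) = 1+1 by rfl, coeff_X_mul, coeff_C_mul, h1]; linear_combination h2
    · refine natDegree_mul_le.trans (Nat.add_le_add h3 ?_)
      refine (natDegree_sub_le _ _).trans ?_
      simp only [natDegree_one]
      refine max_le (by omega) ((natDegree_C_mul_le _ _).trans natDegree_X_le)
noncomputable def PQ (m : ℕ) : K[X] := ∏ i ∈ range m, (1 - C (1/((i:K)+1+m)^1) * X)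
lemma PQ_eval (m : ℕ) (x : K) : (PQ m).eval x = ∏ i ∈ range m, (1 - 1/((i:K)+1+m)^1 * x) := by
  unfold PQ; rw [eval_prod]; simp
lemma PQ_step (m : ℕ) (x : K) : (PQ m).eval (x+1) * (2*m - x) = (PQ m).eval x * (m - x) := by
  have key : ∀ x : K, (PQ m).eval x = (∏ i ∈ range m, ((i:K)+1+m-x)) / ∏ i ∈ range m, ((i:K)+1+m) := by
    intro x; rw [PQ_eval, ← prod_div_distrib]; apply prod_congr rfl; intro i _
    have : (i:K)+1+m ≠ 0 := by exact_mod_cast (by omega : i+1+m ≠ 0)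
    field_simp
  have h0 : ∏ i ∈ range m, ((i:K)+1+m) ≠ 0 := prod_ne_zero_iff.2 fun i _ => by exact_mod_cast (by omega : i+1+m ≠ 0)
  have h1 : ∏ i ∈ range (m+1), ((i:K)+m-x) = (∏ i ∈ range m, ((i:K)+1+m-(x+1))) * (2*m-x) := by
    rw [prod_range_succ]; congr 1
    · apply prod_congr rfl; intro i _; ring
    · ring
  have h2 : ∏ i ∈ range (m+1), ((i:K)+m-x) = (∏ i ∈ range m, ((i:K)+1+m-x)) * (m-x) := by
    rw [prod_range_succ']; congr 1
    · apply prod_congr rfl; intro i _; push_cast; ring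
    · push_cast; ring
  rw [key, key, div_mul_eq_mul_div, div_mul_eq_mul_div, ← h1, ← h2]
end gen
variable {p : ℕ} [hp : Fact p.Prime]
lemma poly_sum {F : ℚ_[p][X]} (h : PD 0 F) {d : ℕ} (hd : F.natDegree ≤ d) (hdp : d + 1 < p) : Dv 1 (∑ j ∈ range p, F.eval (j:ℚ_[p])) := by
  have : ∑ j ∈ range p, F.eval (j:ℚ_[p]) = ∑ i ∈ range (d+1), F.coeff i * ∑ j ∈ range p, (j:ℚ_[p])^i := by
    simp only [mul_sum]
    rw [sum_comm]
    apply sum_congr rfl; intro j _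
    exact eval_eq_sum_range' (by omega) _
  rw [this]
  refine Dv.sum fun i hi => (h i).mul ?_
  have := power_sum (p := p) (n := i) (by have := mem_range.1 hi; omega)
  unfold Cg at this; rwa [sub_zero] at this
end S19

set_option linter.unusedSectionVars false
set_option linter.unusedSimpArgs false
namespace S19
open Finset Polynomial
variable {p : ℕ} [hp : Fact p.Prime]
lemma un_im {m i : ℕ} (hm : p = 3*m+1) (hi : i < m) : Un ((i:ℚ_[p])+1+(m:ℚ_[p])) := by
  have := un_of_lt (p := p) (n := i+1+m) (by omega) (by omega); push_cast at this; exact this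
lemma PD_PQ {m : ℕ} (hm : p = 3*m+1) : PD 0 (PQ m : ℚ_[p][X]) := by
  unfold PQ
  have : ∀ s : Finset ℕ, (∀ i ∈ s, i < m) → PD 0 (∏ i ∈ s, (1 - C (1/((i:ℚ_[p])+1+m)^1) * X : ℚ_[p][X])) := by
    intro s
    induction s using Finset.induction_on with
    | empty => intro _; rw [prod_empty]; exact PD.one
    | insert a s ha ih =>
      intro h
      rw [prod_insert ha]
      refine PD.mul ?_ (ih fun i hi => h i (mem_insert_of_mem hi))
      refine PD.one.sub ((PD.C (Dv.one.div ?_)).mul PD.X)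
      exact (un_im hm (h a (mem_insert_self _ _))).pow 1
  exact this _ fun i hi => mem_range.1 hi
lemma PQ_refl {m : ℕ} (hm : p = 3*m+1) {x : ℚ_[p]} (hx : Dv 0 x) : Cg 1 ((PQ m).eval ((p:ℚ_[p])-x)) ((PQ m).eval x) := by
  rw [PQ_eval, PQ_eval, ← prod_range_reflect]
  have hd : ∀ i ∈ range m, ∀ y : ℚ_[p], Dv 0 y → Dv 0 (1 - 1/((i:ℚ_[p])+1+(m:ℚ_[p]))^1*y) := fun i hi y hy =>
    Dv.one.sub ((Dv.one.div ((un_im hm (mem_range.1 hi)).pow 1)).mul hy)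
  refine Cg.prod (fun j hj => ?_) (fun j hj => hd _ hj _ hx)
  · have hj' := mem_range.1 hj
    have u1 := un_im hm hj'
    have u2 := un_im (p := p) (i := m-1-j) hm (by omega)
    have e : ((m-1-j:ℕ):ℚ_[p])+1+m = p - (j+1+m) := by
      rw [eq_sub_iff_add_eq]; norm_cast; omega
    rw [e] at u2 ⊢
    generalize (j:ℚ_[p])+1+(m:ℚ_[p]) = J at *
    have n1 := u1.ne; have n2 := u2.ne
    refine cgd (z := p * ((x-J)/((p-J)*J))) (Dv.p1.mulr ((hx.sub u1.dv).div (u2.mul u1))) ?_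
    generalize hq : (p:ℚ_[p]) - J = B at *
    rw [show (p:ℚ_[p]) = B + J by rw [← hq]; ring]
    field_simp
    ring
lemma RR_PQ {m : ℕ} (hm : p = 3*m+1) (j : ℕ) (hj : j ≤ m) : Cg 1 ((-1)^j * (((m.choose j : ℕ):ℚ_[p]) * (((m.factorial:ℕ):ℚ_[p]) * ((j.factorial:ℕ):ℚ_[p]) / (((m+j).factorial:ℕ):ℚ_[p])))) ((PQ m).eval (j:ℚ_[p])) := by
  induction j with
  | zero => 
    have : ((m.factorial:ℕ):ℚ_[p]) ≠ 0 := by exact_mod_cast Nat.factorial_ne_zero m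
    refine Cg.of_eq ?_
    rw [PQ_eval]; simp [this]
  | succ j ih =>
    have ih := ih (by omega)
    have u := un_im (p := p) (i := j) hm (by omega)
    have hs := PQ_step m (j:ℚ_[p])
    have hr : (((m.choose (j+1) : ℕ):ℚ_[p]) * (((m.factorial:ℕ):ℚ_[p]) * (((j+1).factorial:ℕ):ℚ_[p]) / (((m+(j+1)).factorial:ℕ):ℚ_[p]))) * ((j:ℚ_[p])+1+m) =
      (((m.choose j : ℕ):ℚ_[p]) * (((m.factorial:ℕ):ℚ_[p]) * ((j.factorial:ℕ):ℚ_[p]) / (((m+j).factorial:ℕ):ℚ_[p]))) * ((m:ℚ_[p]) - j) := by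
      have h2 : ((m.choose (j+1) : ℕ):ℚ_[p]) * ((j:ℚ_[p])+1) = (m.choose j : ℕ) * ((m:ℚ_[p])-j) := by
        have := Nat.choose_succ_right_eq m j
        rw [← Nat.cast_sub (by omega : j ≤ m)]; exact_mod_cast this
      have h4 : (((m+j).factorial:ℕ):ℚ_[p]) ≠ 0 := by exact_mod_cast Nat.factorial_ne_zero (m+j)
      rw [show m+(j+1) = (m+j)+1 by ring, Nat.factorial_succ (m+j), Nat.factorial_succ j]
      have h5 := u.ne
      push_cast
      rw [show (m:ℚ_[p])+j+1 = j+1+m by ring]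
      generalize (j:ℚ_[p])+1+m = J at *
      generalize (((m+j).factorial:ℕ):ℚ_[p]) = A at *
      field_simp
      linear_combination (m.factorial : ℚ_[p])*((j.factorial:ℕ):ℚ_[p])*h2
    push_cast
    refine Dv.of_mul (x := (j:ℚ_[p])+1+(m:ℚ_[p])) ?_ u
    have hp' : (p:ℚ_[p]) = 3*m+1 := by exact_mod_cast hm
    generalize (((m.choose (j+1) : ℕ):ℚ_[p]) * (((m.factorial:ℕ):ℚ_[p]) * (((j+1).factorial:ℕ):ℚ_[p]) / (((m+(j+1)).factorial:ℕ):ℚ_[p]))) = R1 at *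
    generalize (((m.choose j : ℕ):ℚ_[p]) * (((m.factorial:ℕ):ℚ_[p]) * ((j.factorial:ℕ):ℚ_[p]) / (((m+j).factorial:ℕ):ℚ_[p]))) = R0 at *
    have d1 : Dv 1 ((p:ℚ_[p]) * (PQ m).eval ((j:ℚ_[p])+1)) := Dv.p1.mulr ((PD_PQ hm).eval (by exact_mod_cast Dv.nat (j+1)))
    have d2 := Dv.mulr ih ((Dv.nat m).sub (Dv.nat (p := p) j))
    have := (Dv.add d1 d2).neg
    rw [show ((j:ℚ_[p])+1+m) * ((-1)^(j+1)*R1 - (PQ m).eval ((j:ℚ_[p])+1)) = -((p:ℚ_[p]) * (PQ m).eval ((j:ℚ_[p])+1) + ((-1)^j*R0 - (PQ m).eval (j:ℚ_[p])) * (m - j)) by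
      rw [pow_succ]; linear_combination (-(-1)^j)*hr + hs + (eval ((j:ℚ_[p])+1) (PQ m)) * hp']
    exact this
lemma PQ_zero {m i : ℕ} (hi : i < m) : (PQ m).eval ((m+i:ℕ)+1:ℚ_[p]) = 0 := by
  rw [PQ_eval]
  refine prod_eq_zero (mem_range.2 hi) ?_
  have : (i:ℚ_[p])+1+m ≠ 0 := by exact_mod_cast (by omega : i+1+m ≠ 0)
  rw [show ((m+i:ℕ)+1:ℚ_[p]) = (i:ℚ_[p])+1+m by push_cast; ring]
  rw [pow_one, one_div, inv_mul_cancel₀ this, sub_self]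
lemma W_coeff (m : ℕ) : ((PQ m : ℚ_[p][X])^2).coeff 0 = 1 ∧ ((PQ m : ℚ_[p][X])^2).coeff 1 = -2*(HH 1 (2*m) - HH 1 m) ∧ 
    ((PQ m : ℚ_[p][X])^2).coeff 2 = 2*(HH 1 (2*m) - HH 1 m)^2 - (HH 2 (2*m) - HH 2 m) ∧ ((PQ m : ℚ_[p][X])^2).natDegree ≤ 2*m := by
  obtain ⟨h0, h1, h2, h3⟩ := prodX m (fun i => 1/((i:ℚ_[p])+1+m)^1)
  have e : ∑ i ∈ range m, (1/((i:ℚ_[p])+1+m)^1)^2 = HH 2 (2*m) - HH 2 m := by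
    rw [← HH_shift]; apply sum_congr rfl; intro i _; rw [pow_one, div_pow, one_pow]
  rw [e, HH_shift] at h2
  rw [HH_shift] at h1
  change (PQ m).coeff _ = _ at h0
  change (PQ m).coeff _ = _ at h1
  change 2*(PQ m).coeff _ = _ at h2
  change (PQ m).natDegree ≤ _ at h3
  refine ⟨?_, ?_, ?_, ?_⟩
  · rw [sq, mul_coeff_zero, h0, one_mul]
  · rw [sq, coeff_mul, Finset.Nat.sum_antidiagonal_eq_sum_range_succ (fun i j => (PQ m : ℚ_[p][X]).coeff i * (PQ m : ℚ_[p][X]).coeff j)]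
    simp only [sum_range_succ, range_zero, sum_empty]
    norm_num
    rw [h0, h1]; ring
  · rw [sq, coeff_mul, Finset.Nat.sum_antidiagonal_eq_sum_range_succ (fun i j => (PQ m : ℚ_[p][X]).coeff i * (PQ m : ℚ_[p][X]).coeff j)]
    simp only [sum_range_succ, range_zero, sum_empty]
    norm_num
    rw [h0, h1]; linear_combination h2
  · exact natDegree_pow_le.trans (by omega)
lemma tau0 {m : ℕ} (hm : p = 3*m+1) (h3 : 3 < p) : Dv 1 ((Tp m : ℚ_[p][X]).coeff (2*m)) := by
  obtain ⟨w0, w1, w2, wd⟩ := W_coeff (p := p) m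
  have hPW : PD 0 ((PQ m : ℚ_[p][X])^2) := (PD_PQ hm).pow 2
  set W := (PQ m : ℚ_[p][X])^2 with hW
  have e1 : Cg 2 (HH 1 (2*m) - HH 1 m : ℚ_[p]) _ := HH1_refl h3 (n := 2*m) (n' := m) (by omega)
  have e2 := HH2_refl (p := p) h3 (n := m) (n' := 2*m) (by omega)
  have dH := dv_HH (p := p) 2 (n := m) (by omega)
  have e1' : Dv 1 (HH 1 (2*m) - HH 1 m : ℚ_[p]) := (e1.mono (by omega : 1 ≤ 2)).dv le_rfl (Dv.mulr Dv.p1.neg (dv_HH 2 (by omega)))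
  have hW2 : Cg 1 (W.coeff 2) (2 * HH 2 m) := by
    rw [w2]
    refine cgd (z := 2*((HH 1 (2*m) - HH 1 m)*(HH 1 (2*m) - HH 1 m)) - (HH 2 (2*m) - -HH 2 m)) (Dv.sub ((Dv.ofNat 2).mul (e1'.mulr (e1'.mono (by omega)))) e2) (by ring)
  set F := W.divX.divX with hF
  have hPF : PD 0 F := hPW.divX.divX
  have hS := poly_sum hPF (d := 2*m-2) (by
    rw [hF, natDegree_divX_eq_natDegree_tsub_one, natDegree_divX_eq_natDegree_tsub_one]; omega) (by omega)
  have hWe : ∀ x : ℚ_[p], W.eval x = F.eval x * x^2 + W.coeff 1 * x + 1 := by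
    intro x
    have a1 := congrArg (eval x) (divX_mul_X_add W)
    have a2 := congrArg (eval x) (divX_mul_X_add W.divX)
    rw [eval_add, eval_mul, eval_X, eval_C] at a1 a2
    rw [coeff_divX, zero_add] at a2
    rw [w0] at a1
    linear_combination (-x)*a2 - a1
  have hF0 : F.eval 0 = W.coeff 2 := by rw [← coeff_zero_eq_eval_zero, hF, coeff_divX, coeff_divX]
  set f : ℕ → ℚ_[p] := fun j => W.eval (j:ℚ_[p]) / (j:ℚ_[p])^2 with hf
  have hsum : ∑ j ∈ range p, F.eval (j:ℚ_[p]) = (∑ i ∈ range (p-1), f (i+1)) - HH 2 (p-1) - W.coeff 1 * HH 1 (p-1) + W.coeff 2 := by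
    have : range p = range ((p-1)+1) := by rw [Nat.sub_add_cancel (by omega)]
    rw [this, sum_range_succ', Nat.cast_zero, hF0]
    congr 1
    unfold HH
    rw [mul_sum, ← sum_sub_distrib, ← sum_sub_distrib]
    apply sum_congr rfl; intro i hi
    have n := (un_succ (p := p) (mem_range.1 hi) (by omega)).ne
    simp only [hf]
    rw [hWe]; push_cast
    generalize (i:ℚ_[p])+1 = J at *
    field_simp
    ring
  rw [hsum] at hS
  have hA : Cg 1 (∑ i ∈ range (p-1), f (i+1)) (-(2*HH 2 m)) := by
    have dW1 : Dv 0 (W.coeff 1) := hPW 1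
    refine cgd (Dv.sub (Dv.add (Dv.add hS (HH2_top h3)) (dW1.mul ((HH1_top h3).mono (by omega : 1 ≤ 2)))) hW2) ?_
    ring
  rw [sum_split_reflect f (by omega : m < p), show p-1-m = m+m by omega] at hA
  have hB : Cg 1 (∑ i ∈ range (m+m), f (p-(i+1))) (∑ i ∈ range m, f (i+1)) := by
    have : ∑ i ∈ range m, f (i+1) = ∑ i ∈ range (m+m), f (i+1) := by
      rw [sum_range_add]
      rw [sum_eq_zero (s := range m) (f := fun x => f (m+x+1)), add_zero]
      intro i hi
      simp only [hf]; rw [hW]; 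
      rw [Nat.cast_add (m+i) 1, Nat.cast_one, eval_pow, PQ_zero (mem_range.1 hi)]; simp
    rw [this]
    refine Cg.sum fun i hi => ?_
    have hi := mem_range.1 hi
    simp only [hf]
    have u1 := un_succ (p := p) hi (by omega)
    rw [Nat.cast_sub (by omega)]; push_cast
    have dd : Cg 1 ((p:ℚ_[p]) - ((i:ℚ_[p])+1)) (-((i:ℚ_[p])+1)) := cgd Dv.p1 (by ring)
    have u2 : Un ((p:ℚ_[p]) - ((i:ℚ_[p])+1)) := dd.symm.un u1.neg
    refine Cg.div ?_ ?_ ?_ (u2.pow 2) (u1.pow 2)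
    · rw [hW, eval_pow, eval_pow]
      exact (PQ_refl hm u1.dv).pow ((PD_PQ hm).eval u1.dv) 2
    · have := dd.pow u1.neg.dv 2
      rwa [neg_sq] at this
    · exact hPW.eval u2.dv
  have hC : Cg 1 (∑ i ∈ range m, f (i+1)) (-HH 2 m) := by
    refine Dv.of_mul (x := 2) ?_ (un2 h3)
    refine Eq.mp (congrArg _ ?_) (Dv.sub hA hB)
    ring
  rw [tau_eq]
  have hD : Cg 1 (∑ i ∈ range m, (((m.choose (i+1) : ℕ):ℚ_[p]) * (((m.factorial:ℕ):ℚ_[p]) * ((i.factorial:ℕ):ℚ_[p]) / (((m+i+1).factorial:ℕ):ℚ_[p])))^2) (∑ i ∈ range m, f (i+1)) := by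
    refine Cg.sum fun i hi => ?_
    have hi := mem_range.1 hi
    have u1 := un_succ (p := p) hi (by omega)
    have h := (RR_PQ hm (i+1) (by omega)).pow ((PD_PQ hm).eval (Dv.nat _)) 2
    have := Dv.div h (u1.pow 2)
    unfold Cg
    refine Eq.mp (congrArg (Dv 1) ?_) this
    simp only [hf]
    rw [hW, eval_pow, mul_pow, ← pow_mul, mul_comm (i+1) 2, pow_mul, neg_one_sq, one_pow, one_mul, Nat.factorial_succ i, sub_div, ← add_assoc m i 1]
    have n1 := u1.ne
    push_cast
    generalize (i:ℚ_[p])+1 = J at *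
    generalize eval J (PQ m) = E
    congr 1
    field_simp
  exact Eq.mp (congrArg _ (by ring)) (Dv.add hD hC)
end S19

set_option linter.unusedSectionVars false
set_option linter.unusedSimpArgs false
namespace S19
open Finset Polynomial
variable {p : ℕ} [hp : Fact p.Prime]
lemma Psi1 (m : ℕ) : (Psi m : ℚ_[p][X]).eval 1 = ((2*m).choose m : ℚ_[p])^2 := by
  unfold Psi
  rw [eval_mul, ff_eval m 0 0 (fun k _ => by rw [add_zero]; exact_mod_cast Nat.succ_ne_zero k), choose_prod, sq]
  congr 1 <;> · apply prod_congr rfl; intro j _; ring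
lemma KK1 {m : ℕ} (hm : p = 3*m+1) (h3 : 3 < p) : Cg 3 ((KK p m).eval 1) (((2*m).choose m : ℚ_[p])^2 * (1 + (p:ℚ_[p])^2 * HH 2 m)) := by
  have e : (KK p m).eval 1 = ((2*m).choose m : ℚ_[p])^2 * ∏ j ∈ range m, (((j:ℚ_[p])+1)^2 / (((j:ℚ_[p])+1+p)*((j:ℚ_[p])+1-p))) := by
    unfold KK
    rw [eval_mul, ff_eval m _ _ (fun k hk => (un_pp (p := p) (by omega)).1.ne), ff_eval m _ _ (fun k hk => by
      rw [← sub_eq_add_neg]; exact (un_pp (p := p) (by omega)).2.ne), choose_prod, ← prod_pow, ← prod_mul_distrib, ← prod_mul_distrib]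
    apply prod_congr rfl; intro j hj
    have hj := mem_range.1 hj
    have n0 := (un_succ (p := p) hj (by omega)).ne
    have n1 := (un_pp (p := p) (k := j) (by omega)).1.ne
    have n2 := (un_pp (p := p) (k := j) (by omega)).2.ne
    rw [show (j:ℚ_[p])+1+m+p-p = j+1+m by ring, show (j:ℚ_[p])+1+m+-p- -p = j+1+m by ring, show (j:ℚ_[p])+1+-p = j+1-p by ring]
    generalize (j:ℚ_[p])+1+p = A at *
    generalize (j:ℚ_[p])+1-p = B at *
    field_simp
  rw [e]
  refine Cg.mul_left ?_ ((Dv.nat _).pow 2)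
  have h := prod_exp h3 (range m) (fun j => ((j:ℚ_[p])+1)^2 / (((j:ℚ_[p])+1+p)*((j:ℚ_[p])+1-p))) (fun _ => 0) (fun j => 1/((j:ℚ_[p])+1)^2) ?_ ?_ ?_
  · simp only [sum_const_zero] at h
    refine h.trans (Cg.of_eq ?_)
    unfold HH; norm_num
  · intro j hj
    have hj := mem_range.1 hj
    have u0 := (un_succ (p := p) hj (by omega))
    have u1 := (un_pp (p := p) (k := j) (by omega)).1
    have u2 := (un_pp (p := p) (k := j) (by omega)).2
    have hp1 : (p:ℚ_[p]) = ((j:ℚ_[p])+1+p) - (j+1) := by ring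
    have hp2 : ((j:ℚ_[p])+1-p) = 2*(j+1) - (j+1+p) := by ring
    have n0 := u0.ne; have n1 := u1.ne; have n2 := u2.ne
    refine cgd (z := (p:ℚ_[p])^4 * (1/(((j:ℚ_[p])+1+p)*((j:ℚ_[p])+1-p)*((j:ℚ_[p])+1)^2))) ?_ ?_
    · exact ((Dv.pp 4).mono (by omega)).mulr (Dv.one.div ((u1.mul u2).mul (u0.pow 2)))
    · rw [mul_zero, add_zero]
      generalize (j:ℚ_[p])+1 = J at *
      have n3 : J^2-(p:ℚ_[p])^2 ≠ 0 := by
        rw [show J^2-(p:ℚ_[p])^2 = (J+p)*(J-p) by ring]; exact mul_ne_zero n1 n2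
      rw [show (J+p)*(J-p) = J^2-(p:ℚ_[p])^2 by ring]
      field_simp
      ring
  · exact fun _ _ => Dv.zero 0
  · exact fun j hj => Dv.one.div ((un_succ (mem_range.1 hj) (by omega)).pow 2)
lemma TS1 (m : ℕ) : (TS m : ℚ_[p][X]).eval 1 = (Tp m).eval 1 := by
  have h1 : (TS m : ℚ_[p][X]).natDegree < 2*m+1 := Nat.lt_succ_of_le (natDegree_le_iff_coeff_eq_zero.2 fun k hk => TS_top m k hk)
  have h2 : (Tp m : ℚ_[p][X]).natDegree < 2*m+1 := Nat.lt_succ_of_le (natDegree_le_iff_coeff_eq_zero.2 fun k hk => Tp_top m k hk)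
  rw [eval_eq_sum_range' h1, eval_eq_sum_range' h2, ← sum_range_reflect]
  apply sum_congr rfl; intro k hk
  have hk := mem_range.1 hk
  rw [one_pow, one_pow, TS_coeff _ _ (by omega), show 2*m-(2*m+1-1-k) = k by omega]
lemma S0_val {m : ℕ} (hm : p = 3*m+1) (h3 : 3 < p) : Cg 3 (SS p 0 : ℚ_[p]) (((2*m).choose m : ℚ_[p])^2 * (1 - 2/3*(p:ℚ_[p])^2*HH 2 m)) := by
  obtain ⟨q, m', e, h⟩ := Shp.ex (p := p) h3
  have hmm : m' = m := by unfold Shp at h; omega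
  subst hmm
  have hv := v_top h3 h
  have hv1 := v_pm1 (p := p) h3
  have hV := vV (p := p) h3 (m := m') (by omega)
  have hdC : Dv 0 ((2*m').choose m' : ℚ_[p]) := Dv.nat _
  have d2 : Dv 0 (HH 2 m' : ℚ_[p]) := dv_HH 2 (by omega)
  have i3 : Dv 0 (1/3 : ℚ_[p]) := Dv.div Dv.one (un3 h3)
  have e1 := (tA_FF hm h3).eval (Dv.one)
  rw [eval_sub, eval_mul, eval_C, tA_eval1, (coeff_NN (K := ℚ_[p]) p).1] at e1
  have g := (GG hm h3).eval Dv.one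
  simp only [eval_add, eval_sub, eval_mul, eval_C] at g
  rw [TS1, Psi1] at g
  have k1 := KK1 hm h3
  have t0 : Dv 3 ((p:ℚ_[p])^2 * ((Tp m' : ℚ_[p][X]).coeff (2*m')) * ((2*m').choose m' : ℚ_[p])^2) := Dv.mulr ((Dv.pp 2).mul' (tau0 hm h3)) (hdC.pow 2)
  have eF : (FF p m').eval 1 = (EE p m').eval 1 - ((KK p m').eval 1 - ((2*m').choose m' : ℚ_[p])^2) - 4*((p:ℚ_[p])/3)^2 * (Tp m').eval 1 := by
    unfold FF
    simp only [eval_add, eval_sub, eval_mul, eval_C]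
    rw [Psi1]
  rw [eF] at e1
  have eE : (EE p m').eval 1 = (∏ j ∈ range m', ((j:ℚ_[p])+1+(m':ℚ_[p])-2*((p:ℚ_[p])/3))/((j:ℚ_[p])+1-p))^2 := by
    unfold EE
    rw [eval_pow, ff_eval m' _ _ (fun k hk => by
      have := (un_pp (p := p) (k := k) (by omega)).2.ne
      rw [show (k:ℚ_[p])+1+ -3*((p:ℚ_[p])/3) = k+1-p by ring]; exact this)]
    congr 1
    apply prod_congr rfl; intro j _; congr 1 <;> ring
  rw [← eE] at hV
  have dE : Dv 0 ((EE p m').eval 1) := (PD_EE h3 (by omega)).eval Dv.one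
  generalize (EE p m').eval 1 = E at *
  generalize (KK p m').eval 1 = Kv at *
  generalize (Tp m' : ℚ_[p][X]).eval 1 = T at *
  generalize (Tp m' : ℚ_[p][X]).coeff (2*m') = tau at *
  have dv := dv_v (p := p) h3 (p-1)
  have r1 := HH1_refl (p := p) h3 (n := 2*m') (n' := m') (by omega)
  have r2 := HH2_refl (p := p) h3 (n := m') (n' := 2*m') (by omega)
  have d22 : Dv 0 (HH 2 (2*m') : ℚ_[p]) := dv_HH 2 (by omega)
  -- p * (HH1 diff) ≡ p² H2
  have r3 : Dv 3 ((p:ℚ_[p]) * (HH 1 (2*m') - HH 1 m' - (p:ℚ_[p]) * HH 2 m' : ℚ_[p])) := by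
    refine Dv.mul' (Dv.p1) (y := _) (s := 2) ?_
    have := Dv.sub r1 (Dv.mul' Dv.p1 r2)
    exact Eq.mp (congrArg (Dv 2) (by ring)) this
  have r3b : Dv 1 (HH 1 (2*m') - HH 1 m' : ℚ_[p]) := (r1.mono (s := 1) (by omega)).dv le_rfl (Dv.mulr Dv.p1.neg d22)
  have r4 : Dv 3 ((p:ℚ_[p])^2 * (HH 2 (2*m') + HH 2 m')) := by
    refine (Dv.pp 2).mul' (s := 1) ?_
    exact Eq.mp (congrArg (Dv 1) (by ring)) r2
  have r5 : Dv 3 ((p:ℚ_[p])^2 * (HH 1 (2*m') - HH 1 m')^2) := by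
    rw [sq (HH 1 (2*m') - HH 1 m')]
    exact ((Dv.pp 2).mul' (s := 1) (r3b.mulr (r3b.mono (by omega))))
  have V2 : Cg 3 (v (p-1) * E) (((2*m').choose m' : ℚ_[p])^2 * (1 - 1/9*(p:ℚ_[p])^2*HH 2 m')) := by
    have h1 := hv.mul_left dE
    rw [mul_comm E, mul_comm E] at h1
    refine (h1.trans hV).trans (Cg.mul_left ?_ (hdC.pow 2))
    have c1 : Dv 0 (-(4/3) : ℚ_[p]) := ((Dv.ofNat 4).div (un3 h3)).neg
    have c2 : Dv 0 (-(4/9) : ℚ_[p]) := ((Dv.ofNat 4).div (un9 h3)).neg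
    have c3 : Dv 0 (8/9 : ℚ_[p]) := ((Dv.ofNat 8).div (un9 h3))
    refine cgd (((r3.mulr c1).add (r4.mulr c2)).add (r5.mulr c3)) ?_
    ring
  generalize (HH 2 m' : ℚ_[p]) = H at *
  have dvp : Dv 3 ((p:ℚ_[p])^2 * (v (p-1) - 1)) := (Dv.pp 2).mul' hv1
  have u2 := un2 (p := p) h3
  refine Dv.of_mul (x := 2) ?_ u2
  have i2 : Dv 0 (1/2:ℚ_[p]) := Dv.div Dv.one u2
  generalize (v (p-1) : ℚ_[p]) = w at *
  generalize (SS p 0 : ℚ_[p]) = S at *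
  generalize ((2*m').choose m' : ℚ_[p]) = c at *
  have i9 : Dv 0 (4/9 : ℚ_[p]) := ((Dv.ofNat 4).div (un9 h3))
  have i109 : Dv 0 (10/9 : ℚ_[p]) := ((Dv.ofNat 10).div (un9 h3))
  -- 2*S = e1 + 2w(E - (K-c²) - 4/9 p² T)
  have k1w := Dv.mulr k1 dv
  have gw := g.mulr dv
  have t0w := t0.mulr dv
  unfold Cg at V2 k1
  refine Eq.mp (congrArg (Dv 3) ?_) ((((((e1.add (V2.mulr (Dv.ofNat 2))).add (k1w.mulr (i109.neg))).add (gw.mulr i9.neg)).add (t0w.mulr i9.neg))).add (dvp.mulr (i109.neg.mul ((hdC.pow 2).mul d2))))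
  ring
end S19

set_option linter.unusedSectionVars false
set_option linter.unusedSimpArgs false
namespace S19
open Finset Polynomial
variable {p : ℕ} [hp : Fact p.Prime]
lemma px (h3 : 3 < p) (k s n : ℕ) (h : s + n < p) : Cg 3 (∏ j ∈ range n, (1 + (p:ℚ_[p]) * ((k:ℚ_[p]) * (1/((j:ℚ_[p])+1+(s:ℚ_[p]))^1))))
   (1 + (p:ℚ_[p]) * ((k:ℚ_[p]) * ∑ j ∈ range n, 1/((j:ℚ_[p])+1+(s:ℚ_[p]))^1) + (p:ℚ_[p])^2 * ((k:ℚ_[p])^2 * (((∑ j ∈ range n, 1/((j:ℚ_[p])+1+(s:ℚ_[p]))^1)^2 - ∑ j ∈ range n, 1/((j:ℚ_[p])+1+(s:ℚ_[p]))^2)/2))) := by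
  have u : ∀ j ∈ range n, Un ((j:ℚ_[p])+1+(s:ℚ_[p])) := fun j hj => by
    have := mem_range.1 hj
    have := un_of_lt (p := p) (n := j+1+s) (by omega) (by omega); push_cast at this; exact this
  have := prod_exp h3 (range n) (fun j => (1 + (p:ℚ_[p]) * ((k:ℚ_[p]) * (1/((j:ℚ_[p])+1+(s:ℚ_[p]))^1)))) (fun j => ((k:ℚ_[p]) * (1/((j:ℚ_[p])+1+(s:ℚ_[p]))^1))) (fun _ => 0) 
    (fun i _ => Cg.of_eq (by ring)) (fun i hi => (Dv.nat k).mul (Dv.one.div ((u i hi).pow 1))) (fun _ _ => Dv.zero 0)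
  refine this.trans (Cg.of_eq ?_)
  have e : ∑ i ∈ range n, ((k:ℚ_[p]) * (1/((i:ℚ_[p])+1+(s:ℚ_[p]))^1))^2 = (k:ℚ_[p])^2 * ∑ j ∈ range n, 1/((j:ℚ_[p])+1+(s:ℚ_[p]))^2 := by
    rw [mul_sum]; apply sum_congr rfl; intro i _; rw [mul_pow, div_pow, one_pow, pow_one]
  rw [← mul_sum, sum_const_zero, e]
  ring
lemma HHs0 (r n : ℕ) : ∑ j ∈ range n, 1/((j:ℚ_[p])+1+((0:ℕ):ℚ_[p]))^r = HH r n := by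
  unfold HH; simp
section
variable {m : ℕ}
lemma rfl1 (hm : p = 3*m+1) (h3 : 3 < p) : Cg 2 (HH 1 (2*m) : ℚ_[p]) (HH 1 m + (p:ℚ_[p]) * HH 2 m) := by
  have r1 := HH1_refl (p := p) h3 (n := 2*m) (n' := m) (by omega)
  have r2 := HH2_refl (p := p) h3 (n := m) (n' := 2*m) (by omega)
  have := Dv.sub r1 (Dv.mul' Dv.p1 r2)
  exact Eq.mp (congrArg (Dv 2) (by ring)) this
lemma rfl2 (hm : p = 3*m+1) (h3 : 3 < p) : Cg 1 (HH 2 (2*m) : ℚ_[p]) (-HH 2 m) := HH2_refl (p := p) h3 (n := m) (n' := 2*m) (by omega)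
lemma Ak (hm : p = 3*m+1) (h3 : 3 < p) (k : ℕ) : Cg 3 (∏ j ∈ range m, (1 + (p:ℚ_[p]) * ((k:ℚ_[p]) * (1/((j:ℚ_[p])+1+(m:ℚ_[p]))^1)))) (1 + ((k:ℚ_[p])+(k:ℚ_[p])^2) * (p:ℚ_[p])^2 * HH 2 m) := by
  refine (px h3 k m m (by omega)).trans ?_
  rw [HH_shift, HH_shift]
  have r1 := rfl1 hm h3
  have r2 := rfl2 hm h3
  have i2 : Dv 0 (1/2:ℚ_[p]) := Dv.div Dv.one (un2 h3)
  have d1 : Dv 0 (HH 2 m : ℚ_[p]) := dv_HH 2 (by omega)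
  have d2 : Dv 0 (HH 1 m : ℚ_[p]) := dv_HH 1 (by omega)
  have d3 : Dv 0 (HH 1 (2*m) : ℚ_[p]) := dv_HH 1 (by omega)
  have r3 : Dv 1 (HH 1 (2*m) - HH 1 m : ℚ_[p]) := Eq.mp (congrArg (Dv 1) (by ring)) (Dv.add (Dv.mono r1 (by omega : 1 ≤ 2)) (Dv.p1.mulr d1))
  have a1 : Dv 3 ((p:ℚ_[p]) * (HH 1 (2*m) - (HH 1 m + (p:ℚ_[p]) * HH 2 m))) := Dv.mul' Dv.p1 r1
  have a2 : Dv 3 ((p:ℚ_[p])^2 * (HH 2 (2*m) - -HH 2 m)) := Dv.mul' (Dv.pp 2) r2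
  have a3 : Dv 3 ((p:ℚ_[p])^2 * ((HH 1 (2*m) - HH 1 m) * (HH 1 (2*m) - HH 1 m))) := Dv.mul' (Dv.pp 2) (r3.mulr (d3.sub d2))
  refine cgd (((a1.mulr (Dv.nat k)).add (a3.mulr (((Dv.nat k).pow 2).mul i2))).sub (a2.mulr (((Dv.nat k).pow 2).mul i2))) ?_
  ring
lemma Bk (hm : p = 3*m+1) (h3 : 3 < p) : Cg 3 (∏ j ∈ range (2*m), (1 + (p:ℚ_[p]) * (((2:ℕ):ℚ_[p]) * (1/((j:ℚ_[p])+1+((0:ℕ):ℚ_[p]))^1)))) 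
   ((∏ j ∈ range m, (1 + (p:ℚ_[p]) * (((1:ℕ):ℚ_[p]) * (1/((j:ℚ_[p])+1+((0:ℕ):ℚ_[p]))^1))))^2 * (1 + 5 * (p:ℚ_[p])^2 * HH 2 m)) := by
  have q1 := px h3 1 0 m (by omega)
  have q2 := px h3 2 0 (2*m) (by omega)
  rw [HHs0, HHs0] at q1 q2
  have r1 := rfl1 hm h3
  have r2 := rfl2 hm h3
  have i2 : Dv 0 (1/2:ℚ_[p]) := Dv.div Dv.one (un2 h3)
  have d1 : Dv 0 (HH 2 m : ℚ_[p]) := dv_HH 2 (by omega)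
  have d2 : Dv 0 (HH 1 m : ℚ_[p]) := dv_HH 1 (by omega)
  have d3 : Dv 0 (HH 1 (2*m) : ℚ_[p]) := dv_HH 1 (by omega)
  have a1 : Dv 3 ((p:ℚ_[p]) * (HH 1 (2*m) - (HH 1 m + (p:ℚ_[p]) * HH 2 m))) := Dv.mul' Dv.p1 r1
  have a2 : Dv 3 ((p:ℚ_[p])^2 * (HH 2 (2*m) - -HH 2 m)) := Dv.mul' (Dv.pp 2) r2
  refine q2.trans ?_
  have dR : Dv 0 (1 + (p:ℚ_[p]) * (((1:ℕ):ℚ_[p]) * HH 1 m) + (p:ℚ_[p])^2 * (((1:ℕ):ℚ_[p])^2 * ((HH 1 m ^ 2 - HH 2 m)/2))) := by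
    refine (Dv.one.add ((Dv.nat p).mul ((Dv.nat 1).mul d2))).add (((Dv.nat p).pow 2).mul (((Dv.nat 1).pow 2).mul ?_))
    exact Dv.div ((d2.pow 2).sub d1) (un2 h3)
  have q3 := (q1.pow dR 2).mul_left (z := 1 + 5 * (p:ℚ_[p])^2 * HH 2 m) (Dv.one.add (((Dv.ofNat 5).mul ((Dv.nat p).pow 2)).mul d1))
  rw [mul_comm] at q3
  refine Cg.trans ?_ q3.symm
  have p3 : Dv 3 ((p:ℚ_[p])^3) := Dv.pp 3
  have p0 : Dv 0 (p:ℚ_[p]) := Dv.nat p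
  have dA : Dv 0 ((HH 1 m ^ 2 - HH 2 m : ℚ_[p])*(1/2)) := ((d2.pow 2).sub d1).mulr i2
  generalize (HH 1 m : ℚ_[p]) = b at *
  generalize (HH 2 m : ℚ_[p]) = d at *
  generalize (HH 1 (2*m) : ℚ_[p]) = a at *
  generalize (HH 2 (2*m) : ℚ_[p]) = c at *
  have s1 : Dv 0 (2*(a+b+(p:ℚ_[p])*d)) := (Dv.ofNat 2).mul ((d3.add d2).add (p0.mul d1))
  have s2 : Dv 0 (4*b*d) := ((Dv.ofNat 4).mul d2).mul d1
  -- remainder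
  have rem : Dv 3 ((p:ℚ_[p])^3 * (4*b*d + 2*(p:ℚ_[p])*d^2 - 2*b*((b^2-d)*(1/2)) - (p:ℚ_[p])*((b^2-d)*(1/2))^2 - 5*d*(2*b + (p:ℚ_[p])*b^2 + (p:ℚ_[p])*(2*((b^2-d)*(1/2))) + (p:ℚ_[p])^2*(2*b*((b^2-d)*(1/2))) + (p:ℚ_[p])^3*((b^2-d)*(1/2))^2))) := by
    refine p3.mulr ?_
    have e2 := Dv.ofNat (p := p) 2
    have e5 := Dv.ofNat (p := p) 5
    generalize (b^2-d)*(1/2) = g at *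
    exact (((s2.add ((e2.mul p0).mul (d1.pow 2))).sub ((e2.mul d2).mul dA)).sub (p0.mul (dA.pow 2))).sub ((e5.mul d1).mul (((((e2.mul d2).add (p0.mul (d2.pow 2))).add (p0.mul (e2.mul dA))).add ((p0.pow 2).mul ((e2.mul d2).mul dA))).add ((p0.pow 3).mul (dA.pow 2))))
  refine cgd ((((a1.mulr (Dv.ofNat 2)).sub (a2.mulr (Dv.ofNat 2))).add ((a1.mul' p0).mulr s1)).add rem) ?_
  push_cast
  ring
lemma wols (h3 : 3 < p) : Cg 3 (((2*p).choose p : ℕ) : ℚ_[p]) 2 := by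
  have q := px (p := p) h3 1 0 (p-1) (by omega)
  rw [HHs0, HHs0] at q
  have h1 := HH1_top (p := p) h3
  have h2 := HH2_top (p := p) h3
  have e : (((2*p).choose p : ℕ) : ℚ_[p]) = 2 * ∏ j ∈ range (p-1), (1 + (p:ℚ_[p]) * (((1:ℕ):ℚ_[p]) * (1/((j:ℚ_[p])+1+((0:ℕ):ℚ_[p]))^1))) := by
    rw [choose_prod]
    have : range p = range ((p-1)+1) := by rw [Nat.sub_add_cancel (by omega)]
    rw [this, prod_range_succ, mul_comm]
    congr 1
    · rw [Nat.cast_sub (by omega), Nat.cast_one, sub_add_cancel]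
      rw [← two_mul, mul_div_assoc, div_self ppne, mul_one]
    · apply prod_congr rfl; intro j hj
      have := (un_succ (p := p) (mem_range.1 hj) (by omega)).ne
      generalize hJ : (j:ℚ_[p])+1 = J at *
      push_cast
      rw [add_zero]
      field_simp
  rw [e]
  have d1 : Dv 0 (HH 1 (p-1) : ℚ_[p]) := h1.mono (by omega)
  have i2 : Dv 0 (1/2:ℚ_[p]) := Dv.div Dv.one (un2 h3)
  have a1 : Dv 3 ((p:ℚ_[p]) * HH 1 (p-1)) := Dv.mul' Dv.p1 h1
  have a2 : Dv 3 ((p:ℚ_[p])^2 * HH 2 (p-1)) := Dv.mul' (Dv.pp 2) h2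
  have : Cg 3 (∏ j ∈ range (p-1), (1 + (p:ℚ_[p]) * (((1:ℕ):ℚ_[p]) * (1/((j:ℚ_[p])+1+((0:ℕ):ℚ_[p]))^1)))) 1 := by
    refine q.trans (cgd ((a1.add ((a1.mul' ((Dv.nat p).mul d1)).mulr i2)).sub (a2.mulr i2)) ?_)
    push_cast; ring
  have := this.mul_left (Dv.ofNat 2)
  rwa [mul_one] at this
end
end S19

set_option linter.unusedSectionVars false
set_option linter.unusedSimpArgs false
namespace S19
open Finset Polynomial
section gen
variable {K : Type*} [Field K] [CharZero K]
lemma fac_add (a n : ℕ) : (((a+n).factorial:ℕ):K) = ((a.factorial:ℕ):K) * ∏ j ∈ range n, ((a:K)+1+j) := by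
  induction n with
  | zero => simp
  | succ n ih => rw [← add_assoc, Nat.factorial_succ, prod_range_succ]; push_cast; rw [ih]; ring
lemma fac_prod (n : ℕ) : ((n.factorial:ℕ):K) = ∏ j ∈ range n, ((j:K)+1) := by
  have := fac_add (K := K) 0 n
  simp only [zero_add, Nat.factorial_zero, Nat.cast_one, one_mul, Nat.cast_zero] at this
  rw [this]; apply prod_congr rfl; intro j _; ring
lemma fac_add' (a n : ℕ) : (((a+n).factorial:ℕ):K) = ((a.factorial:ℕ):K) * ((n.factorial:ℕ):K) * ∏ j ∈ range n, (1 + (a:K) * (1/((j:K)+1))) := by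
  rw [fac_add, fac_prod n, mul_assoc, ← prod_mul_distrib]
  congr 1
  apply prod_congr rfl; intro j _
  have : (j:K)+1 ≠ 0 := by exact_mod_cast Nat.succ_ne_zero j
  field_simp
  ring
lemma prod_stp (x : K) (n : ℕ) : (∏ j ∈ range n, (x+j)) * (x+n) = x * ∏ j ∈ range n, (x+1+j) := by
  rw [← prod_range_succ (fun j : ℕ => x + (j:K)), prod_range_succ', mul_comm]
  congr 1
  · simp
  · apply prod_congr rfl; intro j _; push_cast; ring
lemma choose_fac (a m : ℕ) : (((a+m).choose m : ℕ):K) * ((m.factorial:ℕ):K) = ∏ j ∈ range m, ((a:K)+1+j) := by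
  have h := fac_add (K := K) a m
  have h2 := Nat.add_choose_mul_factorial_mul_factorial a m
  have h3 : (((a+m).choose m : ℕ):K) * ((a.factorial:ℕ):K) * ((m.factorial:ℕ):K) = (((a+m).factorial:ℕ):K) := by
    rw [← h2]; push_cast; ring
  have h4 : ((a.factorial:ℕ):K) ≠ 0 := by exact_mod_cast Nat.factorial_ne_zero a
  apply mul_left_cancel₀ h4
  rw [← h, ← h3]; ring
end gen
variable {p : ℕ} [hp : Fact p.Prime]
section
variable {m : ℕ}
lemma Acomb (hm : p = 3*m+1) (k : ℕ) : (((2*m).choose m : ℕ):ℚ_[p]) * ((m.factorial:ℕ):ℚ_[p]) * (∏ j ∈ range m, (1 + (p:ℚ_[p]) * ((k:ℚ_[p]) * (1/((j:ℚ_[p])+1+(m:ℚ_[p]))^1)))) = ∏ j ∈ range m, ((k:ℚ_[p])*p+m+1+j) := by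
  rw [two_mul, choose_fac, ← prod_mul_distrib]
  apply prod_congr rfl; intro j _
  have : (j:ℚ_[p])+1+m ≠ 0 := by exact_mod_cast (by omega : j+1+m ≠ 0)
  rw [show (m:ℚ_[p])+1+j = j+1+m by ring, show (k:ℚ_[p])*p+m+1+j = k*p+(j+1+m) by ring]
  generalize (j:ℚ_[p])+1+m = J at *
  field_simp
  ring
lemma C5 (hm : p = 3*m+1) : (((5*m).choose m : ℕ):ℚ_[p]) * (5*(m:ℚ_[p])+1) = (4*(m:ℚ_[p])+1) * ((((2*m).choose m : ℕ):ℚ_[p]) * (∏ j ∈ range m, (1 + (p:ℚ_[p]) * (((1:ℕ):ℚ_[p]) * (1/((j:ℚ_[p])+1+(m:ℚ_[p]))^1))))) := by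
  have hp' : (p:ℚ_[p]) = 3*m+1 := by exact_mod_cast hm
  have h := Acomb hm 1
  have h1 := choose_fac (K := ℚ_[p]) (4*m) m
  rw [show 4*m+m = 5*m by ring] at h1
  have h2 := prod_stp ((4*m:ℕ)+1:ℚ_[p]) m
  have h4 : ((m.factorial:ℕ):ℚ_[p]) ≠ 0 := by exact_mod_cast Nat.factorial_ne_zero m
  have e : ∏ j ∈ range m, (((1:ℕ):ℚ_[p])*p+m+1+j) = ∏ j ∈ range m, (((4*m:ℕ):ℚ_[p])+1+1+j) := by
    apply prod_congr rfl; intro j _; rw [hp']; push_cast; ring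
  rw [e] at h
  rw [← h1, ← h] at h2
  apply mul_left_cancel₀ h4
  push_cast at h2 ⊢
  linear_combination h2
lemma C8 (hm : p = 3*m+1) : (((8*m).choose m : ℕ):ℚ_[p]) * ((8*(m:ℚ_[p])+1)*(8*(m:ℚ_[p])+2)) = (7*(m:ℚ_[p])+1)*(7*(m:ℚ_[p])+2) * ((((2*m).choose m : ℕ):ℚ_[p]) * (∏ j ∈ range m, (1 + (p:ℚ_[p]) * (((2:ℕ):ℚ_[p]) * (1/((j:ℚ_[p])+1+(m:ℚ_[p]))^1))))) := by
  have hp' : (p:ℚ_[p]) = 3*m+1 := by exact_mod_cast hm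
  have h := Acomb hm 2
  have h1 := choose_fac (K := ℚ_[p]) (7*m) m
  rw [show 7*m+m = 8*m by ring] at h1
  have h2 := prod_stp ((7*m:ℕ)+1:ℚ_[p]) m
  have h3 := prod_stp ((7*m:ℕ)+1+1:ℚ_[p]) m
  have h4 : ((m.factorial:ℕ):ℚ_[p]) ≠ 0 := by exact_mod_cast Nat.factorial_ne_zero m
  have e : ∏ j ∈ range m, (((2:ℕ):ℚ_[p])*p+m+1+j) = ∏ j ∈ range m, (((7*m:ℕ):ℚ_[p])+1+1+1+j) := by
    apply prod_congr rfl; intro j _; rw [hp']; push_cast; ring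
  rw [e] at h
  rw [← h1] at h2
  rw [← h] at h3
  apply mul_left_cancel₀ h4
  push_cast at h2 h3 ⊢
  linear_combination (8*(m:ℚ_[p])+2)*h2 + (7*(m:ℚ_[p])+1)*h3
lemma C84 (hm : p = 3*m+1) : (((8*m).choose (4*m) : ℕ):ℚ_[p]) * ((8*(m:ℚ_[p])+1)*(8*(m:ℚ_[p])+2)) * (∏ j ∈ range m, (1 + (p:ℚ_[p]) * (((1:ℕ):ℚ_[p]) * (1/((j:ℚ_[p])+1+((0:ℕ):ℚ_[p]))^1))))^2 =
    (4*(m:ℚ_[p])+1)^2 * (((2*p).choose p : ℕ) : ℚ_[p]) * (((2*m).choose m : ℕ):ℚ_[p]) * (∏ j ∈ range (2*m), (1 + (p:ℚ_[p]) * (((2:ℕ):ℚ_[p]) * (1/((j:ℚ_[p])+1+((0:ℕ):ℚ_[p]))^1)))) := by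
  have f1 := fac_add' (K := ℚ_[p]) p m
  have f2 := fac_add' (K := ℚ_[p]) (2*p) (2*m)
  have e1 : ∏ j ∈ range m, (1 + (p:ℚ_[p]) * (((1:ℕ):ℚ_[p]) * (1/((j:ℚ_[p])+1+((0:ℕ):ℚ_[p]))^1))) = ∏ j ∈ range m, (1 + (p:ℚ_[p]) * (1/((j:ℚ_[p])+1))) := by
    apply prod_congr rfl; intro j _; push_cast; ring
  have e2 : ∏ j ∈ range (2*m), (1 + (p:ℚ_[p]) * (((2:ℕ):ℚ_[p]) * (1/((j:ℚ_[p])+1+((0:ℕ):ℚ_[p]))^1))) = ∏ j ∈ range (2*m), (1 + ((2*p:ℕ):ℚ_[p]) * (1/((j:ℚ_[p])+1))) := by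
    apply prod_congr rfl; intro j _; push_cast; ring
  rw [e1, e2]
  have g1 : (((p+m).factorial:ℕ):ℚ_[p]) = (4*m+1) * (((4*m).factorial:ℕ):ℚ_[p]) := by
    rw [show p+m = 4*m+1 by omega, Nat.factorial_succ]; push_cast; ring
  have g2 : (((2*p+2*m).factorial:ℕ):ℚ_[p]) = (8*m+2)*(8*m+1) * (((8*m).factorial:ℕ):ℚ_[p]) := by
    rw [show 2*p+2*m = 8*m+1+1 by omega, Nat.factorial_succ, Nat.factorial_succ]; push_cast; ring
  have cf : ∀ n : ℕ, (((2*n).choose n : ℕ):ℚ_[p]) * ((n.factorial:ℕ):ℚ_[p])^2 = (((2*n).factorial:ℕ):ℚ_[p]) := by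
    intro n
    have := Nat.add_choose_mul_factorial_mul_factorial n n
    rw [← two_mul] at this
    rw [← this]; push_cast; ring
  have c1 := cf (4*m); have c2 := cf m; have c3 := cf p
  rw [show 2*(4*m) = 8*m by ring] at c1
  rw [g1] at f1
  rw [g2, ← c1, ← c2, ← c3] at f2
  have n1 : ((m.factorial:ℕ):ℚ_[p]) ≠ 0 := by exact_mod_cast Nat.factorial_ne_zero m
  have n2 : ((p.factorial:ℕ):ℚ_[p]) ≠ 0 := by exact_mod_cast Nat.factorial_ne_zero p
  have n3 : (((4*m).factorial:ℕ):ℚ_[p]) ≠ 0 := by exact_mod_cast Nat.factorial_ne_zero (4*m)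
  apply mul_left_cancel₀ (mul_ne_zero (pow_ne_zero 2 n1) (pow_ne_zero 2 n2))
  generalize (∏ j ∈ range m, (1 + (p:ℚ_[p]) * (1/((j:ℚ_[p])+1)))) = D1 at *
  generalize ∏ j ∈ range (2*m), (1 + ((2*p:ℕ):ℚ_[p]) * (1/((j:ℚ_[p])+1))) = D2 at *
  generalize ((m.factorial:ℕ):ℚ_[p]) = A at *
  generalize ((p.factorial:ℕ):ℚ_[p]) = B at *
  generalize (((4*m).factorial:ℕ):ℚ_[p]) = G at *
  generalize (((2*m).choose m : ℕ):ℚ_[p]) = c at *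
  generalize (((8*m).choose (4*m) : ℕ):ℚ_[p]) = d at *
  generalize (((2*p).choose p : ℕ):ℚ_[p]) = e at *
  -- f1 : (4m+1) G = B A D1 ;  f2 : (8m+2)(8m+1) (d G²) = e B² (c A²) D2
  linear_combination (-(d*((8*(m:ℚ_[p])+1)*(8*(m:ℚ_[p])+2))*(B*A*D1+(4*m+1)*G)))*f1 + (4*(m:ℚ_[p])+1)^2*f2
lemma Bsum (hm : p = 3*m+1) (h3 : 3 < p) : Cg 3 (((p:ℚ_[p])-1) * (20 * (((2*m).choose m : ℕ):ℚ_[p]) - 32 * (((5*m).choose m : ℕ):ℚ_[p]) + 5 * (2 * (((8*m).choose m : ℕ):ℚ_[p]) + (((8*m).choose (4*m) : ℕ):ℚ_[p]))))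
    (-9 * ((((2*m).choose m : ℕ):ℚ_[p]) * (1 - 1/3*((p:ℚ_[p])^2*HH 2 m)))) := by
  have hp' : (m:ℚ_[p]) = ((p:ℚ_[p])-1)/3 := by
    have : (p:ℚ_[p]) = 3*m+1 := by exact_mod_cast hm
    rw [this]; ring
  have c5 := C5 hm; have c8 := C8 hm; have c84 := C84 hm
  have a1 := Ak hm h3 1; have a2 := Ak hm h3 2; have b := Bk hm h3; have w := wols (p := p) h3
  have uD : Un (∏ j ∈ range m, (1 + (p:ℚ_[p]) * (((1:ℕ):ℚ_[p]) * (1/((j:ℚ_[p])+1+((0:ℕ):ℚ_[p]))^1)))) := by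
    refine Un.prod fun j hj => Un_1d (Dv.p1.mulr ((Dv.nat 1).mul (Dv.one.div (Un.pow ?_ 1))))
    have := un_succ (p := p) (mem_range.1 hj) (by omega)
    simpa using this
  have dH : Dv 0 (HH 2 m : ℚ_[p]) := dv_HH 2 (by omega)
  have dC : Dv 0 (((2*m).choose m : ℕ):ℚ_[p]) := Dv.nat _
  have i3 : Dv 0 (1/3 : ℚ_[p]) := Dv.div Dv.one (un3 h3)
  have p0 : Dv 0 (p:ℚ_[p]) := Dv.nat p
  have m0 : Dv 0 (m:ℚ_[p]) := Dv.nat m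
  have uW : Un ((5*(p:ℚ_[p])-2)*(8*(p:ℚ_[p])-5)*(8*(p:ℚ_[p])-2)) := by
    have e2 : Un (-2:ℚ_[p]) := (un2 h3).neg
    have e5 : Un (-5:ℚ_[p]) := by
      have := Un.nat (p := p) (n := 5) (fun h => by
        have := (Nat.prime_dvd_prime_iff_eq hp.out Nat.prime_five).1 h; omega)
      exact_mod_cast this.neg
    refine ((e2.of_sub ?_).mul (e5.of_sub ?_)).mul (e2.of_sub ?_)
    · exact Eq.mp (congrArg (Dv 1) (by ring)) ((Dv.p1.mulr (Dv.ofNat 5)).neg)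
    · exact Eq.mp (congrArg (Dv 1) (by ring)) ((Dv.p1.mulr (Dv.ofNat 8)).neg)
    · exact Eq.mp (congrArg (Dv 1) (by ring)) ((Dv.p1.mulr (Dv.ofNat 8)).neg)
  have d8 : Dv 0 (((8*m).choose (4*m) : ℕ):ℚ_[p]) := Dv.nat _
  generalize (∏ j ∈ range m, (1 + (p:ℚ_[p]) * (((1:ℕ):ℚ_[p]) * (1/((j:ℚ_[p])+1+((0:ℕ):ℚ_[p]))^1)))) = D1 at *
  generalize (∏ j ∈ range (2*m), (1 + (p:ℚ_[p]) * (((2:ℕ):ℚ_[p]) * (1/((j:ℚ_[p])+1+((0:ℕ):ℚ_[p]))^1)))) = D2 at *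
  generalize (∏ j ∈ range m, (1 + (p:ℚ_[p]) * (((1:ℕ):ℚ_[p]) * (1/((j:ℚ_[p])+1+(m:ℚ_[p]))^1)))) = A1 at *
  generalize (∏ j ∈ range m, (1 + (p:ℚ_[p]) * (((2:ℕ):ℚ_[p]) * (1/((j:ℚ_[p])+1+(m:ℚ_[p]))^1)))) = A2 at *
  generalize (HH 2 m : ℚ_[p]) = H at *
  generalize (((2*m).choose m : ℕ):ℚ_[p]) = c at *
  generalize (((8*m).choose (4*m) : ℕ):ℚ_[p]) = d at *
  generalize (((2*p).choose p : ℕ):ℚ_[p]) = e at *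
  generalize (((5*m).choose m : ℕ):ℚ_[p]) = x5 at *
  generalize (((8*m).choose m : ℕ):ℚ_[p]) = x8 at *
  have m41 : Dv 0 (4*(m:ℚ_[p])+1) := ((Dv.ofNat 4).mul m0).add Dv.one
  have k84 : Cg 3 (d * ((8*(m:ℚ_[p])+1)*(8*(m:ℚ_[p])+2))) ((4*(m:ℚ_[p])+1)^2 * 2 * c * (1 + 5 * (p:ℚ_[p])^2 * H)) := by
    refine Dv.of_mul (x := D1^2) ?_ (uD.pow 2)
    have dB : Dv 0 (D1^2 * (1 + 5 * (p:ℚ_[p])^2 * H)) := (uD.dv.pow 2).mul (Dv.one.add (((Dv.ofNat 5).mul (p0.pow 2)).mul dH))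
    have z1 := Dv.mulr w dB
    have ew : Dv 0 e := w.dv (s := 0) (by omega) (Dv.ofNat 2)
    have z2 := Dv.mul ew b
    have := Dv.mul ((m41.pow 2).mul dC) (z1.add z2)
    refine Eq.mp (congrArg (Dv 3) ?_) this
    linear_combination -c84
  refine Dv.of_mul (x := (5*(p:ℚ_[p])-2)*(8*(p:ℚ_[p])-5)*(8*(p:ℚ_[p])-2)) ?_ uW
  -- assemble
  have p1 : Dv 0 ((p:ℚ_[p])-1) := p0.sub Dv.one
  have t5 : Dv 3 ((((p:ℚ_[p])-1) * (-32) * ((8*(p:ℚ_[p])-5)*(8*(p:ℚ_[p])-2)) * ((4*(p:ℚ_[p])-1)*c)) * (A1 - (1 + (((1:ℕ):ℚ_[p])+((1:ℕ):ℚ_[p])^2)*(p:ℚ_[p])^2*H))) :=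
    Dv.mul (((p1.mul (Dv.ofNat 32).neg).mul ((((Dv.ofNat 8).mul p0).sub (Dv.ofNat 5)).mul (((Dv.ofNat 8).mul p0).sub (Dv.ofNat 2)))).mul ((((Dv.ofNat 4).mul p0).sub Dv.one).mul dC)) a1
  have t8 : Dv 3 ((((p:ℚ_[p])-1) * 10 * (5*(p:ℚ_[p])-2) * ((7*(p:ℚ_[p])-1)*(7*(p:ℚ_[p])-4)*c)) * (A2 - (1 + (((2:ℕ):ℚ_[p])+((2:ℕ):ℚ_[p])^2)*(p:ℚ_[p])^2*H))) :=
    Dv.mul (((p1.mul (Dv.ofNat 10)).mul (((Dv.ofNat 5).mul p0).sub (Dv.ofNat 2))).mul (((((Dv.ofNat 7).mul p0).sub Dv.one).mul (((Dv.ofNat 7).mul p0).sub (Dv.ofNat 4))).mul dC)) a2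
  have t84 := Dv.mul ((((Dv.ofNat 45).mul p1)).mul (((Dv.ofNat 5).mul p0).sub (Dv.ofNat 2))) k84
  have r1 : Dv 3 ((p:ℚ_[p])^3 * (c*(-972+1458*(p:ℚ_[p])) + c*H*(-732+3078*(p:ℚ_[p])-4824*(p:ℚ_[p])^2+2316*(p:ℚ_[p])^3))) :=
    (Dv.pp 3).mulr ((dC.mul ((Dv.ofNat 972).neg.add ((Dv.ofNat 1458).mul p0))).add ((dC.mul dH).mul
      ((((Dv.ofNat 732).neg.add ((Dv.ofNat 3078).mul p0)).sub ((Dv.ofNat 4824).mul (p0.pow 2))).add ((Dv.ofNat 2316).mul (p0.pow 3)))))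
  refine Eq.mp (congrArg (Dv 3) ?_) (((t5.add t8).add t84).add r1)
  rw [hp'] at c5 c8 ⊢
  push_cast
  linear_combination (-(((p:ℚ_[p])-1)*(-32)*((8*(p:ℚ_[p])-5)*(8*(p:ℚ_[p])-2))*3))*c5 - (((p:ℚ_[p])-1)*10*(5*(p:ℚ_[p])-2)*9)*c8
end
end S19

set_option linter.unusedSectionVars false
set_option linter.unusedSimpArgs false
namespace S19
open Finset Polynomial
variable {p : ℕ} [hp : Fact p.Prime]
lemma z_lt (x : ℤ_[p]) : ‖x‖ < 1 ↔ PadicInt.toZMod x = 0 := by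
  rw [← RingHom.mem_ker, PadicInt.ker_toZMod, IsLocalRing.mem_maximalIdeal, mem_nonunits_iff, PadicInt.isUnit_iff]
  have := PadicInt.norm_le_one x
  constructor
  · intro h; exact h.ne
  · intro h; exact lt_of_le_of_ne this h
lemma z_un (x : ℤ_[p]) : ‖x‖ = 1 ↔ PadicInt.toZMod x ≠ 0 := by
  rw [Ne, ← z_lt]
  have := PadicInt.norm_le_one x
  constructor
  · intro h; rw [h]; exact lt_irrefl _
  · intro h; exact le_antisymm this (not_lt.1 h)
lemma z_dvd (x : ℤ_[p]) : (p:ℤ_[p]) ∣ x ↔ PadicInt.toZMod x = 0 := by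
  rw [← z_lt, PadicInt.norm_lt_one_iff_dvd]
/-- Hensel lift. -/
lemma hens (x : ZMod p) : ∃ z : ℤ_[p], z ^ p = z ∧ PadicInt.toZMod z = x := by
  obtain ⟨a, ha⟩ := ZMod.ringHom_surjective (PadicInt.toZMod (p := p)) x
  have d : ‖(aeval a) (derivative (X^p - X : ℤ_[p][X]))‖ = 1 := by
    rw [z_un, derivative_sub, derivative_X_pow]; simp
  have h0 : ‖(aeval a) (X^p - X : ℤ_[p][X])‖ < 1 := by
    rw [z_lt]; simp
  obtain ⟨z, hz, hz2, -⟩ := hensels_lemma (F := (X^p - X : ℤ_[p][X])) (a := a) (by rw [d, one_pow]; exact h0)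
  refine ⟨z, ?_, ?_⟩
  · simpa [sub_eq_zero] using hz
  · rw [d, z_lt, map_sub, sub_eq_zero] at hz2
    rw [hz2, ha]
/-- Teichmüller character. -/
lemma exists_teich : ∃ w : MulChar (ZMod p) ℤ_[p], ∀ x, PadicInt.toZMod (w x) = x := by
  classical
  obtain ⟨g, hg⟩ := IsCyclic.exists_generator (α := (ZMod p)ˣ)
  obtain ⟨z, hz, hzg⟩ := hens (g : ZMod p)
  have hu : IsUnit z := by
    rw [PadicInt.isUnit_iff, z_un, hzg]; exact g.ne_zero
  obtain ⟨z, rfl⟩ := hu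
  have hz1 : z ^ (p-1) = 1 := by
    have h1 : z ^ p = z := by ext1; simpa using hz
    have h2 : z ^ (p-1) * z = 1 * z := by
      rw [← pow_succ, Nat.sub_add_cancel hp.out.one_lt.le, h1, one_mul]
    exact mul_right_cancel h2
  have hm : z ∈ rootsOfUnity (Fintype.card (ZMod p)ˣ) ℤ_[p] := by
    rw [ZMod.card_units p]; exact (mem_rootsOfUnity _ _).2 hz1
  have sp := MulChar.ofRootOfUnity_spec hm hg
  refine ⟨MulChar.ofRootOfUnity hm hg, fun x => ?_⟩
  generalize MulChar.ofRootOfUnity hm hg = w at sp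
  by_cases hx : x = 0
  · subst hx; rw [MulChar.map_zero, map_zero]
  obtain ⟨u, rfl⟩ : IsUnit x := isUnit_iff_ne_zero.2 hx
  obtain ⟨k, hk⟩ := (Submonoid.mem_powers_iff _ _).1 ((mem_powers_iff_mem_zpowers).2 (hg u))
  rw [← hk]; push_cast; rw [map_pow, map_pow, sp, hzg]
section
variable {m : ℕ} {w : MulChar (ZMod p) ℤ_[p]}
lemma w_pow (hw : ∀ x, PadicInt.toZMod (w x) = x) {x : ZMod p} (hx : x ≠ 0) : w x ^ (p-1) = 1 := by
  obtain ⟨u, rfl⟩ : IsUnit x := isUnit_iff_ne_zero.2 hx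
  rw [← map_pow]
  norm_cast
  rw [ZMod.units_pow_card_sub_one_eq_one]
  simp
lemma w_ne (hw : ∀ x, PadicInt.toZMod (w x) = x) {j : ℕ} (hj : ¬ (p-1) ∣ j) : w ^ j ≠ 1 := by
  intro h
  apply hj
  have := (FiniteField.forall_pow_eq_one_iff (ZMod p) j).1 ?_
  · rwa [ZMod.card] at this
  · intro x
    ext1
    have hj0 : j ≠ 0 := by rintro rfl; exact hj (dvd_zero _)
    have h1 : (w^j) (x : ZMod p) = 1 := by rw [h]; simp
    rw [MulChar.pow_apply' _ hj0] at h1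
    have := congrArg PadicInt.toZMod h1
    rw [map_pow, hw, map_one] at this
    rw [Units.val_pow_eq_pow_val, this, Units.val_one]
lemma w_sum (hw : ∀ x, PadicInt.toZMod (w x) = x) {j : ℕ} (hj : j ≠ 0) : ∑ x, w x ^ j = if (p-1) ∣ j then (p:ℤ_[p]) - 1 else 0 := by
  have e : ∀ x, w x ^ j = (w^j) x := fun x => (MulChar.pow_apply' _ hj x).symm
  simp_rw [e]
  split_ifs with h
  · have : w ^ j = 1 := by
      ext u
      rw [MulChar.pow_apply' _ hj]
      obtain ⟨c, rfl⟩ := h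
      rw [pow_mul, w_pow hw u.ne_zero]; simp
    rw [this, MulChar.sum_one_eq_card_units, ZMod.card_units p, Nat.cast_sub hp.out.one_lt.le, Nat.cast_one]
  · exact MulChar.sum_eq_zero_of_ne_one (w_ne hw h)
lemma w_bin (hm : p = 3*m+1) (hw : ∀ x, PadicInt.toZMod (w x) = x) (hm0 : 0 < m) (n : ℕ) : ∑ x, w x ^ (2*m) * (1 - w x)^n =
    ((p:ℤ_[p]) - 1) * ∑ k ∈ (range (n+1)).filter (fun k => 3*m ∣ 2*m+k), (-1)^k * (n.choose k : ℤ_[p]) := by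
  have : ∀ x, w x ^ (2*m) * (1 - w x)^n = ∑ k ∈ range (n+1), (-1)^k * (n.choose k : ℤ_[p]) * w x^(2*m+k) := by
    intro x
    rw [sub_eq_neg_add, add_pow, mul_sum]
    refine sum_congr rfl fun k _ => ?_
    rw [neg_pow, one_pow, pow_add]; ring
  simp_rw [this]
  rw [sum_comm, mul_sum, sum_filter]
  refine sum_congr rfl fun k _ => ?_
  rw [← mul_sum, w_sum hw (by omega)]
  have : p - 1 = 3*m := by omega
  rw [this]
  split_ifs
  · ring
  · ring
lemma w_pt (hm : p = 3*m+1) (hw : ∀ x, PadicInt.toZMod (w x) = x) (hm0 : 0 < m) (x : ZMod p) : (p:ℤ_[p])^3 ∣ 9 * (w (1-x))^(2*m) - (20*(1-w x)^(2*m) - 16*(1-w x)^(5*m) + 5*(1-w x)^(8*m)) := by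
  by_cases hx : x = 1
  · subst hx
    have h2 : 2*m ≠ 0 := by omega
    have h5 : 5*m ≠ 0 := by omega
    have h8 : 8*m ≠ 0 := by omega
    rw [sub_self, MulChar.map_zero, map_one, sub_self, zero_pow h2, zero_pow h5, zero_pow h8]
    simp
  have c3 : (w (1-x)^m)^3 = 1 := by
    rw [← pow_mul, show m*3 = p-1 by omega, w_pow hw (sub_ne_zero.2 (Ne.symm hx))]
  have d : (p:ℤ_[p]) ∣ (1-w x)^m - w (1-x)^m := by
    refine dvd_trans ?_ (sub_dvd_pow_sub_pow _ _ m)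
    rw [z_dvd]; simp [hw]
  rw [mul_comm 2 m, mul_comm 5 m, mul_comm 8 m, pow_mul, pow_mul, pow_mul, pow_mul]
  generalize (1-w x)^m = U at *
  generalize w (1-x)^m = C at *
  have := (pow_dvd_pow_of_dvd d 3).mul_right (-(5*U^5+15*U^4*C+30*U^3*C^2+34*U^2*C^3+27*U*C^4+9*C^5))
  refine this.trans (dvd_of_eq ?_)
  have c8 : C^8 = C^2 := by linear_combination (C^5+C^2)*c3
  have c6 : C^6 = 1 := by linear_combination (C^3+1)*c3
  linear_combination 16*U^5*c3 - 20*U^2*c6 + 9*c8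
end
end S19

set_option linter.unusedSectionVars false
set_option linter.unusedSimpArgs false
namespace S19
open Finset Polynomial
variable {p : ℕ} [hp : Fact p.Prime]
section
variable {m : ℕ} {w : MulChar (ZMod p) ℤ_[p]}
lemma filt2 (hm0 : 0 < m) : (range (2*m+1)).filter (fun k => 3*m ∣ 2*m+k) = {m} := by
  ext k
  simp only [mem_filter, mem_range, mem_singleton]
  constructor
  · rintro ⟨h, c, hc⟩
    have : c < 2 := by by_contra h2; nlinarith [Nat.mul_le_mul_left (3*m) (not_lt.1 h2)]
    interval_cases c <;> omega
  · rintro rfl; exact ⟨by omega, 1, by ring⟩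
lemma filt5 (hm0 : 0 < m) : (range (5*m+1)).filter (fun k => 3*m ∣ 2*m+k) = {m, 4*m} := by
  ext k
  simp only [mem_filter, mem_range, mem_singleton, mem_insert]
  constructor
  · rintro ⟨h, c, hc⟩
    have : c < 3 := by by_contra h2; nlinarith [Nat.mul_le_mul_left (3*m) (not_lt.1 h2)]
    interval_cases c <;> omega
  · rintro (rfl|rfl)
    · exact ⟨by omega, 1, by ring⟩
    · exact ⟨by omega, 2, by ring⟩
lemma filt8 (hm0 : 0 < m) : (range (8*m+1)).filter (fun k => 3*m ∣ 2*m+k) = {m, 4*m, 7*m} := by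
  ext k
  simp only [mem_filter, mem_range, mem_singleton, mem_insert]
  constructor
  · rintro ⟨h, c, hc⟩
    have : c < 4 := by by_contra h2; nlinarith [Nat.mul_le_mul_left (3*m) (not_lt.1 h2)]
    interval_cases c <;> omega
  · rintro (rfl|rfl|rfl)
    · exact ⟨by omega, 1, by ring⟩
    · exact ⟨by omega, 2, by ring⟩
    · exact ⟨by omega, 3, by ring⟩
lemma m_even (hm : p = 3*m+1) (h3 : 3 < p) : Even m := by
  rcases hp.out.eq_two_or_odd with h | h
  · omega
  · rw [Nat.even_iff]; omega
lemma J_val (hm : p = 3*m+1) (hw : ∀ x, PadicInt.toZMod (w x) = x) (h3 : 3 < p) : Cg 3 ((∑ x, w x^(2*m) * w (1-x)^(2*m) : ℤ_[p]) : ℚ_[p])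
    (-((((2*m).choose m : ℕ):ℚ_[p]) * (1 - 1/3*((p:ℚ_[p])^2*HH 2 m)))) := by
  have hm0 : 0 < m := by omega
  have ev := m_even hm h3
  have b2 := w_bin hm hw hm0 (2*m)
  have b5 := w_bin hm hw hm0 (5*m)
  have b8 := w_bin hm hw hm0 (8*m)
  rw [filt2 hm0, sum_singleton, ev.neg_one_pow] at b2
  rw [filt5 hm0, sum_pair (by omega), ev.neg_one_pow, (ev.mul_left 4).neg_one_pow,
    Nat.choose_symm_of_eq_add (show 5*m = 4*m + m by ring)] at b5
  rw [filt8 hm0, sum_insert (by simp; omega), sum_pair (by omega), ev.neg_one_pow, (ev.mul_left 4).neg_one_pow, (ev.mul_left 7).neg_one_pow,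
    Nat.choose_symm_of_eq_add (show 8*m = 7*m + m by ring)] at b8
  have hd : (p:ℤ_[p])^3 ∣ ∑ x, w x^(2*m) * (9 * (w (1-x))^(2*m) - (20*(1-w x)^(2*m) - 16*(1-w x)^(5*m) + 5*(1-w x)^(8*m))) :=
    dvd_sum fun x _ => (w_pt hm hw hm0 x).mul_left _
  have e : ∑ x, w x^(2*m) * (9 * (w (1-x))^(2*m) - (20*(1-w x)^(2*m) - 16*(1-w x)^(5*m) + 5*(1-w x)^(8*m)))
    = 9 * (∑ x, w x^(2*m) * w (1-x)^(2*m)) - (20 * (∑ x, w x^(2*m) * (1-w x)^(2*m)) - 16*(∑ x, w x^(2*m) * (1-w x)^(5*m)) + 5 * (∑ x, w x^(2*m) * (1-w x)^(8*m))) := by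
    simp only [mul_sum, ← sum_sub_distrib, ← sum_add_distrib]
    exact sum_congr rfl fun x _ => by ring
  rw [e, b2, b5, b8] at hd
  obtain ⟨q, hq⟩ := hd
  have hB := Bsum hm h3
  generalize (∑ x, w x^(2*m) * w (1-x)^(2*m)) = J at *
  have hq' := congrArg (PadicInt.Coe.ringHom (p := p)) hq
  have hc : ∀ x : ℤ_[p], PadicInt.Coe.ringHom x = (x:ℚ_[p]) := fun _ => rfl
  simp only [map_sub, map_mul, map_add, map_pow, map_natCast, map_ofNat, map_one] at hq'
  rw [hc J, hc q] at hq'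
  have u9 : Un (9:ℚ_[p]) := un9 h3
  refine Dv.of_mul (x := 9) ?_ u9
  have h1 : Dv 3 ((p:ℚ_[p])^3 * (q:ℚ_[p])) := ⟨q, rfl⟩
  refine Eq.mp (congrArg (Dv 3) ?_) (h1.add hB)
  linear_combination -hq'
lemma J_sq (hm : p = 3*m+1) (hw : ∀ x, PadicInt.toZMod (w x) = x) (h3 : 3 < p) : Cg 3 (((∑ x, w x^(2*m) * w (1-x)^(2*m) : ℤ_[p]) : ℚ_[p])^2) (SS p 0 : ℚ_[p]) := by
  have dH : Dv 0 (HH 2 m : ℚ_[p]) := dv_HH 2 (by omega)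
  have dC : Dv 0 (((2*m).choose m : ℕ):ℚ_[p]) := Dv.nat _
  have i3 : Dv 0 (1/3 : ℚ_[p]) := Dv.div Dv.one (un3 h3)
  have p0 : Dv 0 (p:ℚ_[p]) := Dv.nat p
  have h := (J_val hm hw h3).pow (dC.mul (Dv.one.sub (i3.mul ((p0.pow 2).mul dH)))).neg 2
  refine h.trans (Cg.trans ?_ (S0_val hm h3).symm)
  refine cgd (z := (p:ℚ_[p])^3 * (((2*m).choose m : ℕ):ℚ_[p])^2 * ((1/3)^2 * (p:ℚ_[p]) * (HH 2 m)^2)) ?_ (by ring)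
  exact ((Dv.pp 3).mulr (dC.pow 2)).mulr (((i3.pow 2).mul p0).mul (dH.pow 2))
lemma J_un (hm : p = 3*m+1) (hw : ∀ x, PadicInt.toZMod (w x) = x) (h3 : 3 < p) : Un ((∑ x, w x^(2*m) * w (1-x)^(2*m) : ℤ_[p]) : ℚ_[p]) := by
  have h := J_val hm hw h3
  have dH : Dv 0 (HH 2 m : ℚ_[p]) := dv_HH 2 (by omega)
  have i3 : Dv 0 (1/3 : ℚ_[p]) := Dv.div Dv.one (un3 h3)
  have u : Un (-((((2*m).choose m : ℕ):ℚ_[p]) * (1 - 1/3*((p:ℚ_[p])^2*HH 2 m)))) := by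
    refine ((un_choose (by omega) (by omega)).mul ?_).neg
    refine Un.one.of_sub ?_
    refine Eq.mp (congrArg (Dv 1) ?_) (Dv.p1.mulr (i3.mul ((Dv.nat p).mul dH)))
    ring
  refine u.of_sub ?_
  have := Dv.mono (Dv.neg h) (show 1 ≤ 3 by norm_num)
  exact Eq.mp (congrArg (Dv 1) (by ring)) this
end
end S19

set_option linter.unusedSectionVars false
set_option linter.unusedSimpArgs false
namespace S19
open Finset Polynomial
variable {p : ℕ} [hp : Fact p.Prime]
lemma int_mu {R : Type*} [CommRing R] [IsDomain R] [CharZero R] {μ : R} (h3 : μ^3 = 1) (h1 : μ ≠ 1)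
    {a b a' b' : ℤ} (h : (a:R) + b*μ = a' + b'*μ) : b = b' := by
  have e : ((a-a' : ℤ):R) = ((b'-b : ℤ):R) * μ := by push_cast; linear_combination h
  have e3 : (a-a')^3 = (b'-b)^3 := by
    have := congrArg (·^3) e
    simp only [mul_pow, h3, mul_one] at this
    exact_mod_cast this
  have e1 : a - a' = b' - b := (Odd.strictMono_pow (by decide : Odd 3)).injective e3
  rw [e1] at e
  have : ((b'-b : ℤ):R) * (μ - 1) = 0 := by linear_combination -e
  rcases mul_eq_zero.1 this with h | h
  · have : b' - b = 0 := by exact_mod_cast h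
    omega
  · exact absurd (sub_eq_zero.1 h) h1
section
variable {m : ℕ} {w : MulChar (ZMod p) ℤ_[p]}
lemma J_int (hm : p = 3*m+1) (hw : ∀ x, PadicInt.toZMod (w x) = x) (h3 : 3 < p) : ∃ (Jb : ℤ_[p]) (u v : ℤ), (∑ x, w x^(2*m) * w (1-x)^(2*m)) * Jb = (p:ℤ_[p]) ∧
    (∑ x, w x^(2*m) * w (1-x)^(2*m)) + Jb = (u:ℤ_[p]) ∧ 4*(p:ℤ) = u^2+27*v^2 := by
  classical
  have hm0 : 0 < m := by omega
  have ev := m_even hm h3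
  have pm : p - 1 = 3*m := by omega
  obtain ⟨χ, hχ⟩ : ∃ χ, χ = w^(2*m) := ⟨_, rfl⟩
  have χa : ∀ x, χ x = w x^(2*m) := fun x => by rw [hχ, MulChar.pow_apply' _ (by omega)]
  have hJ : jacobiSum χ χ = ∑ x, w x^(2*m) * w (1-x)^(2*m) := by
    unfold jacobiSum; exact sum_congr rfl fun x _ => by rw [χa, χa]
  rw [← hJ]
  have ne1 : χ ≠ 1 := by
    rw [hχ]; refine w_ne hw ?_
    rw [pm]; intro h; have := Nat.le_of_dvd (by omega) h; omega
  have ne2 : χ * χ ≠ 1 := by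
    rw [hχ, ← pow_add]; refine w_ne hw ?_
    rw [pm]; rintro ⟨c, hc⟩
    have h1 : c < 2 := by by_contra h2; nlinarith [Nat.mul_le_mul_left (3*m) (not_lt.1 h2)]
    interval_cases c <;> omega
  have c3 : χ^3 = 1 := by
    ext x
    rw [MulChar.pow_apply' _ (by norm_num), χa, ← pow_mul, show 2*m*3 = (p-1)*2 by omega, pow_mul, w_pow hw x.ne_zero]
    simp
  have inv : χ⁻¹ = χ^2 := by
    rw [inv_eq_iff_mul_eq_one, ← c3]; rw [pow_succ' χ 2]
  obtain ⟨g, hg⟩ : ∃ g : (ZMod p)ˣ, χ g ≠ 1 := by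
    by_contra hcon; push Not at hcon
    apply ne1; ext x; rw [hcon]; simp
  obtain ⟨μ, hμ⟩ : ∃ μ, μ = χ g := ⟨_, rfl⟩
  rw [← hμ] at hg
  have μ3 : μ^3 = 1 := by
    rw [hμ, ← MulChar.pow_apply' _ (by norm_num), c3]; simp
  have prim : IsPrimitiveRoot μ 3 := by
    rw [IsPrimitiveRoot.iff_orderOf]
    exact orderOf_eq_prime μ3 hg
  have μ2 : μ^2 + μ + 1 = 0 := by
    have : (μ - 1) * (μ^2+μ+1) = 0 := by linear_combination μ3
    exact (mul_eq_zero.1 this).resolve_left (sub_ne_zero.2 hg)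
  -- conjugate pairs
  have pair : ∀ s : Finset (ZMod p), ∃ a b : ℤ, ∑ x ∈ s, χ x * χ (1-x) = (a:ℤ_[p]) + b * μ ∧
      ∑ x ∈ s, (χ x)^2 * (χ (1-x))^2 = (a:ℤ_[p]) + b * μ^2 := by
    have single : ∀ x, ∃ a b : ℤ, χ x * χ (1-x) = (a:ℤ_[p]) + b * μ ∧
      (χ x)^2 * (χ (1-x))^2 = (a:ℤ_[p]) + b * μ^2 := by
      intro x
      by_cases hx : x = 0
      · exact ⟨0, 0, by subst hx; rw [MulChar.map_zero]; simp, by subst hx; rw [MulChar.map_zero]; simp⟩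
      by_cases hx1 : 1 - x = 0
      · exact ⟨0, 0, by rw [hx1, MulChar.map_zero]; simp, by rw [hx1, MulChar.map_zero]; simp⟩
      have hy : x * (1-x) ≠ 0 := mul_ne_zero hx hx1
      obtain ⟨k, hk, e⟩ := MulChar.exists_apply_eq_pow c3 prim hy
      rw [← mul_pow, ← map_mul, e]
      interval_cases k
      · exact ⟨1, 0, by simp, by simp⟩
      · exact ⟨0, 1, by simp, by simp⟩
      · refine ⟨-1, -1, ?_, ?_⟩
        · push_cast; linear_combination μ2
        · push_cast; linear_combination μ2 + μ * μ3
    intro s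
    induction s using Finset.induction_on with
    | empty => exact ⟨0, 0, by simp, by simp⟩
    | insert x s hx ih =>
      obtain ⟨a, b, h1, h2⟩ := ih
      obtain ⟨a', b', h1', h2'⟩ := single x
      refine ⟨a'+a, b'+b, ?_, ?_⟩
      · rw [sum_insert hx, h1, h1']; push_cast; ring
      · rw [sum_insert hx, h2, h2']; push_cast; ring
  obtain ⟨a, b, h1, h2⟩ := pair univ
  have j1 : jacobiSum χ χ = (a:ℤ_[p]) + b*μ := h1
  have j2 : jacobiSum χ⁻¹ χ⁻¹ = (a:ℤ_[p]) + b*μ^2 := by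
    rw [inv, ← h2]; unfold jacobiSum
    exact sum_congr rfl fun x _ => by rw [MulChar.pow_apply' _ (by norm_num), MulChar.pow_apply' _ (by norm_num)]
  -- norm
  have nrm : jacobiSum χ χ * jacobiSum χ⁻¹ χ⁻¹ = (p:ℤ_[p]) := by
    have f : Function.Injective (PadicInt.Coe.ringHom (p := p)) := Subtype.val_injective
    have := jacobiSum_mul_jacobiSum_inv (F := ZMod p) (F' := ℚ_[p]) (χ := χ.ringHomComp PadicInt.Coe.ringHom)
      (φ := χ.ringHomComp PadicInt.Coe.ringHom) ?_ ?_ ?_ ?_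
    · rw [MulChar.ringHomComp_inv, jacobiSum_ringHomComp, jacobiSum_ringHomComp, ← map_mul, ZMod.card] at this
      apply f
      rw [this, map_natCast]
    · rw [ringChar.eq_zero, ZMod.ringChar_zmod_n]; exact hp.out.ne_zero.symm
    · rwa [MulChar.ringHomComp_ne_one_iff f]
    · rwa [MulChar.ringHomComp_ne_one_iff f]
    · rwa [← MulChar.ringHomComp_mul, MulChar.ringHomComp_ne_one_iff f]
  -- divisibility
  obtain ⟨z, hz, hz'⟩ := exists_jacobiSum_eq_neg_one_add (by norm_num : 2 < 3) c3 c3 (by rw [ZMod.card]; exact ⟨m, pm⟩) prim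
  have : ∃ c d : ℤ, z = (c:ℤ_[p]) + d * μ := by
    refine Algebra.adjoin_induction (p := fun z _ => ∃ c d : ℤ, z = (c:ℤ_[p]) + d * μ) ?_ ?_ ?_ ?_ hz
    · intro x hx; rw [Set.mem_singleton_iff] at hx; exact ⟨0, 1, by rw [hx]; simp⟩
    · intro r; exact ⟨r, 0, by simp⟩
    · rintro x y - - ⟨c, d, rfl⟩ ⟨c', d', rfl⟩
      exact ⟨c+c', d+d', by push_cast; ring⟩
    · rintro x y - - ⟨c, d, rfl⟩ ⟨c', d', rfl⟩
      exact ⟨c*c'-d*d', c*d'+d*c'-d*d', by push_cast; linear_combination (d:ℤ_[p])*d'*μ2⟩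
  obtain ⟨c, d, rfl⟩ := this
  have hb : b = 3*d-3*c := by
    refine int_mu (a := a) (a' := -1+3*d) μ3 hg ?_
    rw [← j1, hz']; push_cast
    linear_combination ((c:ℤ_[p]) + d * μ - 3*d) * μ2
  rw [j1, j2] at nrm
  rw [j1]
  have key : (p:ℤ) = a^2 - a*b + b^2 := by
    have : ((p:ℤ):ℤ_[p]) = ((a^2 - a*b + b^2 : ℤ) : ℤ_[p]) := by
      push_cast; rw [← nrm]; linear_combination (a:ℤ_[p])*b*μ2 + (b:ℤ_[p])^2*μ3
    exact_mod_cast this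
  refine ⟨(a:ℤ_[p]) + b*μ^2, 2*a-b, d-c, nrm, ?_, ?_⟩
  · push_cast; linear_combination (b:ℤ_[p])*μ2
  · rw [key, hb]; ring
end
lemma repr_uniq {u v x y : ℤ} (h1 : 4*(p:ℤ) = u^2+27*v^2) (h2 : 4*(p:ℤ) = x^2+27*y^2) (h3 : 3 < p) : x^2 = u^2 := by
  have pp : Prime (p:ℤ) := Nat.prime_iff_prime_int.1 hp.out
  have hpos : (0:ℤ) < p := by exact_mod_cast hp.out.pos
  -- if p ∣ u*y - x*v for suitable signs then it vanishes
  have key : ∀ x : ℤ, 4*(p:ℤ) = x^2+27*y^2 → (p:ℤ) ∣ u*y - x*v → x^2 = u^2 := by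
    rintro x h2 ⟨t, ht⟩
    have e : 16*(p:ℤ)^2 = (u*x+27*v*y)^2 + 27*(u*y-x*v)^2 := by
      linear_combination (4*(p:ℤ))*h1 + (u^2+27*v^2)*h2
    rw [ht] at e
    have t0 : t = 0 := by
      by_contra h
      have : 1 ≤ t^2 := by have := sq_pos_of_ne_zero h; omega
      nlinarith [sq_nonneg (u*x+27*v*y), pow_pos hpos 2]
    rw [t0, mul_zero] at ht
    have : 4*(p:ℤ)*(x^2-u^2) = 0 := by
      linear_combination (x^2)*h1 - u^2*h2 - 27*(u*y+x*v)*ht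
    rcases mul_eq_zero.1 this with h | h
    · omega
    · omega
  have : (p:ℤ) ∣ (u*y - x*v)*(u*y - (-x)*v) := ⟨4*y^2-4*v^2, by linear_combination v^2*h2 - y^2*h1⟩
  rcases pp.dvd_or_dvd this with h | h
  · exact key x h2 h
  · have := key (-x) (by rw [h2]; ring) h
    rw [← this]; ring
end S19

set_option linter.unusedSectionVars false
set_option linter.unusedSimpArgs false
namespace S19
open Finset Polynomial
variable {p : ℕ} [hp : Fact p.Prime]
lemma psq_div {s t : ℚ_[p]} (hs : Un s) (ht : Un t) (h : Dv 1 (s - t)) : Dv 3 ((p:ℚ_[p])^2/s - (p:ℚ_[p])^2/t) := by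
  have h1 := ((Dv.pp (p := p) 2).mul' h).div (hs.mul ht)
  refine Eq.mp (congrArg (Dv 3) ?_) h1.neg
  have := hs.ne; have := ht.ne
  field_simp; ring
lemma S0_x {m : ℕ} (hm : p = 3*m+1) (h3 : 3 < p) {x y : ℤ} (hx : 4*(p:ℤ) = x^2+27*y^2) :
    Un ((x:ℚ_[p])^2) ∧ Cg 3 (SS p 0 : ℚ_[p]) ((x:ℚ_[p])^2 - 2*(p:ℚ_[p]) - (p:ℚ_[p])^2/(x:ℚ_[p])^2) := by
  obtain ⟨w, hw⟩ := exists_teich (p := p)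
  obtain ⟨Jb, u, v, h1, h2, h4⟩ := J_int hm hw h3
  have hsq := J_sq hm hw h3
  have hun := J_un hm hw h3
  generalize (∑ x, w x^(2*m) * w (1-x)^(2*m)) = J at *
  have e1 : (J:ℚ_[p]) * (Jb:ℚ_[p]) = (p:ℚ_[p]) := by
    have := congrArg (PadicInt.Coe.ringHom (p := p)) h1
    rwa [map_mul, map_natCast] at this
  have e2 : (J:ℚ_[p]) + (Jb:ℚ_[p]) = (u:ℚ_[p]) := by
    have := congrArg (PadicInt.Coe.ringHom (p := p)) h2
    rwa [map_add, map_intCast] at this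
  have ux : (x:ℚ_[p])^2 = (u:ℚ_[p])^2 := by exact_mod_cast congrArg (Int.cast : ℤ → ℚ_[p]) (repr_uniq h4 hx h3)
  rw [ux]
  have dJb : Dv 0 (Jb:ℚ_[p]) := ⟨Jb, by simp⟩
  have us : Un ((J:ℚ_[p])^2) := hun.pow 2
  have ne := hun.ne
  have ejb : (Jb:ℚ_[p]) = (p:ℚ_[p])/(J:ℚ_[p]) := by field_simp; rw [← e1]; ring
  have d1 : Dv 1 ((J:ℚ_[p])^2 - (u:ℚ_[p])^2) := by
    have := Dv.p1.mulr (Dv.sub ((Dv.ofNat 2).neg) (Dv.div dJb hun))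
    refine Eq.mp (congrArg (Dv 1) ?_) this
    rw [← e2, ejb]; field_simp; ring
  have uu : Un ((u:ℚ_[p])^2) := us.of_sub d1
  refine ⟨uu, ?_⟩
  have h5 := psq_div us uu d1
  refine Eq.mp (congrArg (Dv 3) ?_) (Dv.add hsq.symm h5.neg)
  rw [← e2] at *
  rw [ejb] at *
  have := uu.ne
  generalize (p:ℚ_[p])^2/((J:ℚ_[p]) + (p:ℚ_[p])/(J:ℚ_[p]))^2 = T
  field_simp; ring
lemma first {m : ℕ} (hm : p = 3*m+1) (h3 : 3 < p) {x y : ℤ} (hx : 4*(p:ℤ) = x^2+27*y^2) :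
    Cg 3 (SS p 2 : ℚ_[p]) (1/16*(x:ℚ_[p])^2 - 1/8*(p:ℚ_[p]) - (p:ℚ_[p])^2/(8*(x:ℚ_[p])^2)) ∧
    Cg 3 (SS p 3 : ℚ_[p]) (7/128*(x:ℚ_[p])^2 - 5/64*(p:ℚ_[p]) - 5*(p:ℚ_[p])^2/(64*(x:ℚ_[p])^2)) := by
  obtain ⟨ux, h0⟩ := S0_x hm h3 hx
  have hS := S0N (p := p) h3
  obtain ⟨q, m', e, h⟩ := Shp.ex (p := p) h3
  have hR := R1_val3 h3 h
  have he : e = 1 := by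
    rcases h with ⟨_, _, h⟩ | ⟨h, _, _⟩
    · exact h
    · omega
  rw [he, Rat.cast_one, one_mul] at hR
  have hT := S3_val (p := p) h3
  generalize (x:ℚ_[p])^2 = X at *
  have nX := ux.ne
  have dX : Dv 1 (X - SS p 0) := by
    have a := Dv.mono (Dv.neg h0) (show 1 ≤ 3 by norm_num)
    have b := Dv.p1.mulr ((Dv.ofNat 2).add ((Dv.nat p).div ux))
    refine Eq.mp (congrArg (Dv 1) ?_) (a.add b)
    field_simp; ring
  have uS : Un (SS p 0 : ℚ_[p]) := ux.of_sub dX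
  have nS := uS.ne
  have hpq := psq_div ux uS dX
  have hN : Dv 3 (16 * SS p 2 - SS p 0 + (p:ℚ_[p])^2/X) := by
    have := Dv.div hS uS
    refine Eq.mp (congrArg (Dv 3) ?_) (this.add hpq)
    generalize (p:ℚ_[p])^2/X = T
    field_simp; ring
  generalize (SS p 0 : ℚ_[p]) = s0 at *
  generalize (SS p 1 : ℚ_[p]) = s1 at *
  generalize (SS p 2 : ℚ_[p]) = s2 at *
  generalize (SS p 3 : ℚ_[p]) = s3 at *
  have e8 : (p:ℚ_[p])^2/(8*X) = 1/8*((p:ℚ_[p])^2/X) := by field_simp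
  have e64 : 5*(p:ℚ_[p])^2/(64*X) = 5/64*((p:ℚ_[p])^2/X) := by field_simp
  rw [e8, e64]
  generalize (p:ℚ_[p])^2/X = T at *
  have u16 : Un (16:ℚ_[p]) := by
    have := (un2 (p := p) h3).pow 4; norm_num at this; exact this
  have i2 : Dv 0 (1/2:ℚ_[p]) := Dv.one.div (un2 h3)
  have r2 : Dv 3 (s2 - (1/16*X - 1/8*(p:ℚ_[p]) - 1/8*T)) := by
    refine Dv.of_mul (x := 16) ?_ u16
    exact Eq.mp (congrArg (Dv 3) (by ring)) (Dv.add hN h0)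
  refine ⟨r2, Dv.of_mul (x := 16) ?_ u16⟩
  refine Eq.mp (congrArg (Dv 3) ?_) (((Dv.add hT (Dv.mul (Dv.ofNat 6) r2)).add (Dv.mul i2 hR)).add (Dv.mul i2 h0))
  have o6 : (OfNat.ofNat 6 : ℚ_[p]) = 6 := rfl
  ring
end S19

theorem statement19 (p : ℕ) (hp : p.Prime) (hp3 : 3 < p) :
    (∀ x y : ℤ, p % 3 = 1 → 4*(p : ℤ) = x^2 + 27*y^2 →
      ratCongr p 3
        (∑ n ∈ Finset.range p, (n:ℚ)^2 * seqV3 n / 243^n)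
        (1/16*(x:ℚ)^2 - 1/8*(p:ℚ) - (p:ℚ)^2/(8*(x:ℚ)^2)) ∧
      ratCongr p 3
        (∑ n ∈ Finset.range p, (n:ℚ)^3 * seqV3 n / 243^n)
        (7/128*(x:ℚ)^2 - 5/64*(p:ℚ) - 5*(p:ℚ)^2/(64*(x:ℚ)^2))) ∧
    (p % 3 = 2 →
      ratCongr p 2
        (∑ n ∈ Finset.range p, (n:ℚ)^2 * seqV3 n / 243^n)
        (1/8*(2*(p:ℚ)+1)*((2*p/3).choose (p/3) : ℚ)^2) ∧
      ratCongr p 2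
        (∑ n ∈ Finset.range p, (n:ℚ)^3 * seqV3 n / 243^n)
        (3/64*(2*(p:ℚ)+1)*((2*p/3).choose (p/3) : ℚ)^2 - (p:ℚ)/32)) ∧
    ratCongr p 4
      (∑ n ∈ Finset.range p, (8*(n:ℚ)+1) * seqV3 n / 243^n)
      ((legendreSym 3 p : ℚ)*(p:ℚ) - 22/3*(p:ℚ)^3*seqU (p-3)) := by
  have : Fact p.Prime := ⟨hp⟩
  refine ⟨?_, ?_, S19.third hp3⟩
  · intro x y h1 hx
    obtain ⟨a, b⟩ := S19.first (p := p) (m := p/3) (by omega) hp3 hx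
    constructor
    · apply S19.ratCongr_of_cg
      rw [S19.SS_cast]
      push_cast
      exact a
    · apply S19.ratCongr_of_cg
      rw [S19.SS_cast]
      push_cast
      exact b
  · intro h2
    obtain ⟨a, b⟩ := S19.second (p := p) (m := p/3) (by omega) hp3
    have e : 2*p/3 = 2*(p/3)+1 := by omega
    rw [e]
    constructor
    · apply S19.ratCongr_of_cg
      rw [S19.SS_cast]
      push_cast
      exact a
    · apply S19.ratCongr_of_cg
      rw [S19.SS_cast]
      push_cast
      exact b
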